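/- (Landau–Page type lemma) There exists an absolute constant c > 0 such that for all T ≥ 3 and P ≥ T^{1/log log T} the following holds: among all primitive Dirichlet characters χ of modulus q with q ≤ T and largest prime factor P⁺(q) ≤ P, there is at most one such character χ for which the Dirichlet L-function L(s,χ) has a zero s in the region Re(s) > 1 - c/log P, |Im(s)| ≤ exp(log P/√(log T)). Moreover, if such a character χ of modulus q exists and is real, then L(s,χ) has exactly one zero in this region, which is simple and real, and there exist absolute constants c_1, c_2 > 0 with P⁺(q) ≥ c_1 log q and log q ≥ c_2 log log T. -/

import Mathlib

/-- `P⁺(q)`: the largest prime factor of `q` (with the convention `P⁺(q) = 0` if `q` has no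
prime factor). -/
def maxPrimeFac (q : ℕ) : ℕ := q.primeFactors.sup id

/-- `s` is a zero of `L(·, χ)` lying in the region
`Re(s) > 1 - c/log P`, `|Im(s)| ≤ exp(log P / √(log T))`. -/
def ZeroInRegion (c P T : ℝ) {q : ℕ} (hq : q ≠ 0) (χ : DirichletCharacter ℂ q) (s : ℂ) :
    Prop :=
  letI : NeZero q := ⟨hq⟩
  DirichletCharacter.LFunction χ s = 0 ∧ 1 - c / Real.log P < s.re ∧
    |s.im| ≤ Real.exp (Real.log P / Real.sqrt (Real.log T))

/-- The derivative of `L(·, χ)` at `s` is nonzero (so a zero `s` is simple). -/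
noncomputable def LDerivNeZero {q : ℕ} (hq : q ≠ 0) (χ : DirichletCharacter ℂ q) (s : ℂ) :
    Prop :=
  letI : NeZero q := ⟨hq⟩
  deriv (DirichletCharacter.LFunction χ) s ≠ 0


open Polynomial Finset

lemma pow_sub_dvd_hasse {K : Type*} [Field K] (f : K[X]) (A : ℕ) : ∀ (l : ℕ) (g : K[X]),
    f ^ (A - l) ∣ hasseDeriv l (f ^ A * g) := by
  induction A with
  | zero => intro l g; simp
  | succ A ih =>
    intro l g
    rw [pow_succ', mul_assoc, hasseDeriv_mul]
    refine Finset.dvd_sum fun ij hij => ?_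
    rw [Finset.HasAntidiagonal.mem_antidiagonal] at hij
    rcases Nat.eq_zero_or_pos ij.1 with h | h
    · rw [h, hasseDeriv_zero', show ij.2 = l by omega]
      rcases Nat.lt_or_ge A l with h2 | h2
      · rw [show A + 1 - l = 0 by omega]; simp
      · rw [show A + 1 - l = (A - l) + 1 by omega, pow_succ']
        exact mul_dvd_mul_left _ (ih l g)
    · exact Dvd.dvd.mul_left ((pow_dvd_pow f (by omega)).trans (ih ij.2 g)) _

/-- quotient with degree bound -/
lemma hasse_quot {K : Type*} [Field K] (f : K[X]) (hf : f.Monic) (A a l : ℕ) (hl : l ≤ A) :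
    ∃ d : K[X], hasseDeriv l (f ^ A * X ^ a) = f ^ (A - l) * d ∧
      d.natDegree ≤ a + l * f.natDegree := by
  obtain ⟨d, hd⟩ := pow_sub_dvd_hasse f A l (X ^ a)
  refine ⟨d, hd, ?_⟩
  rcases eq_or_ne d 0 with h0 | h0
  · simp [h0]
  have h1 := natDegree_hasseDeriv_le (f ^ A * X ^ a) l
  rw [hd, (hf.pow _).natDegree_mul' h0] at h1
  rw [hf.natDegree_pow, (hf.pow A).natDegree_mul (monic_X_pow a), hf.natDegree_pow,
    natDegree_X_pow] at h1
  have : A * f.natDegree = (A - l) * f.natDegree + l * f.natDegree := by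
    rw [← add_mul]; congr 1; omega
  omega

/-- vanishing of high order -/
lemma stepanov_aux {K : Type*} [Field K] [Fintype K] [DecidableEq K] (m D e M J k : ℕ)
    (hq : Fintype.card K = m * e + 1) (hm : 0 < m) (f : K[X]) (hf : f.Monic)
    (hD : f.natDegree = D) (hcop : Nat.Coprime D m) (hMq : M ≤ Fintype.card K)
    (hJk : J + k ≤ e) (hcount : M * (J + k + M * D) < m * J * k)
    (c : K) :
    M * #{x : K | f.eval x ≠ 0 ∧ f.eval x ^ e = c} ≤ D * M + D * Fintype.card K + Fintype.card K * J := by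
  classical
  set q := Fintype.card K with hqdef
  choose! d hd hdd using fun (i a l : ℕ) (hl : l ≤ M + e * i) => hasse_quot f hf (M + e * i) a l hl
  set I := Fin m × Fin J × Fin k
  let W := J + k + M * D
  let Φ : (I → K) →ₗ[K] (Fin M × Fin W → K) :=
    { toFun := fun κ lw => ∑ t : I, κ t * (C (c ^ t.1.1) * X ^ (t.2.1 : ℕ) * d t.1 t.2.2 lw.1).coeff lw.2
      map_add' := by intro x y; ext lw; simp [add_mul, Finset.sum_add_distrib]
      map_smul' := by intro r x; ext lw; simp [Finset.mul_sum, mul_assoc] }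
  have hker : LinearMap.ker Φ ≠ ⊥ := by
    apply LinearMap.ker_ne_bot_of_finrank_lt
    rw [Module.finrank_fintype_fun_eq_card, Module.finrank_fintype_fun_eq_card]
    simp only [I, W, Fintype.card_prod, Fintype.card_fin]
    calc _ < _ := hcount
      _ = _ := by ring
  obtain ⟨κ, hκ, hκ0⟩ := (Submodule.ne_bot_iff _).1 hker
  rw [LinearMap.mem_ker] at hκ
  have hrel : ∀ l < M, ∑ t : I, C (κ t) * (C (c ^ t.1.1) * X ^ (t.2.1 : ℕ) * d t.1 t.2.2 l) = 0 := by
    intro l hl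
    ext w
    rw [finsetSum_coeff]
    simp only [coeff_C_mul, coeff_zero]
    by_cases hw : w < W
    · have := congrFun hκ (⟨l, hl⟩, ⟨w, hw⟩)
      simpa [Φ, coeff_C_mul, mul_assoc] using this
    · refine Finset.sum_eq_zero fun t _ => ?_
      have h1 : (X ^ (t.2.1 : ℕ) * d t.1 t.2.2 l).natDegree < w := by
        refine lt_of_le_of_lt natDegree_mul_le ?_
        have := hdd t.1 t.2.2 l (by omega)
        rw [natDegree_X_pow]
        have h2 := t.2.1.2; have h3 := t.2.2.2
        have : l * f.natDegree ≤ M * D := by rw [hD]; gcongr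
        omega
      rw [mul_assoc, coeff_C_mul, coeff_eq_zero_of_natDegree_lt h1]; simp
  let deg : I → ℕ := fun t => D * (M + e * t.1) + q * t.2.1 + t.2.2
  let g : I → K[X] := fun t => f ^ (M + e * (t.1 : ℕ)) * X ^ (q * (t.2.1 : ℕ) + t.2.2)
  have hgm : ∀ t, (g t).Monic := fun t => (hf.pow _).mul (monic_X_pow _)
  have hgd : ∀ t, (g t).natDegree = deg t := by
    intro t
    simp only [g, deg]
    rw [(hf.pow _).natDegree_mul (monic_X_pow _), hf.natDegree_pow, natDegree_X_pow, hD]; ring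
  have hinj : Function.Injective deg := by
    rintro ⟨i, j, a⟩ ⟨i', j', a'⟩ h
    simp only [deg] at h
    have hj := j.2; have hj' := j'.2; have ha := a.2; have ha' := a'.2
    rw [hq] at h
    have e1 : e * (D * i + m * j) + (j + a) = e * (D * i' + m * j') + (j' + a' : ℕ) := by
      have : D * (M + e * i) + (m * e + 1) * j + a = D * M + (e * (D * i + m * j) + (j + a)) := by ring
      have : D * (M + e * i') + (m * e + 1) * j' + a' = D * M + (e * (D * i' + m * j') + (j' + a')) := by ring
      omega
    have e2 : (j : ℕ) + a = j' + a' := by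
      have := congrArg (· % e) e1
      simpa [Nat.mul_add_mod, Nat.mod_eq_of_lt (show (j : ℕ) + a < e by omega),
        Nat.mod_eq_of_lt (show (j' : ℕ) + a' < e by omega)] using this
    have e3 : D * i + m * j = D * i' + m * (j' : ℕ) := by
      have : 0 < e := by omega
      apply Nat.eq_of_mul_eq_mul_left this; omega
    have e4 : (i : ℕ) = i' := by
      have h5 : D * i ≡ D * i' [MOD m] := by
        have := congrArg (· % m) e3
        simpa [Nat.ModEq] using this
      have h6 : (i : ℕ) ≡ i' [MOD m] := Nat.ModEq.cancel_left_of_coprime (by simpa [Nat.coprime_comm] using hcop) h5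
      exact Nat.ModEq.eq_of_lt_of_lt h6 i.2 i'.2
    have e5 : (j : ℕ) = j' := by
      rw [e4] at e3
      exact Nat.eq_of_mul_eq_mul_left hm (by omega)
    have : (a : ℕ) = a' := by omega
    exact Prod.ext (Fin.ext e4) (Prod.ext (Fin.ext e5) (Fin.ext this))
  let R : K[X] := ∑ t : I, C (κ t) * g t
  have hR0 : R ≠ 0 := by
    obtain ⟨t0, ht0⟩ : ∃ t, κ t ≠ 0 := by by_contra! h; exact hκ0 (funext h)
    have := degree_sum_eq_of_disjoint (fun t : I => C (κ t) * g t) univ (by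
      rintro t ⟨-, ht⟩ s ⟨-, hs⟩ hts
      simp only [Function.onFun, Function.comp]
      have h1 : κ t ≠ 0 := by rintro h; simp [h] at ht
      have h2 : κ s ≠ 0 := by rintro h; simp [h] at hs
      rw [degree_C_mul h1, degree_C_mul h2, degree_eq_natDegree (hgm t).ne_zero,
        degree_eq_natDegree (hgm s).ne_zero, hgd, hgd]
      exact fun h => hts (hinj (by exact_mod_cast h)))
    intro hR
    change (R).degree = _ at this
    rw [hR, degree_zero] at this
    have h3 := Finset.le_sup (f := fun t => (C (κ t) * g t).degree) (mem_univ t0)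
    rw [← this, degree_C_mul ht0, le_bot_iff, degree_eq_bot] at h3
    exact (hgm t0).ne_zero h3
  have hRd : R.natDegree ≤ D * M + D * q + q * J := by
    refine natDegree_sum_le_of_forall_le _ _ fun t _ => ?_
    refine (natDegree_C_mul_le _ _).trans ?_
    rw [hgd]
    simp only [deg]
    have h1 := t.1.2; have h2 := t.2.1.2; have h3 := t.2.2.2
    have h4 : D * (M + e * t.1) ≤ D * M + D * q := by
      rw [mul_add]; gcongr; rw [hq]; nlinarith
    have h5 : q * t.2.1 + t.2.2 ≤ q * J := by
      have : q * (t.2.1 + 1) ≤ q * J := by gcongr; omega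
      have : e ≤ q := by rw [hq]; nlinarith
      rw [mul_add] at *; omega
    omega
  have hroot : ∀ x : K, f.eval x ≠ 0 → f.eval x ^ e = c → (X - C x) ^ M ∣ R := by
    intro x hx hxc
    have h1 : X ^ M ∣ taylor x R := by
      have hfr : (X + C x : K[X]) ^ q = X ^ q + C x := by
        have : Fact (ringChar K).Prime := ⟨CharP.char_is_prime K _⟩
        obtain ⟨n, hn, hc⟩ := FiniteField.card K (ringChar K)
        rw [hqdef, hc, add_pow_char_pow, ← hc, ← C_pow, FiniteField.pow_card]
      have h2 : X ^ M ∣ taylor x R - taylor x (∑ t : I, C (κ t * x ^ (t.2.1 : ℕ)) * (f ^ (M + e * (t.1 : ℕ)) * X ^ (t.2.2 : ℕ))) := by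
        simp only [R, map_sum, g, ← Finset.sum_sub_distrib]
        refine dvd_sum fun t _ => ?_
        have : taylor x (C (κ t) * (f ^ (M + e * (t.1:ℕ)) * X ^ (q * (t.2.1 : ℕ) + t.2.2))) - taylor x (C (κ t * x ^ (t.2.1 : ℕ)) * (f ^ (M + e * (t.1 : ℕ)) * X ^ (t.2.2 : ℕ))) = (C (κ t) * taylor x (f ^ (M + e * (t.1 : ℕ)) * X ^ (t.2.2 : ℕ))) * ((X ^ q + C x) ^ (t.2.1 : ℕ) - C x ^ (t.2.1 : ℕ)) := by
          rw [← hfr]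
          simp only [taylor_mul, taylor_C, C_mul, C_pow, taylor_pow, taylor_X]
          ring
        rw [this]
        refine Dvd.dvd.mul_left ?_ _
        refine dvd_trans ?_ (sub_dvd_pow_sub_pow _ _ _)
        rw [add_sub_cancel_right]; exact pow_dvd_pow _ hMq
      rw [dvd_iff_dvd_of_dvd_sub h2, X_pow_dvd_iff]
      intro l hl
      rw [taylor_coeff, map_sum, eval_finsetSum]
      have h3 := congrArg (eval x) (hrel l hl)
      rw [eval_finsetSum, eval_zero] at h3
      have h4 : ∀ t : I, eval x (hasseDeriv l (C (κ t * x ^ (t.2.1 : ℕ)) * (f ^ (M + e * (t.1 : ℕ)) * X ^ (t.2.2 : ℕ)))) = f.eval x ^ (M - l) * eval x (C (κ t) * (C (c ^ t.1.1) * X ^ (t.2.1 : ℕ) * d t.1 t.2.2 l)) := by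
        intro t
        rw [← smul_eq_C_mul, map_smul, hd t.1 t.2.2 l (by omega)]
        simp only [eval_smul, eval_mul, eval_pow, eval_C, eval_X, smul_eq_mul]
        rw [← hxc, show M + e * (t.1 : ℕ) - l = (M - l) + e * (t.1 : ℕ) by omega, pow_add, pow_mul]
        ring
      rw [Finset.sum_congr rfl fun t _ => h4 t, ← Finset.mul_sum, h3, mul_zero]
    have h5 := map_dvd (taylorAlgHom (-x)) h1
    simpa [taylor_taylor, sub_eq_add_neg] using h5
  set S : Finset K := {x : K | f.eval x ≠ 0 ∧ f.eval x ^ e = c} with hS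
  have h6 : M • S.val ≤ R.roots := by
    rw [Multiset.le_iff_count]
    intro x
    rw [Multiset.count_nsmul, count_roots, Multiset.count_eq_of_nodup S.nodup]
    split_ifs with h
    · simp only [hS, Finset.mem_val, Finset.mem_filter, mem_univ, true_and] at h
      rw [mul_one, le_rootMultiplicity_iff hR0]
      exact hroot x h.1 h.2
    · simp
  have h7 := Multiset.card_le_card h6
  rw [Multiset.card_nsmul] at h7
  calc M * #S ≤ R.roots.card := by simpa using h7
    _ ≤ R.natDegree := card_roots' _
    _ ≤ _ := hRd

set_option maxHeartbeats 1000000 in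
lemma stepanov {m D : ℕ} (hm : 0 < m) (hcop : Nat.Coprime D m) : ∃ B : ℝ, 0 ≤ B ∧
    ∀ (K : Type) [Field K] [Fintype K] [DecidableEq K] (f : K[X]) (e : ℕ) (c : K),
      Fintype.card K = m * e + 1 → f.Monic → f.natDegree = D →
      (#{x : K | f.eval x ≠ 0 ∧ f.eval x ^ e = c} : ℝ) ≤
        (Fintype.card K : ℝ) / m + B * √(Fintype.card K) := by
  obtain ⟨G, hG⟩ : ∃ G : ℕ, G = 100 * (m + 1) ^ 2 * (D + 2) ^ 2 := ⟨_, rfl⟩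
  refine ⟨G ^ 2, by positivity, fun K _ _ _ f e c hq hf hD => ?_⟩
  set q := Fintype.card K with hqdef
  set N := #{x : K | f.eval x ≠ 0 ∧ f.eval x ^ e = c} with hN
  have hmR : (1 : ℝ) ≤ m := by exact_mod_cast hm
  have hNq : N ≤ q := card_le_univ _
  have hs : √(q : ℝ) ^ 2 = q := Real.sq_sqrt (by positivity)
  have hs0 : 0 ≤ √(q : ℝ) := Real.sqrt_nonneg _
  rcases le_or_gt q (G ^ 4) with hsm | hlg
  · have h1 : √(q : ℝ) ≤ (G : ℝ) ^ 2 := by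
      rw [Real.sqrt_le_left (by positivity), ← pow_mul]; exact_mod_cast hsm
    have : (N : ℝ) ≤ q := by exact_mod_cast hNq
    have : (0 : ℝ) ≤ q / m := by positivity
    nlinarith
  obtain ⟨M, hM⟩ : ∃ M, M = Nat.sqrt q := ⟨_, rfl⟩
  have hMq : M * M ≤ q := hM ▸ Nat.sqrt_le q
  have hMq' : q < (M + 1) * (M + 1) := hM ▸ Nat.lt_succ_sqrt q
  have hMG : G ^ 2 ≤ M := by rw [hM, Nat.le_sqrt]; calc _ = G ^ 4 := by ring
                               _ ≤ _ := hlg.le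
  have hG0 : 100 ≤ G := by
    rw [hG, mul_assoc]; exact Nat.le_mul_of_pos_right _ (by positivity)
  obtain ⟨J, hJ⟩ : ∃ J, J = M / m + 1 + 2 * (D + 2) := ⟨_, rfl⟩
  have hJm : M + 2 * m * (D + 2) ≤ m * J := by
    have := Nat.lt_div_mul_add (a := M) hm
    rw [hJ]; nlinarith
  have hJM : J ≤ M + 2 * D + 5 := by
    have := Nat.div_le_self M m; omega
  have hGD : 100 * (D + 2) ≤ G := by
    rw [hG, show 100 * (m + 1) ^ 2 * (D + 2) ^ 2 = 100 * (D + 2) * ((m + 1) ^ 2 * (D + 2)) by ring]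
    exact Nat.le_mul_of_pos_right _ (by positivity)
  have hGm : 100 * (m + 1) * (D + 2) ≤ G := by
    rw [hG, show 100 * (m + 1) ^ 2 * (D + 2) ^ 2 = 100 * (m + 1) * (D + 2) * ((m + 1) * (D + 2)) by ring]
    exact Nat.le_mul_of_pos_right _ (by positivity)
  have hM1 : G * 100 ≤ M := by
    calc G * 100 ≤ G * G := by gcongr
      _ = G ^ 2 := by ring
      _ ≤ M := hMG
  have hM2 : 100 * (m + 1) * (D + 2) ≤ M := by omega
  have hM4 : 100 * (m + 1) ≤ M := le_trans (Nat.le_mul_of_pos_right _ (by omega)) hM2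
  have hme : M * M ≤ m * e + 1 := by omega
  have hJM2 : J ≤ 2 * M := by omega
  have hmJ : m * J + 2 ≤ m * e := by
    have : m * J ≤ m * (2 * M) := by gcongr
    have : 100 * (m + 1) * M ≤ M * M := by gcongr
    have : m * (2 * M) + 3 ≤ 100 * (m + 1) * M := by
      rw [show 100 * (m + 1) * M = m * (2 * M) + (98 * (m * M) + 100 * M) by ring]; omega
    omega
  have hJe : J ≤ e := le_of_mul_le_mul_left (by omega : m * J ≤ m * e) hm
  obtain ⟨k, rfl⟩ := Nat.exists_eq_add_of_le hJe
  have hkey : M * (J + k + M * D) < m * J * k := by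
    have h2 : (M + 2 * m * (D + 2)) * k ≤ m * J * k := by gcongr
    have h3 : 2 * (D + 2) * (M * M) ≤ 2 * (D + 2) * (m * (J + k) + 1) := by gcongr
    have h4 : M * J + 2 * (D + 2) * (m * J) + 2 * (D + 2) < M * M * 3 := by
      have h5 : 2 * (D + 2) * (m * J) ≤ 2 * (D + 2) * (m * (2 * M)) := by gcongr
      have h6 : 100 * (m + 1) * (D + 2) * M ≤ M * M := by gcongr
      have h7 : M * J ≤ M * (2 * M) := by gcongr
      have h8 : 2 * (D + 2) < M := by omega
      have h9 : M ≤ M * M := Nat.le_mul_self M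
      have h10 : 0 ≤ D * M ∧ 0 ≤ m * M := by simp
      have h11 : 2 * (D + 2) * (m * (2 * M)) + 100 * (D + 2) * M + 96 * m * (D + 2) * M  ≤ M * M := by linarith
      have h12 : 0 ≤ D * M ∧ 0 ≤ m * M ∧ 0 ≤ m * D * M := by simp
      have h13 : M ≤ 100 * (D + 2) * M := Nat.le_mul_of_pos_left _ (by omega)
      have h14 : 0 ≤ 96 * m * (D + 2) * M := by positivity
      linarith
    zify at h2 h3 h4 ⊢
    have h15 : (0 : ℤ) ≤ D * (M * M) := by positivity
    have h16 : (0 : ℤ) ≤ M * M := by positivity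
    linarith
  have h1 := stepanov_aux m D (J + k) M J k hq hm f hf hD hcop
    ((Nat.le_mul_self M).trans hMq) le_rfl hkey c
  rw [← hN, ← hqdef] at h1
  have h1R : (M : ℝ) * N ≤ D * M + D * q + q * J := by exact_mod_cast h1
  have hMpos : (0 : ℝ) < M := by have : 0 < M := by omega
                                 exact_mod_cast this
  have hJR : (J : ℝ) ≤ M / m + (2 * D + 5) := by
    have : ((M / m : ℕ) : ℝ) ≤ M / m := Nat.cast_div_le
    rw [hJ]; push_cast; linarith
  have hsM : √(q : ℝ) ≤ 2 * M := by
    rw [Real.sqrt_le_left (by positivity)]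
    have : q ≤ (2 * M) ^ 2 := by nlinarith
    exact_mod_cast this
  have hGR : 100 * ((D : ℝ) + 2) ≤ G := by exact_mod_cast hGD
  have hs1 : 1 ≤ √(q : ℝ) := by
    rw [Real.one_le_sqrt]; have : 1 ≤ q := by omega
    exact_mod_cast this
  have h8 : (M : ℝ) * N ≤ M * (q / m + (D + (6 * D + 10) * √q)) := by
    have h9 : (q : ℝ) * J ≤ q * (M / m + (2 * D + 5)) := by gcongr
    have h10 : (q : ℝ) ≤ √q * (2 * M) := by nlinarith
    have h11 : (q : ℝ) * (3 * D + 5) ≤ √q * (2 * M) * (3 * D + 5) := by gcongr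
    calc (M : ℝ) * N ≤ D * M + D * q + q * (M / m + (2 * D + 5)) := by linarith
      _ = D * M + M * (q / m) + q * (3 * D + 5) := by ring
      _ ≤ D * M + M * (q / m) + √q * (2 * M) * (3 * D + 5) := by linarith
      _ = _ := by ring
  have h12 := le_of_mul_le_mul_left h8 hMpos
  have h13 : (D : ℝ) + (6 * D + 10) * √q ≤ (G : ℝ) ^ 2 * √q := by
    have hD0 : (0 : ℝ) ≤ D := Nat.cast_nonneg D
    have : (D : ℝ) ≤ D * √q := le_mul_of_one_le_right hD0 hs1
    have hG2 : (G : ℝ) ≤ (G : ℝ) ^ 2 := le_self_pow₀ (by linarith) two_ne_zero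
    have : (7 * D + 10 : ℝ) * √q ≤ (G : ℝ) ^ 2 * √q := by gcongr; linarith
    linarith
  linarith

open Polynomial Finset

lemma charsum_K {m D : ℕ} (hm : 1 < m) (hcop : Nat.Coprime D m) : ∃ C : ℝ,
    ∀ (K : Type) [Field K] [Fintype K] (f : K[X]) (ψ : MulChar K ℂ), ψ ^ m = 1 → ψ ≠ 1 →
      m ∣ Fintype.card K - 1 → f.Monic → f.natDegree = D →
      ‖∑ x : K, ψ (f.eval x)‖ ≤ C * √(Fintype.card K) := by
  classical
  obtain ⟨B, hB0, hB⟩ := stepanov (by omega : 0 < m) hcop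
  refine ⟨m * B + D, fun K _ _ f ψ hψm hψ1 hmd hf hD => ?_⟩
  obtain ⟨e, he⟩ := hmd
  have hq1 : 1 < Fintype.card K := Fintype.one_lt_card
  set q := Fintype.card K with hq
  have hqe : q = m * e + 1 := by omega
  have he0 : 0 < e := by rcases Nat.eq_zero_or_pos e with h | h
                         · simp [h] at hqe; omega
                         · exact h
  -- the fibre structure
  obtain ⟨g, hg⟩ := IsCyclic.exists_generator (α := Kˣ)
  have hgo : orderOf g = m * e := by
    rw [orderOf_eq_card_of_forall_mem_zpowers hg, Nat.card_eq_fintype_card, Fintype.card_units]; omega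
  have hker : ∀ u : Kˣ, u ^ e = 1 → ψ u = 1 := by
    intro u hu
    obtain ⟨j, rfl⟩ := (Subgroup.mem_zpowers_iff).1 (hg u)
    rw [← zpow_natCast, ← zpow_mul, ← orderOf_dvd_iff_zpow_eq_one, hgo] at hu
    have h1 : (m : ℤ) ∣ j := by
      push_cast at hu
      exact Int.dvd_of_mul_dvd_mul_right (by exact_mod_cast he0.ne') hu
    obtain ⟨r, rfl⟩ := h1
    rw [mul_comm, zpow_mul, zpow_natCast, Units.val_pow_eq_pow_val, map_pow, ← MulChar.pow_apply_coe, hψm]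
    exact MulChar.one_apply_coe _
  have hcard : ∀ y : Kˣ, #{c : Kˣ | y ^ e = c ^ e} = e := by
    intro y
    have h1 : #{c : Kˣ | y ^ e = c ^ e} = #{c : Kˣ | c ^ e = 1} := by
      refine Finset.card_bij' (fun c _ => c * y⁻¹) (fun c _ => c * y) ?_ ?_ ?_ ?_
      · intro c hc; simp at hc ⊢; rw [mul_pow, ← hc, inv_pow, mul_inv_cancel]
      · intro c hc; simp at hc ⊢; rw [mul_pow, hc, one_mul]
      · intro c _; simp
      · intro c _; simp
    rw [h1]
    refine le_antisymm (IsCyclic.card_pow_eq_one_le he0) ?_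
    have h2 : orderOf (g ^ m) = e := by
      rw [orderOf_pow_of_dvd (by omega) (by rw [hgo]; exact dvd_mul_right _ _), hgo, Nat.mul_div_cancel_left _ (by omega)]
    calc e = #((univ : Finset (Subgroup.zpowers (g ^ m))).map (Function.Embedding.subtype _)) := by
            rw [card_map, card_univ, ← Nat.card_eq_fintype_card, Nat.card_zpowers, h2]
      _ ≤ _ := by
        refine card_le_card fun c hc => ?_
        simp only [mem_map, mem_univ, true_and, Function.Embedding.subtype_apply] at hc
        obtain ⟨⟨c', hc'⟩, rfl⟩ := hc
        obtain ⟨j, rfl⟩ := Subgroup.mem_zpowers_iff.1 hc'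
        simp only [mem_filter, mem_univ, true_and]
        rw [← zpow_natCast, ← zpow_mul, mul_comm, zpow_mul, zpow_natCast, ← h2, pow_orderOf_eq_one, one_zpow]
  let N : Kˣ → ℕ := fun c => #{x : K | f.eval x ≠ 0 ∧ f.eval x ^ e = (c : K) ^ e}
  have hfib : ∀ (φ : Kˣ → ℂ), ∑ c : Kˣ, φ c * N c =
      ∑ x : K, ∑ c : Kˣ, if f.eval x ≠ 0 ∧ f.eval x ^ e = (c : K) ^ e then φ c else 0 := by
    intro φ
    rw [sum_comm]
    refine sum_congr rfl fun c _ => ?_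
    rw [← sum_filter, sum_const, nsmul_eq_mul, mul_comm]
  have hS : (e : ℂ) * ∑ x : K, ψ (f.eval x) = ∑ c : Kˣ, ψ c * N c := by
    rw [hfib, mul_sum]
    refine sum_congr rfl fun x _ => ?_
    rcases eq_or_ne (f.eval x) 0 with h | h
    · simp [h, MulChar.map_zero]
    · obtain ⟨y, hy⟩ := (isUnit_iff_ne_zero.2 h)
      rw [← hy]
      have h1 : ∀ c : Kˣ, (if (y : K) ≠ 0 ∧ (y : K) ^ e = (c : K) ^ e then ψ c else 0) = if y ^ e = c ^ e then ψ y else 0 := by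
        intro c
        have h2 : (y : K) ^ e = (c : K) ^ e ↔ y ^ e = c ^ e := by
          rw [Units.ext_iff]; simp
        simp only [h2, ne_eq, Units.ne_zero, not_false_eq_true, true_and]
        split_ifs with h3
        · have h4 := hker (c * y⁻¹) (by rw [mul_pow, ← h3, inv_pow, mul_inv_cancel])
          rw [show (c : K) = ((c * y⁻¹ : Kˣ) : K) * y by simp, map_mul, h4, one_mul]
        · rfl
      rw [sum_congr rfl fun c _ => h1 c, ← sum_filter, sum_const, hcard, nsmul_eq_mul]
  have hψ0 : ∑ c : Kˣ, ψ c = 0 := by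
    refine sum_hom_units_eq_zero (ψ.toMonoidHom.comp (Units.coeHom K)) fun h => hψ1 ?_
    ext c
    simpa using DFunLike.congr_fun h c
  have hn : ∀ c : Kˣ, ‖ψ c‖ = 1 := fun c => Complex.norm_eq_one_of_pow_eq_one (n := m)
    (by rw [← MulChar.pow_apply_coe, hψm, MulChar.one_apply_coe]) (by omega)
  set Z := #{x : K | f.eval x = 0}
  have hNs : ∑ c : Kˣ, (N c : ℝ) = e * (q - Z) := by
    have h1 := hfib (fun _ => 1)
    have h2 : ∑ x : K, ∑ c : Kˣ, (if f.eval x ≠ 0 ∧ f.eval x ^ e = (c : K) ^ e then (1 : ℂ) else 0) = e * (q - Z) := by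
      have h3 : ∀ x : K, ∑ c : Kˣ, (if f.eval x ≠ 0 ∧ f.eval x ^ e = (c : K) ^ e then (1 : ℂ) else 0) =
          e * (1 - if f.eval x = 0 then 1 else 0) := by
        intro x
        rcases eq_or_ne (f.eval x) 0 with h | h
        · simp [h]
        · obtain ⟨y, hy⟩ := (isUnit_iff_ne_zero.2 h)
          have h4 : ∀ c : Kˣ, (y : K) ^ e = (c : K) ^ e ↔ y ^ e = c ^ e := fun c => by
            rw [Units.ext_iff]; simp
          rw [← hy]
          simp only [h4, ne_eq, Units.ne_zero, not_false_eq_true, true_and]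
          rw [← sum_filter, sum_const, hcard]; simp
      rw [sum_congr rfl fun x _ => h3 x, ← mul_sum, sum_sub_distrib, ← sum_filter]
      simp [Z, hq]
    rw [h2] at h1
    have : ((∑ c : Kˣ, (N c : ℝ) : ℝ) : ℂ) = ((e * (q - Z) : ℝ) : ℂ) := by push_cast; simpa using h1
    exact_mod_cast this
  have hZ : (Z : ℝ) ≤ D := by
    have h1 : ({x : K | f.eval x = 0} : Finset K) ⊆ f.roots.toFinset := fun x hx => by
      simpa [hf.ne_zero] using hx
    exact_mod_cast (card_le_card h1).trans ((Multiset.toFinset_card_le _).trans ((card_roots' f).trans hD.le))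
  set b : ℝ := (q : ℝ) / m + B * √q
  have hmain : (e : ℝ) * ‖∑ x : K, ψ (f.eval x)‖ ≤ e * (m * B * √q + Z) := by
    calc (e : ℝ) * ‖∑ x : K, ψ (f.eval x)‖ = ‖∑ c : Kˣ, ψ c * N c‖ := by rw [← hS]; simp
      _ = ‖∑ c : Kˣ, ψ c * ((N c - b : ℝ) : ℂ)‖ := by
        congr 1; push_cast
        simp only [mul_sub, sum_sub_distrib, ← sum_mul, hψ0]; simp
      _ ≤ ∑ c : Kˣ, (b - N c) := by
        refine norm_sum_le_of_le _ fun c _ => ?_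
        rw [norm_mul, Complex.norm_real, Real.norm_eq_abs, abs_sub_comm,
          abs_of_nonneg (sub_nonneg.2 (hB K f e _ hqe hf hD))]
        refine mul_le_of_le_one_left (sub_nonneg.2 (hB K f e _ hqe hf hD)) (hn c).le
      _ = e * (m * B * √q + Z) := by
        rw [sum_sub_distrib, hNs, sum_const, card_univ, Fintype.card_units, ← hq, nsmul_eq_mul, he]
        have : (m : ℝ) ≠ 0 := by positivity
        simp only [b]; push_cast; field_simp; ring
  have h3 := le_of_mul_le_mul_left hmain (by exact_mod_cast he0)
  have hs1 : 1 ≤ √(q : ℝ) := by rw [Real.one_le_sqrt]; exact_mod_cast hq1.le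
  have : (D : ℝ) ≤ D * √q := le_mul_of_one_le_right (Nat.cast_nonneg D) hs1
  calc _ ≤ _ := h3
    _ ≤ (m * B + D) * √q := by linarith

/-- bound over all extensions -/
lemma charsum_ext (p : ℕ) [Fact p.Prime] (χ : MulChar (ZMod p) ℂ) (hχ : χ ≠ 1) (f : (ZMod p)[X])
    (hf : f.Monic) (hcop : Nat.Coprime f.natDegree (orderOf χ)) : ∃ C : ℝ, ∀ (K : Type) [Field K] [Fintype K] [Algebra (ZMod p) K],
      ‖∑ x : K, χ (Algebra.norm (ZMod p) (aeval x f))‖ ≤ C * √(Fintype.card K) := by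
  have hm : 1 < orderOf χ := by
    have := orderOf_pos χ
    have := mt orderOf_eq_one_iff.1 hχ
    omega
  obtain ⟨C, hC⟩ := charsum_K hm hcop
  refine ⟨C, fun K _ _ _ => ?_⟩
  let ψ : MulChar K ℂ := { χ.toMonoidHom.comp (Algebra.norm (ZMod p)) with
    map_nonunit' := fun a ha => by
      have : a = 0 := by simpa using ha
      simp [this, Algebra.norm_zero, MulChar.map_zero] }
  have hψ : ∀ y, ψ y = χ (Algebra.norm (ZMod p) y) := fun y => rfl
  have h1 := hC K (f.map (algebraMap _ _)) ψ (by
      ext y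
      rw [MulChar.pow_apply_coe, hψ, MulChar.one_apply_coe, ← MulChar.pow_apply' _ (by omega), pow_orderOf_eq_one]
      exact MulChar.one_apply (IsUnit.map _ y.isUnit)) (by
      intro h
      apply hχ
      ext a
      obtain ⟨y, hy⟩ := FiniteField.norm_surjective (ZMod p) K a
      have hy0 : IsUnit y := by
        rw [isUnit_iff_ne_zero]; rintro rfl; rw [Algebra.norm_zero] at hy; exact a.ne_zero hy.symm
      rw [← hy, ← hψ, h, MulChar.one_apply hy0, hy, MulChar.one_apply_coe]) (by
      refine (MulChar.orderOf_dvd_card_sub_one _ χ).trans ?_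
      rw [ZMod.card, Module.card_eq_pow_finrank (K := ZMod p) (V := K), ZMod.card]
      simpa using Nat.sub_dvd_pow_sub_pow p 1 _) (hf.map _) (hf.natDegree_map _)
  refine le_trans (le_of_eq ?_) h1
  congr 1
  refine sum_congr rfl fun x _ => ?_
  rw [hψ, eval_map_algebraMap]

open Polynomial Finset

section Lfun
open scoped Classical
variable {p : ℕ} [Fact p.Prime]

/-- monic polynomials of degree r -/
noncomputable def monF (p : ℕ) [Fact p.Prime] (r : ℕ) : Finset (ZMod p)[X] :=
  univ.image fun v : Fin r → ZMod p => X ^ r + ∑ i : Fin r, C (v i) * X ^ (i : ℕ)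

lemma mem_monF {r : ℕ} {g : (ZMod p)[X]} : g ∈ monF p r ↔ g.Monic ∧ g.natDegree = r := by
  simp only [monF, mem_image, mem_univ, true_and]
  constructor
  · rintro ⟨v, rfl⟩
    have h : (∑ i : Fin r, C (v i) * X ^ (i : ℕ)).degree < (r : WithBot ℕ) := by
      refine (degree_sum_le _ _).trans_lt ?_
      refine (Finset.sup_lt_iff (WithBot.bot_lt_coe r)).2 ?_
      intro i _
      exact (degree_C_mul_X_pow_le _ _).trans_lt (WithBot.coe_lt_coe.2 i.2)
    refine ⟨monic_X_pow_add h, ?_⟩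
    rw [natDegree_eq_of_degree_eq_some (n := r)]
    rw [degree_add_eq_left_of_degree_lt (by rwa [degree_X_pow]), degree_X_pow]
  · rintro ⟨hg, rfl⟩
    refine ⟨fun i => g.coeff i, ?_⟩
    conv_rhs => rw [hg.as_sum]
    rw [Finset.sum_range]

noncomputable def irrF (p : ℕ) [Fact p.Prime] (r : ℕ) : Finset (ZMod p)[X] :=
  (monF p r).filter Irreducible

noncomputable def XF (χ : MulChar (ZMod p) ℂ) (s : Finset (ZMod p)) (e : ZMod p → ℕ) (g : (ZMod p)[X]) : ℂ :=
  ∏ a ∈ s, χ ((-1) ^ g.natDegree * g.eval a) ^ e a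

variable (χ : MulChar (ZMod p) ℂ) (s : Finset (ZMod p)) (e : ZMod p → ℕ)

lemma XF_mul {g h : (ZMod p)[X]} (hg : g ≠ 0) (hh : h ≠ 0) :
    XF χ s e (g * h) = XF χ s e g * XF χ s e h := by
  simp only [XF, ← prod_mul_distrib, ← mul_pow, ← map_mul]
  refine prod_congr rfl fun a _ => ?_
  rw [natDegree_mul hg hh, eval_mul]; congr 2; ring

lemma XF_pow {g : (ZMod p)[X]} (hg : g ≠ 0) (n : ℕ) : XF χ s e (g ^ n) = XF χ s e g ^ n := by
  induction n with
  | zero => simp [XF]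
  | succ n ih => rw [pow_succ, XF_mul χ s e (pow_ne_zero _ hg) hg, ih, pow_succ]

noncomputable def AF (r : ℕ) : ℂ := ∑ g ∈ monF p r, XF χ s e g

noncomputable def TF (j : ℕ) : ℂ := ∑ d ∈ Icc 1 j, ∑ i ∈ Icc 1 j,
  if d * i = j then ∑ π ∈ irrF p d, (d : ℂ) * XF χ s e π ^ i else 0

lemma deg_ident {r : ℕ} {g : (ZMod p)[X]} (hg : g ∈ monF p r) :
    r = ∑ d ∈ Icc 1 r, ∑ π ∈ irrF p d, d * #{i ∈ Icc 1 r | π ^ i ∣ g} := by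
  obtain ⟨hm, hr⟩ := mem_monF.1 hg
  open UniqueFactorizationMonoid in
  set Φ := normalizedFactors g with hΦ
  have hirr : ∀ π ∈ Φ, Irreducible π ∧ π.Monic := fun π h =>
    ⟨UniqueFactorizationMonoid.irreducible_of_normalized_factor π h, by
      have := UniqueFactorizationMonoid.normalize_normalized_factor π h
      rw [← this]
      exact monic_normalize (UniqueFactorizationMonoid.irreducible_of_normalized_factor π h).ne_zero⟩
  have hprod : Φ.prod = g := by
    have h1 := UniqueFactorizationMonoid.prod_normalizedFactors_eq (a := g) hm.ne_zero
    rw [hΦ, h1, hm.normalize_eq_self]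
  have hdeg : r = (Φ.map natDegree).sum := by
    rw [← hr, ← hprod, natDegree_multiset_prod_of_monic _ fun π h => (hirr π h).2]
  have hcnt : ∀ d, ∀ π ∈ irrF p d, ∀ i, π ^ i ∣ g ↔ i ≤ Φ.count π := by
    intro d π hπ i
    simp only [irrF, mem_filter, mem_monF] at hπ
    rw [pow_dvd_iff_le_emultiplicity, UniqueFactorizationMonoid.emultiplicity_eq_count_normalizedFactors
      hπ.2 hm.ne_zero, hπ.1.1.normalize_eq_self, Nat.cast_le]
  have hle : ∀ π ∈ Φ, π.natDegree ∈ Icc 1 r ∧ Φ.count π ≤ r := by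
    intro π hπ
    have h1 := (hirr π hπ).1.natDegree_pos
    have h2 : Φ.count π * π.natDegree ≤ r := by
      rw [hdeg, Finset.sum_multiset_map_count]
      simpa using Finset.single_le_sum (f := fun a => Φ.count a • a.natDegree) (fun _ _ => Nat.zero_le _)
        (Multiset.mem_toFinset.2 hπ)
    have h3 : 1 ≤ Φ.count π := Multiset.one_le_count_iff_mem.2 hπ
    rw [mem_Icc]
    refine ⟨⟨h1, ?_⟩, ?_⟩ <;> nlinarith
  have hcard : ∀ d, ∀ π ∈ irrF p d, d * #{i ∈ Icc 1 r | π ^ i ∣ g} = Φ.count π • π.natDegree := by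
    intro d π hπ
    simp only [hcnt d π hπ]
    simp only [irrF, mem_filter, mem_monF] at hπ
    rw [hπ.1.2, smul_eq_mul, mul_comm]
    congr 1
    by_cases h : π ∈ Φ
    · have : (Icc 1 r).filter (fun i => i ≤ Φ.count π) = Icc 1 (Φ.count π) := by
        ext i; simp only [mem_filter, mem_Icc]; have := (hle π h).2; omega
      rw [this]; simp
    · rw [Multiset.count_eq_zero_of_notMem h]
      refine card_eq_zero.2 (filter_eq_empty_iff.2 fun i hi => ?_)
      rw [mem_Icc] at hi; omega
  rw [sum_congr rfl fun d _ => sum_congr rfl (hcard d), ← sum_biUnion]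
  · conv_lhs => rw [hdeg, Finset.sum_multiset_map_count]
    refine sum_subset (fun π hπ => ?_) (fun π _ hπ => ?_)
    · rw [Multiset.mem_toFinset] at hπ
      rw [mem_biUnion]
      exact ⟨π.natDegree, (hle π hπ).1, by simp [irrF, mem_monF, hirr π hπ]⟩
    · rw [Multiset.mem_toFinset] at hπ
      simp [Multiset.count_eq_zero_of_notMem hπ]
  · intro a _ b _ hab
    rw [Function.onFun, disjoint_left]
    intro π h1 h2
    simp only [irrF, mem_filter, mem_monF] at h1 h2
    exact hab (h1.1.2.symm.trans h2.1.2)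

lemma sum_dvd_mon {d : ℕ} {π : (ZMod p)[X]} (hπ : π ∈ irrF p d) (r i : ℕ) :
    ∑ g ∈ (monF p r).filter (fun g => π ^ i ∣ g), XF χ s e g =
      if d * i ≤ r then XF χ s e π ^ i * AF χ s e (r - d * i) else 0 := by
  simp only [irrF, mem_filter, mem_monF] at hπ
  obtain ⟨⟨hm, rfl⟩, hirr⟩ := hπ
  split_ifs with h
  · rw [AF, mul_sum, ← XF_pow χ s e hm.ne_zero]
    symm
    refine sum_bij (fun h _ => π ^ i * h) ?_ ?_ ?_ ?_
    · intro g hg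
      rw [mem_monF] at hg
      simp only [mem_filter, mem_monF, dvd_mul_right, and_true]
      exact ⟨(hm.pow i).mul hg.1, by rw [(hm.pow i).natDegree_mul hg.1, hm.natDegree_pow, hg.2, mul_comm i]; omega⟩
    · intro a _ b _ hab
      exact mul_left_cancel₀ (pow_ne_zero i hm.ne_zero) hab
    · intro g hg
      simp only [mem_filter, mem_monF] at hg
      obtain ⟨⟨hg1, hg2⟩, k, rfl⟩ := hg
      have hk := (hm.pow i).of_mul_monic_left hg1
      refine ⟨k, ?_, rfl⟩
      rw [(hm.pow i).natDegree_mul hk, hm.natDegree_pow, mul_comm i] at hg2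
      exact mem_monF.2 ⟨hk, by omega⟩
    · intro g hg
      rw [mem_monF] at hg
      exact (XF_mul χ s e (pow_ne_zero i hm.ne_zero) hg.1.ne_zero).symm
  · refine sum_eq_zero fun g hg => ?_
    simp only [mem_filter, mem_monF] at hg
    have h1 := natDegree_le_of_dvd hg.2 hg.1.1.ne_zero
    rw [hm.natDegree_pow, hg.1.2, mul_comm] at h1
    exact absurd h1 h

lemma newtonF (r : ℕ) : (r : ℂ) * AF χ s e r = ∑ j ∈ Icc 1 r, AF χ s e (r - j) * TF χ s e j := by
  have h1 : (r : ℂ) * AF χ s e r = ∑ d ∈ Icc 1 r, ∑ π ∈ irrF p d, ∑ i ∈ Icc 1 r,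
      (d : ℂ) * ∑ g ∈ (monF p r).filter (fun g => π ^ i ∣ g), XF χ s e g := by
    rw [AF, mul_sum]
    have : ∀ g ∈ monF p r, (r : ℂ) * XF χ s e g = ∑ d ∈ Icc 1 r, ∑ π ∈ irrF p d, ∑ i ∈ Icc 1 r,
        if π ^ i ∣ g then (d : ℂ) * XF χ s e g else 0 := by
      intro g hg
      conv_lhs => rw [deg_ident hg]
      push_cast
      simp only [sum_mul]
      refine sum_congr rfl fun d _ => sum_congr rfl fun π _ => ?_
      rw [← sum_filter, sum_const, nsmul_eq_mul]; ring
    rw [sum_congr rfl this, sum_comm]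
    refine sum_congr rfl fun d _ => ?_
    rw [sum_comm]
    refine sum_congr rfl fun π _ => ?_
    rw [sum_comm]
    refine sum_congr rfl fun i _ => ?_
    rw [sum_filter, mul_sum]
    refine sum_congr rfl fun g _ => by split_ifs <;> simp
  rw [h1]
  have h2 : ∀ d ∈ Icc 1 r, ∑ π ∈ irrF p d, ∑ i ∈ Icc 1 r,
      (d : ℂ) * ∑ g ∈ (monF p r).filter (fun g => π ^ i ∣ g), XF χ s e g =
      ∑ i ∈ Icc 1 r, ∑ j ∈ Icc 1 r, if d * i = j then AF χ s e (r - j) * ∑ π ∈ irrF p d, (d : ℂ) * XF χ s e π ^ i else 0 := by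
    intro d hd
    rw [sum_comm]
    refine sum_congr rfl fun i hi => ?_
    rw [mem_Icc] at hi hd
    rw [Finset.sum_ite_eq]
    have : 1 ≤ d * i := Nat.mul_pos hd.1 hi.1
    split_ifs with h
    · rw [mem_Icc] at h
      rw [mul_sum]
      refine sum_congr rfl fun π hπ => ?_
      rw [sum_dvd_mon χ s e hπ r i, if_pos h.2]; ring
    · refine sum_eq_zero fun π hπ => ?_
      rw [sum_dvd_mon χ s e hπ r i, if_neg (fun h' => h (mem_Icc.2 ⟨this, h'⟩)), mul_zero]
  rw [sum_congr rfl h2]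
  simp only [TF]
  have h3 : ∀ j ∈ Icc 1 r, ∀ G : ℕ → ℕ → ℂ, ∑ d ∈ Icc 1 j, ∑ i ∈ Icc 1 j, (if d * i = j then G d i else 0) =
      ∑ d ∈ Icc 1 r, ∑ i ∈ Icc 1 r, if d * i = j then G d i else 0 := by
    intro j hj G
    rw [mem_Icc] at hj
    rw [← sum_product', ← sum_product']
    refine sum_subset (product_subset_product (Icc_subset_Icc_right hj.2) (Icc_subset_Icc_right hj.2)) ?_
    rintro ⟨d, i⟩ h1 h2
    simp only [mem_product, mem_Icc] at h1 h2
    rw [if_neg]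
    intro hdi
    simp only at hdi
    have := Nat.le_mul_of_pos_right d h1.2.1
    have := Nat.le_mul_of_pos_left i h1.1.1
    omega
  rw [sum_congr rfl fun d _ => sum_comm, sum_comm]
  refine sum_congr rfl fun j hj => ?_
  rw [h3 j hj, mul_sum]
  refine sum_congr rfl fun d _ => ?_
  rw [mul_sum]
  refine sum_congr rfl fun i _ => ?_
  split_ifs <;> simp
end Lfun

open Polynomial Finset

section Lfun2
open scoped Classical
variable {p : ℕ} [Fact p.Prime]
variable (χ : MulChar (ZMod p) ℂ) (s : Finset (ZMod p)) (e : ZMod p → ℕ)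

open IntermediateField in
lemma norm_sub_alg {K : Type} [Field K] [Fintype K] [Algebra (ZMod p) K] (x : K) (a : ZMod p) (i : ℕ)
    (hi : (minpoly (ZMod p) x).natDegree * i = Module.finrank (ZMod p) K) :
    Algebra.norm (ZMod p) (x - algebraMap _ K a) =
      ((-1) ^ (minpoly (ZMod p) x).natDegree * (minpoly (ZMod p) x).eval a) ^ i := by
  have hx : IsIntegral (ZMod p) (x - algebraMap _ K a) := .of_finite _ _
  set y := x - algebraMap _ K a with hy
  have hmin : minpoly (ZMod p) y = (minpoly (ZMod p) x).comp (X + C a) := minpoly.sub_algebraMap x a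
  have hd : (minpoly (ZMod p) y).natDegree = (minpoly (ZMod p) x).natDegree := by
    rw [hmin, natDegree_comp, natDegree_X_add_C, mul_one]
  have hpos : 0 < (minpoly (ZMod p) y).natDegree := minpoly.natDegree_pos hx
  have hfr : Module.finrank (ZMod p)⟮y⟯ K = i := by
    have h1 := Module.finrank_mul_finrank (ZMod p) (ZMod p)⟮y⟯ K
    rw [IntermediateField.adjoin.finrank hx, ← hi, ← hd] at h1
    exact Nat.eq_of_mul_eq_mul_left hpos h1
  rw [Algebra.norm_eq_norm_adjoin, hfr]
  congr 1
  have h2 := Algebra.PowerBasis.norm_gen_eq_coeff_zero_minpoly (IntermediateField.adjoin.powerBasis hx)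
  rw [IntermediateField.adjoin.powerBasis_gen, IntermediateField.adjoin.powerBasis_dim,
    IntermediateField.minpoly_gen] at h2
  rw [h2, hd, hmin, coeff_zero_eq_eval_zero, eval_comp]; simp

lemma TF_eq {K : Type} [Field K] [Fintype K] [Algebra (ZMod p) K] :
    ∑ x : K, χ (Algebra.norm (ZMod p) (aeval x (∏ a ∈ s, (X - C a) ^ e a))) =
      TF χ s e (Module.finrank (ZMod p) K) := by
  obtain ⟨j, hj⟩ : ∃ j, j = Module.finrank (ZMod p) K := ⟨_, rfl⟩
  have hj0 : 0 < j := hj ▸ Module.finrank_pos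
  rw [← hj]
  have h1 : ∀ x : K, χ (Algebra.norm (ZMod p) (aeval x (∏ a ∈ s, (X - C a) ^ e a))) =
      ∑ d ∈ Icc 1 j, ∑ i ∈ Icc 1 j, if d * i = j then ∑ π ∈ irrF p d,
        if minpoly (ZMod p) x = π then XF χ s e π ^ i else 0 else 0 := by
    intro x
    have hx : IsIntegral (ZMod p) x := .of_finite _ _
    obtain ⟨i, hi⟩ := minpoly.degree_dvd hx
    rw [← hj] at hi
    have hd0 := minpoly.natDegree_pos hx
    have hi0 : 0 < i := Nat.pos_of_ne_zero (by rintro rfl; omega)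
    rw [sum_eq_single_of_mem (minpoly (ZMod p) x).natDegree, sum_eq_single_of_mem i, if_pos hi.symm,
      sum_eq_single_of_mem (minpoly (ZMod p) x), if_pos rfl]
    · rw [map_prod, map_prod, map_prod, XF, ← prod_pow]
      refine prod_congr rfl fun a _ => ?_
      have h0 : aeval x (X - C a) = x - algebraMap _ K a := by simp
      simp only [map_pow, h0, norm_sub_alg x a i (hi.symm.trans hj)]
      ring
    · simp [irrF, mem_monF, minpoly.monic hx, minpoly.irreducible hx]
    · intro π _ h; rw [if_neg (Ne.symm h)]
    · rw [mem_Icc]; exact ⟨hi0, by rw [hi]; exact Nat.le_mul_of_pos_left _ hd0⟩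
    · intro i' _ h
      rw [if_neg]
      rw [hi]
      exact fun h' => h (Nat.eq_of_mul_eq_mul_left hd0 h')
    · rw [mem_Icc]; exact ⟨hd0, by rw [hi]; exact Nat.le_mul_of_pos_right _ hi0⟩
    · intro d _ h
      refine sum_eq_zero fun i' _ => ?_
      split_ifs
      · refine sum_eq_zero fun π hπ => ?_
        rw [if_neg]
        rintro rfl
        simp only [irrF, mem_filter, mem_monF] at hπ
        exact h hπ.1.2.symm
      · rfl
  rw [sum_congr rfl fun x _ => h1 x, sum_comm, TF]
  refine sum_congr rfl fun d _ => ?_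
  rw [sum_comm]
  refine sum_congr rfl fun i _ => ?_
  split_ifs with hdi
  · rw [sum_comm]
    refine sum_congr rfl fun π hπ => ?_
    rw [← sum_filter, sum_const, nsmul_eq_mul]
    congr 2
    simp only [irrF, mem_filter, mem_monF] at hπ
    obtain ⟨⟨hm, hd⟩, hirr⟩ := hπ
    have hcard : Fintype.card K = p ^ j := by rw [Module.card_eq_pow_finrank (K := ZMod p), ZMod.card, hj]
    have hdvd : π ∣ X ^ Fintype.card K - X := by
      rw [hcard]
      have := (Irreducible.natDegree_dvd_iff_dvd_X_pow_card_pow_sub_X hirr (n := j)).1 ⟨i, by rw [hd, hdi]⟩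
      rwa [Nat.card_zmod] at this
    have hspl := (FiniteField.isSplittingField_sub K (ZMod p)).splits'
    have hspl' : (map (algebraMap (ZMod p) K) π).Splits := by
      refine hspl.of_dvd ?_ (Polynomial.map_dvd _ hdvd)
      rw [Polynomial.map_ne_zero_iff (algebraMap (ZMod p) K).injective]
      exact FiniteField.X_pow_card_sub_X_ne_zero _ Fintype.one_lt_card
    have hc := card_rootSet_eq_natDegree (PerfectField.separable_of_irreducible hirr) hspl'
    rw [hd] at hc
    rw [← hc, ← Fintype.card_subtype]
    refine Fintype.card_congr (Equiv.subtypeEquivRight fun x => ?_)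
    rw [mem_rootSet]
    constructor
    · rintro rfl; exact ⟨hm.ne_zero, minpoly.aeval _ _⟩
    · rintro ⟨_, h⟩; exact (minpoly.eq_of_irreducible_of_monic hirr h hm).symm
  · simp

lemma AF_zero : AF χ s e 0 = 1 := by
  have : monF p 0 = {1} := by
    ext g
    rw [mem_monF, mem_singleton]
    exact ⟨fun h => eq_one_of_monic_natDegree_zero h.1 h.2, by rintro rfl; simp⟩
  simp [AF, this, XF]

lemma AF_one : AF χ s e 1 = ∑ x : ZMod p, ∏ a ∈ s, χ (x - a) ^ e a := by
  symm
  refine sum_bij (fun x _ => X - C x) ?_ ?_ ?_ ?_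
  · intro x _; exact mem_monF.2 ⟨monic_X_sub_C x, natDegree_X_sub_C x⟩
  · intro x _ y _ h; simpa using h
  · intro g hg
    obtain ⟨hm, hd⟩ := mem_monF.1 hg
    refine ⟨-g.coeff 0, mem_univ _, ?_⟩
    conv_rhs => rw [hm.as_sum, hd]
    simp
  · intro x _
    refine prod_congr rfl fun a _ => ?_
    simp

lemma AF_big {a0 : ZMod p} (ha : a0 ∈ s) (hχ : χ ^ e a0 ≠ 1) {r : ℕ} (hr : #s ≤ r) : AF χ s e r = 0 := by
  obtain ⟨u, hu⟩ := MulChar.ne_one_iff.1 hχ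
  rw [MulChar.pow_apply_coe] at hu
  have hinj : Set.InjOn (id : ZMod p → ZMod p) s := Function.injective_id.injOn
  set L := Lagrange.basis s id a0 with hL
  have hL1 : L.eval a0 = 1 := Lagrange.eval_basis_self hinj ha
  have hL2 : ∀ b ∈ s, b ≠ a0 → L.eval b = 0 := fun b hb h =>
    Lagrange.eval_basis_of_ne (v := id) (Ne.symm h) hb
  have hLd : L.degree < r := by
    rw [hL, Lagrange.degree_basis hinj ha]
    have := card_pos.2 ⟨a0, ha⟩
    exact Nat.cast_lt.2 (by omega)
  set τ : ZMod p → (ZMod p)[X] → (ZMod p)[X] := fun u g => g + C ((u - 1) * g.eval a0) * L with hτ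
  have hmem : ∀ u, ∀ g ∈ monF p r, τ u g ∈ monF p r := by
    intro u g hg
    obtain ⟨hm, hd⟩ := mem_monF.1 hg
    have : (C ((u - 1) * g.eval a0) * L).degree < g.degree := by
      rw [degree_eq_natDegree hm.ne_zero, hd]
      exact ((degree_mul_le _ _).trans (add_le_add_left degree_C_le _)).trans_lt (by simpa using hLd)
    exact mem_monF.2 ⟨hm.add_of_left this, by rw [natDegree_add_eq_left_of_degree_lt this, hd]⟩
  have hev : ∀ u g, (τ u g).eval a0 = u * g.eval a0 := by
    intro u g; simp only [hτ, eval_add, eval_mul, eval_C, hL1]; ring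
  have hinv : ∀ u v : ZMod p, v * u = 1 → ∀ g, τ v (τ u g) = g := by
    intro u v huv g
    have h1 := hev u g
    simp only [hτ] at h1 ⊢
    rw [h1, add_assoc, ← add_mul, ← C_add]
    have : (u - 1) * eval a0 g + (v - 1) * (u * eval a0 g) = 0 := by
      linear_combination (eval a0 g) * huv
    rw [this]; simp
  have key : AF χ s e r = χ u ^ e a0 * AF χ s e r := by
    conv_lhs => rw [AF]
    rw [AF, mul_sum]
    symm
    refine sum_nbij' (τ u) (τ (u⁻¹ : (ZMod p)ˣ)) (hmem _) (hmem _) (fun g _ => hinv _ _ u.inv_mul g)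
      (fun g _ => hinv _ _ u.mul_inv g) ?_
    intro g hg
    have hd := (mem_monF.1 hg).2
    have hd' := (mem_monF.1 (hmem u g hg)).2
    rw [XF, XF, ← mul_prod_erase s _ ha, ← mul_prod_erase s _ ha, hd, hd', hev, ← mul_assoc, ← mul_pow, ← map_mul]
    congr 1
    · ring_nf
    · refine prod_congr rfl fun b hb => ?_
      rw [mem_erase] at hb
      simp [hτ, hL2 b hb.2 hb.1]
  have : (1 - χ u ^ e a0) * AF χ s e r = 0 := by linear_combination key
  rcases mul_eq_zero.1 this with h | h
  · exact absurd (sub_eq_zero.1 h).symm hu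
  · exact h
end Lfun2

lemma newton_bound (A T : ℕ → ℂ) (n : ℕ) (K ρ : ℝ) (hρ : 0 < ρ) (hA0 : A 0 = 1) (hA : ∀ r, n < r → A r = 0)
    (hN : ∀ r : ℕ, (r : ℂ) * A r = ∑ j ∈ Icc 1 r, A (r - j) * T j)
    (hT : ∀ j, 1 ≤ j → ‖T j‖ ≤ K * ρ ^ j) : ‖A 1‖ ≤ n * ρ := by
  set B : ℂ[X] := ∑ r ∈ range (n + 1), C (A r) * X ^ r with hB
  have hcoeff : ∀ r, B.coeff r = A r := by
    intro r
    simp only [hB, finsetSum_coeff, coeff_C_mul, coeff_X_pow, mul_ite, mul_one, mul_zero, sum_ite_eq, mem_range]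
    split_ifs with h
    · rfl
    · rw [hA r (by omega)]
  have hBd : B.natDegree ≤ n := natDegree_le_iff_coeff_eq_zero.2 fun r hr => by rw [hcoeff, hA r hr]
  set T' : ℕ → ℂ := fun j => if j = 0 then 0 else T j with hT'
  have hT'b : ∀ j, ‖T' j‖ ≤ |K| * ρ ^ j := by
    intro j
    simp only [hT']
    split_ifs with h
    · rw [norm_zero]; positivity
    · exact (hT j (by omega)).trans (by gcongr; exact le_abs_self K)
  have hroot : ∀ z0 : ℂ, B.eval z0 = 0 → 1 ≤ ‖z0‖ * ρ := by
    intro z0 hz0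
    by_contra! hlt
    have hB0 : B ≠ 0 := by intro h; have := hcoeff 0; rw [h, hA0] at this; simp at this
    have hz00 : z0 ≠ 0 := by
      rintro rfl
      rw [← coeff_zero_eq_eval_zero, hcoeff, hA0] at hz0; exact one_ne_zero hz0
    obtain ⟨D, hD, hDz⟩ := exists_eq_pow_rootMultiplicity_mul_and_not_dvd B hB0 z0
    obtain ⟨m, hm⟩ : ∃ m, m = B.rootMultiplicity z0 := ⟨_, rfl⟩
    have hm0 : 0 < m := hm ▸ (rootMultiplicity_pos hB0).2 hz0
    rw [← hm] at hD
    rw [dvd_iff_isRoot, IsRoot] at hDz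
    -- radius
    obtain ⟨η, hη1, hη2⟩ : ∃ η, ‖z0‖ < η ∧ η * ρ < 1 := by
      obtain ⟨η, h1, h2⟩ := exists_between ((lt_div_iff₀ hρ).2 hlt)
      exact ⟨η, h1, (lt_div_iff₀ hρ).1 h2⟩
    have hη0 : 0 < η := (norm_nonneg _).trans_lt hη1
    have hgeo : Summable fun j : ℕ => |K| * (η * ρ) ^ j :=
      (summable_geometric_of_lt_one (by positivity) hη2).mul_left _
    have hle : ∀ z : ℂ, ‖z‖ < η → ∀ j, ‖T' j * z ^ j‖ ≤ |K| * (η * ρ) ^ j := by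
      intro z hz j
      rw [norm_mul, norm_pow, mul_comm η, mul_pow, ← mul_assoc]
      gcongr
      exact hT'b j
    have hsum : ∀ z : ℂ, ‖z‖ < η → Summable fun j => ‖T' j * z ^ j‖ := fun z hz =>
      Summable.of_nonneg_of_le (fun _ => norm_nonneg _) (hle z hz) hgeo
    set Φ : ℂ → ℂ := fun z => ∑' j, T' j * z ^ j with hΦ
    have hΦb : ∀ z : ℂ, ‖z‖ < η → ‖Φ z‖ ≤ ∑' j : ℕ, |K| * (η * ρ) ^ j := fun z hz =>
      tsum_of_norm_bounded hgeo.hasSum (hle z hz)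
    have hid : ∀ z : ℂ, ‖z‖ < η → z * (derivative B).eval z = B.eval z * Φ z := by
      intro z hz
      have hfin : ∀ r ∉ range (n + 1), A r * z ^ r = 0 := by
        intro r hr; rw [mem_range] at hr; rw [hA r (by omega), zero_mul]
      have e1 : B.eval z = ∑' r, A r * z ^ r := by
        rw [tsum_eq_sum hfin, hB, eval_finsetSum]; simp
      have hs1 : Summable fun r => ‖A r * z ^ r‖ := summable_of_ne_finset_zero (s := range (n + 1))
        fun r hr => by rw [hfin r hr, norm_zero]
      have e2 : z * (derivative B).eval z = ∑' r : ℕ, (r : ℂ) * A r * z ^ r := by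
        rw [tsum_eq_sum (s := range (n + 1)) (fun r hr => by rw [mul_assoc, hfin r hr, mul_zero]), hB, derivative_sum,
          eval_finsetSum, mul_sum]
        refine sum_congr rfl fun r _ => ?_
        rcases r with _ | r
        · simp
        · simp; ring
      rw [e1, e2, hΦ, tsum_mul_tsum_eq_tsum_sum_antidiagonal_of_summable_norm hs1 (hsum z hz)]
      refine tsum_congr fun r => ?_
      rw [hN, Finset.Nat.sum_antidiagonal_eq_sum_range_succ (fun a b => A a * z ^ a * (T' b * z ^ b)),
        ← Finset.sum_range_reflect, sum_range_succ']
      simp only [hT']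
      rw [← Finset.Ico_succ_right_eq_Icc, sum_Ico_eq_sum_range, sum_mul]
      simp only [Nat.succ_eq_succ, Nat.succ_eq_add_one, add_tsub_cancel_right, tsub_zero, tsub_self, if_true, zero_mul, mul_zero, add_zero]
      refine sum_congr rfl fun k hk => ?_
      rw [mem_range] at hk
      have h1 : r + 1 - 1 - (k + 1) = r - (1 + k) := by omega
      have h2 : r - (r - (1 + k)) = 1 + k := by omega
      have h3 : z ^ r = z ^ (r - (1 + k)) * z ^ (1 + k) := by rw [← pow_add]; congr 1; omega
      rw [add_tsub_cancel_right] at h1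
      rw [h3, h1, h2, if_neg (by omega : 1 + k ≠ 0)]
      ring
    have hid2 : ∀ z : ℂ, ‖z‖ < η → z ≠ z0 → m * z * D.eval z = (z - z0) * (D.eval z * Φ z - z * (derivative D).eval z) := by
      intro z hz hne
      have h1 := hid z hz
      obtain ⟨k, rfl⟩ : ∃ k, m = k + 1 := ⟨m - 1, by omega⟩
      rw [hD] at h1
      simp only [derivative_mul, derivative_X_sub_C_pow, eval_add, eval_mul, eval_pow, eval_sub, eval_X, eval_C,
        add_tsub_cancel_right] at h1
      refine mul_left_cancel₀ (pow_ne_zero k (sub_ne_zero.2 hne)) ?_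
      rw [pow_succ] at h1
      linear_combination h1
    have hnb : ∀ᶠ z in nhdsWithin z0 {z0}ᶜ, ‖z‖ < η ∧ z ≠ z0 := by
      refine Filter.Eventually.and ?_ self_mem_nhdsWithin
      exact nhdsWithin_le_nhds (continuous_norm.continuousAt.eventually_lt continuousAt_const hη1)
    have hl1 : Filter.Tendsto (fun z => m * z * D.eval z) (nhdsWithin z0 {z0}ᶜ) (nhds (m * z0 * D.eval z0)) :=
      ((continuous_const.mul continuous_id).mul D.continuous).continuousAt.tendsto.mono_left nhdsWithin_le_nhds
    have hl2 : Filter.Tendsto (fun z => m * z * D.eval z) (nhdsWithin z0 {z0}ᶜ) (nhds 0) := by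
      have ht : Filter.Tendsto (fun z => ‖z - z0‖ * (‖D.eval z‖ * (∑' j : ℕ, |K| * (η * ρ) ^ j) + ‖z * (derivative D).eval z‖))
          (nhdsWithin z0 {z0}ᶜ) (nhds 0) := by
        have : Continuous (fun z => ‖z - z0‖ * (‖D.eval z‖ * (∑' j : ℕ, |K| * (η * ρ) ^ j) + ‖z * (derivative D).eval z‖)) := by
          have := D.continuous; have := (derivative D).continuous
          fun_prop
        have h := (this.tendsto z0).mono_left (nhdsWithin_le_nhds (s := {z0}ᶜ))
        simpa using h
      refine squeeze_zero_norm' ?_ ht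
      filter_upwards [hnb] with z hz
      rw [hid2 z hz.1 hz.2, norm_mul]
      gcongr
      refine (norm_sub_le _ _).trans ?_
      gcongr
      rw [norm_mul]
      gcongr
      exact hΦb z hz.1
    have := tendsto_nhds_unique hl1 hl2
    simp [hm0.ne', hz00, hDz] at this
  rcases Nat.eq_zero_or_pos B.natDegree with h0 | h0
  · rw [← hcoeff, coeff_eq_zero_of_natDegree_lt (by omega), norm_zero]; positivity
  have htr : B.natTrailingDegree = 0 := by
    rw [natTrailingDegree_eq_zero]; right; rw [hcoeff, hA0]; exact one_ne_zero
  have hmon : B.reverse.Monic := by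
    rw [Monic, reverse_leadingCoeff, trailingCoeff, htr, hcoeff, hA0]
  have hrd : B.reverse.natDegree = B.natDegree := by rw [reverse_natDegree, htr, Nat.sub_zero]
  have hnext : B.reverse.nextCoeff = A 1 := by
    rw [nextCoeff, if_neg (by omega), hrd, coeff_reverse, revAt_le (by omega), ← hcoeff]
    congr 1; omega
  rw [← hnext, (IsAlgClosed.splits _).nextCoeff_eq_neg_sum_roots_of_monic hmon, norm_neg]
  have hr : ∀ w ∈ B.reverse.roots, ‖w‖ ≤ ρ := by
    intro w hw
    rw [mem_roots hmon.ne_zero, IsRoot] at hw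
    have hw0 : w ≠ 0 := by
      rintro rfl
      rw [← coeff_zero_eq_eval_zero, coeff_zero_reverse, leadingCoeff_eq_zero] at hw
      rw [hw] at h0; simp at h0
    have : B.eval w⁻¹ = 0 := by
      let _ := invertibleOfNonzero (inv_ne_zero hw0)
      have h1 := eval₂_reverse_eq_zero_iff (RingHom.id ℂ) w⁻¹ B
      rw [invOf_eq_inv, inv_inv] at h1
      exact h1.1 hw
    have h2 := hroot _ this
    rwa [norm_inv, inv_mul_eq_div, one_le_div (norm_pos_iff.2 hw0)] at h2
  calc ‖B.reverse.roots.sum‖ ≤ (B.reverse.roots.map norm).sum := norm_multiset_sum_le _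
    _ ≤ Multiset.card (B.reverse.roots.map norm) • ρ := by
        refine Multiset.sum_le_card_nsmul _ _ ?_
        intro x hx
        obtain ⟨w, hw, rfl⟩ := Multiset.mem_map.1 hx
        exact hr w hw
    _ ≤ n * ρ := by
        rw [nsmul_eq_mul, Multiset.card_map]
        gcongr
        exact (card_roots' _).trans (hrd.le.trans hBd)

lemma weil {p : ℕ} [Fact p.Prime] (χ : MulChar (ZMod p) ℂ) (hχ : χ ≠ 1) (s : Finset (ZMod p)) (e : ZMod p → ℕ)
    (hcop : Nat.Coprime (∑ a ∈ s, e a) (orderOf χ)) : ‖∑ x : ZMod p, ∏ a ∈ s, χ (x - a) ^ e a‖ ≤ #s * √p := by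
  obtain ⟨a0, ha0, hne⟩ : ∃ a0 ∈ s, χ ^ e a0 ≠ 1 := by
    by_contra! h
    have h1 : orderOf χ ∣ ∑ a ∈ s, e a := Finset.dvd_sum fun a ha => orderOf_dvd_of_pow_eq_one (h a ha)
    have h2 := Nat.dvd_gcd h1 dvd_rfl
    rw [hcop, Nat.dvd_one, orderOf_eq_one_iff] at h2
    exact hχ h2
  set f : (ZMod p)[X] := ∏ a ∈ s, (X - C a) ^ e a with hf
  have hfm : f.Monic := monic_prod_of_monic _ _ fun a _ => (monic_X_sub_C a).pow _
  have hfd : f.natDegree = ∑ a ∈ s, e a := by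
    rw [hf, natDegree_prod_of_monic _ _ fun a _ => (monic_X_sub_C a).pow _]
    exact sum_congr rfl fun a _ => by rw [(monic_X_sub_C a).natDegree_pow, natDegree_X_sub_C, mul_one]
  obtain ⟨K, hK⟩ := charsum_ext p χ hχ f hfm (by rwa [hfd])
  have hp : 0 < p := (Fact.out : p.Prime).pos
  rw [← AF_one]
  refine newton_bound (AF χ s e) (TF χ s e) #s K (√p) (by positivity) (AF_zero χ s e)
    (fun r hr => AF_big χ s e ha0 hne hr.le) (newtonF χ s e) ?_
  intro j hj
  let _ : Fintype (GaloisField p j) := Fintype.ofFinite _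
  have h1 := hK (GaloisField p j)
  have hfr := GaloisField.finrank p (n := j) (by omega)
  rw [hf, TF_eq χ s e, hfr, Module.card_eq_pow_finrank (K := ZMod p), hfr, ZMod.card] at h1
  refine h1.trans (le_of_eq ?_)
  push_cast
  congr 1
  rw [Real.sqrt_eq_iff_eq_sq (by positivity) (by positivity), ← pow_mul, mul_comm, pow_mul, Real.sq_sqrt (by positivity)]

open Polynomial Finset

section Cube
variable {A : Type*} [CommRing A]

/-- divided difference -/
noncomputable def dq (s t : A) (f : A[X]) : A[X] :=
  f.sum fun n c => C c * ∑ i ∈ range n, (X + C s) ^ i * (X + C t) ^ (n - 1 - i)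

lemma dq_range (s t : A) (f : A[X]) (N : ℕ) (h : f.natDegree < N) :
    dq s t f = ∑ n ∈ range N, C (f.coeff n) * ∑ i ∈ range n, (X + C s) ^ i * (X + C t) ^ (n - 1 - i) :=
  sum_over_range' _ (fun n => by simp) _ h

lemma dq_spec (s t : A) (f : A[X]) : f.comp (X + C s) - f.comp (X + C t) = C (s - t) * dq s t f := by
  rw [comp_eq_sum_left, comp_eq_sum_left, sum_def, sum_def, dq, sum_def, ← sum_sub_distrib, mul_sum]
  refine sum_congr rfl fun n _ => ?_
  have := (Commute.all (X + C s : A[X]) (X + C t)).geom_sum₂_mul n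
  rw [← mul_sub, ← this, C_sub]; ring

lemma dq_map {B : Type*} [CommRing B] (φ : A →+* B) (s t : A) (f : A[X]) :
    (dq s t f).map φ = dq (φ s) (φ t) (f.map φ) := by
  rw [dq_range s t f (f.natDegree + 1) (by omega), dq_range _ _ (f.map φ) (f.natDegree + 1)
    (by have := natDegree_map_le (f := φ) (p := f); omega)]
  simp [Polynomial.map_sum]

/-- cube polynomials (even part, odd part) -/
noncomputable def cub (s t : ℕ → A) : ℕ → A[X] × A[X]
  | 0 => (X, 1)
  | i + 1 => ((cub s t i).1.comp (X + C (s i)) * (cub s t i).2.comp (X + C (t i)),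
      (cub s t i).2.comp (X + C (s i)) * (cub s t i).1.comp (X + C (t i)))

noncomputable def cubR (s t : ℕ → A) : ℕ → A[X]
  | 0 => X - 1
  | i + 1 => dq (s i) (t i) (cubR s t i) * (cub s t i).2.comp (X + C (t i)) -
      (cubR s t i).comp (X + C (t i)) * dq (s i) (t i) (cub s t i).2

lemma cub_spec (s t : ℕ → A) (k : ℕ) :
    (cub s t k).1 = (cub s t k).2 + C (∏ i ∈ range k, (s i - t i)) * cubR s t k := by
  induction k with
  | zero => simp [cub, cubR]
  | succ k ih =>
    have h1 := dq_spec (s k) (t k) (cubR s t k)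
    have h2 := dq_spec (s k) (t k) (cub s t k).2
    simp only [cub, cubR, ih, add_comp, mul_comp, C_comp, prod_range_succ, C_mul]
    linear_combination (C (∏ i ∈ range k, (s i - t i)) * ((cub s t k).2.comp (X + C (t k)))) * h1 -
      C (∏ i ∈ range k, (s i - t i)) * ((cubR s t k).comp (X + C (t k))) * h2

lemma cub_map {B : Type*} [CommRing B] (φ : A →+* B) (s t : ℕ → A) (k : ℕ) :
    (cub s t k).1.map φ = (cub (fun i => φ (s i)) (fun i => φ (t i)) k).1 ∧
    (cub s t k).2.map φ = (cub (fun i => φ (s i)) (fun i => φ (t i)) k).2 ∧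
    (cubR s t k).map φ = cubR (fun i => φ (s i)) (fun i => φ (t i)) k := by
  induction k with
  | zero => simp [cub, cubR]
  | succ k ih => simp [cub, cubR, Polynomial.map_comp, ih, dq_map]

lemma cub_congr {s t s' t' : ℕ → A} {k : ℕ} (h : ∀ i < k, s i = s' i ∧ t i = t' i) :
    cub s t k = cub s' t' k ∧ cubR s t k = cubR s' t' k := by
  induction k with
  | zero => simp [cub, cubR]
  | succ k ih =>
    have h1 := ih fun i hi => h i (by omega)
    simp [cub, cubR, h1, (h k (by omega)).1, (h k (by omega)).2]

/-- coefficient N is c, and above N all vanish -/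
def HT (f : A[X]) (N : ℤ) (c : A) : Prop :=
  (N < 0 → c = 0) ∧ ∀ j : ℕ, N ≤ j → f.coeff j = if (j : ℤ) = N then c else 0

lemma HT.mul {f g : A[X]} {N M : ℤ} {c d : A} (hf : HT f N c) (hg : HT g M d) : HT (f * g) (N + M) (c * d) := by
  refine ⟨fun h => ?_, fun j hj => ?_⟩
  · rcases lt_or_ge N 0 with h1 | h1
    · rw [hf.1 h1, zero_mul]
    · rw [hg.1 (by omega), mul_zero]
  rw [coeff_mul]
  have key : ∀ x ∈ antidiagonal j, f.coeff x.1 * g.coeff x.2 =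
      if ((x.1 : ℤ) = N ∧ (x.2 : ℤ) = M) then c * d else 0 := by
    rintro ⟨a, b⟩ hx
    rw [HasAntidiagonal.mem_antidiagonal] at hx
    simp only at hx ⊢
    rcases lt_or_ge (a : ℤ) N with h1 | h1
    · rw [hg.2 b (by omega), if_neg (by omega), mul_zero, if_neg (by omega)]
    rcases lt_or_ge (b : ℤ) M with h2 | h2
    · rw [hf.2 a (by omega), if_neg (by omega), zero_mul, if_neg (by omega)]
    rw [hf.2 a h1, hg.2 b h2]
    by_cases h3 : (a : ℤ) = N <;> by_cases h4 : (b : ℤ) = M <;> simp [h3, h4]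
  rw [sum_congr rfl key]
  split_ifs with h
  · rcases lt_or_ge N 0 with h1 | h1
    · simp [hf.1 h1]
    rcases lt_or_ge M 0 with h2 | h2
    · simp [hg.1 h2]
    rw [sum_eq_single_of_mem (N.toNat, M.toNat)]
    · rw [if_pos]; simp; omega
    · rw [HasAntidiagonal.mem_antidiagonal]; simp only; omega
    · rintro ⟨a, b⟩ _ hne
      rw [if_neg]
      rintro ⟨h3, h4⟩
      simp only at h3 h4
      apply hne
      rw [← h3, ← h4]; simp
  · refine sum_eq_zero fun x hx => if_neg ?_
    rw [HasAntidiagonal.mem_antidiagonal] at hx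
    omega

lemma HT.sub {f g : A[X]} {N : ℤ} {c d : A} (hf : HT f N c) (hg : HT g N d) : HT (f - g) N (c - d) := by
  refine ⟨fun h => by rw [hf.1 h, hg.1 h, sub_zero], fun j hj => ?_⟩
  rw [coeff_sub, hf.2 j hj, hg.2 j hj]; split_ifs <;> simp

lemma HT_X_add_C_pow (s : A) (n : ℕ) : HT ((X + C s) ^ n) n 1 := by
  induction n with
  | zero =>
    refine ⟨by simp, fun j hj => ?_⟩
    simp [coeff_one]
  | succ n ih =>
    have h1 : HT (X + C s) 1 1 := by
      refine ⟨by simp, fun j hj => ?_⟩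
      rw [coeff_add, coeff_X, coeff_C, if_neg (show j ≠ 0 by omega), add_zero]
      congr 1
      simp [eq_comm]
    have := ih.mul h1
    rw [pow_succ]; simpa using this

lemma HT.natDegree_lt {f : A[X]} {N : ℤ} {c : A} (hf : HT f N c) (M : ℕ) (hM : N < M) : f.natDegree < M + 1 := by
  rw [Nat.lt_succ_iff, natDegree_le_iff_coeff_eq_zero]
  intro j hj
  rw [hf.2 j (by omega), if_neg (by omega)]

lemma HT.sum_monomial {f : A[X]} {N : ℤ} {c : A} (hf : HT f N c) (b : ℤ) (u : ℕ → A[X]) (v : ℕ → A)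
    (hu : ∀ n, HT (u n) (n - b) (v n)) (hb : N - b < 0 → 0 ≤ N → v N.toNat = 0) (M : ℕ) (hM : f.natDegree < M) (hNM : N < M) :
    HT (∑ n ∈ range M, C (f.coeff n) * u n) (N - b) (c * v N.toNat) := by
  refine ⟨fun h => ?_, fun j hj => ?_⟩
  · rcases lt_or_ge N 0 with h1 | h1
    · rw [hf.1 h1, zero_mul]
    · rw [hb h h1, mul_zero]
  simp only [finsetSum_coeff, coeff_C_mul]
  rcases lt_or_ge N 0 with h1 | h1
  · rw [hf.1 h1, zero_mul, ite_self]
    refine sum_eq_zero fun n _ => ?_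
    rw [hf.2 n (by omega), if_neg (by omega), zero_mul]
  rw [sum_eq_single_of_mem N.toNat]
  · rw [hf.2 _ (by omega), if_pos (by omega), (hu _).2 _ (by omega)]
    split_ifs <;> first | rfl | omega | simp
  · rw [mem_range]; omega
  · intro n _ hn
    rcases lt_or_ge (n : ℤ) N with h2 | h2
    · rw [(hu n).2 j (by omega), if_neg (by omega), mul_zero]
    · rw [hf.2 n h2, if_neg (by omega), zero_mul]

lemma HT.comp {f : A[X]} {N : ℤ} {c : A} (hf : HT f N c) (s : A) : HT (f.comp (X + C s)) N c := by
  obtain ⟨M, hM1, hM2⟩ : ∃ M : ℕ, f.natDegree < M ∧ N < M := ⟨f.natDegree + N.toNat + 1, by omega, by omega⟩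
  have h := hf.sum_monomial 0 (fun n => (X + C s) ^ n) (fun _ => 1) (fun n => by simpa using HT_X_add_C_pow s n)
    (by intros; omega) M hM1 hM2
  rw [comp_eq_sum_left, sum_over_range' _ (fun n => by simp) M hM1]
  simpa using h

lemma HT.dq {f : A[X]} {N : ℤ} {c : A} (hf : HT f N c) (s t : A) : HT (dq s t f) (N - 1) (c * (N : A)) := by
  obtain ⟨M, hM1, hM2⟩ : ∃ M : ℕ, f.natDegree < M ∧ N < M := ⟨f.natDegree + N.toNat + 1, by omega, by omega⟩
  have h := hf.sum_monomial 1 (fun n => ∑ i ∈ range n, (X + C s) ^ i * (X + C t) ^ (n - 1 - i)) (fun n => (n : A))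
    (fun n => ?_) ?_ M hM1 hM2
  · rw [dq_range s t f M hM1]
    convert h using 1
    rcases lt_or_ge N 0 with h1 | h1
    · rw [hf.1 h1, zero_mul, zero_mul]
    · congr 1
      rw [← Int.cast_natCast, Int.toNat_of_nonneg h1]
  · refine ⟨fun h => ?_, fun j hj => ?_⟩
    · rw [(by omega : n = 0), Nat.cast_zero]
    · rw [finsetSum_coeff, sum_congr rfl (g := fun _ => if (j : ℤ) = n - 1 then (1 : A) else 0)]
      · rw [sum_const, card_range]; split_ifs <;> simp
      · intro i hi
        rw [mem_range] at hi
        have h1 := ((HT_X_add_C_pow s i).mul (HT_X_add_C_pow t (n - 1 - i))).2 j (by omega)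
        rw [h1, mul_one]
        congr 1
        apply propext; omega
  · intro h1 h2
    rw [(by omega : N = 0)]; simp

lemma cub_HT (s t : ℕ → A) (k : ℕ) : HT (cub s t (k + 1)).2 (2 ^ k : ℕ) 1 ∧ HT (cub s t (k + 1)).1 (2 ^ k : ℕ) 1 ∧
    ∃ ε : ℤ, (ε = 1 ∨ ε = -1) ∧ HT (cubR s t (k + 1)) ((2 ^ k : ℕ) - (k + 1 : ℕ)) ((ε * k.factorial : ℤ) : A) := by
  induction k with
  | zero =>
    have h1 : HT (1 : A[X]) 0 1 := by simpa using HT_X_add_C_pow (0 : A) 0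
    have h2 : ∀ u : A, HT (X + C u) 1 1 := fun u => by simpa using HT_X_add_C_pow u 1
    refine ⟨?_, ?_, 1, Or.inl rfl, ?_⟩
    · simpa [cub] using h2 (t 0)
    · simpa [cub] using h2 (s 0)
    · have e1 : dq (s 0) (t 0) (X - 1 : A[X]) = 1 := by
        rw [dq_range _ _ _ 2 (by have := natDegree_X_sub_C_le (1 : A); rw [C_1] at this; omega), sum_range_succ, sum_range_one]
        simp [coeff_one]
      have e2 : dq (s 0) (t 0) (1 : A[X]) = 0 := by
        rw [dq_range _ _ _ 1 (by simp), sum_range_one]; simp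
      simp only [cubR, cub, e1, e2]
      simpa using h1
  | succ k ih =>
    obtain ⟨h1, h2, ε, hε, h3⟩ := ih
    have e0 : ((2 ^ (k + 1) : ℕ) : ℤ) = (2 ^ k : ℕ) + (2 ^ k : ℕ) := by push_cast; ring
    refine ⟨?_, ?_, -ε, by omega, ?_⟩
    · rw [cub, e0]; simpa using (h1.comp (s (k + 1))).mul (h2.comp (t (k + 1)))
    · rw [cub, e0]; simpa using (h2.comp (s (k + 1))).mul (h1.comp (t (k + 1)))
    · rw [cubR]
      have h4 := ((h3.dq (s (k + 1)) (t (k + 1))).mul (h1.comp (t (k + 1))))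
      have h5 := ((h3.comp (t (k + 1))).mul (h1.dq (s (k + 1)) (t (k + 1))))
      rw [show ((2 ^ k : ℕ) : ℤ) - (k + 1 : ℕ) - 1 + (2 ^ k : ℕ) = (2 ^ (k + 1) : ℕ) - (k + 1 + 1 : ℕ) by push_cast; ring] at h4
      rw [show ((2 ^ k : ℕ) : ℤ) - (k + 1 : ℕ) + ((2 ^ k : ℕ) - 1) = (2 ^ (k + 1) : ℕ) - (k + 1 + 1 : ℕ) by push_cast; ring] at h5
      convert h4.sub h5 using 1
      rw [Nat.factorial_succ]; push_cast; ring

lemma dq_zero (n : ℕ) (c : A) : dq 0 0 (C c * X ^ n) = C (c * n) * X ^ (n - 1) := by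
  rw [dq_range _ _ _ (n + 1) (Nat.lt_succ_of_le (natDegree_C_mul_X_pow_le c n)), sum_eq_single_of_mem n (by simp)]
  · have : ∀ i ∈ range n, (X + C (0 : A)) ^ i * (X + C 0) ^ (n - 1 - i) = X ^ (n - 1) := fun i hi => by
      rw [mem_range] at hi
      rw [C_0, add_zero, ← pow_add]; congr 1; omega
    rw [sum_congr rfl this]; simp; ring
  · intro b _ hb; simp [coeff_X_pow, hb]

lemma cub_zero (k : ℕ) : (cub (0 : ℕ → A) 0 (k + 1)).2 = X ^ 2 ^ k ∧ (cub (0 : ℕ → A) 0 (k + 1)).1 = X ^ 2 ^ k ∧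
    ∃ ε : ℤ, (ε = 1 ∨ ε = -1) ∧ cubR (0 : ℕ → A) 0 (k + 1) = C ((ε * k.factorial : ℤ) : A) * X ^ (2 ^ k - (k + 1)) := by
  induction k with
  | zero =>
    refine ⟨by simp [cub], by simp [cub], 1, Or.inl rfl, ?_⟩
    have e1 : dq 0 0 (X - 1 : A[X]) = 1 := by
      rw [dq_range _ _ _ 2 (by have := natDegree_X_sub_C_le (1 : A); rw [C_1] at this; omega), sum_range_succ, sum_range_one]
      simp [coeff_one]
    have e2 : dq 0 0 (1 : A[X]) = 0 := by simpa using dq_zero 0 (1 : A)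
    simp [cubR, cub, e1, e2]
  | succ k ih =>
    obtain ⟨h1, h2, ε, hε, h3⟩ := ih
    refine ⟨by rw [cub, h1, h2]; simp; ring, by rw [cub, h1, h2]; simp; ring, -ε, by omega, ?_⟩
    have h6 := dq_zero (2 ^ k) (1 : A)
    rw [C_1, one_mul, one_mul] at h6
    rw [cubR, h1, h3]
    simp only [Pi.zero_apply, dq_zero, h6]
    have hk : k + 1 ≤ 2 ^ k := Nat.lt_two_pow_self
    simp only [C_0, add_zero, comp_X]
    rcases hk.eq_or_lt with h | h
    · rw [pow_succ, ← h]
      have e1 : (k + 1) * 2 - (k + 1 + 1) = k := by omega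
      simp only [e1, Nat.sub_self, Nat.factorial_succ, add_tsub_cancel_right]; simp; ring
    · have e1 : 2 ^ (k + 1) - (k + 1 + 1) = (2 ^ k - (k + 1) - 1) + 2 ^ k := by rw [pow_succ]; omega
      have e2 : 2 ^ (k + 1) - (k + 1 + 1) = (2 ^ k - (k + 1)) + (2 ^ k - 1) := by rw [pow_succ]; omega
      have e3 : ((2 ^ k - (k + 1) : ℕ) : A) = 2 ^ k - (k + 1) := by rw [Nat.cast_sub hk]; push_cast; ring
      have u1 : (X : A[X]) ^ (2 ^ k - (k + 1) - 1) * X ^ 2 ^ k = X ^ (2 ^ (k + 1) - (k + 1 + 1)) := by rw [← pow_add, e1]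
      have u2 : (X : A[X]) ^ (2 ^ k - (k + 1)) * X ^ (2 ^ k - 1) = X ^ (2 ^ (k + 1) - (k + 1 + 1)) := by rw [← pow_add, e2]
      rw [e3, Nat.factorial_succ]
      simp only [Int.cast_mul, Int.cast_neg, Int.cast_add, Int.cast_one, Int.cast_natCast, Nat.cast_mul, Nat.cast_add, Nat.cast_one, Nat.cast_pow,
        Nat.cast_ofNat, C_mul, C_sub, C_add, C_neg, C_1, C_pow]
      linear_combination (C (ε : A) * C (k.factorial : A) * (C 2 ^ k - (C (k : A) + 1))) * u1 -
        (C (ε : A) * C (k.factorial : A) * C 2 ^ k) * u2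
end Cube

open Polynomial Finset

lemma weil2 {p : ℕ} [Fact p.Prime] (χ : MulChar (ZMod p) ℂ) (hχ : χ ≠ 1) (s : Finset (ZMod p)) (e : ZMod p → ℕ)
    (v : ZMod p) (hv : v ∈ s) (hev : e v = 1) (hdvd : orderOf χ ∣ ∑ a ∈ s, e a) :
    ‖∑ x : ZMod p, ∏ a ∈ s, χ (x - a) ^ e a‖ ≤ 1 + #s * √p := by
  have hm := orderOf_pos χ
  have hχpow : ∀ u : ZMod p, u ≠ 0 → ∀ n, orderOf χ ∣ n → χ u ^ n = 1 := by
    intro u hu n hn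
    rw [show u = ((Units.mk0 u hu : (ZMod p)ˣ) : ZMod p) from rfl, ← MulChar.pow_apply_coe,
      orderOf_dvd_iff_pow_eq_one.1 hn, MulChar.one_apply_coe]
  have hn1 : ∀ u : ZMod p, ‖χ u‖ ≤ 1 := by
    intro u
    by_cases hu : u = 0
    · rw [hu, MulChar.map_nonunit χ not_isUnit_zero]; simp
    · exact (Complex.norm_eq_one_of_pow_eq_one (hχpow u hu _ dvd_rfl) hm.ne').le
  -- new points
  set b : ZMod p → ZMod p := fun a => -(v - a)⁻¹ with hb
  set s' := (s.erase v).image b with hs'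
  have hinj : Set.InjOn b (s.erase v) := by
    intro x _ y _ hxy
    simpa [hb] using hxy
  set e' : ZMod p → ℕ := fun z => e (v + z⁻¹) with he'
  have hebb : ∀ a, e' (b a) = e a := by intro a; simp only [he', hb, inv_neg, inv_inv]; congr 1; ring
  have hsum : ∑ z ∈ s', e' z + 1 = ∑ a ∈ s, e a := by
    rw [hs', sum_image hinj, sum_congr rfl fun a _ => hebb a, ← hev, sum_erase_add _ _ hv]
  have hcop : Nat.Coprime (∑ z ∈ s', e' z) (orderOf χ) := by
    obtain ⟨n, hn⟩ := hdvd
    rw [hn] at hsum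
    have : IsCoprime ((∑ z ∈ s', e' z : ℕ) : ℤ) (orderOf χ : ℤ) := ⟨-1, n, by
      have : ((∑ z ∈ s', e' z : ℕ) : ℤ) + 1 = orderOf χ * n := by exact_mod_cast hsum
      linear_combination -this⟩
    exact Nat.isCoprime_iff_coprime.1 this
  have hW := weil χ hχ s' e' hcop
  have hcard : #s' ≤ #s := card_image_le.trans (card_erase_le)
  set c : ℂ := ∏ a ∈ s.erase v, χ (v - a) ^ e a with hc
  have hc1 : ‖c‖ ≤ 1 := by
    rw [hc, norm_prod]
    exact prod_le_one (fun _ _ => norm_nonneg _) fun a _ => by rw [norm_pow]; exact pow_le_one₀ (norm_nonneg _) (hn1 _)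
  have key : ∀ y : ZMod p, y ≠ 0 → ∏ a ∈ s, χ (y⁻¹ + v - a) ^ e a = c * ∏ z ∈ s', χ (y - z) ^ e' z := by
    intro y hy
    have h1 : ∀ a ∈ s.erase v, χ (y⁻¹ + v - a) ^ e a = (χ (v - a) ^ e a * χ (y - b a) ^ e a) * χ y⁻¹ ^ e a := by
      intro a ha
      rw [mem_erase] at ha
      have : v - a ≠ 0 := sub_ne_zero.2 (Ne.symm ha.1)
      rw [← mul_pow, ← mul_pow, ← map_mul, ← map_mul]
      congr 2
      simp only [hb]; field_simp; ring
    rw [← mul_prod_erase s _ hv, prod_congr rfl h1, prod_mul_distrib, prod_mul_distrib, ← hc, hs', prod_image hinj,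
      prod_pow_eq_pow_sum, add_sub_cancel_right]
    have h3 : ∏ a ∈ s.erase v, χ (y - b a) ^ e' (b a) = ∏ a ∈ s.erase v, χ (y - b a) ^ e a :=
      prod_congr rfl fun a _ => by rw [hebb]
    rw [h3]
    have h2 : χ y⁻¹ ^ e v * χ y⁻¹ ^ (∑ i ∈ s.erase v, e i) = 1 := by
      rw [← pow_add, add_sum_erase _ _ hv]; exact hχpow _ (inv_ne_zero hy) _ hdvd
    linear_combination (c * ∏ x ∈ s.erase v, χ (y - b x) ^ e x) * h2
  have e1 : ∑ x : ZMod p, ∏ a ∈ s, χ (x - a) ^ e a = ∑ y ∈ univ.erase (0 : ZMod p), c * ∏ z ∈ s', χ (y - z) ^ e' z := by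
    rw [← Equiv.sum_comp (Equiv.addRight v), ← Finset.add_sum_erase _ _ (mem_univ (0 : ZMod p))]
    have h0 : ∏ a ∈ s, χ ((Equiv.addRight v) 0 - a) ^ e a = 0 := prod_eq_zero hv (by
      rw [hev, pow_one, show (Equiv.addRight v) 0 - v = 0 by simp]; exact MulChar.map_nonunit χ not_isUnit_zero)
    rw [h0, zero_add]
    refine sum_nbij' (fun x => x⁻¹) (fun x => x⁻¹) (by simp) (by simp) (by simp) (by simp) ?_
    intro x hx
    rw [mem_erase] at hx
    rw [← key _ (inv_ne_zero hx.1), inv_inv]; simp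
  rw [e1, ← mul_sum, norm_mul]
  have e2 : ∑ y ∈ univ.erase (0 : ZMod p), ∏ z ∈ s', χ (y - z) ^ e' z =
      ∑ y : ZMod p, ∏ z ∈ s', χ (y - z) ^ e' z - ∏ z ∈ s', χ (0 - z) ^ e' z := by
    rw [← Finset.add_sum_erase _ _ (mem_univ (0 : ZMod p))]; ring
  have e3 : ‖∏ z ∈ s', χ (0 - z) ^ e' z‖ ≤ 1 := by
    rw [norm_prod]
    exact prod_le_one (fun _ _ => norm_nonneg _) fun a _ => by rw [norm_pow]; exact pow_le_one₀ (norm_nonneg _) (hn1 _)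
  calc _ ≤ 1 * ‖∑ y ∈ univ.erase (0 : ZMod p), ∏ z ∈ s', χ (y - z) ^ e' z‖ := by gcongr
    _ ≤ ‖∑ y : ZMod p, ∏ z ∈ s', χ (y - z) ^ e' z‖ + 1 := by
        rw [one_mul, e2]; exact (norm_sub_le _ _).trans (by gcongr)
    _ ≤ #s * √p + 1 := by
        gcongr
        exact hW.trans (by gcongr)
    _ = _ := add_comm _ _

lemma weil3 {p : ℕ} [Fact p.Prime] (χ : MulChar (ZMod p) ℂ) (hχ : χ ≠ 1) (E O E' : (ZMod p)[X]) (v : ZMod p)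
    (hE : E.Monic) (hO : O.Monic) (hEs : E.Splits) (hOs : O.Splits) (hd : E.natDegree = O.natDegree)
    (hEE : E = (X - C v) * E') (hE' : E'.eval v ≠ 0) (hOv : O.eval v ≠ 0) :
    ‖∑ x : ZMod p, χ (E.eval x) * (starRingEnd ℂ) (χ (O.eval x))‖ ≤ 1 + (2 * E.natDegree) * √p := by
  have hm := orderOf_pos χ
  have hm2 : 2 ≤ orderOf χ := by
    have := mt orderOf_eq_one_iff.1 hχ
    omega
  set m := orderOf χ with hmm
  set s := (E.roots + O.roots).toFinset with hs
  set e : ZMod p → ℕ := fun a => E.roots.count a + (m - 1) * O.roots.count a with he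
  have hE0 := hE.ne_zero
  have hO0 := hO.ne_zero
  have hconj : ∀ u : ZMod p, (starRingEnd ℂ) (χ u) = χ u ^ (m - 1) := by
    intro u
    by_cases hu : u = 0
    · rw [hu, MulChar.map_nonunit χ not_isUnit_zero, zero_pow (by omega), map_zero]
    · have h1 : χ u ^ m = 1 := by
        rw [show u = ((Units.mk0 u hu : (ZMod p)ˣ) : ZMod p) from rfl, ← MulChar.pow_apply_coe, hmm, pow_orderOf_eq_one, MulChar.one_apply_coe]
      have h2 := Complex.norm_eq_one_of_pow_eq_one h1 hm.ne'
      have h3 : χ u ≠ 0 := by rw [← norm_pos_iff, h2]; exact one_pos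
      rw [← Complex.inv_eq_conj h2]
      refine mul_left_cancel₀ h3 ?_
      rw [mul_inv_cancel₀ h3, ← pow_succ', Nat.sub_add_cancel hm, h1]
  have hprod : ∀ (G : (ZMod p)[X]), G.Monic → G.Splits → G.roots.toFinset ⊆ s → ∀ x, χ (G.eval x) = ∏ a ∈ s, χ (x - a) ^ G.roots.count a := by
    intro G hG hGs hsub x
    conv_lhs => rw [hGs.eq_prod_roots_of_monic hG]
    rw [eval_multiset_prod, Multiset.map_map, map_multiset_prod, Multiset.map_map, Finset.prod_multiset_map_count]
    refine (prod_subset hsub fun a _ ha => ?_).trans ?_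
    · rw [Multiset.mem_toFinset] at ha
      rw [Multiset.count_eq_zero_of_notMem ha, pow_zero]
    · refine prod_congr rfl fun a _ => by simp
  have h1 : ∀ x, χ (E.eval x) * (starRingEnd ℂ) (χ (O.eval x)) = ∏ a ∈ s, χ (x - a) ^ e a := by
    intro x
    rw [hconj, hprod E hE hEs (by rw [hs, Multiset.toFinset_add]; exact subset_union_left) x,
      hprod O hO hOs (by rw [hs, Multiset.toFinset_add]; exact subset_union_right) x, ← prod_pow, ← prod_mul_distrib]
    refine prod_congr rfl fun a _ => ?_
    rw [he]; ring
  rw [sum_congr rfl fun x _ => h1 x]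
  have hsumc : ∀ G : (ZMod p)[X], G.roots.toFinset ⊆ s → ∑ a ∈ s, G.roots.count a = Multiset.card G.roots := by
    intro G hG
    exact Multiset.sum_count_eq_card fun a ha => hG (Multiset.mem_toFinset.2 ha)
  have hev : e v = 1 := by
    have h2 : O.roots.count v = 0 := Multiset.count_eq_zero_of_notMem (by
      rw [mem_roots hO0]; exact hOv)
    have h3 : E.roots.count v = 1 := by
      rw [hEE] at hE0 ⊢
      rw [roots_mul hE0, roots_X_sub_C, Multiset.count_add, Multiset.count_singleton_self, Multiset.count_eq_zero_of_notMem]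
      intro h
      exact hE' (mem_roots'.1 h).2
    show E.roots.count v + (m - 1) * O.roots.count v = 1
    rw [h2, h3, mul_zero, add_zero]
  have hvs : v ∈ s := by
    rw [hs, Multiset.mem_toFinset, Multiset.mem_add]; left
    rw [mem_roots hE0, hEE]; simp
  have hcards : #s ≤ 2 * E.natDegree := by
    refine (Multiset.toFinset_card_le _).trans ?_
    rw [Multiset.card_add]
    have := card_roots' E; have := card_roots' O; omega
  refine (weil2 χ hχ s e v hvs hev ?_).trans ?_
  · rw [he, sum_add_distrib, ← mul_sum, hsumc E (by rw [hs, Multiset.toFinset_add]; exact subset_union_left),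
      hsumc O (by rw [hs, Multiset.toFinset_add]; exact subset_union_right), ← hEs.natDegree_eq_card_roots, ← hOs.natDegree_eq_card_roots, hd]
    refine ⟨O.natDegree, ?_⟩
    obtain ⟨m', hm'⟩ : ∃ m', m = m' + 1 := ⟨m - 1, by omega⟩
    rw [← hmm, hm']; simp; ring
  · have : ((#s : ℕ) : ℝ) ≤ 2 * E.natDegree := by exact_mod_cast hcards
    gcongr

open Polynomial Finset

structure IsLoc (p a : ℕ) (φ : ℤ → ℂ) : Prop where
  mul : ∀ x y, φ (x * y) = φ x * φ y
  one : φ 1 = 1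
  per : ∀ x y, ((p ^ a : ℕ) : ℤ) ∣ x - y → φ x = φ y
  zero : ∀ x, (p : ℤ) ∣ x → φ x = 0
  norm : ∀ x, ¬ (p : ℤ) ∣ x → ‖φ x‖ = 1
  prim : ∃ u, ((p ^ (a - 1) : ℕ) : ℤ) ∣ u - 1 ∧ ¬ (p : ℤ) ∣ u ∧ φ u ≠ 1

noncomputable def FF (φ : ℤ → ℂ) (s t : ℕ → ℤ) (k : ℕ) (n : ℤ) : ℂ :=
  φ ((cub s t k).1.eval n) * (starRingEnd ℂ) (φ ((cub s t k).2.eval n))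

lemma cub_cast (m : ℕ) (s t : ℕ → ℤ) (k : ℕ) (n : ℤ) :
    (((cub s t k).1.eval n : ℤ) : ZMod m) = (cub (fun i => (s i : ZMod m)) (fun i => (t i : ZMod m)) k).1.eval (n : ZMod m) ∧
    (((cub s t k).2.eval n : ℤ) : ZMod m) = (cub (fun i => (s i : ZMod m)) (fun i => (t i : ZMod m)) k).2.eval (n : ZMod m) ∧
    (((cubR s t k).eval n : ℤ) : ZMod m) = (cubR (fun i => (s i : ZMod m)) (fun i => (t i : ZMod m)) k).eval (n : ZMod m) := by
  have h := cub_map (Int.castRingHom (ZMod m)) s t k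
  simp only [eq_intCast] at h
  refine ⟨?_, ?_, ?_⟩
  · rw [← h.1, eval_intCast_map]; rfl
  · rw [← h.2.1, eval_intCast_map]; rfl
  · rw [← h.2.2, eval_intCast_map]; rfl

lemma cub_mod (m : ℕ) {s t s' t' : ℕ → ℤ} {k : ℕ} (h : ∀ i < k, (m : ℤ) ∣ s i - s' i ∧ (m : ℤ) ∣ t i - t' i) {n n' : ℤ}
    (hn : (m : ℤ) ∣ n - n') : (m : ℤ) ∣ (cub s t k).1.eval n - (cub s' t' k).1.eval n' ∧
    (m : ℤ) ∣ (cub s t k).2.eval n - (cub s' t' k).2.eval n' ∧ (m : ℤ) ∣ (cubR s t k).eval n - (cubR s' t' k).eval n' := by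
  have h1 := cub_cast m s t k n
  have h2 := cub_cast m s' t' k n'
  simp only [← ZMod.intCast_zmod_eq_zero_iff_dvd, Int.cast_sub, sub_eq_zero] at *
  have h3 := cub_congr h
  rw [h1.1, h1.2.1, h1.2.2, h2.1, h2.2.1, h2.2.2, h3.1, h3.2, hn]
  simp

lemma FF_step (φ : ℤ → ℂ) (hmul : ∀ x y, φ (x * y) = φ x * φ y) (s t : ℕ → ℤ) (k : ℕ) (n : ℤ) :
    FF φ s t (k + 1) n = FF φ s t k (n + s k) * (starRingEnd ℂ) (FF φ s t k (n + t k)) := by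
  simp only [FF, cub, eval_mul, eval_comp, eval_add, eval_X, eval_C, hmul, map_mul, Complex.conj_conj]
  ring

lemma FF_congr (φ : ℤ → ℂ) {s t s' t' : ℕ → ℤ} {k : ℕ} (h : ∀ i < k, s i = s' i ∧ t i = t' i) (n : ℤ) :
    FF φ s t k n = FF φ s' t' k n := by
  rw [FF, FF, (cub_congr h).1]

section loc
variable {p a : ℕ} {φ : ℤ → ℂ} (hp : p.Prime) (H : IsLoc p a φ)
include H

lemma IsLoc.norm_le (x : ℤ) : ‖φ x‖ ≤ 1 := by
  by_cases h : (p : ℤ) ∣ x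
  · rw [H.zero x h]; simp
  · rw [H.norm x h]

lemma FF_norm_le (s t : ℕ → ℤ) (k : ℕ) (n : ℤ) : ‖FF φ s t k n‖ ≤ 1 := by
  rw [FF, norm_mul, RCLike.norm_conj]
  exact mul_le_one₀ (H.norm_le _) (norm_nonneg _) (H.norm_le _)

lemma IsLoc.conj_mul {x : ℤ} (h : ¬ (p : ℤ) ∣ x) : φ x * (starRingEnd ℂ) (φ x) = 1 := by
  rw [Complex.mul_conj, Complex.normSq_eq_norm_sq, H.norm x h]; simp

lemma IsLoc.ratio {x y x' y' : ℤ} (hy : ¬ (p : ℤ) ∣ y) (hy' : ¬ (p : ℤ) ∣ y') (h : ((p ^ a : ℕ) : ℤ) ∣ x' * y - x * y') :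
    φ x' * (starRingEnd ℂ) (φ y') = φ x * (starRingEnd ℂ) (φ y) := by
  have h1 := H.per _ _ h
  rw [H.mul, H.mul] at h1
  have h2 := H.conj_mul hy
  have h3 := H.conj_mul hy'
  linear_combination (starRingEnd ℂ (φ y) * starRingEnd ℂ (φ y')) * h1 - φ x' * starRingEnd ℂ (φ y') * h2 + φ x * starRingEnd ℂ (φ y) * h3

include hp
lemma IsLoc.a_pos : 0 < a := by
  rcases Nat.eq_zero_or_pos a with h | h
  · have h1 := H.per 0 1 (by rw [h]; simp)
    rw [H.zero 0 (dvd_zero _), H.one] at h1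
    simp at h1
  · exact h

/-- periodicity -/
lemma FF_per {s t s' t' : ℕ → ℤ} {k c : ℕ} (hc : 1 ≤ c) (W : ℤ) (r r' : ℕ → ℤ)
    (hr : ∏ i ∈ range k, (s i - t i) = W * ∏ i ∈ range k, r i)
    (hr' : ∏ i ∈ range k, (s' i - t' i) = W * ∏ i ∈ range k, r' i)
    (hrr : ∀ i < k, ((p ^ c : ℕ) : ℤ) ∣ r i - r' i)
    (hW : ((p ^ a : ℕ) : ℤ) ∣ W * (p ^ c : ℕ))
    (h : ∀ i < k, ((p ^ c : ℕ) : ℤ) ∣ s i - s' i ∧ ((p ^ c : ℕ) : ℤ) ∣ t i - t' i) {n n' : ℤ} (hn : ((p ^ c : ℕ) : ℤ) ∣ n - n') :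
    FF φ s t k n = FF φ s' t' k n' := by
  obtain ⟨h1, h2, h3⟩ := cub_mod (p ^ c) h hn
  have hpc : (p : ℤ) ∣ ((p ^ c : ℕ) : ℤ) := by exact_mod_cast dvd_pow_self p (by omega)
  have e1 := congrArg (eval n) (cub_spec s t k)
  have e2 := congrArg (eval n') (cub_spec s' t' k)
  simp only [eval_add, eval_mul, eval_C] at e1 e2
  have h4 : ((p ^ c : ℕ) : ℤ) ∣ ∏ i ∈ range k, r i - ∏ i ∈ range k, r' i := by
    simp only [← ZMod.intCast_zmod_eq_zero_iff_dvd, Int.cast_sub, sub_eq_zero] at hrr ⊢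
    rw [Int.cast_prod, Int.cast_prod]
    exact prod_congr rfl fun i hi => hrr i (mem_range.1 hi)
  rw [FF, FF]
  by_cases hO : (p : ℤ) ∣ (cub s t k).2.eval n
  · have : (p : ℤ) ∣ (cub s' t' k).2.eval n' := by
      have := dvd_sub hO (hpc.trans h2); simpa using this
    rw [H.zero _ hO, H.zero _ this]; simp
  · have hO' : ¬ (p : ℤ) ∣ (cub s' t' k).2.eval n' := by
      intro h; apply hO
      have := dvd_add h (hpc.trans h2); simpa using this
    refine H.ratio hO' hO ?_
    rw [e1, e2, hr, hr']
    refine hW.trans ?_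
    obtain ⟨u, hu⟩ := h2
    obtain ⟨v, hv⟩ := h3
    obtain ⟨w, hw⟩ := h4
    generalize (cub s t k).2.eval n = O at *
    generalize (cub s' t' k).2.eval n' = O' at *
    generalize (cubR s t k).eval n = R at *
    generalize (cubR s' t' k).eval n' = R' at *
    generalize ∏ i ∈ range k, r i = D at *
    generalize ∏ i ∈ range k, r' i = D' at *
    generalize ((p ^ c : ℕ) : ℤ) = m at *
    refine ⟨w * R * O' + D' * v * O' - D' * R' * u, ?_⟩
    linear_combination W * R * O' * hw + W * D' * O' * hv - W * D' * R' * hu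

lemma lemX {s t : ℕ → ℤ} {k c c1 d : ℕ} (u : ℤ) (hu : ¬ (p : ℤ) ∣ u) (hc1 : 1 ≤ c1) (hd : c = c1 + d) (hd1 : 1 ≤ d) (hdc : d ≤ c1)
    (hca : c ≤ a) (D : ℤ) (hW : ∏ i ∈ range k, (s i - t i) = (p ^ (a - c) : ℕ) * u * D)
    (hs0 : s k = 0) (ht0 : t k = 0) (n : ℤ)
    (hper : ∀ n n' : ℤ, ((p ^ c : ℕ) : ℤ) ∣ n - n' → FF φ s t k n = FF φ s t k n')
    (hne : ∑ y ∈ range (p ^ d), FF φ s t k (n + (p ^ c1 : ℕ) * y) ≠ 0) :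
    ¬ (p : ℤ) ∣ (cub s t k).1.eval n ∧ ¬ (p : ℤ) ∣ (cub s t k).2.eval n ∧ ((p ^ d : ℕ) : ℤ) ∣ D * (cubR s t (k + 1)).eval n := by
  have hpc : (p : ℤ) ∣ ((p ^ c1 : ℕ) : ℤ) := by exact_mod_cast dvd_pow_self p (by omega)
  have hpZ : Prime (p : ℤ) := Nat.prime_iff_prime_int.1 hp
  have cong : ∀ y : ℤ, ((p ^ c1 : ℕ) : ℤ) ∣ (cub s t k).1.eval (n + (p ^ c1 : ℕ) * y) - (cub s t k).1.eval n ∧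
      ((p ^ c1 : ℕ) : ℤ) ∣ (cub s t k).2.eval (n + (p ^ c1 : ℕ) * y) - (cub s t k).2.eval n := fun y => by
    have := cub_mod (p ^ c1) (s := s) (t := t) (s' := s) (t' := t) (k := k) (fun i _ => by simp) (n := n + (p ^ c1 : ℕ) * y) (n' := n) (by simp)
    exact ⟨this.1, this.2.1⟩
  have hndvd : ¬ (p : ℤ) ∣ (cub s t k).1.eval n ∧ ¬ (p : ℤ) ∣ (cub s t k).2.eval n := by
    rw [← not_or]
    intro hor
    apply hne
    refine sum_eq_zero fun y _ => ?_
    rw [FF]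
    rcases hor with h | h
    · rw [H.zero, zero_mul]
      have := dvd_add h (hpc.trans (cong y).1); simpa using this
    · rw [H.zero ((cub s t k).2.eval _), map_zero, mul_zero]
      have := dvd_add h (hpc.trans (cong y).2); simpa using this
  refine ⟨hndvd.1, hndvd.2, ?_⟩
  obtain ⟨ω, hω⟩ : ∃ ω, ω = (cub s t k).2.eval n * (cub s t k).1.eval n := ⟨_, rfl⟩
  obtain ⟨ρ, hρ⟩ : ∃ ρ, ρ = (cubR s t (k + 1)).eval n := ⟨_, rfl⟩
  have hωp : ¬ (p : ℤ) ∣ ω := by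
    rw [hω]; intro h
    rcases hpZ.dvd_or_dvd h with h | h
    exacts [hndvd.2 h, hndvd.1 h]
  have key : ∀ y0 y : ℤ, FF φ s t k (n + (p ^ c1 : ℕ) * (y + y0)) * (starRingEnd ℂ) (FF φ s t k (n + (p ^ c1 : ℕ) * y)) =
      φ (ω + (p ^ (a - c) : ℕ) * u * D * ((p ^ c1 : ℕ) * y0) * ρ) * (starRingEnd ℂ) (φ ω) := by
    intro y0 y
    set s' := Function.update s k ((p ^ c1 : ℕ) * (y + y0)) with hs'
    set t' := Function.update t k ((p ^ c1 : ℕ) * y) with ht'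
    have hlt : ∀ i < k, s i = s' i ∧ t i = t' i := fun i hi => by
      simp [hs', ht', Function.update_of_ne hi.ne]
    have hk : s' k = (p ^ c1 : ℕ) * (y + y0) ∧ t' k = (p ^ c1 : ℕ) * y := by simp [hs', ht']
    have e0 := FF_step φ H.mul s' t' k n
    rw [hk.1, hk.2, ← FF_congr φ hlt, ← FF_congr φ hlt] at e0
    rw [← e0, FF]
    have e1 := congrArg (eval n) (cub_spec s' t' (k + 1))
    have hprod : ∏ i ∈ range (k + 1), (s' i - t' i) = (p ^ (a - c) : ℕ) * u * D * ((p ^ c1 : ℕ) * y0) := by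
      have hst : ∏ i ∈ range k, (s i - t i) = ∏ i ∈ range k, (s' i - t' i) :=
        prod_congr rfl fun i hi => by rw [(hlt i (mem_range.1 hi)).1, (hlt i (mem_range.1 hi)).2]
      rw [prod_range_succ, hk.1, hk.2, ← hW, hst]
      ring
    rw [hprod] at e1
    simp only [eval_add, eval_mul, eval_C] at e1
    obtain ⟨-, h2, h3⟩ := cub_mod (p ^ c1) (s := s') (t := t') (s' := s) (t' := t) (k := k + 1) (n := n) (n' := n) (by
      intro i hi
      rcases Nat.lt_succ_iff_lt_or_eq.1 hi with h | h
      · simp [(hlt i h).1, (hlt i h).2]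
      · rw [h, hk.1, hk.2, hs0, ht0]; simp) (by simp)
    have e2 : (cub s t (k + 1)).2.eval n = ω := by
      rw [hω]; simp [cub, hs0, ht0]
    rw [e2] at h2
    rw [← hρ] at h3
    have hO' : ¬ (p : ℤ) ∣ (cub s' t' (k + 1)).2.eval n := by
      intro h; apply hωp
      have := dvd_sub h (hpc.trans h2); simpa using this
    refine H.ratio hωp hO' ?_
    rw [e1]
    have hpp : ((p ^ a : ℕ) : ℤ) ∣ (p ^ (a - c) : ℕ) * (p ^ c1 : ℕ) * (p ^ c1 : ℕ) := by
      norm_cast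
      rw [← pow_add, ← pow_add]
      exact pow_dvd_pow _ (by omega)
    refine hpp.trans ?_
    obtain ⟨v, hv⟩ := h2
    obtain ⟨w, hw⟩ := h3
    generalize (cub s' t' (k+1)).2.eval n = O at *
    generalize (cubR s' t' (k+1)).eval n = R at *
    refine ⟨u * D * y0 * (w * ω - ρ * v), ?_⟩
    linear_combination ((p ^ (a - c) : ℕ) * u * D * ((p ^ c1 : ℕ) * y0)) * (ω * hw - ρ * hv)
  have hzeta : ∀ y0 : ℕ, φ (ω + (p ^ (a - c) : ℕ) * u * D * ((p ^ c1 : ℕ) * y0) * ρ) * (starRingEnd ℂ) (φ ω) = 1 := by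
    intro y0
    set ζ := φ (ω + (p ^ (a - c) : ℕ) * u * D * ((p ^ c1 : ℕ) * y0) * ρ) * (starRingEnd ℂ) (φ ω) with hζ
    have hstep : ∀ y : ℕ, FF φ s t k (n + (p ^ c1 : ℕ) * ((y + y0 : ℕ) : ℤ)) = ζ * FF φ s t k (n + (p ^ c1 : ℕ) * y) := by
      intro y
      have h1 := key y0 y
      rw [← hζ] at h1
      have h2 : FF φ s t k (n + (p ^ c1 : ℕ) * y) * (starRingEnd ℂ) (FF φ s t k (n + (p ^ c1 : ℕ) * y)) = 1 := by
        have h3 := H.conj_mul (x := (cub s t k).1.eval (n + (p ^ c1 : ℕ) * y)) (by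
          intro h; apply hndvd.1
          have := dvd_sub h (hpc.trans (cong y).1); simpa using this)
        have h4 := H.conj_mul (x := (cub s t k).2.eval (n + (p ^ c1 : ℕ) * y)) (by
          intro h; apply hndvd.2
          have := dvd_sub h (hpc.trans (cong y).2); simpa using this)
        simp only [FF, map_mul, Complex.conj_conj]
        generalize φ ((cub s t k).1.eval (n + (p ^ c1 : ℕ) * y)) = A at *
        generalize φ ((cub s t k).2.eval (n + (p ^ c1 : ℕ) * y)) = B at *
        linear_combination B * starRingEnd ℂ B * h3 + h4
      push_cast at *
      linear_combination FF φ s t k (n + (p : ℤ) ^ c1 * y) * h1 - FF φ s t k (n + (p : ℤ) ^ c1 * (y + y0)) * h2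
    have hsum : ∑ y ∈ range (p ^ d), FF φ s t k (n + (p ^ c1 : ℕ) * ((y + y0 : ℕ) : ℤ)) = ∑ y ∈ range (p ^ d), FF φ s t k (n + (p ^ c1 : ℕ) * y) := by
      have hP : ∀ y : ℕ, FF φ s t k (n + (p ^ c1 : ℕ) * ((y + p ^ d : ℕ) : ℤ)) = FF φ s t k (n + (p ^ c1 : ℕ) * y) := by
        intro y
        apply hper
        refine ⟨1, ?_⟩
        rw [hd]; push_cast; ring
      clear hstep hζ ζ
      induction y0 with
      | zero => simp
      | succ j ih =>
        rw [← ih, ← sub_eq_zero, ← sum_sub_distrib]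
        have := sum_range_sub (fun y => FF φ s t k (n + (p ^ c1 : ℕ) * ((y + j : ℕ) : ℤ))) (p ^ d)
        rw [show (p ^ d + j) = j + p ^ d by ring, hP, zero_add, sub_self] at this
        rw [← this]
        exact sum_congr rfl fun y _ => by rw [show y + (j + 1) = y + 1 + j by ring]
    rw [sum_congr rfl fun y _ => hstep y, ← mul_sum] at hsum
    exact mul_right_cancel₀ hne (hsum.trans (one_mul _).symm)
  -- conclude
  by_contra hnd
  rw [← hρ] at hnd
  obtain ⟨j, v, hv, hDv⟩ : ∃ (j : ℕ) (v : ℤ), ¬ (p : ℤ) ∣ v ∧ D * ρ = (p : ℤ) ^ j * v := by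
    have h0 : D * ρ ≠ 0 := by rintro h; rw [h] at hnd; simp at hnd
    obtain ⟨j, v, h1, h2⟩ := WfDvdMonoid.max_power_factor h0 hpZ.irreducible
    exact ⟨j, v, h1, h2⟩
  have hj : j < d := by
    by_contra h
    apply hnd
    rw [hDv]; push_cast
    exact (pow_dvd_pow _ (by omega)).trans (dvd_mul_right _ _)
  obtain ⟨u', ⟨r, hr⟩, hu1, hu2⟩ := H.prim
  have hpuv : IsCoprime (u * v) (p : ℤ) := by
    refine IsCoprime.symm ((Prime.coprime_iff_not_dvd hpZ).2 fun h => ?_)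
    rcases hpZ.dvd_or_dvd h with h | h
    exacts [hu h, hv h]
  obtain ⟨α, β, hαβ⟩ := hpuv
  -- z natural with z ≡ r ω α mod p
  obtain ⟨z, hz⟩ : ∃ z : ℕ, (p : ℤ) ∣ z - r * ω * α := by
    refine ⟨((r * ω * α) % p).toNat, ?_⟩
    rw [Int.toNat_of_nonneg (Int.emod_nonneg _ hpZ.ne_zero)]
    exact (Int.mod_modEq _ _).symm.dvd
  have h1 := hzeta (p ^ (d - 1 - j) * z)
  have h2 : φ (ω + (p ^ (a - c) : ℕ) * u * D * ((p ^ c1 : ℕ) * (p ^ (d - 1 - j) * z : ℕ)) * ρ) = φ (ω * u') := by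
    apply H.per
    obtain ⟨q, hq⟩ := hz
    have hpw : (p : ℤ) ^ (a - c) * p ^ c1 * p ^ (d - 1 - j) * p ^ j = p ^ (a - 1) := by
      rw [← pow_add, ← pow_add, ← pow_add]; congr 1; omega
    have hpa : (p : ℤ) ^ (a - 1) * p = p ^ a := by rw [← pow_succ]; congr 1; omega
    push_cast at hr ⊢
    refine ⟨u * v * q - r * ω * β, ?_⟩
    rw [← hpa]
    linear_combination (p : ℤ) ^ (a - c) * p ^ c1 * p ^ (d - 1 - j) * u * z * hDv + u * v * z * hpw + (p : ℤ) ^ (a-1) * u * v * hq - ω * hr + (p : ℤ) ^ (a - 1) * r * ω * hαβ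
  rw [h2, H.mul] at h1
  apply hu2
  linear_combination h1 - φ u' * (H.conj_mul hωp)
end loc

open Polynomial Finset

noncomputable def avg {K : Type*} [Field K] (m : ℕ) (G : ℤ → K) : K := (∑ x ∈ range m, G x) / m

lemma avg_const {K : Type*} [Field K] [CharZero K] {m : ℕ} (hm : 0 < m) (c : K) : avg m (fun _ => c) = c := by
  have : (m : K) ≠ 0 := by exact_mod_cast hm.ne'
  simp [avg]; field_simp

lemma avg_mono {m : ℕ} {G G' : ℤ → ℝ} (h : ∀ x : ℕ, x < m → G x ≤ G' x) : avg m G ≤ avg m G' := by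
  unfold avg; gcongr with x hx; exact h x (mem_range.1 hx)

lemma avg_congr {K : Type*} [Field K] {m : ℕ} {G G' : ℤ → K} (h : ∀ x : ℕ, x < m → G x = G' x) : avg m G = avg m G' := by
  unfold avg; congr 1; exact sum_congr rfl fun x hx => h x (mem_range.1 hx)

lemma avg_add {K : Type*} [Field K] (m : ℕ) (G G' : ℤ → K) : avg m (fun x => G x + G' x) = avg m G + avg m G' := by
  simp only [avg, sum_add_distrib, add_div]

lemma avg_mul_left {K : Type*} [Field K] (m : ℕ) (c : K) (G : ℤ → K) : avg m (fun x => c * G x) = c * avg m G := by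
  simp only [avg, ← mul_sum, mul_div_assoc]

lemma norm_avg_le (m : ℕ) (G : ℤ → ℂ) : ‖avg m G‖ ≤ avg m (fun x => ‖G x‖) := by
  unfold avg
  rw [norm_div, Complex.norm_natCast]
  gcongr
  exact norm_sum_le _ _

lemma sum_range_split {K : Type*} [AddCommMonoid K] (m d : ℕ) (G : ℕ → K) :
    ∑ x ∈ range (m * d), G x = ∑ n ∈ range m, ∑ y ∈ range d, G (n + m * y) := by
  induction d with
  | zero => simp
  | succ d ih =>
    rw [mul_add, mul_one, sum_range_add, ih]
    simp only [sum_range_succ, sum_add_distrib]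
    congr 1
    exact sum_congr rfl fun x _ => by rw [add_comm]

lemma avg_split {K : Type*} [Field K] (m d : ℕ) (G : ℤ → K) :
    avg (m * d) G = avg m (fun n => avg d (fun y => G (n + m * y))) := by
  unfold avg
  rw [sum_range_split m d (fun x => G x), ← sum_div, div_div]
  push_cast
  rw [mul_comm (m : K)]

lemma avg_dvd (m r : ℕ) (hm : 0 < m) (hr : 0 < r) (x : ℤ) : avg (m * r) (fun y => if (m : ℤ) ∣ x - y then (1 : ℝ) else 0) ≤ 1 / m := by
  rw [avg_split]
  have h : ∀ n : ℤ, avg r (fun y => if (m : ℤ) ∣ x - (n + m * y) then (1 : ℝ) else 0) = if (m : ℤ) ∣ x - n then 1 else 0 := by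
    intro n
    have : ∀ y : ℤ, ((m : ℤ) ∣ x - (n + m * y)) = ((m : ℤ) ∣ x - n) := fun y => by
      rw [eq_iff_iff, ← sub_sub]; exact dvd_sub_left (dvd_mul_right _ _)
    simp only [this]; exact avg_const hr _
  simp only [h]
  unfold avg
  gcongr
  rw [sum_ite, sum_const_zero, add_zero, sum_const, nsmul_eq_mul, mul_one]
  have : #{x_1 ∈ range m | ((m : ℤ) ∣ x - (x_1 : ℕ))} ≤ 1 := by
    rw [card_le_one]
    intro a ha b hb
    simp only [mem_filter, mem_range] at ha hb
    have h3 : (m : ℤ) ∣ (a : ℤ) - b := by have := dvd_sub hb.2 ha.2; simpa using this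
    have := (Nat.modEq_iff_dvd.2 (by simpa using h3) : b ≡ a [MOD m])
    rw [Nat.ModEq, Nat.mod_eq_of_lt ha.1, Nat.mod_eq_of_lt hb.1] at this
    exact this.symm
  exact_mod_cast this

lemma avg_root {p : ℕ} [Fact p.Prime] (f : (ZMod p)[X]) (hf : f ≠ 0) (D : ℕ) (hD : f.natDegree ≤ D) (w b : ZMod p) (hw : w ≠ 0) :
    avg p (fun x => if f.eval (w * (x : ZMod p) + b) = 0 then (1 : ℝ) else 0) ≤ D / p := by
  unfold avg
  gcongr
  rw [sum_ite, sum_const_zero, add_zero, sum_const, nsmul_eq_mul, mul_one]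
  have : #{x ∈ range p | f.eval (w * (((x : ℕ) : ℤ) : ZMod p) + b) = 0} ≤ #f.roots.toFinset := by
    refine card_le_card_of_injOn (fun x : ℕ => w * ((x : ℤ) : ZMod p) + b) ?_ ?_
    · intro x hx
      simp only [coe_filter, Set.mem_ofPred_eq] at hx
      simp only [mem_coe, Multiset.mem_toFinset, mem_roots hf]; exact hx.2
    · intro x hx y hy hxy
      simp only [coe_filter, Set.mem_ofPred_eq, mem_range] at hx hy
      have h1 : ((x : ℕ) : ZMod p) = y := by
        have := mul_left_cancel₀ hw (add_right_cancel hxy)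
        simpa using this
      have := (ZMod.natCast_eq_natCast_iff' _ _ _).1 h1
      rwa [Nat.mod_eq_of_lt hx.1, Nat.mod_eq_of_lt hy.1] at this
  exact_mod_cast this.trans ((Multiset.toFinset_card_le _).trans ((card_roots' f).trans hD))

noncomputable def EE (m : ℕ) : ℕ → ((ℕ → ℤ × ℤ) → ℝ) → ℝ
  | 0, G => G 0
  | k + 1, G => EE m k (fun h => avg m fun x => avg m fun y => G (Function.update h k (x, y)))

section EE
variable {m : ℕ}
lemma EE_mono {k : ℕ} {G G' : (ℕ → ℤ × ℤ) → ℝ} (h : ∀ x, G x ≤ G' x) : EE m k G ≤ EE m k G' := by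
  induction k generalizing G G' with
  | zero => exact h 0
  | succ k ih => exact ih fun x => avg_mono fun _ _ => avg_mono fun _ _ => h _

lemma EE_const (hm : 0 < m) (k : ℕ) (c : ℝ) : EE m k (fun _ => c) = c := by
  induction k with
  | zero => rfl
  | succ k ih => simp only [EE, avg_const hm]; exact ih

lemma EE_add (k : ℕ) (G G' : (ℕ → ℤ × ℤ) → ℝ) : EE m k (fun h => G h + G' h) = EE m k G + EE m k G' := by
  induction k generalizing G G' with
  | zero => rfl
  | succ k ih => simp only [EE, avg_add]; exact ih _ _

lemma EE_smul (k : ℕ) (c : ℝ) (G : (ℕ → ℤ × ℤ) → ℝ) : EE m k (fun h => c * G h) = c * EE m k G := by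
  induction k generalizing G with
  | zero => rfl
  | succ k ih => simp only [EE, avg_mul_left]; exact ih _

lemma EE_sum (hm : 0 < m) (k : ℕ) {ι : Type*} (S : Finset ι) (G : ι → (ℕ → ℤ × ℤ) → ℝ) :
    EE m k (fun h => ∑ i ∈ S, G i h) = ∑ i ∈ S, EE m k (G i) := by
  classical
  induction S using Finset.induction_on with
  | empty => simpa using EE_const hm k 0
  | insert a S ha ih => simp only [sum_insert ha]; rw [EE_add, ih]

lemma EE_ign (hm : 0 < m) {i k : ℕ} (hik : i < k) (B : ℝ) (G : (ℕ → ℤ × ℤ) → ℝ)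
    (hG : ∀ h j a, i < j → G (Function.update h j a) = G h)
    (hB : ∀ h, avg m (fun x => avg m fun y => G (Function.update h i (x, y))) ≤ B) : EE m k G ≤ B := by
  induction k with
  | zero => omega
  | succ k ih =>
    rcases Nat.lt_succ_iff_lt_or_eq.1 hik with h1 | h1
    · simp only [EE, hG _ _ _ h1, avg_const hm]; exact ih h1
    · subst h1
      exact (EE_mono hB).trans (EE_const hm _ _).le
end EE

lemma EE_delta (k m r i : ℕ) (hi : i < k) (hm : 0 < m) (hr : 0 < r) :
    EE (m * r) k (fun h => if (m : ℤ) ∣ (h i).1 - (h i).2 then (1 : ℝ) else 0) ≤ 1 / m := by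
  have hmr : 0 < m * r := Nat.mul_pos hm hr
  refine EE_ign hmr hi _ _ ?_ ?_
  · intro h j a hj; rw [Function.update_of_ne hj.ne]
  · intro h
    simp only [Function.update_self]
    exact (avg_mono fun x _ => avg_dvd m r hm hr x).trans (avg_const hmr _).le

noncomputable def GG (φ : ℤ → ℂ) (w : ℕ → ℕ) (k m : ℕ) (h : ℕ → ℤ × ℤ) : ℝ :=
  ‖avg m (FF φ (fun i => w i * (h i).1) (fun i => w i * (h i).2) k)‖

section loc
variable {p a : ℕ} {φ : ℤ → ℂ} (hp : p.Prime) (H : IsLoc p a φ)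
include hp H

/-- periodicity in n and h -/
lemma FFw_per (w : ℕ → ℕ) {k c : ℕ} (hc : 1 ≤ c) (hW : p ^ a ∣ (∏ i ∈ range k, w i) * p ^ c)
    {h h' : ℕ → ℤ × ℤ} (hh : ∀ i < k, ((p ^ c : ℕ) : ℤ) ∣ (h i).1 - (h' i).1 ∧ ((p ^ c : ℕ) : ℤ) ∣ (h i).2 - (h' i).2)
    {n n' : ℤ} (hn : ((p ^ c : ℕ) : ℤ) ∣ n - n') :
    FF φ (fun i => w i * (h i).1) (fun i => w i * (h i).2) k n = FF φ (fun i => w i * (h' i).1) (fun i => w i * (h' i).2) k n' := by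
  refine FF_per hp H hc ((∏ i ∈ range k, w i : ℕ) : ℤ) (fun i => (h i).1 - (h i).2) (fun i => (h' i).1 - (h' i).2) ?_ ?_ ?_ ?_ ?_ hn
  · rw [Nat.cast_prod, ← prod_mul_distrib]; simp only [mul_sub]
  · rw [Nat.cast_prod, ← prod_mul_distrib]; simp only [mul_sub]
  · intro i hi
    show _ ∣ ((h i).1 - (h i).2) - ((h' i).1 - (h' i).2)
    rw [sub_sub_sub_comm]
    exact dvd_sub (hh i hi).1 (hh i hi).2
  · exact_mod_cast hW
  · intro i hi
    simp only [← mul_sub]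
    exact ⟨(hh i hi).1.mul_left _, (hh i hi).2.mul_left _⟩

lemma GG_le (w : ℕ → ℕ) {k c c1 d : ℕ} (hc1 : 1 ≤ c1) (hd : c = c1 + d) (hd1 : 1 ≤ d) (hdc : d ≤ c1)
    (hca : c ≤ a) (u : ℕ) (hu : ¬ p ∣ u) (hW : ∏ i ∈ range k, w i = p ^ (a - c) * u) (hwk : w k = 0) (h : ℕ → ℤ × ℤ) (C : ℤ → Prop) [DecidablePred C]
    (hC : ∀ n, ¬ (p : ℤ) ∣ (cub (fun i => w i * (h i).1) (fun i => w i * (h i).2) k).1.eval n →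
      ¬ (p : ℤ) ∣ (cub (fun i => w i * (h i).1) (fun i => w i * (h i).2) k).2.eval n →
      ((p ^ d : ℕ) : ℤ) ∣ (∏ i ∈ range k, ((h i).1 - (h i).2)) * (cubR (fun i => w i * (h i).1) (fun i => w i * (h i).2) (k + 1)).eval n → C n) :
    GG φ w k (p ^ c) h ≤ avg (p ^ c1) (fun n => if C n then 1 else 0) := by
  have hW' : p ^ a ∣ (∏ i ∈ range k, w i) * p ^ c := by
    rw [hW, mul_right_comm, ← pow_add, Nat.sub_add_cancel hca]; exact dvd_mul_right _ _
  unfold GG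
  rw [hd, pow_add, avg_split]
  refine (norm_avg_le _ _).trans (avg_mono fun n _ => ?_)
  by_cases hz : ∑ y ∈ range (p ^ d), FF φ (fun i => w i * (h i).1) (fun i => w i * (h i).2) k ((n : ℤ) + (p ^ c1 : ℕ) * y) = 0
  · rw [avg, hz]; simp; split_ifs <;> simp
  · have hX := lemX hp H (u : ℤ) (by exact_mod_cast hu) hc1 hd hd1 hdc hca (∏ i ∈ range k, ((h i).1 - (h i).2)) (by
      have : (∏ i ∈ range k, (w i : ℤ)) = (p ^ (a - c) : ℕ) * u := by exact_mod_cast hW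
      rw [← this, ← prod_mul_distrib]; simp only [mul_sub]) (by simp [hwk]) (by simp [hwk]) (n : ℤ)
      (fun n n' hn => FFw_per hp H w (by omega) hW' (by simp) hn) hz
    rw [if_pos (hC _ hX.1 hX.2.1 hX.2.2)]
    refine (norm_avg_le _ _).trans ((avg_mono fun y _ => FF_norm_le H _ _ _ _).trans (avg_const (pow_pos hp.pos _) _).le)

lemma LB1 (w : ℕ → ℕ) {k : ℕ} (ha : 2 ≤ a) (hk : k < p) (u : ℕ) (hu : ¬ p ∣ u) (hW : ∏ i ∈ range k, w i = p ^ (a - 2) * u) (hwk : w k = 0) :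
    EE (p ^ 2) k (GG φ w k (p ^ 2)) ≤ (k + 2 ^ k) / p := by
  have : Fact p.Prime := ⟨hp⟩
  have hpZ : Prime (p : ℤ) := Nat.prime_iff_prime_int.1 hp
  have key : ∀ h, GG φ w k (p ^ 2) h ≤ ∑ i ∈ range k, (if (p : ℤ) ∣ (h i).1 - (h i).2 then (1 : ℝ) else 0) + 2 ^ k / p := by
    intro h
    set f := (cubR (fun i => ((w i * (h i).1 : ℤ) : ZMod p)) (fun i => ((w i * (h i).2 : ℤ) : ZMod p)) (k + 1)) with hf
    by_cases hb : ∃ i < k, (p : ℤ) ∣ (h i).1 - (h i).2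
    · obtain ⟨i, hi, hb⟩ := hb
      have h1 : GG φ w k (p ^ 2) h ≤ 1 := (norm_avg_le _ _).trans ((avg_mono fun y _ => FF_norm_le H _ _ _ _).trans (avg_const (pow_pos hp.pos _) _).le)
      have h2 := single_le_sum (f := fun i => if (p : ℤ) ∣ (h i).1 - (h i).2 then (1 : ℝ) else 0) (s := range k) (fun i _ => by split_ifs <;> simp) (mem_range.2 hi)
      simp only [hb, if_true] at h2
      have : (0 : ℝ) ≤ 2 ^ k / p := by positivity
      linarith
    · push Not at hb
      have h1 := GG_le hp H w (c1 := 1) (d := 1) le_rfl rfl le_rfl le_rfl ha u hu hW hwk h (fun n => f.eval ((1 : ZMod p) * (n : ZMod p) + 0) = 0) (by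
        intro n _ _ h3
        rw [pow_one] at h3
        rcases hpZ.dvd_or_dvd h3 with h4 | h4
        · rw [hpZ.dvd_finsetProd_iff] at h4
          obtain ⟨i, hi, h4⟩ := h4
          exact absurd h4 (hb i (mem_range.1 hi))
        · rw [← ZMod.intCast_zmod_eq_zero_iff_dvd, (cub_cast p _ _ _ _).2.2] at h4
          simpa [hf] using h4)
      obtain ⟨_, _, ε, hε, hHT⟩ := cub_HT (fun i => ((w i * (h i).1 : ℤ) : ZMod p)) (fun i => ((w i * (h i).2 : ℤ) : ZMod p)) k
      rw [← hf] at hHT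
      have hf0 : f ≠ 0 := by
        intro h0
        have h5 : k + 1 ≤ 2 ^ k := Nat.lt_two_pow_self
        have h6 := hHT.2 (2 ^ k - (k + 1)) (by omega)
        rw [h0, if_pos (by push_cast [h5]; ring), coeff_zero, eq_comm, ZMod.intCast_zmod_eq_zero_iff_dvd] at h6
        have h7 : (p : ℤ) ∣ k.factorial := by rcases hε with rfl | rfl <;> simpa using h6
        exact absurd ((hp.dvd_factorial).1 (by exact_mod_cast h7)) (by omega)
      have hdeg := hHT.natDegree_lt (2 ^ k) (by omega)
      rw [pow_one] at h1
      have h2 := avg_root f hf0 (2 ^ k) (by omega) 1 0 one_ne_zero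
      have h8 : (0 : ℝ) ≤ ∑ i ∈ range k, (if (p : ℤ) ∣ (h i).1 - (h i).2 then (1 : ℝ) else 0) := sum_nonneg fun i _ => by split_ifs <;> simp
      push_cast at h2
      linarith
  refine (EE_mono key).trans ?_
  have hpos : 0 < p ^ 2 := pow_pos hp.pos _
  rw [EE_add, EE_const hpos, EE_sum hpos, add_div]
  gcongr
  calc _ ≤ ∑ i ∈ range k, 1 / (p : ℝ) := by
        gcongr with i hi
        rw [pow_two]
        exact EE_delta k p p i (mem_range.1 hi) hp.pos hp.pos
    _ = k / p := by simp; ring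

omit H in
lemma strip {x y : ℤ} {j m : ℕ} (hx : ¬ (p : ℤ) ^ j ∣ x) (h : (p : ℤ) ^ (m + j) ∣ x * y) : (p : ℤ) ^ m ∣ y := by
  have hpZ : Prime (p : ℤ) := Nat.prime_iff_prime_int.1 hp
  have h0 : x ≠ 0 := by rintro rfl; simp at hx
  obtain ⟨e, v, h1, h2⟩ := WfDvdMonoid.max_power_factor h0 hpZ.irreducible
  have he : e < j := by
    by_contra hh
    apply hx; rw [h2]; exact (pow_dvd_pow _ (by omega)).trans (dvd_mul_right _ _)
  rw [h2, show m + j = e + (m + j - e) by omega, pow_add, mul_assoc] at h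
  have h3 := (mul_dvd_mul_iff_left (pow_ne_zero e hpZ.ne_zero)).1 h
  exact (pow_dvd_pow _ (by omega)).trans (hpZ.pow_dvd_of_dvd_mul_left _ h1 h3)

omit H in
lemma strip_prod {k j m : ℕ} (x : ℕ → ℤ) {y : ℤ} (hx : ∀ i < k, ¬ (p : ℤ) ^ j ∣ x i) (h : (p : ℤ) ^ (m + k * j) ∣ (∏ i ∈ range k, x i) * y) :
    (p : ℤ) ^ m ∣ y := by
  induction k generalizing m with
  | zero => simpa using h
  | succ k ih =>
    refine ih (fun i hi => hx i (by omega)) (m := m) (strip hp (hx k (by omega)) (j := j) ?_)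
    rw [prod_range_succ] at h
    convert h using 1 <;> ring

lemma LB2 (w : ℕ → ℕ) {k c c1 d b j : ℕ} (hc1 : 1 ≤ c1) (hd : c = c1 + d) (hd1 : 1 ≤ d) (hdc : d ≤ c1) (hdb : d ≤ b) (hj : k * (j + 1) < d)
    (hca : c ≤ a) (u : ℕ) (hu : ¬ p ∣ u) (hW : ∏ i ∈ range k, w i = p ^ (a - c) * u) (hwk : w k = 0) (hwb : ∀ i < k, p ^ b ∣ w i) (hk : 1 ≤ k) :
    EE (p ^ c) k (GG φ w k (p ^ c)) ≤ k / (p : ℝ) ^ j := by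
  have : Fact p.Prime := ⟨hp⟩
  have hpZ : Prime (p : ℤ) := Nat.prime_iff_prime_int.1 hp
  have key : ∀ h, GG φ w k (p ^ c) h ≤ ∑ i ∈ range k, (if ((p ^ j : ℕ) : ℤ) ∣ (h i).1 - (h i).2 then (1 : ℝ) else 0) := by
    intro h
    by_cases hb : ∃ i < k, ((p ^ j : ℕ) : ℤ) ∣ (h i).1 - (h i).2
    · obtain ⟨i, hi, hb⟩ := hb
      have h1 : GG φ w k (p ^ c) h ≤ 1 := (norm_avg_le _ _).trans ((avg_mono fun y _ => FF_norm_le H _ _ _ _).trans (avg_const (pow_pos hp.pos _) _).le)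
      have h2 := single_le_sum (f := fun i => if ((p ^ j : ℕ) : ℤ) ∣ (h i).1 - (h i).2 then (1 : ℝ) else 0) (s := range k) (fun i _ => by split_ifs <;> simp) (mem_range.2 hi)
      simp only [hb, if_true] at h2
      linarith
    · push Not at hb
      have h1 := GG_le hp H w hc1 hd hd1 hdc hca u hu hW hwk h (fun n => False) (by
        intro n hE _ h3
        push_cast at h3 hb
        have hws : ∀ m ≤ b, ∀ i < k + 1, ((p ^ m : ℕ) : ℤ) ∣ w i * (h i).1 - (0 : ℕ → ℤ) i ∧ ((p ^ m : ℕ) : ℤ) ∣ w i * (h i).2 - (0 : ℕ → ℤ) i := by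
          intro m hm i hi
          have : ((p ^ m : ℕ) : ℤ) ∣ w i := by
            rcases Nat.lt_succ_iff_lt_or_eq.1 hi with hi | rfl
            · exact_mod_cast (pow_dvd_pow _ hm).trans (hwb i hi)
            · rw [hwk]; simp
          simp only [Pi.zero_apply, sub_zero]
          exact ⟨this.mul_right _, this.mul_right _⟩
        obtain ⟨k', rfl⟩ : ∃ k', k = k' + 1 := ⟨k - 1, by omega⟩
        have hn : ¬ (p : ℤ) ∣ n := by
          intro hpn
          apply hE
          have h4 := (cub_mod (p ^ 1) (k := k' + 1) (n := n) (n' := n) (fun i hi => hws 1 (by omega) i (by omega)) (by simp)).1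
          rw [(cub_zero k').2.1, pow_one, eval_pow, eval_X] at h4
          have := dvd_add h4 (hpn.trans (dvd_pow_self n (pow_pos two_pos k').ne'))
          simpa using this
        have h4 := (cub_mod (p ^ d) (n := n) (n' := n) (hws d hdb) (by simp)).2.2
        obtain ⟨_, _, ε, hε, h5⟩ := cub_zero (A := ℤ) (k' + 1)
        rw [h5] at h4
        have h6 : (p : ℤ) ^ d ∣ (∏ i ∈ range (k' + 1), ((h i).1 - (h i).2)) * ((k' + 1).factorial * n ^ (2 ^ (k' + 1) - (k' + 1 + 1))) := by
          have h7 := dvd_sub h3 (Dvd.dvd.mul_left (by push_cast at h4; exact h4) (∏ i ∈ range (k' + 1), ((h i).1 - (h i).2)))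
          rw [← mul_sub, sub_sub_cancel] at h7
          simp only [eval_mul, eval_C, eval_pow, eval_X] at h7
          rcases hε with rfl | rfl
          · simpa using h7
          · rw [← dvd_neg]; simpa using h7
        have h8 := strip_prod hp (m := d - (k' + 1) * j) (j := j) _ hb (by rw [Nat.sub_add_cancel (by nlinarith)]; exact h6)
        have h9 := (hpZ.pow_dvd_of_dvd_mul_right _ (mt hpZ.dvd_of_dvd_pow hn) h8)
        have h10 : p ^ (k' + 1) ∣ (k' + 1).factorial := by
          have : d - (k' + 1) * j ≥ k' + 1 := by have : (k' + 1) * (j + 1) = (k' + 1) * j + (k' + 1) := by ring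
                                                 omega
          exact_mod_cast (pow_dvd_pow _ this).trans h9
        rw [padicValNat_dvd_iff_le (Nat.factorial_ne_zero _)] at h10
        have := padicValNat_factorial_lt_of_ne_zero (p := p) (Nat.succ_ne_zero k')
        simp only [Nat.succ_eq_add_one] at this
        omega)
      have h2 : avg (p ^ c1) (fun n => if (fun n : ℤ => False) n then (1 : ℝ) else 0) = 0 := by simp [avg]
      rw [h2] at h1
      exact h1.trans (sum_nonneg fun i _ => by split_ifs <;> simp)
  refine (EE_mono key).trans ?_
  have hpos : 0 < p ^ c := pow_pos hp.pos _
  rw [EE_sum hpos]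
  calc _ ≤ ∑ i ∈ range k, 1 / ((p ^ j : ℕ) : ℝ) := by
        gcongr with i hi
        have hjc : j ≤ c := by nlinarith
        rw [show p ^ c = p ^ j * p ^ (c - j) by rw [← pow_add]; congr 1; omega]
        exact EE_delta k (p ^ j) (p ^ (c - j)) i (mem_range.1 hi) (pow_pos hp.pos _) (pow_pos hp.pos _)
    _ = k / (p : ℝ) ^ j := by simp; ring
end loc

open Polynomial Finset

lemma cub_monic {p : ℕ} [Fact p.Prime] (S T : ℕ → ZMod p) (i : ℕ) :
    (cub S T i).1.Monic ∧ (cub S T i).2.Monic ∧ (cub S T i).1.Splits ∧ (cub S T i).2.Splits := by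
  induction i with
  | zero => exact ⟨monic_X, monic_one, Splits.X, Splits.one⟩
  | succ i ih =>
    obtain ⟨h1, h2, h3, h4⟩ := ih
    have hs : ∀ (f : (ZMod p)[X]) (a : ZMod p), f.Splits → (f.comp (X + C a)).Splits := fun f a hf =>
      hf.comp_of_natDegree_le_one_of_monic (natDegree_X_add_C a).le (monic_X_add_C a)
    exact ⟨(h1.comp_X_add_C _).mul (h2.comp_X_add_C _), (h2.comp_X_add_C _).mul (h1.comp_X_add_C _), (hs _ _ h3).mul (hs _ _ h4),
      (hs _ _ h4).mul (hs _ _ h3)⟩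

lemma cub_deg {p : ℕ} [Fact p.Prime] (S T : ℕ → ZMod p) (i : ℕ) :
    (cub S T (i + 1)).1.natDegree = 2 ^ i ∧ (cub S T (i + 1)).2.natDegree = 2 ^ i := by
  obtain ⟨h1, h2, -⟩ := cub_HT S T i
  have key : ∀ f : (ZMod p)[X], HT f (2 ^ i : ℕ) 1 → f.natDegree = 2 ^ i := by
    intro f hf
    refine natDegree_eq_of_le_of_coeff_ne_zero ?_ (n := 2 ^ i) ?_
    · rw [natDegree_le_iff_coeff_eq_zero]; intro j hj
      rw [hf.2 j (by exact_mod_cast hj.le), if_neg (by exact_mod_cast hj.ne')]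
    · rw [hf.2 _ le_rfl, if_pos rfl]; exact one_ne_zero
  exact ⟨key _ h2, key _ h1⟩

lemma cub_deg_mul {p : ℕ} [Fact p.Prime] (S T : ℕ → ZMod p) (i : ℕ) :
    ((cub S T i).1 * (cub S T i).2).natDegree ≤ 2 ^ i := by
  cases i with
  | zero => simp [cub]
  | succ i =>
    refine natDegree_mul_le.trans ?_
    rw [(cub_deg S T i).1, (cub_deg S T i).2, pow_succ]; omega

def xx {p : ℕ} (S : ℕ → ZMod p) (i : ℕ) : ZMod p := - ∑ j ∈ range i, S j

lemma cub_track {p : ℕ} [Fact p.Prime] (S T : ℕ → ZMod p) (i : ℕ)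
    (hnb : ∀ j < i, ((cub S T j).1 * (cub S T j).2).eval (xx S j + T j - S j) ≠ 0) :
    ∃ E', (cub S T i).1 = (X - C (xx S i)) * E' ∧ E'.eval (xx S i) ≠ 0 ∧ (cub S T i).2.eval (xx S i) ≠ 0 := by
  induction i with
  | zero => exact ⟨1, by simp [cub, xx], by simp, by simp [cub]⟩
  | succ i ih =>
    obtain ⟨E', h1, h2, h3⟩ := ih fun j hj => hnb j (by omega)
    have hb := hnb i (by omega)
    rw [eval_mul] at hb
    have hx : xx S (i + 1) = xx S i - S i := by simp [xx, sum_range_succ]; ring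
    refine ⟨E'.comp (X + C (S i)) * (cub S T i).2.comp (X + C (T i)), ?_, ?_, ?_⟩
    · simp only [cub]; rw [h1, hx]; simp only [mul_comp, sub_comp, X_comp, C_comp, C_sub]; ring
    · rw [hx]; simp only [eval_mul, eval_comp, eval_add, eval_X, eval_C, sub_add_cancel]
      rw [show xx S i - S i + T i = xx S i + T i - S i by ring]
      exact mul_ne_zero h2 (right_ne_zero_of_mul hb)
    · rw [hx]; simp only [cub, eval_mul, eval_comp, eval_add, eval_X, eval_C, sub_add_cancel]
      rw [show xx S i - S i + T i = xx S i + T i - S i by ring]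
      exact mul_ne_zero h3 (left_ne_zero_of_mul hb)

lemma exists_mulChar {p : ℕ} {φ : ℤ → ℂ} [Fact p.Prime] (H : IsLoc p 1 φ) :
    ∃ χ : MulChar (ZMod p) ℂ, χ ≠ 1 ∧ ∀ n : ℤ, χ (n : ZMod p) = φ n := by
  have hp := Fact.out (p := p.Prime)
  have hval : ∀ n : ℤ, φ (((n : ZMod p).val : ℕ) : ℤ) = φ n := fun n => by
    apply H.per
    rw [pow_one, ← ZMod.intCast_zmod_eq_zero_iff_dvd]; simp
  let χ : MulChar (ZMod p) ℂ :=
    { toFun := fun x => φ (x.val : ℤ)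
      map_one' := by have := hval 1; rw [Int.cast_one] at this; rw [this, H.one]
      map_mul' := fun x y => by
        have := hval ((x.val : ℤ) * (y.val : ℤ))
        rw [H.mul] at this; rw [← this]; congr 3; simp
      map_nonunit' := fun x hx => by
        have : x = 0 := by by_contra h; exact hx (isUnit_iff_ne_zero.2 h)
        rw [this]; simp [H.zero] }
  refine ⟨χ, ?_, fun n => hval n⟩
  obtain ⟨u, -, h2, h3⟩ := H.prim
  intro h
  apply h3
  rw [← hval u]
  have h4 : χ (u : ZMod p) = 1 := by
    rw [h, MulChar.one_apply]
    rw [isUnit_iff_ne_zero, Ne, ZMod.intCast_zmod_eq_zero_iff_dvd]; exact h2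
  exact h4

lemma LB3 {p : ℕ} {φ : ℤ → ℂ} (hp : p.Prime) (H : IsLoc p 1 φ) (w : ℕ → ℕ) {k : ℕ} (hk : 1 ≤ k) (hw : ∀ i < k, ¬ p ∣ w i) :
    EE p k (GG φ w k p) ≤ (2 ^ k + 1 + 2 ^ k * √p) / p := by
  have : Fact p.Prime := ⟨hp⟩
  obtain ⟨χ, hχ1, hχ⟩ := exists_mulChar H
  set S : (ℕ → ℤ × ℤ) → ℕ → ZMod p := fun h i => ((w i * (h i).1 : ℤ) : ZMod p) with hS
  set T : (ℕ → ℤ × ℤ) → ℕ → ZMod p := fun h i => ((w i * (h i).2 : ℤ) : ZMod p) with hT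
  set bad : ℕ → (ℕ → ℤ × ℤ) → ℝ := fun i h => if ((cub (S h) (T h) i).1 * (cub (S h) (T h) i).2).eval (xx (S h) i + T h i - S h i) = 0 then 1 else 0 with hbad
  have hbn : ∀ i h, 0 ≤ bad i h := fun i h => by rw [hbad]; dsimp only; split_ifs <;> simp
  have key : ∀ h, GG φ w k p h ≤ ∑ i ∈ range k, bad i h + (1 + 2 ^ k * √p) / p := by
    intro h
    have hpos : (0 : ℝ) ≤ (1 + 2 ^ k * √p) / p := by positivity
    by_cases hb : ∃ i < k, ((cub (S h) (T h) i).1 * (cub (S h) (T h) i).2).eval (xx (S h) i + T h i - S h i) = 0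
    · obtain ⟨i, hi, hb⟩ := hb
      have h1 : GG φ w k p h ≤ 1 := (norm_avg_le _ _).trans ((avg_mono fun y _ => FF_norm_le H _ _ _ _).trans (avg_const hp.pos _).le)
      have h2 := single_le_sum (f := fun i => bad i h) (s := range k) (fun i _ => hbn i h) (mem_range.2 hi)
      have h3 : bad i h = 1 := if_pos hb
      linarith
    · push Not at hb
      have h8 : (0 : ℝ) ≤ ∑ i ∈ range k, bad i h := sum_nonneg fun i _ => hbn i h
      refine le_trans ?_ (le_add_of_nonneg_left h8)
      obtain ⟨E', h1, h2, h3⟩ := cub_track (S h) (T h) k hb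
      obtain ⟨m1, m2, m3, m4⟩ := cub_monic (S h) (T h) k
      obtain ⟨k', rfl⟩ : ∃ k', k = k' + 1 := ⟨k - 1, by omega⟩
      obtain ⟨d1, d2⟩ := cub_deg (S h) (T h) k'
      have hw3 := weil3 χ hχ1 _ _ E' _ m1 m2 m3 m4 (by rw [d1, d2]) h1 h2 h3
      rw [d1] at hw3
      unfold GG avg
      rw [norm_div, Complex.norm_natCast]
      gcongr
      have hsum : ∑ x ∈ range p, FF φ (fun i => w i * (h i).1) (fun i => w i * (h i).2) (k' + 1) (x : ℤ) =
          ∑ x : ZMod p, χ ((cub (S h) (T h) (k' + 1)).1.eval x) * (starRingEnd ℂ) (χ ((cub (S h) (T h) (k' + 1)).2.eval x)) := by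
        refine sum_nbij' (fun x => ((x : ℤ) : ZMod p)) (fun x => x.val) (by simp) (fun x _ => mem_range.2 (ZMod.val_lt x)) ?_ (by simp) ?_
        · intro x hx; simp [Nat.mod_eq_of_lt (mem_range.1 hx)]
        · intro x _
          have hc := cub_cast p (fun i => w i * (h i).1) (fun i => w i * (h i).2) (k' + 1) x
          rw [FF, ← hχ, ← hχ, hc.1, hc.2.1]
      rw [hsum]
      refine hw3.trans (le_of_eq ?_)
      push_cast; ring
  refine (EE_mono key).trans ?_
  rw [EE_add, EE_const hp.pos, EE_sum hp.pos, add_assoc, add_div (2 ^ k : ℝ)]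
  gcongr
  calc _ ≤ ∑ i ∈ range k, (2 : ℝ) ^ i / p := by
        gcongr with i hi
        refine EE_ign hp.pos (mem_range.1 hi) _ _ ?_ ?_
        · intro h j a hj
          have hS' : ∀ l ≤ i, S (Function.update h j a) l = S h l := fun l hl => by simp only [hS]; rw [Function.update_of_ne (by omega)]
          have hT' : ∀ l ≤ i, T (Function.update h j a) l = T h l := fun l hl => by simp only [hT]; rw [Function.update_of_ne (by omega)]
          simp only [hbad]
          rw [(cub_congr (k := i) fun l hl => ⟨hS' l hl.le, hT' l hl.le⟩).1, hS' i le_rfl, hT' i le_rfl]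
          have : xx (S (Function.update h j a)) i = xx (S h) i := by
            unfold xx; congr 1; exact sum_congr rfl fun l hl => hS' l (mem_range.1 hl).le
          rw [this]
        · intro h
          refine (avg_mono (G' := fun _ => (2 : ℝ) ^ i / p) fun x _ => ?_).trans (avg_const hp.pos _).le
          have hS' : ∀ y : ℤ × ℤ, ∀ l < i, S (Function.update h i y) l = S h l := fun y l hl => by simp only [hS]; rw [Function.update_of_ne (by omega)]
          have hT' : ∀ y : ℤ × ℤ, ∀ l < i, T (Function.update h i y) l = T h l := fun y l hl => by simp only [hT]; rw [Function.update_of_ne (by omega)]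
          have hwi : ((w i : ℕ) : ZMod p) ≠ 0 := by
            rw [Ne, ZMod.natCast_eq_zero_iff]; exact hw i (mem_range.1 hi)
          have h1 := avg_root ((cub (S h) (T h) i).1 * (cub (S h) (T h) i).2) ((cub_monic (S h) (T h) i).1.mul (cub_monic (S h) (T h) i).2.1).ne_zero
            (2 ^ i) (cub_deg_mul _ _ _) (w i : ZMod p) (xx (S h) i - w i * (x : ZMod p)) hwi
          push_cast at h1
          refine le_trans (le_of_eq (avg_congr fun y _ => ?_)) h1
          simp only [hbad]
          have : xx (S (Function.update h i (((x : ℕ) : ℤ), ((y : ℕ) : ℤ)))) i = xx (S h) i := by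
            unfold xx; congr 1; exact sum_congr rfl fun l hl => hS' _ l (mem_range.1 hl)
          rw [(cub_congr (k := i) fun l hl => ⟨hS' (((x : ℕ) : ℤ), ((y : ℕ) : ℤ)) l hl, hT' (((x : ℕ) : ℤ), ((y : ℕ) : ℤ)) l hl⟩).1, this]
          have e : xx (S h) i + T (Function.update h i (((x : ℕ) : ℤ), ((y : ℕ) : ℤ))) i - S (Function.update h i (((x : ℕ) : ℤ), ((y : ℕ) : ℤ))) i =
            (w i : ZMod p) * ((y : ℤ) : ZMod p) + (xx (S h) i - w i * (x : ZMod p)) := by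
            simp only [hS, hT, Function.update_self]; push_cast; ring
          rw [e]
    _ ≤ 2 ^ k / p := by
        rw [← sum_div]
        gcongr
        rw [geom_sum_eq (by norm_num)]; norm_num

open Polynomial Finset

lemma sum_range_zmod {K : Type*} [AddCommMonoid K] (n : ℕ) [NeZero n] (G : ℤ → K) : ∑ y ∈ range n, G y = ∑ z : ZMod n, G (z.val : ℤ) := by
  refine sum_nbij' (fun x => (x : ZMod n)) (fun x => x.val) (by simp) (fun x _ => mem_range.2 (ZMod.val_lt x)) ?_ (by simp) ?_
  · intro x hx; exact ZMod.val_cast_of_lt (mem_range.1 hx)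
  · intro x hx; rw [ZMod.val_cast_of_lt (mem_range.1 hx)]

lemma avg_affine {K : Type*} [Field K] {m n : ℕ} (hn : 0 < n) (hmn : Nat.Coprime m n) (g : ℤ → K)
    (hg : ∀ x y : ℤ, (n : ℤ) ∣ x - y → g x = g y) (x : ℤ) : avg n (fun y => g (x + m * y)) = avg n g := by
  have : NeZero n := ⟨hn.ne'⟩
  unfold avg
  congr 1
  rw [sum_range_zmod n (fun y => g (x + m * y)), sum_range_zmod n g]
  let e : ZMod n ≃ ZMod n := ((ZMod.unitOfCoprime m hmn).mulLeft).trans (Equiv.addLeft (x : ZMod n))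
  rw [← Equiv.sum_comp e (fun z => g (z.val : ℤ))]
  refine sum_congr rfl fun z _ => hg _ _ ?_
  rw [← ZMod.intCast_zmod_eq_zero_iff_dvd]
  simp [e, ZMod.unitOfCoprime]

lemma avg_crt {K : Type*} [Field K] [CharZero K] {m n : ℕ} (hn : 0 < n) (hmn : Nat.Coprime m n) (f g : ℤ → K)
    (hf : ∀ x y : ℤ, (m : ℤ) ∣ x - y → f x = f y) (hg : ∀ x y : ℤ, (n : ℤ) ∣ x - y → g x = g y) :
    avg (m * n) (fun x => f x * g x) = avg m f * avg n g := by
  rw [avg_split]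
  have h : ∀ x : ℤ, avg n (fun y => f (x + m * y) * g (x + m * y)) = avg n g * f x := by
    intro x
    rw [← avg_affine hn hmn g hg x, mul_comm, ← avg_mul_left]
    exact avg_congr fun y _ => by rw [hf (x + m * y) x (by simp)]
  simp only [h]
  rw [avg_mul_left, mul_comm]

def HInv (m : ℕ) (G : (ℕ → ℤ × ℤ) → ℝ) : Prop :=
  ∀ h h', (∀ i, (m : ℤ) ∣ (h i).1 - (h' i).1 ∧ (m : ℤ) ∣ (h i).2 - (h' i).2) → G h = G h'

lemma HInv.upd {m : ℕ} {G : (ℕ → ℤ × ℤ) → ℝ} (hG : HInv m G) {h h' : ℕ → ℤ × ℤ} (hh : ∀ i, (m : ℤ) ∣ (h i).1 - (h' i).1 ∧ (m : ℤ) ∣ (h i).2 - (h' i).2)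
    (k : ℕ) {x x' y y' : ℤ} (hx : (m : ℤ) ∣ x - x') (hy : (m : ℤ) ∣ y - y') : G (Function.update h k (x, y)) = G (Function.update h' k (x', y')) := by
  apply hG
  intro i
  by_cases hi : i = k
  · subst hi; simp [hx, hy]
  · simp [Function.update_of_ne hi, hh i]

lemma EE_crt {m n : ℕ} (hn : 0 < n) (hmn : Nat.Coprime m n) (k : ℕ) (G H : (ℕ → ℤ × ℤ) → ℝ) (hG : HInv m G) (hH : HInv n H) :
    EE (m * n) k (fun h => G h * H h) = EE m k G * EE n k H := by
  induction k generalizing G H with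
  | zero => rfl
  | succ k ih =>
    simp only [EE]
    rw [← ih _ _ ?_ ?_]
    · congr 1
      funext h
      rw [← avg_crt hn hmn]
      · exact avg_congr fun x _ => avg_crt hn hmn _ _ (fun y y' hy => hG.upd (by simp) k (by simp) hy) (fun y y' hy => hH.upd (by simp) k (by simp) hy)
      · intro x y hxy; exact avg_congr fun _ _ => hG.upd (by simp) k hxy (by simp)
      · intro x y hxy; exact avg_congr fun _ _ => hH.upd (by simp) k hxy (by simp)
    · intro h h' hh; exact avg_congr fun _ _ => avg_congr fun _ _ => hG.upd hh k (by simp) (by simp)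
    · intro h h' hh; exact avg_congr fun _ _ => avg_congr fun _ _ => hH.upd hh k (by simp) (by simp)

lemma avg_crt_prod (S : Finset ℕ) (m : ℕ → ℕ) (hm : ∀ p ∈ S, 0 < m p) (hcop : ∀ p ∈ S, ∀ p' ∈ S, p ≠ p' → Nat.Coprime (m p) (m p'))
    (f : ℕ → ℤ → ℂ) (hf : ∀ p ∈ S, ∀ x y : ℤ, (m p : ℤ) ∣ x - y → f p x = f p y) :
    avg (∏ p ∈ S, m p) (fun x => ∏ p ∈ S, f p x) = ∏ p ∈ S, avg (m p) (f p) := by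
  induction S using Finset.induction_on with
  | empty => simp [avg]
  | insert p S hpS ih =>
    simp only [prod_insert hpS]
    rw [avg_crt, ih]
    · exact fun q hq => hm q (mem_insert_of_mem hq)
    · exact fun q hq r hr => hcop q (mem_insert_of_mem hq) r (mem_insert_of_mem hr)
    · exact fun q hq => hf q (mem_insert_of_mem hq)
    · exact prod_pos fun q hq => hm q (mem_insert_of_mem hq)
    · exact Nat.Coprime.prod_right fun q hq => hcop p (mem_insert_self _ _) q (mem_insert_of_mem hq) (by rintro rfl; exact hpS hq)
    · exact hf p (mem_insert_self _ _)
    · intro x y hxy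
      refine prod_congr rfl fun q hq => hf q (mem_insert_of_mem hq) _ _ (dvd_trans ?_ hxy)
      exact_mod_cast dvd_prod_of_mem m hq

lemma EE_crt_prod (k : ℕ) (S : Finset ℕ) (m : ℕ → ℕ) (hm : ∀ p ∈ S, 0 < m p) (hcop : ∀ p ∈ S, ∀ p' ∈ S, p ≠ p' → Nat.Coprime (m p) (m p'))
    (G : ℕ → (ℕ → ℤ × ℤ) → ℝ) (hG : ∀ p ∈ S, HInv (m p) (G p)) :
    EE (∏ p ∈ S, m p) k (fun h => ∏ p ∈ S, G p h) = ∏ p ∈ S, EE (m p) k (G p) := by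
  induction S using Finset.induction_on with
  | empty => simpa using EE_const one_pos k 1
  | insert p S hpS ih =>
    simp only [prod_insert hpS]
    rw [EE_crt, ih]
    · exact fun q hq => hm q (mem_insert_of_mem hq)
    · exact fun q hq r hr => hcop q (mem_insert_of_mem hq) r (mem_insert_of_mem hr)
    · exact fun q hq => hG q (mem_insert_of_mem hq)
    · exact prod_pos fun q hq => hm q (mem_insert_of_mem hq)
    · exact Nat.Coprime.prod_right fun q hq => hcop p (mem_insert_self _ _) q (mem_insert_of_mem hq) (by rintro rfl; exact hpS hq)
    · exact hG p (mem_insert_self _ _)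
    · intro x y hxy
      refine prod_congr rfl fun q hq => hG q (mem_insert_of_mem hq) _ _ fun i => ?_
      have : (m q : ℤ) ∣ (∏ p ∈ S, m p : ℕ) := by exact_mod_cast dvd_prod_of_mem m hq
      exact ⟨this.trans (hxy i).1, this.trans (hxy i).2⟩

lemma EE_sq {m : ℕ} (hm : 0 < m) (k : ℕ) (G : (ℕ → ℤ × ℤ) → ℝ) : (EE m k G) ^ 2 ≤ EE m k (fun h => G h ^ 2) := by
  obtain ⟨μ, hμ⟩ : ∃ μ, μ = EE m k G := ⟨_, rfl⟩
  have h1 : EE m k (fun h => (2 * μ) * G h + (-μ ^ 2)) ≤ EE m k (fun h => G h ^ 2) := EE_mono fun h => by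
    nlinarith [sq_nonneg (G h - μ)]
  rw [EE_add, EE_smul, EE_const hm, ← hμ] at h1
  rw [← hμ]; linarith

/-- shifting a sum of a bounded function -/
lemma shift_sum (F : ℤ → ℂ) (hF : ∀ n, ‖F n‖ ≤ 1) (N j : ℕ) : ‖∑ n ∈ range N, F ((n : ℤ) + j) - ∑ n ∈ range N, F n‖ ≤ 2 * j := by
  induction j with
  | zero => simp
  | succ j ih =>
    have h := sum_range_sub (fun n => F ((n : ℤ) + j)) N
    have e : ∑ n ∈ range N, F ((n : ℤ) + (j + 1 : ℕ)) - ∑ n ∈ range N, F n =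
      (∑ n ∈ range N, F ((n : ℤ) + j) - ∑ n ∈ range N, F n) + (F ((N : ℤ) + j) - F ((0 : ℕ) + j)) := by
      rw [← h, sum_sub_distrib]
      have : ∀ n : ℕ, F ((n : ℤ) + (j + 1 : ℕ)) = F ((n + 1 : ℕ) + j) := fun n => by congr 1; push_cast; ring
      simp only [this]; ring
    rw [e]
    refine (norm_add_le _ _).trans ?_
    have h2 := (norm_sub_le (F ((N : ℤ) + j)) (F ((0 : ℕ) + j))).trans (add_le_add (hF _) (hF _))
    push_cast at *
    linarith

lemma vdC (N w Q : ℕ) (hN : 0 < N) (hQ : 0 < Q) (g f : ℤ → ℂ) (hg : ∀ n, ‖g n‖ ≤ 1) (hf : ∀ n, ‖f n‖ ≤ 1)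
    (hper : ∀ n j : ℤ, g (n + w * j) = g n) :
    ‖avg N (fun n => g n * f n)‖ ^ 2 ≤
      avg Q (fun x => avg Q fun y => ‖avg N (fun n => f (n + w * x) * (starRingEnd ℂ) (f (n + w * y)))‖) + 4 * (w * Q) / N := by
  have hN' : (0 : ℝ) < N := by exact_mod_cast hN
  have hQ' : (0 : ℝ) < Q := by exact_mod_cast hQ
  have hNc : (N : ℂ) ≠ 0 := by exact_mod_cast hN.ne'
  have hQc : (Q : ℂ) ≠ 0 := by exact_mod_cast hQ.ne'
  set F : ℤ → ℂ := fun n => g n * f n with hFdef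
  have hF : ∀ n, ‖F n‖ ≤ 1 := fun n => by
    rw [hFdef]; simp only [norm_mul]; exact mul_le_one₀ (hg n) (norm_nonneg _) (hf n)
  set u : ℤ → ℂ := fun n => avg Q (fun x => f (n + w * x)) with hu
  set B := ‖avg N (fun n => g n * u n)‖ with hB
  set R := avg Q (fun x => avg Q fun y => ‖avg N (fun n => f (n + w * x) * (starRingEnd ℂ) (f (n + w * y)))‖) with hR
  set ε : ℝ := 2 * (w * Q) / N with hε
  have hε0 : 0 ≤ ε := by positivity
  have ha1 : ‖avg N F‖ ≤ 1 := (norm_avg_le _ _).trans ((avg_mono fun y _ => hF _).trans (avg_const hN _).le)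
  have hu1 : ∀ n, ‖u n‖ ≤ 1 := fun n => (norm_avg_le _ _).trans ((avg_mono fun y _ => hf _).trans (avg_const hQ _).le)
  have hB1 : B ≤ 1 := (norm_avg_le _ _).trans ((avg_mono fun y _ => by
    rw [norm_mul]; exact mul_le_one₀ (hg _) (norm_nonneg _) (hu1 _)).trans (avg_const hN _).le)
  have hswap : avg N (fun n => g n * u n) = avg Q (fun x => avg N (fun n => F (n + w * x))) := by
    simp only [hu, hFdef, avg, hper]
    simp only [← sum_div, mul_div_assoc', mul_sum]
    rw [sum_comm, div_right_comm]
  have h1 : ‖avg N F - avg N (fun n => g n * u n)‖ ≤ ε := by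
    rw [hswap]
    have e : avg N F - avg Q (fun x => avg N (fun n => F (n + w * x))) = avg Q (fun x => avg N F - avg N (fun n => F (n + w * x))) := by
      have := avg_add Q (fun _ => avg N F) (fun x => (-1) * avg N (fun n => F (n + w * x)))
      rw [avg_mul_left, avg_const hQ] at this
      rw [sub_eq_add_neg, neg_eq_neg_one_mul, ← this]
      congr 1; funext x; ring
    rw [e]
    refine (norm_avg_le _ _).trans ((avg_mono fun x hx => ?_).trans (avg_const hQ ε).le)
    have h2 := shift_sum F hF N (w * x)
    unfold avg
    rw [← sub_div, norm_div, Complex.norm_natCast, hε, norm_sub_rev]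
    gcongr
    push_cast at h2
    refine h2.trans ?_
    have : (x : ℝ) ≤ Q := by exact_mod_cast hx.le
    gcongr
  have h2 : ‖avg N F‖ ≤ B + ε := by
    have := norm_add_le (avg N F - avg N (fun n => g n * u n)) (avg N (fun n => g n * u n))
    rw [sub_add_cancel] at this
    rw [hB]; linarith
  have h3 : B ^ 2 ≤ R := by
    have e1 : B ≤ avg N (fun n => ‖u n‖) := (norm_avg_le _ _).trans (avg_mono fun n _ => by
      rw [norm_mul]; exact mul_le_of_le_one_left (norm_nonneg _) (hg _))
    have e2 : (avg N (fun n => ‖u n‖)) ^ 2 ≤ avg N (fun n => ‖u n‖ ^ 2) := by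
      obtain ⟨μ, hμ⟩ : ∃ μ, μ = avg N (fun n => ‖u n‖) := ⟨_, rfl⟩
      have h1 : avg N (fun n => (2 * μ) * ‖u n‖ + (-μ ^ 2)) ≤ avg N (fun n => ‖u n‖ ^ 2) := avg_mono fun h _ => by
        nlinarith [sq_nonneg (‖u h‖ - μ)]
      rw [avg_add, avg_mul_left, avg_const hN, ← hμ] at h1
      rw [← hμ]; linarith
    have e3 : ((avg N (fun n => ‖u n‖ ^ 2) : ℝ) : ℂ) = avg Q (fun x => avg Q fun y => avg N (fun n => f (n + w * x) * (starRingEnd ℂ) (f (n + w * y)))) := by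
      have : ∀ n, ((‖u n‖ ^ 2 : ℝ) : ℂ) = u n * (starRingEnd ℂ) (u n) := fun n => by
        rw [Complex.mul_conj, Complex.normSq_eq_norm_sq]
      simp only [avg, Complex.ofReal_div, Complex.ofReal_sum, this, Complex.ofReal_natCast]
      simp only [hu, avg, map_div₀, map_sum, Complex.conj_natCast, div_mul_div_comm, sum_mul_sum]
      simp only [← sum_div]
      rw [sum_comm]
      simp_rw [sum_comm (s := range N)]
      field_simp
    have e4 : avg N (fun n => ‖u n‖ ^ 2) ≤ R := by
      have h0 : 0 ≤ avg N (fun n => ‖u n‖ ^ 2) := by unfold avg; positivity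
      calc avg N (fun n => ‖u n‖ ^ 2) = ‖((avg N (fun n => ‖u n‖ ^ 2) : ℝ) : ℂ)‖ := by
            rw [Complex.norm_real, Real.norm_of_nonneg h0]
        _ ≤ R := by
            rw [e3]
            exact (norm_avg_le _ _).trans (avg_mono fun x _ => norm_avg_le _ _)
    have hB0 : 0 ≤ B := norm_nonneg _
    nlinarith
  have hB0 : 0 ≤ B := norm_nonneg _
  have ha0 : 0 ≤ ‖avg N F‖ := norm_nonneg _
  have : 4 * ((w : ℝ) * Q) / N = 2 * ε := by rw [hε]; ring
  rw [this]
  nlinarith [mul_le_mul_of_nonneg_left h2 ha0, mul_le_mul_of_nonneg_right h2 hB0]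

lemma avg_per (N Q : ℕ) (hN : 0 < N) (hQ : 0 < Q) (F : ℤ → ℂ) (hF : ∀ n, ‖F n‖ ≤ 1) (hper : ∀ x y : ℤ, (Q : ℤ) ∣ x - y → F x = F y) :
    ‖avg N F‖ ≤ ‖avg Q F‖ + Q / N := by
  have hN' : (0 : ℝ) < N := by exact_mod_cast hN
  have hQ' : (0 : ℝ) < Q := by exact_mod_cast hQ
  have hQc : (Q : ℂ) ≠ 0 := by exact_mod_cast hQ.ne'
  have key : ‖∑ x ∈ range N, F x‖ ≤ (N / Q : ℕ) * ‖∑ x ∈ range Q, F x‖ + Q := by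
    have h1 : N = Q * (N / Q) + N % Q := (Nat.div_add_mod N Q).symm
    have h2 : ∑ x ∈ range N, F x = (N / Q : ℕ) * ∑ x ∈ range Q, F x + ∑ x ∈ range (N % Q), F ((Q * (N / Q) + x : ℕ) : ℤ) := by
      conv_lhs => rw [h1]
      rw [sum_range_add, sum_range_split Q (N / Q) (fun x : ℕ => F (x : ℤ)), mul_sum]
      congr 1
      refine sum_congr rfl fun n _ => ?_
      have : ∀ y : ℕ, F ((n + Q * y : ℕ) : ℤ) = F n := fun y => hper _ _ (by push_cast; simp)
      simp only [this, sum_const, card_range, nsmul_eq_mul]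
    rw [h2]
    refine (norm_add_le _ _).trans ?_
    rw [norm_mul, Complex.norm_natCast]
    gcongr
    refine (norm_sum_le _ _).trans ((sum_le_sum fun _ _ => hF _).trans ?_)
    simp; exact_mod_cast (Nat.mod_lt N hQ).le
  unfold avg
  rw [norm_div, norm_div, Complex.norm_natCast, Complex.norm_natCast, div_le_iff₀ hN']
  refine key.trans ?_
  have h4 : ((N / Q : ℕ) : ℝ) ≤ N / Q := Nat.cast_div_le
  have h5 := mul_le_mul_of_nonneg_right h4 (norm_nonneg (∑ x ∈ range Q, F x))
  have : (‖∑ x ∈ range Q, F x‖ / Q + Q / N) * N = N / Q * ‖∑ x ∈ range Q, F x‖ + Q := by field_simp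
  rw [this]; linarith

open Polynomial Finset

noncomputable def HH (φ : ℕ → ℤ → ℂ) (w : ℕ → ℕ) (A : Finset ℕ) (i : ℕ) (h : ℕ → ℤ × ℤ) (n : ℤ) : ℂ :=
  ∏ p ∈ A, FF (φ p) (fun j => w j * (h j).1) (fun j => w j * (h j).2) i n

def alive (S : Finset ℕ) (a w : ℕ → ℕ) (i : ℕ) : Finset ℕ := S.filter fun p => ¬ p ^ a p ∣ ∏ j ∈ range i, w j

section
variable {S : Finset ℕ} {a : ℕ → ℕ} {φ : ℕ → ℤ → ℂ}

lemma HH_norm_le (H : ∀ p ∈ S, IsLoc p (a p) (φ p)) (w : ℕ → ℕ) {A : Finset ℕ} (hA : A ⊆ S) (i : ℕ) (h : ℕ → ℤ × ℤ) (n : ℤ) : ‖HH φ w A i h n‖ ≤ 1 := by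
  unfold HH
  rw [norm_prod]
  exact prod_le_one (fun _ _ => norm_nonneg _) fun p hp => FF_norm_le (H p (hA hp)) _ _ _ _

lemma avg_HH_le (H : ∀ p ∈ S, IsLoc p (a p) (φ p)) (w : ℕ → ℕ) {A : Finset ℕ} (hA : A ⊆ S) (i : ℕ) (h : ℕ → ℤ × ℤ) {N : ℕ} (hN : 0 < N) :
    ‖avg N (HH φ w A i h)‖ ≤ 1 :=
  (norm_avg_le _ _).trans ((avg_mono fun _ _ => HH_norm_le H w hA i h _).trans (avg_const hN _).le)

lemma HH_step (hS : ∀ p ∈ S, p.Prime) (H : ∀ p ∈ S, IsLoc p (a p) (φ p)) (w : ℕ → ℕ) (i N Q : ℕ) (hN : 0 < N) (hQ : 0 < Q) :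
    (EE Q i fun h => ‖avg N (HH φ w (alive S a w i) i h)‖) ^ 2 ≤
      (EE Q (i + 1) fun h => ‖avg N (HH φ w (alive S a w (i + 1)) (i + 1) h)‖) + 4 * (w i * Q) / N := by
  refine (EE_sq hQ _ _).trans ?_
  have key : ∀ h : ℕ → ℤ × ℤ, ‖avg N (HH φ w (alive S a w i) i h)‖ ^ 2 ≤
      (avg Q fun x => avg Q fun y => ‖avg N (HH φ w (alive S a w (i + 1)) (i + 1) (Function.update h i (x, y)))‖) + 4 * (w i * Q) / N := by
    intro h
    have hsub : alive S a w (i + 1) ⊆ alive S a w i := by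
      intro p hp
      simp only [alive, mem_filter] at hp ⊢
      exact ⟨hp.1, fun h => hp.2 (by rw [prod_range_succ]; exact dvd_mul_of_dvd_left h _)⟩
    have hsS : alive S a w i ⊆ S := filter_subset _ _
    have e1 : HH φ w (alive S a w i) i h = fun n => HH φ w (alive S a w i \ alive S a w (i + 1)) i h n * HH φ w (alive S a w (i + 1)) i h n := by
      funext n; unfold HH; rw [prod_sdiff hsub]
    have e2 : ∀ x y : ℤ, HH φ w (alive S a w (i + 1)) (i + 1) (Function.update h i (x, y)) =
        fun n => HH φ w (alive S a w (i + 1)) i h (n + w i * x) * (starRingEnd ℂ) (HH φ w (alive S a w (i + 1)) i h (n + w i * y)) := by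
      intro x y; funext n; unfold HH
      rw [map_prod, ← prod_mul_distrib]
      refine prod_congr rfl fun p hp => ?_
      rw [FF_step _ (H p (hsS (hsub hp))).mul]
      simp only [Function.update_self]
      have : ∀ j < i, (fun j => (w j : ℤ) * (Function.update h i (x, y) j).1) j = (fun j => (w j : ℤ) * (h j).1) j ∧
        (fun j => (w j : ℤ) * (Function.update h i (x, y) j).2) j = (fun j => (w j : ℤ) * (h j).2) j := fun j hj => by
        simp [Function.update_of_ne hj.ne]
      rw [FF_congr _ this, FF_congr _ this]
    rw [e1]
    simp only [e2]
    refine vdC N (w i) Q hN hQ _ _ (HH_norm_le H w (sdiff_subset.trans hsS) i h) (HH_norm_le H w (hsub.trans hsS) i h) ?_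
    intro n j
    unfold HH
    refine prod_congr rfl fun p hp => ?_
    simp only [alive, mem_sdiff, mem_filter, not_and, not_not, prod_range_succ] at hp
    obtain ⟨d1, d2, h1, h2, h3⟩ := exists_dvd_and_dvd_of_dvd_mul (hp.2 hp.1.1)
    obtain ⟨c, -, rfl⟩ := (Nat.dvd_prime_pow (hS p hp.1.1)).1 (Dvd.intro_left _ h3.symm)
    refine FFw_per (hS p hp.1.1) (H p hp.1.1) w (c := c) ?_ ?_ (by simp) ?_
    · by_contra hc
      have : c = 0 := by omega
      rw [this, pow_zero, mul_one] at h3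
      exact hp.1.2 (h3 ▸ h1)
    · rw [h3]; exact mul_dvd_mul_right h1 _
    · rw [add_sub_cancel_left]; exact dvd_mul_of_dvd_left (by exact_mod_cast h2) _
  refine (EE_mono key).trans (le_of_eq ?_)
  rw [EE_add, EE_const hQ]; rfl

theorem thmG (hS : ∀ p ∈ S, p.Prime) (H : ∀ p ∈ S, IsLoc p (a p) (φ p)) (w c : ℕ → ℕ) (k N Q W : ℕ) (hN : 0 < N)
    (hW : ∀ i < k, w i ≤ W) (hW1 : 1 ≤ W)
    (hc : ∀ p ∈ S, p ^ a p ∣ (∏ j ∈ range k, w j) * p ^ c p) (hQ : Q = ∏ p ∈ alive S a w k, p ^ c p) :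
    (‖∑ n ∈ range N, ∏ p ∈ S, φ p n‖ / N) ^ 2 ^ k ≤ (∏ p ∈ alive S a w k, EE (p ^ c p) k (GG (φ p) w k (p ^ c p))) + 2 ^ (k + 3) * (W * Q) / N := by
  have hN' : (0 : ℝ) < N := by exact_mod_cast hN
  have hQ0 : 0 < Q := by
    rw [hQ]; exact prod_pos fun p hp => pow_pos (hS p (mem_filter.1 hp).1).pos _
  set M : ℕ → ℝ := fun i => EE Q i fun h => ‖avg N (HH φ w (alive S a w i) i h)‖ with hM
  have hM1 : ∀ i, M i ≤ 1 := fun i => (EE_mono fun h => avg_HH_le H w (filter_subset _ _) i h hN).trans (EE_const hQ0 i 1).le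
  have hM0 : ∀ i, 0 ≤ M i := fun i => (EE_const hQ0 i 0).ge.trans (EE_mono fun h => norm_nonneg _)
  obtain ⟨η, hη⟩ : ∃ η : ℝ, η = 4 * (W * Q) / N := ⟨_, rfl⟩
  have hη0 : 0 ≤ η := by rw [hη]; positivity
  have hiter : ∀ i ≤ k, M 0 ^ 2 ^ i ≤ M i + (2 ^ i - 1) * η := by
    intro i
    induction i with
    | zero => intro _; simp
    | succ i ih =>
      intro hi
      have h1 := ih (by omega)
      have h2 : M i ^ 2 ≤ M (i + 1) + η := by
        refine (HH_step hS H w i N Q hN hQ0).trans ?_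
        rw [hη]
        have : (w i : ℝ) ≤ W := by exact_mod_cast hW i (by omega)
        gcongr
      obtain ⟨x, hx⟩ : ∃ x, x = M 0 ^ 2 ^ i := ⟨_, rfl⟩
      have hx0 : 0 ≤ x := hx ▸ pow_nonneg (hM0 0) _
      have hx1 : x ≤ 1 := hx ▸ pow_le_one₀ (hM0 0) (hM1 0)
      rw [pow_succ 2 i, pow_mul, ← hx]
      rw [← hx] at h1
      have h3 : (1 : ℝ) ≤ 2 ^ i := one_le_pow₀ (by norm_num)
      have h4 : 0 ≤ (2 ^ i - 1) * η := mul_nonneg (by linarith) hη0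
      have h5 : x ^ 2 ≤ M i ^ 2 + 2 * ((2 ^ i - 1) * η) := by
        rcases le_total x (M i) with h | h
        · have := pow_le_pow_left₀ hx0 h 2; linarith
        · nlinarith [mul_le_mul_of_nonneg_right h1 hx0, mul_le_mul_of_nonneg_right h1 (hM0 i), mul_le_mul_of_nonneg_left hx1 h4, mul_le_mul_of_nonneg_left (hM1 i) h4]
      have : (2 : ℝ) ^ (i + 1) = 2 * 2 ^ i := by ring
      rw [this]; nlinarith
  have hk := hiter k le_rfl
  have hstart : ‖∑ n ∈ range N, ∏ p ∈ S, φ p n‖ / N ≤ M 0 := by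
    have hcub : ∀ n : ℤ, HH φ w S 0 0 n = ∏ p ∈ S, φ p n := fun n => prod_congr rfl fun p hp => by
      simp [FF, cub, (H p hp).one]
    have e : ‖∑ n ∈ range N, ∏ p ∈ S, φ p n‖ / N = ‖avg N (HH φ w S 0 0)‖ := by
      unfold avg; rw [norm_div, Complex.norm_natCast]; simp only [hcub]
    rw [e]
    have hal : alive S a w 0 = S := by
      refine filter_true_of_mem fun p hp => ?_
      simp only [range_zero, prod_empty, Nat.dvd_one]
      exact (Nat.one_lt_pow (IsLoc.a_pos (hS p hp) (H p hp)).ne' (hS p hp).one_lt).ne'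
    show _ ≤ ‖avg N (HH φ w (alive S a w 0) 0 0)‖
    rw [hal]
  have hsub : alive S a w k ⊆ S := filter_subset _ _
  have hc1 : ∀ p ∈ alive S a w k, 1 ≤ c p := fun p hp => by
    by_contra h
    have h0 : c p = 0 := by omega
    have := hc p (hsub hp)
    rw [h0, pow_zero, mul_one] at this
    exact (mem_filter.1 hp).2 this
  have hcop : ∀ p ∈ alive S a w k, ∀ p' ∈ alive S a w k, p ≠ p' → Nat.Coprime (p ^ c p) (p' ^ c p') := fun p hp q hq hpq =>
    Nat.Coprime.pow _ _ ((Nat.coprime_primes (hS p (hsub hp)) (hS q (hsub hq))).2 hpq)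
  have hpos : ∀ p ∈ alive S a w k, 0 < p ^ c p := fun p hp => pow_pos (hS p (hsub hp)).pos _
  have hper : ∀ p ∈ alive S a w k, ∀ (h h' : ℕ → ℤ × ℤ), (∀ i, ((p ^ c p : ℕ) : ℤ) ∣ (h i).1 - (h' i).1 ∧ ((p ^ c p : ℕ) : ℤ) ∣ (h i).2 - (h' i).2) →
      ∀ x y : ℤ, ((p ^ c p : ℕ) : ℤ) ∣ x - y → FF (φ p) (fun j => w j * (h j).1) (fun j => w j * (h j).2) k x = FF (φ p) (fun j => w j * (h' j).1) (fun j => w j * (h' j).2) k y :=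
    fun p hp h h' hh x y hxy => FFw_per (hS p (hsub hp)) (H p (hsub hp)) w (hc1 p hp) (hc p (hsub hp)) (fun i _ => hh i) hxy
  have hend : M k ≤ (∏ p ∈ alive S a w k, EE (p ^ c p) k (GG (φ p) w k (p ^ c p))) + Q / N := by
    rw [← EE_crt_prod k _ _ hpos hcop, ← hQ, ← EE_const hQ0 k (Q / N : ℝ), ← EE_add]
    · refine EE_mono fun h => ?_
      refine (avg_per N Q hN hQ0 _ (HH_norm_le H w hsub k h) ?_).trans (le_of_eq ?_)
      · intro x y hxy
        refine prod_congr rfl fun p hp => hper p hp h h (by simp) _ _ (dvd_trans ?_ hxy)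
        rw [hQ]; exact_mod_cast dvd_prod_of_mem (fun p => p ^ c p) hp
      · congr 1
        unfold HH GG
        rw [hQ, avg_crt_prod _ _ hpos hcop _ (fun p hp => hper p hp h h (by simp)), norm_prod]
    · intro p hp h h' hh
      unfold GG
      congr 1
      exact avg_congr fun x _ => hper p hp h h' hh _ _ (by simp)
  have hfin := pow_le_pow_left₀ (by positivity) hstart (2 ^ k)
  have hlast : (Q : ℝ) / N + (2 ^ k - 1) * η ≤ 2 ^ (k + 3) * (W * Q) / N := by
    have h1 : (Q : ℝ) / N ≤ η := by
      rw [hη]; have : (1 : ℝ) ≤ W := by exact_mod_cast hW1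
      gcongr; nlinarith [(Nat.cast_nonneg Q : (0 : ℝ) ≤ Q)]
    have h2 : (2 : ℝ) ^ (k + 3) * (W * Q) / N = 2 * 2 ^ k * η := by rw [hη]; ring
    rw [h2]
    have h3 : (1 : ℝ) ≤ 2 ^ k := one_le_pow₀ (by norm_num)
    nlinarith
  linarith
end

open Polynomial Finset

lemma rpow_nat_le {x y : ℝ} (hx : 0 ≤ x) (hy : 0 ≤ y) (n : ℕ) (hn : n ≠ 0) (h : x ^ n ≤ y ^ n) : x ≤ y := (pow_le_pow_iff_left₀ hx hy hn).1 h

lemma Mp1 {p a : ℕ} (hp : p.Prime) {φ : ℤ → ℂ} (H : IsLoc p a φ) (w : ℕ → ℕ) {k : ℕ} (hk : 1 ≤ k) (hpk : 16 ^ (k + 2) ≤ p) (u : ℕ) (hu : ¬ p ∣ u)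
    (hW : ∏ i ∈ range k, w i = p ^ (a - min a 2) * u) (hwk : w k = 0) :
    EE (p ^ min a 2) k (GG φ w k (p ^ min a 2)) ≤ (p : ℝ) ^ (-(1 / 4) : ℝ) := by
  have hp0 : (0 : ℝ) < p := by exact_mod_cast hp.pos
  obtain ⟨r, hr⟩ : ∃ r : ℝ, r = (p : ℝ) ^ (1 / 4 : ℝ) := ⟨_, rfl⟩
  have hr0 : 0 < r := hr ▸ Real.rpow_pos_of_pos hp0 _
  have hr4 : r ^ 4 = p := by rw [hr, ← Real.rpow_natCast, ← Real.rpow_mul hp0.le]; norm_num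
  have hr2 : √(p : ℝ) = r ^ 2 := by
    rw [← hr4, show r ^ 4 = (r ^ 2) ^ 2 by ring, Real.sqrt_sq (by positivity)]
  have hrk : (2 : ℝ) ^ (k + 2) ≤ r := by
    refine rpow_nat_le (by positivity) hr0.le 4 (by norm_num) ?_
    rw [hr4, ← pow_mul, mul_comm, pow_mul]; norm_num; exact_mod_cast hpk
  have hgoal : (p : ℝ) ^ (-(1 / 4) : ℝ) = r ^ 3 / p := by
    rw [Real.rpow_neg hp0.le, ← hr, ← hr4]; field_simp
  have hkk : (k : ℝ) ≤ 2 ^ k := by exact_mod_cast Nat.lt_two_pow_self.le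
  have h2k : (2 : ℝ) ^ (k + 2) = 4 * 2 ^ k := by ring
  have h1k : (1 : ℝ) ≤ 2 ^ k := one_le_pow₀ (by norm_num)
  rw [h2k] at hrk
  have hr1 : 1 ≤ r := by linarith
  have hr3 : r ^ 2 ≤ r ^ 3 := pow_le_pow_right₀ hr1 (by norm_num)
  have hr22 : r ≤ r ^ 2 := by nlinarith
  rw [hgoal]
  rcases Nat.lt_or_ge a 2 with ha | ha
  · have ha1 : a = 1 := by have := H.a_pos hp; omega
    subst ha1
    have hw : ∀ i < k, ¬ p ∣ w i := fun i hi h => by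
      simp only [show min 1 2 = 1 by rfl, Nat.sub_self, pow_zero, one_mul] at hW
      exact hu (hW ▸ h.trans (dvd_prod_of_mem w (mem_range.2 hi)))
    simp only [show min 1 2 = 1 by rfl, pow_one]
    refine (LB3 hp H w hk hw).trans ?_
    gcongr
    rw [hr2]
    have : 4 * (2 ^ k : ℝ) * r ^ 2 ≤ r * r ^ 2 := by gcongr
    nlinarith [mul_le_mul_of_nonneg_left (hr1.trans hr22) (by positivity : (0:ℝ) ≤ 2 ^ k)]
  · rw [min_eq_right ha] at hW ⊢
    have hkp : k < p := by
      have h1 : k < 2 ^ k := Nat.lt_two_pow_self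
      have h2 : 2 ^ k ≤ 16 ^ (k + 2) := (Nat.pow_le_pow_left (by norm_num) k).trans (Nat.pow_le_pow_right (by norm_num) (by omega))
      omega
    refine (LB1 hp H w ha hkp u hu hW hwk).trans ?_
    gcongr
    linarith

lemma Mp2 {p a : ℕ} (hp : p.Prime) {φ : ℤ → ℂ} (H : IsLoc p a φ) (w : ℕ → ℕ) {k b c : ℕ} (hk : 1 ≤ k) (ha : 10 * (k + 1) ^ 3 ≤ a) (hb : b = a / (k + 1)) (hc : c = a - k * b)
    (u : ℕ) (hu : ¬ p ∣ u) (hW : ∏ i ∈ range k, w i = p ^ (k * b) * u) (hwk : w k = 0) (hwb : ∀ i < k, p ^ b ∣ w i) :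
    EE (p ^ c) k (GG φ w k (p ^ c)) ≤ (p : ℝ) ^ (-(a / (8 * (k + 1) ^ 2)) : ℝ) := by
  have hp1 : (1 : ℝ) ≤ p := by exact_mod_cast hp.one_lt.le
  have hab : (k + 1) * b ≤ a := by rw [hb]; exact Nat.mul_div_le _ _
  have hab2 : a < (k + 1) * (b + 1) := by
    rw [hb]; exact Nat.lt_mul_div_succ a (by omega)
  have hkb : k * b + b ≤ a := by have : (k + 1) * b = k * b + b := by ring
                                 omega
  have hkb2 : a ≤ k * b + b + k := by have : (k + 1) * (b + 1) = k * b + b + k + 1 := by ring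
                                      omega
  have hbig : 10 * (k + 1) ^ 2 ≤ b := by
    rw [hb, Nat.le_div_iff_mul_le (by omega)]; exact le_trans (by rw [mul_assoc, ← pow_succ]) ha
  have hbk : 20 * k + 20 ≤ b := by
    have := Nat.mul_le_mul_left (10 * (k + 1)) (by omega : 2 ≤ k + 1)
    have e : 10 * (k + 1) ^ 2 = 10 * (k + 1) * (k + 1) := by ring
    omega
  obtain ⟨d, hd⟩ : ∃ d, d = c / 2 := ⟨_, rfl⟩
  obtain ⟨j, hj⟩ : ∃ j, j = (d - 1) / k - 1 := ⟨_, rfl⟩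
  have hd1 : k + 1 ≤ d := by omega
  have hj0 : 1 ≤ (d - 1) / k := by rw [Nat.le_div_iff_mul_le (by omega)]; omega
  have hj1 : k * (j + 1) < d := by
    rw [hj, Nat.sub_add_cancel hj0]
    have := Nat.mul_div_le (d - 1) k
    omega
  have hj2 : d ≤ k * (j + 2) := by
    have := Nat.lt_div_mul_add (a := d - 1) (b := k) (by omega)
    have e : (d - 1) / k = j + 1 := by omega
    rw [e] at this
    have e2 : (j + 1) * k + k = k * (j + 2) := by ring
    omega
  have hW' : ∏ i ∈ range k, w i = p ^ (a - c) * u := by rw [hW]; congr 2; omega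
  refine (LB2 hp H w (c1 := c - d) (d := d) (b := b) (j := j) (by omega) (by omega) (by omega) (by omega) (by omega) hj1 (by omega) u hu hW' hwk hwb hk).trans ?_
  have hkp : (k : ℝ) ≤ (p : ℝ) ^ (k : ℝ) := by
    rw [Real.rpow_natCast]
    have h1 : k ≤ p ^ k := Nat.lt_two_pow_self.le.trans (Nat.pow_le_pow_left hp.two_le k)
    exact_mod_cast h1
  rw [← Real.rpow_natCast (p : ℝ) j]
  calc (k : ℝ) / (p : ℝ) ^ (j : ℝ) ≤ (p : ℝ) ^ (k : ℝ) / (p : ℝ) ^ (j : ℝ) := by gcongr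
    _ = (p : ℝ) ^ ((k : ℝ) - j) := by rw [Real.rpow_sub (by linarith)]
    _ ≤ _ := by
      refine Real.rpow_le_rpow_of_exponent_le hp1 ?_
      -- k + a/(8(k+1)^2) ≤ j
      have hk0 : (1 : ℝ) ≤ k := by exact_mod_cast hk
      have a1 : (10 : ℝ) * (k + 1) ^ 3 ≤ a := by exact_mod_cast ha
      have a2 : (b : ℝ) ≤ 2 * d + 1 := by exact_mod_cast (by omega : b ≤ 2 * d + 1)
      have a3 : (d : ℝ) ≤ k * (j + 2) := by exact_mod_cast hj2
      have a4 : (a : ℝ) ≤ (k + 1) * (b + 1) := by exact_mod_cast hab2.le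
      have a5 : (a : ℝ) ≤ (k + 1) * (2 * (k * (j + 2)) + 2) := a4.trans (mul_le_mul_of_nonneg_left (by linarith) (by positivity))
      have a6 : (a : ℝ) ≤ 2 * (k + 1) ^ 2 * (j + 3) := a5.trans (sub_nonneg.1 (by
        rw [show (2 : ℝ) * (k + 1) ^ 2 * (j + 3) - (k + 1) * (2 * (k * (j + 2)) + 2) = 2 * (k + 1) * (k + j + 2) by ring]; positivity))
      have a7 : (a : ℝ) / (8 * (k + 1) ^ 2) + (k : ℝ) ≤ j := by
        have hpos : (0 : ℝ) < (k + 1) ^ 2 := by positivity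
        obtain ⟨t, ht⟩ : ∃ t : ℝ, t = a / (k + 1) ^ 2 := ⟨_, rfl⟩
        have ht1 : (a : ℝ) = t * (k + 1) ^ 2 := by rw [ht]; field_simp
        have b1 : t ≤ 2 * (j + 3) := by
          rw [ht, div_le_iff₀ hpos]; linarith
        have b2 : 10 * ((k : ℝ) + 1) ≤ t := by
          rw [ht, le_div_iff₀ hpos]; linarith
        have b3 : (a : ℝ) / (8 * (k + 1) ^ 2) = t / 8 := by rw [ht]; field_simp
        rw [b3]; linarith
      linarith

lemma exists_dvd_between {P X : ℝ} (hX : 1 ≤ X) (hP : 1 ≤ P) (m : ℕ) (hm : m ≠ 0) (hmP : ∀ p : ℕ, p.Prime → p ∣ m → (p : ℝ) ≤ P) (hXm : X < m) : ∃ d, d ∣ m ∧ X < d ∧ (d : ℝ) ≤ X * P := by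
  induction m using induction_on_primes with
  | zero => exact absurd rfl hm
  | one => simp at hXm; linarith
  | prime_mul p m hp ih =>
    rcases lt_or_ge X (m : ℝ) with h | h
    · obtain ⟨d, h1, h2⟩ := ih (by rintro rfl; simp at hm) (fun r hr hrm => hmP r hr (hrm.mul_left _)) h
      exact ⟨d, h1.mul_left _, h2⟩
    · refine ⟨_, dvd_rfl, hXm, ?_⟩
      have := hmP p hp (dvd_mul_right _ _)
      push_cast
      rw [mul_comm]; gcongr

lemma greedy {P X : ℝ} (hX : 1 ≤ X) (hP : 1 ≤ P) (k : ℕ) (m : ℕ) (hm : m ≠ 0) (hmP : ∀ p : ℕ, p.Prime → p ∣ m → (p : ℝ) ≤ P) (hXm : (m : ℝ) ≤ X ^ k) :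
    ∃ w : ℕ → ℕ, ∏ i ∈ range k, w i = m ∧ ∀ i, (w i : ℝ) ≤ X * P := by
  induction k generalizing m with
  | zero =>
    refine ⟨fun _ => 1, ?_, fun _ => by push_cast; nlinarith⟩
    have : m ≤ 1 := by simpa using hXm
    simp; omega
  | succ k ih =>
    obtain ⟨d, hd, hd1, hd2⟩ : ∃ d, d ∣ m ∧ ((m / d : ℕ) : ℝ) ≤ X ^ k ∧ (d : ℝ) ≤ X * P := by
      rcases lt_or_ge X (m : ℝ) with h | h
      · obtain ⟨d, h1, h2, h3⟩ := exists_dvd_between hX hP m hm hmP h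
        refine ⟨d, h1, ?_, h3⟩
        refine Nat.cast_div_le.trans ?_
        rw [div_le_iff₀ (by linarith)]
        calc (m : ℝ) ≤ X ^ k * X := by rw [← pow_succ]; exact hXm
          _ ≤ _ := by gcongr
      · refine ⟨m, dvd_rfl, ?_, by nlinarith⟩
        rw [Nat.div_self (Nat.pos_of_ne_zero hm)]; push_cast; exact one_le_pow₀ hX
    have hmd : m / d ≠ 0 := (Nat.div_pos (Nat.le_of_dvd (Nat.pos_of_ne_zero hm) hd) (Nat.pos_of_dvd_of_pos hd (Nat.pos_of_ne_zero hm))).ne'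
    obtain ⟨w, h1, h2⟩ := ih (m / d) hmd (fun p hp h => hmP p hp (h.trans (Nat.div_dvd_of_dvd hd))) hd1
    refine ⟨fun i => if i = k then d else w i, ?_, fun i => by dsimp; split_ifs; exacts [hd2, h2 i]⟩
    rw [prod_range_succ, if_pos rfl, prod_congr rfl (g := w), h1, Nat.div_mul_cancel hd]
    intro i hi; rw [if_neg (mem_range.1 hi).ne]

lemma exists_subset_between {P Z : ℝ} (hZ : 1 ≤ Z) (hP : 1 ≤ P) (S : Finset ℕ) (hSP : ∀ p ∈ S, (p : ℝ) ≤ P) (h : Z ≤ ∏ p ∈ S, (p : ℝ)) :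
    ∃ S1 ⊆ S, Z ≤ ∏ p ∈ S1, (p : ℝ) ∧ ∏ p ∈ S1, (p : ℝ) ≤ Z * P := by
  induction S using Finset.induction_on with
  | empty => exact ⟨∅, subset_rfl, h, by simp; nlinarith⟩
  | insert p S hpS ih =>
    rcases le_or_gt Z (∏ p ∈ S, (p : ℝ)) with h1 | h1
    · obtain ⟨S1, a1, a2⟩ := ih (fun q hq => hSP q (mem_insert_of_mem hq)) h1
      exact ⟨S1, a1.trans (subset_insert _ _), a2⟩
    · refine ⟨_, subset_rfl, h, ?_⟩
      rw [prod_insert hpS, mul_comm]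
      have := hSP p (mem_insert_self _ _)
      gcongr

open Polynomial Finset

lemma not_dvd_prod_pow {S : Finset ℕ} (hS : ∀ p ∈ S, p.Prime) (e : ℕ → ℕ) {p : ℕ} (hp : p.Prime) (hpS : p ∉ S) : ¬ p ∣ ∏ r ∈ S, r ^ e r := by
  intro h
  obtain ⟨r, hr, h⟩ := (hp.prime.dvd_finsetProd_iff _).1 h
  have := (Nat.prime_dvd_prime_iff_eq hp (hS r hr)).1 (hp.dvd_of_dvd_pow h)
  exact hpS (this ▸ hr)

section
variable {S : Finset ℕ} {a : ℕ → ℕ} {φ : ℕ → ℤ → ℂ}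

theorem thmG' (hS : ∀ p ∈ S, p.Prime) (H : ∀ p ∈ S, IsLoc p (a p) (φ p)) (w c : ℕ → ℕ) (k N : ℕ) (hN : 0 < N) {W : ℝ}
    (hW : ∀ i < k, (w i : ℝ) ≤ W) (hW1 : 1 ≤ W) (hca : ∀ p ∈ S, c p ≤ a p) (hprod : ∏ i ∈ range k, w i = ∏ p ∈ S, p ^ (a p - c p))
    (B : ℕ → ℝ) (hB : ∀ p ∈ S, c p ≠ 0 → ∀ u, ¬ p ∣ u → ∏ i ∈ range k, w i = p ^ (a p - c p) * u → EE (p ^ c p) k (GG (φ p) w k (p ^ c p)) ≤ B p) :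
    (‖∑ n ∈ range N, ∏ p ∈ S, φ p n‖ / N) ^ 2 ^ k ≤ (∏ p ∈ S with c p ≠ 0, B p) + 2 ^ (k + 3) * (W * ∏ p ∈ S, (p : ℝ) ^ c p) / N := by
  have hu : ∀ p ∈ S, ∃ u, ¬ p ∣ u ∧ ∏ i ∈ range k, w i = p ^ (a p - c p) * u := fun p hp =>
    ⟨∏ r ∈ S.erase p, r ^ (a r - c r), not_dvd_prod_pow (fun r hr => hS r (mem_of_mem_erase hr)) _ (hS p hp) (notMem_erase _ _), by
      rw [hprod, mul_prod_erase S (fun p => p ^ (a p - c p)) hp]⟩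
  have hal : alive S a w k = S.filter fun p => c p ≠ 0 := by
    refine filter_congr fun p hp => not_congr ?_
    obtain ⟨u, h1, h2⟩ := hu p hp
    rw [h2]
    constructor
    · intro h
      have h3 : p ^ a p ∣ p ^ (a p - c p) := ((((hS p hp).coprime_iff_not_dvd).2 h1).pow_left _).dvd_of_dvd_mul_right h
      have := (Nat.pow_dvd_pow_iff_le_right (hS p hp).one_lt).1 h3
      have := hca p hp
      have := IsLoc.a_pos (hS p hp) (H p hp)
      omega
    · intro h; rw [h, Nat.sub_zero]; exact dvd_mul_right _ _
  have hW0 : 0 ≤ W := by linarith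
  have := thmG hS H w c k N (∏ p ∈ alive S a w k, p ^ c p) ⌊W⌋₊ hN (fun i hi => Nat.le_floor (hW i hi)) (Nat.le_floor (by simpa using hW1)) (by
    intro p hp
    obtain ⟨u, h1, h2⟩ := hu p hp
    rw [h2, mul_right_comm, ← pow_add, Nat.sub_add_cancel (hca p hp)]
    exact dvd_mul_right _ _) rfl
  refine this.trans ?_
  rw [hal]
  gcongr ?_ + 2 ^ (k + 3) * (?_ * ?_) / N
  · refine prod_le_prod (fun p hp => ?_) fun p hp => ?_
    · rw [← EE_const (pow_pos (hS p (mem_filter.1 hp).1).pos (c p)) k 0]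
      exact EE_mono fun h => norm_nonneg _
    · rw [mem_filter] at hp
      obtain ⟨u, h1, h2⟩ := hu p hp.1
      exact hB p hp.1 hp.2 u h1 h2
  · exact Nat.floor_le hW0
  · push_cast
    refine le_of_eq (prod_subset (filter_subset _ _) fun p hp hpn => ?_)
    simp only [mem_filter, not_and, not_not] at hpn
    rw [hpn hp, pow_zero]

variable {P X Z : ℝ} {k N : ℕ}

theorem case1 (hS : ∀ p ∈ S, p.Prime) (H : ∀ p ∈ S, IsLoc p (a p) (φ p)) (hP : 1 ≤ P) (hSP : ∀ p ∈ S, (p : ℝ) ≤ P) (hk : 1 ≤ k) (hX : 1 ≤ X)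
    (hq : ((∏ p ∈ S, p ^ a p : ℕ) : ℝ) ≤ X ^ k) (hN : 0 < N) (hZ : 1 ≤ Z) (hZS : Z ≤ ∏ p ∈ S with 16 ^ (k + 2) ≤ p, (p : ℝ)) :
    (‖∑ n ∈ range N, ∏ p ∈ S, φ p n‖ / N) ^ 2 ^ k ≤ Z ^ (-(1 / 4) : ℝ) + 2 ^ (k + 3) * (X * P * (Z * P) ^ 2) / N := by
  obtain ⟨S1, hS1, hZ1, hZ2⟩ := exists_subset_between hZ hP _ (fun p hp => hSP p (mem_filter.1 hp).1) hZS
  have hS1S : S1 ⊆ S := hS1.trans (filter_subset _ _)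
  set c : ℕ → ℕ := fun p => if p ∈ S1 then min (a p) 2 else 0 with hc
  have hcS : ∀ p ∈ S1, c p = min (a p) 2 := fun p hp => if_pos hp
  have hcn : ∀ p, p ∉ S1 → c p = 0 := fun p hp => if_neg hp
  have hca : ∀ p ∈ S, c p ≤ a p := fun p _ => by simp only [hc]; split_ifs <;> omega
  have hm0 : ∏ p ∈ S, p ^ (a p - c p) ≠ 0 := prod_ne_zero_iff.2 fun p hp => pow_ne_zero _ (hS p hp).ne_zero
  obtain ⟨w, hw1, hw2⟩ := greedy hX hP k _ hm0 (fun r hr h => by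
    by_contra hn
    exact not_dvd_prod_pow hS _ hr (fun h => hn (hSP r h)) h) (le_trans (by
      exact_mod_cast prod_le_prod' fun p hp => Nat.pow_le_pow_right (hS p hp).pos (Nat.sub_le _ _)) hq)
  set w' : ℕ → ℕ := fun i => if i < k then w i else 0 with hw'
  have hww : ∏ i ∈ range k, w' i = ∏ p ∈ S, p ^ (a p - c p) := by
    rw [← hw1]; exact prod_congr rfl fun i hi => if_pos (mem_range.1 hi)
  have hfil : S.filter (fun p => c p ≠ 0) = S1 := by
    ext p
    simp only [mem_filter]
    constructor
    · rintro ⟨-, h⟩; by_contra hn; exact h (hcn p hn)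
    · intro h
      have := IsLoc.a_pos (hS p (hS1S h)) (H p (hS1S h))
      exact ⟨hS1S h, by rw [hcS p h]; omega⟩
  have hmain := thmG' hS H w' c k N hN (W := X * P) (fun i hi => by simp only [hw', if_pos hi]; exact hw2 i) (by nlinarith) hca hww
    (fun p => (p : ℝ) ^ (-(1 / 4) : ℝ)) (by
      intro p hp hcp u hu hpu
      have hp1 : p ∈ S1 := by rw [← hfil]; exact mem_filter.2 ⟨hp, hcp⟩
      rw [hcS p hp1] at hpu ⊢
      exact Mp1 (hS p hp) (H p hp) w' hk (mem_filter.1 (hS1 hp1)).2 u hu hpu (by simp [hw']))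
  refine hmain.trans ?_
  rw [hfil]
  gcongr ?_ + 2 ^ (k + 3) * (X * P * ?_) / N
  · rw [Real.finsetProd_rpow _ _ fun _ _ => Nat.cast_nonneg _]
    exact Real.rpow_le_rpow_of_nonpos (by linarith) hZ1 (by norm_num)
  · rw [← prod_subset hS1S (fun p _ hp => by rw [hcn p hp, pow_zero])]
    calc ∏ p ∈ S1, (p : ℝ) ^ c p ≤ ∏ p ∈ S1, (p : ℝ) ^ 2 := by
          refine prod_le_prod (fun _ _ => by positivity) fun p hp => pow_le_pow_right₀ (by exact_mod_cast (hS p (hS1S hp)).one_lt.le) ?_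
          rw [hcS p hp]; exact min_le_right _ _
      _ = (∏ p ∈ S1, (p : ℝ)) ^ 2 := prod_pow _ _ _
      _ ≤ _ := by gcongr

theorem case2 (hS : ∀ p ∈ S, p.Prime) (H : ∀ p ∈ S, IsLoc p (a p) (φ p)) (hP : 1 ≤ P) (hSP : ∀ p ∈ S, (p : ℝ) ≤ P) (hk : 1 ≤ k) (hX : 1 ≤ X)
    (hq : ((∏ p ∈ S, p ^ a p : ℕ) : ℝ) ≤ X ^ k) (hN : 0 < N) (hZ : 1 ≤ Z) (hZS : Z ≤ ∏ p ∈ S with 10 * (k + 1) ^ 3 ≤ a p, (p : ℝ) ^ a p) :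
    (‖∑ n ∈ range N, ∏ p ∈ S, φ p n‖ / N) ^ 2 ^ k ≤ Z ^ (-(1 / (8 * (k + 1) ^ 2)) : ℝ) + 2 ^ (k + 3) * (X ^ 4 * P) / N := by
  set S2 := S.filter fun p => 10 * (k + 1) ^ 3 ≤ a p with hS2
  have hS2S : S2 ⊆ S := filter_subset _ _
  set b : ℕ → ℕ := fun p => a p / (k + 1) with hb
  set c : ℕ → ℕ := fun p => if p ∈ S2 then a p - k * b p else 0 with hc
  have hcS : ∀ p ∈ S2, c p = a p - k * b p := fun p hp => if_pos hp
  have hcn : ∀ p, p ∉ S2 → c p = 0 := fun p hp => if_neg hp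
  have hca : ∀ p ∈ S, c p ≤ a p := fun p _ => by simp only [hc]; split_ifs <;> omega
  have hbk : ∀ p, k * b p + b p ≤ a p := fun p => by
    have := Nat.mul_div_le (a p) (k + 1)
    have e : (k + 1) * (a p / (k + 1)) = k * b p + b p := by rw [hb]; ring
    omega
  have hbk2 : ∀ p, a p ≤ k * b p + b p + k := fun p => by
    have := Nat.lt_mul_div_succ (a p) (by omega : 0 < k + 1)
    have e : (k + 1) * (a p / (k + 1) + 1) = k * b p + b p + k + 1 := by rw [hb]; ring
    omega
  have hkb : ∀ p ∈ S2, k + 1 ≤ b p := fun p hp => by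
    rw [hb, Nat.le_div_iff_mul_le (by omega)]
    have := (mem_filter.1 hp).2
    have h1 : (k + 1) * (k + 1) ≤ (k + 1) ^ 3 := by
      rw [show (k + 1) ^ 3 = (k + 1) * (k + 1) * (k + 1) by ring]; exact Nat.le_mul_of_pos_right _ (by omega)
    omega
  have hp1 : ∀ p ∈ S, (1 : ℝ) ≤ p := fun p hp => by exact_mod_cast (hS p hp).one_lt.le
  obtain ⟨g, hg⟩ : ∃ g, g = ∏ p ∈ S2, p ^ b p := ⟨_, rfl⟩
  obtain ⟨m, hm⟩ : ∃ m, m = ∏ p ∈ S \ S2, p ^ a p := ⟨_, rfl⟩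
  have hm0 : m ≠ 0 := hm ▸ prod_ne_zero_iff.2 fun p hp => pow_ne_zero _ (hS p (sdiff_subset hp)).ne_zero
  have hg0 : 1 ≤ g := hg ▸ Nat.one_le_iff_ne_zero.2 (prod_ne_zero_iff.2 fun p hp => pow_ne_zero _ (hS p (hS2S hp)).ne_zero)
  have hgk : g ^ k * m = ∏ p ∈ S, p ^ (a p - c p) := by
    rw [hg, hm, ← prod_sdiff hS2S, mul_comm, ← prod_pow]
    refine congrArg₂ _ (prod_congr rfl fun p hp => ?_) (prod_congr rfl fun p hp => ?_)
    · rw [hcn p (mem_sdiff.1 hp).2, Nat.sub_zero]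
    · rw [hcS p hp, ← pow_mul]; congr 1; have := hbk p; rw [mul_comm]; omega
  have hgq : g ^ k * m ≤ ∏ p ∈ S, p ^ a p := by
    rw [hgk]; exact prod_le_prod' fun p hp => Nat.pow_le_pow_right (hS p hp).pos (Nat.sub_le _ _)
  have hgqR : ((g : ℝ) ^ k) * m ≤ X ^ k := le_trans (by exact_mod_cast hgq) hq
  have hg0R : (1 : ℝ) ≤ g := by exact_mod_cast hg0
  have hm0R : (1 : ℝ) ≤ m := by exact_mod_cast Nat.one_le_iff_ne_zero.2 hm0
  have hgX : (g : ℝ) ≤ X := by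
    refine rpow_nat_le (by linarith) (by linarith) k (by omega) (le_trans ?_ hgqR)
    exact le_mul_of_one_le_right (by positivity) hm0R
  obtain ⟨w, hw1, hw2⟩ := greedy hX hP k m hm0 (fun r hr h => by
    by_contra hn
    exact not_dvd_prod_pow (fun p hp => hS p (sdiff_subset hp)) _ hr (fun h => hn (hSP r (sdiff_subset h))) (hm ▸ h))
      (le_trans (le_mul_of_one_le_left (by linarith) (one_le_pow₀ hg0R)) hgqR)
  set w' : ℕ → ℕ := fun i => if i < k then g * w i else 0 with hw'
  have hww : ∏ i ∈ range k, w' i = ∏ p ∈ S, p ^ (a p - c p) := by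
    rw [← hgk, ← hw1, prod_congr rfl (g := fun i => g * w i), prod_mul_distrib, prod_const, card_range]
    exact fun i hi => if_pos (mem_range.1 hi)
  have hfil : S.filter (fun p => c p ≠ 0) = S2 := by
    ext p
    simp only [mem_filter]
    constructor
    · rintro ⟨-, h⟩; by_contra hn; exact h (hcn p hn)
    · intro h
      exact ⟨hS2S h, by rw [hcS p h]; have := hbk p; have := hkb p h; omega⟩
  have hmain := thmG' hS H w' c k N hN (W := X * (X * P)) (fun i hi => by
      simp only [hw', if_pos hi]; push_cast; exact mul_le_mul hgX (hw2 i) (by positivity) (by linarith)) (by nlinarith [mul_le_mul hX hP zero_le_one (by linarith)]) hca hww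
    (fun p => (p : ℝ) ^ (-(a p / (8 * (k + 1) ^ 2)) : ℝ)) (by
      intro p hp hcp u hu hpu
      have hp1 : p ∈ S2 := by rw [← hfil]; exact mem_filter.2 ⟨hp, hcp⟩
      refine Mp2 (hS p hp) (H p hp) w' hk (mem_filter.1 hp1).2 rfl (hcS p hp1) u hu ?_ (by simp [hw']) ?_
      · rw [hpu, hcS p hp1]; exact congrArg (fun e => p ^ e * u) (Nat.sub_sub_self ((Nat.le_add_right _ _).trans (hbk p)))
      · intro i hi
        simp only [hw', if_pos hi]
        exact dvd_mul_of_dvd_left (hg ▸ dvd_prod_of_mem (fun p => p ^ b p) hp1) _)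
  refine hmain.trans ?_
  rw [hfil]
  have hQ : ∏ p ∈ S, (p : ℝ) ^ c p ≤ X ^ 2 := by
    rw [← prod_subset hS2S (fun p _ hp => by rw [hcn p hp, pow_zero])]
    calc ∏ p ∈ S2, (p : ℝ) ^ c p ≤ ∏ p ∈ S2, ((p : ℝ) ^ b p) ^ 2 := by
          refine prod_le_prod (fun _ _ => by positivity) fun p hp => ?_
          rw [← pow_mul]
          refine pow_le_pow_right₀ (hp1 p (hS2S hp)) ?_
          rw [hcS p hp]; have := hbk2 p; have := hkb p hp; omega
      _ = (g : ℝ) ^ 2 := by rw [prod_pow, hg]; push_cast; rfl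
      _ ≤ _ := by gcongr
  have e4 : X ^ 4 * P = X * (X * P) * X ^ 2 := by ring
  rw [e4]
  gcongr ?_ + 2 ^ (k + 3) * (X * (X * P) * ?_) / N
  have : ∀ p ∈ S2, (p : ℝ) ^ (-(a p / (8 * (k + 1) ^ 2)) : ℝ) = ((p : ℝ) ^ a p) ^ (-(1 / (8 * (k + 1) ^ 2)) : ℝ) := fun p hp => by
    rw [← Real.rpow_natCast_mul (Nat.cast_nonneg _)]; congr 1; ring
  rw [prod_congr rfl this, Real.finsetProd_rpow _ _ fun _ _ => by positivity]
  exact Real.rpow_le_rpow_of_nonpos (by linarith) hZS (by rw [neg_nonpos]; positivity)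

/-- remaining case: the modulus is small -/
theorem case3 (hS : ∀ p ∈ S, p.Prime) {Z1 Z2 : ℝ} (h1 : (∏ p ∈ S with 16 ^ (k + 2) ≤ p, (p : ℝ)) ≤ Z1)
    (h2 : (∏ p ∈ S with 10 * (k + 1) ^ 3 ≤ a p, (p : ℝ) ^ a p) ≤ Z2) :
    ((∏ p ∈ S, p ^ a p : ℕ) : ℝ) ≤ (4 : ℝ) ^ (16 ^ (k + 2) * (10 * (k + 1) ^ 3)) * Z1 ^ (10 * (k + 1) ^ 3) * Z2 := by
  have hp1 : ∀ p ∈ S, (1 : ℝ) ≤ p := fun p hp => by exact_mod_cast (hS p hp).one_lt.le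
  obtain ⟨A, hA⟩ : ∃ A, A = 10 * (k + 1) ^ 3 := ⟨_, rfl⟩
  obtain ⟨y, hy⟩ : ∃ y, y = 16 ^ (k + 2) := ⟨_, rfl⟩
  rw [← hA] at h2 ⊢
  rw [← hy] at h1 ⊢
  have hsplit : ∀ p ∈ S, (p : ℝ) ^ a p ≤ (if y ≤ p then (p : ℝ) else 1) ^ A * (if y ≤ p then 1 else (p : ℝ)) ^ A * (if A ≤ a p then (p : ℝ) ^ a p else 1) := by
    intro p hp
    have hA1 : (1 : ℝ) ≤ (p : ℝ) ^ A := one_le_pow₀ (hp1 p hp)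
    have h0 : (if y ≤ p then (p : ℝ) else 1) ^ A * (if y ≤ p then 1 else (p : ℝ)) ^ A = (p : ℝ) ^ A := by split_ifs <;> simp
    rw [h0]
    split_ifs with h
    · exact le_mul_of_one_le_left (by positivity) hA1
    · rw [mul_one]; exact pow_le_pow_right₀ (hp1 p hp) (by omega)
  push_cast
  refine (prod_le_prod (fun _ _ => by positivity) hsplit).trans ?_
  rw [prod_mul_distrib, prod_mul_distrib, prod_pow, prod_pow, ← prod_filter, ← prod_filter]
  have h3 : ∏ p ∈ S, (if y ≤ p then 1 else (p : ℝ)) ≤ 4 ^ y := by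
    have e : ∏ p ∈ S, (if y ≤ p then 1 else (p : ℝ)) = ∏ p ∈ S with ¬ y ≤ p, (p : ℝ) := by
      rw [prod_filter]; exact prod_congr rfl fun p _ => by split_ifs <;> rfl
    rw [e]
    have : ∏ p ∈ S with ¬ y ≤ p, p ≤ primorial y := by
      refine prod_le_prod_of_subset_of_one_le' (fun p hp => ?_) (fun p hp _ => (mem_filter.1 hp).2.one_lt.le)
      simp only [mem_filter, mem_range] at hp ⊢
      exact ⟨by omega, hS p hp.1⟩
    have h : ((∏ p ∈ S with ¬ y ≤ p, p : ℕ) : ℝ) ≤ ((4 ^ y : ℕ) : ℝ) := Nat.cast_le.2 (this.trans (primorial_le_four_pow y))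
    rw [Nat.cast_prod, Nat.cast_pow, Nat.cast_ofNat] at h; exact h
  have hn1 : 0 ≤ ∏ p ∈ S with y ≤ p, (p : ℝ) := prod_nonneg fun _ _ => by positivity
  have hn2 : 0 ≤ ∏ p ∈ S, (if y ≤ p then 1 else (p : ℝ)) := prod_nonneg fun _ _ => by split_ifs <;> positivity
  have hn3 : 0 ≤ ∏ p ∈ S with A ≤ a p, (p : ℝ) ^ a p := prod_nonneg fun _ _ => by positivity
  rw [pow_mul, mul_comm (((4 : ℝ) ^ y) ^ A)]
  have i1 := pow_le_pow_left₀ hn1 h1 A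
  have i2 := pow_le_pow_left₀ hn2 h3 A
  exact mul_le_mul (mul_le_mul i1 i2 (by positivity) ((pow_nonneg hn1 A).trans i1)) h2 hn3 (mul_nonneg ((pow_nonneg hn1 A).trans i1) (by positivity))
end

open Polynomial Finset

set_option maxHeartbeats 400000 in
theorem KT0 {ℓ D : ℝ} (hℓ : 1 < ℓ) (hD : ℓ / Real.log ℓ ≤ D) {S : Finset ℕ} {a : ℕ → ℕ} {φ : ℕ → ℤ → ℂ}
    (hS : ∀ p ∈ S, p.Prime) (H : ∀ p ∈ S, IsLoc p (a p) (φ p)) (hSP : ∀ p ∈ S, (p : ℝ) ≤ Real.exp D)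
    (hq : ((∏ p ∈ S, p ^ a p : ℕ) : ℝ) ≤ Real.exp (2 * ℓ)) (N : ℕ) (hN : Real.exp (1000 * D) ≤ N)
    (htriv : ‖∑ n ∈ range N, ∏ p ∈ S, φ p n‖ ≤ ((∏ p ∈ S, p ^ a p : ℕ) : ℝ)) :
    ‖∑ n ∈ range N, ∏ p ∈ S, φ p n‖ ≤ √N + 2 * N * Real.exp (-(D / ℓ ^ (1 / 4 : ℝ))) := by
  obtain ⟨lam, hlam⟩ : ∃ x, x = Real.log ℓ := ⟨_, rfl⟩
  have hl0 : 0 < lam := hlam ▸ Real.log_pos hℓ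
  have hℓe : ℓ = Real.exp lam := by rw [hlam, Real.exp_log (by linarith)]
  rw [← hlam] at hD
  have hℓD : ℓ ≤ lam * D := by rw [div_le_iff₀ hl0] at hD; linarith
  have hD0 : 0 < D := lt_of_lt_of_le (div_pos (by linarith) hl0) hD
  have hN0 : (0 : ℝ) < N := (Real.exp_pos _).trans_le hN
  have hNn : 0 < N := by exact_mod_cast hN0
  have hsq : ∀ x ≤ 500 * D, Real.exp x ≤ √N := fun x hx => by
    refine Real.le_sqrt_of_sq_le ?_
    rw [← Real.exp_nat_mul]
    exact (Real.exp_le_exp.2 (by push_cast; linarith)).trans hN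
  have hE0 : 0 ≤ 2 * (N : ℝ) * Real.exp (-(D / ℓ ^ (1 / 4 : ℝ))) := by positivity
  have hsq0 := Real.sqrt_nonneg (N : ℝ)
  have triv : ∀ x ≤ 500 * D, ((∏ p ∈ S, p ^ a p : ℕ) : ℝ) ≤ Real.exp x → ‖∑ n ∈ range N, ∏ p ∈ S, φ p n‖ ≤ √N + 2 * N * Real.exp (-(D / ℓ ^ (1 / 4 : ℝ))) :=
    fun x hx h => by linarith [htriv.trans (h.trans (hsq x hx))]
  rcases lt_or_ge lam 100 with h100 | h100
  · exact triv (2 * ℓ) (by have := mul_le_mul_of_nonneg_right h100.le hD0.le; linarith) hq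
  -- main case
  obtain ⟨k, hk⟩ : ∃ k, k = ⌈lam / 50⌉₊ := ⟨_, rfl⟩
  have hk1 : lam / 50 ≤ k := hk ▸ Nat.le_ceil _
  have hk2 : (k : ℝ) < lam / 50 + 1 := hk ▸ Nat.ceil_lt_add_one (by linarith)
  have hkpos : 1 ≤ k := by
    have : (0 : ℝ) < k := by linarith
    exact_mod_cast this
  have hDbig : Real.exp (lam / 2) ≤ D := by
    refine le_trans ?_ hD
    rw [le_div_iff₀ hl0, hℓe]
    have h1 : lam ≤ Real.exp (lam / 2) := by
      have := Real.quadratic_le_exp_of_nonneg (show 0 ≤ lam / 2 by linarith)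
      nlinarith
    calc Real.exp (lam / 2) * lam ≤ Real.exp (lam / 2) * Real.exp (lam / 2) := by gcongr
      _ = Real.exp lam := by rw [← Real.exp_add]; ring_nf
  have e1 : (2.7 : ℝ) ≤ Real.exp 1 := by have := Real.exp_one_gt_d9; linarith
  have e3 : (16 : ℝ) ≤ Real.exp 3 := by
    have : Real.exp 3 = Real.exp 1 ^ 3 := by rw [← Real.exp_nat_mul]; norm_num
    rw [this]; exact le_trans (by norm_num) (pow_le_pow_left₀ (by norm_num) e1 3)
  have e4 : (40 : ℝ) ≤ Real.exp 4 := by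
    have : Real.exp 4 = Real.exp 1 ^ 4 := by rw [← Real.exp_nat_mul]; norm_num
    rw [this]; exact le_trans (by norm_num) (pow_le_pow_left₀ (by norm_num) e1 4)
  have e2 : (4 : ℝ) ≤ Real.exp 2 := by
    have : Real.exp 2 = Real.exp 1 ^ 2 := by rw [← Real.exp_nat_mul]; norm_num
    rw [this]; exact le_trans (by norm_num) (pow_le_pow_left₀ (by norm_num) e1 2)
  have hk3 : ((k : ℝ) + 1) ^ 3 ≤ Real.exp (3 * k) := by
    rw [show (3 : ℝ) * k = (3 : ℕ) * (k : ℝ) by norm_num, Real.exp_nat_mul]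
    exact pow_le_pow_left₀ (by positivity) (Real.add_one_le_exp _) 3
  obtain ⟨A, hA⟩ : ∃ A, A = 10 * (k + 1) ^ 3 := ⟨_, rfl⟩
  have hAR : (A : ℝ) = 10 * ((k : ℝ) + 1) ^ 3 := by rw [hA]; push_cast; ring
  have hA1 : (1 : ℝ) ≤ A := by rw [hAR]; linarith [one_le_pow₀ (by linarith : (1:ℝ) ≤ (k : ℝ) + 1) (n := 3)]
  have hAe : (A : ℝ) ≤ Real.exp (3 * k + 3) := by
    rw [hAR, Real.exp_add, mul_comm]; exact mul_le_mul hk3 (by linarith) (by norm_num) (Real.exp_pos _).le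
  have hsmall : (4 : ℝ) ^ (16 ^ (k + 2) * A) ≤ Real.exp D := by
    have h1 : ((16 ^ (k + 2) * A : ℕ) : ℝ) * 2 ≤ D := by
      refine le_trans ?_ hDbig
      push_cast
      have h16 : (16 : ℝ) ^ (k + 2) ≤ Real.exp (3 * (k + 2)) := by
        rw [show (3 : ℝ) * (k + 2) = (k + 2 : ℕ) * (3 : ℝ) by push_cast; ring, Real.exp_nat_mul]
        exact pow_le_pow_left₀ (by norm_num) e3 _
      calc (16 : ℝ) ^ (k + 2) * A * 2 ≤ Real.exp (3 * (k + 2)) * Real.exp (3 * k + 3) * Real.exp 1 := by gcongr; linarith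
        _ = Real.exp (6 * k + 10) := by rw [← Real.exp_add, ← Real.exp_add]; ring_nf
        _ ≤ _ := Real.exp_le_exp.2 (by linarith)
    calc (4 : ℝ) ^ (16 ^ (k + 2) * A) ≤ Real.exp 2 ^ (16 ^ (k + 2) * A) := by gcongr
      _ = Real.exp (((16 ^ (k + 2) * A : ℕ) : ℝ) * 2) := by rw [Real.exp_nat_mul]
      _ ≤ _ := Real.exp_le_exp.2 h1
  have h2k3 : (2 : ℝ) ^ (k + 3) ≤ Real.exp D := by
    refine le_trans (pow_le_pow_left₀ (by norm_num) (by norm_num : (2 : ℝ) ≤ 4) _) (le_trans (pow_le_pow_right₀ (by norm_num) ?_) hsmall)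
    have h1 : k + 2 < 16 ^ (k + 2) := Nat.lt_pow_self (by norm_num)
    have h2 : 1 ≤ A := by exact_mod_cast hA1
    exact le_trans (by omega) (Nat.le_mul_of_pos_right _ h2)
  have hP1 : 1 ≤ Real.exp D := Real.one_le_exp hD0.le
  have hX1 : 1 ≤ Real.exp (100 * D) := Real.one_le_exp (by linarith)
  have hqX : ((∏ p ∈ S, p ^ a p : ℕ) : ℝ) ≤ Real.exp (100 * D) ^ k := by
    refine hq.trans ?_
    rw [← Real.exp_nat_mul]
    exact Real.exp_le_exp.2 (by have := mul_le_mul_of_nonneg_right hk1 hD0.le; linarith)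
  have hZ1 : 1 ≤ Real.exp (D / A) := Real.one_le_exp (by positivity)
  have hDA : D / (4 * A) ≤ D := div_le_self hD0.le (by linarith)
  have herr : ∀ x ≤ 900 * D, (2 : ℝ) ^ (k + 3) * Real.exp x / N ≤ Real.exp (-(D / (4 * A))) := by
    intro x hx
    rw [div_le_iff₀ hN0]
    calc (2 : ℝ) ^ (k + 3) * Real.exp x ≤ Real.exp D * Real.exp x := by gcongr
      _ ≤ Real.exp (-(D / (4 * A))) * Real.exp (1000 * D) := by
          rw [← Real.exp_add, ← Real.exp_add]; exact Real.exp_le_exp.2 (by linarith)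
      _ ≤ _ := by gcongr
  have fin : (‖∑ n ∈ range N, ∏ p ∈ S, φ p n‖ / N) ^ 2 ^ k ≤ Real.exp (-(D / (4 * A))) + Real.exp (-(D / (4 * A))) →
      ‖∑ n ∈ range N, ∏ p ∈ S, φ p n‖ ≤ √N + 2 * N * Real.exp (-(D / ℓ ^ (1 / 4 : ℝ))) := by
    intro h
    have h1 : ‖∑ n ∈ range N, ∏ p ∈ S, φ p n‖ / N ≤ 2 * Real.exp (-(D / (4 * A * 2 ^ k))) := by
      refine rpow_nat_le (by positivity) (by positivity) (2 ^ k) (by positivity) (h.trans ?_)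
      rw [mul_pow, ← Real.exp_nat_mul]
      have : ((2 ^ k : ℕ) : ℝ) * -(D / (4 * A * 2 ^ k)) = -(D / (4 * A)) := by push_cast; field_simp
      rw [this, ← two_mul]
      gcongr
      exact le_self_pow₀ (by norm_num) (by positivity)
    have h2 : 4 * (A : ℝ) * 2 ^ k ≤ ℓ ^ (1 / 4 : ℝ) := by
      rw [hℓe, ← Real.exp_mul]
      have h2k : (2 : ℝ) ^ k ≤ Real.exp k := by
        rw [show (k : ℝ) = k * (1 : ℝ) by ring, Real.exp_nat_mul]; exact pow_le_pow_left₀ (by norm_num) (by linarith) _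
      calc 4 * (A : ℝ) * 2 ^ k = 40 * ((k : ℝ) + 1) ^ 3 * 2 ^ k := by rw [hAR]; ring
        _ ≤ Real.exp 4 * Real.exp (3 * k) * Real.exp k := by gcongr
        _ = Real.exp (4 * k + 4) := by rw [← Real.exp_add, ← Real.exp_add]; ring_nf
        _ ≤ _ := Real.exp_le_exp.2 (by linarith)
    have h3 : Real.exp (-(D / (4 * A * 2 ^ k))) ≤ Real.exp (-(D / ℓ ^ (1 / 4 : ℝ))) := by
      refine Real.exp_le_exp.2 (neg_le_neg ?_)
      gcongr
    rw [div_le_iff₀ hN0] at h1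
    have h4 := mul_le_mul_of_nonneg_left h3 (by positivity : 0 ≤ 2 * (N : ℝ))
    linarith
  by_cases hc1 : Real.exp (D / A) ≤ ∏ p ∈ S with 16 ^ (k + 2) ≤ p, (p : ℝ)
  · refine fin ((case1 hS H hP1 hSP hkpos hX1 hqX hNn hZ1 hc1).trans ?_)
    rw [← Real.exp_mul]
    refine add_le_add (le_of_eq ?_) ?_
    · congr 1; field_simp
    · rw [← Real.exp_add, ← Real.exp_add, ← Real.exp_nat_mul, ← Real.exp_add]
      have : D / A ≤ D := div_le_self hD0.le hA1
      exact herr _ (by push_cast; linarith)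
  by_cases hc2 : Real.exp D ≤ ∏ p ∈ S with 10 * (k + 1) ^ 3 ≤ a p, (p : ℝ) ^ a p
  · refine fin ((case2 hS H hP1 hSP hkpos hX1 hqX hNn hP1 hc2).trans ?_)
    rw [← Real.exp_mul]
    refine add_le_add (Real.exp_le_exp.2 ?_) ?_
    · rw [mul_neg, neg_le_neg_iff, mul_one_div]
      refine div_le_div_of_nonneg_left hD0.le (by positivity) ?_
      rw [hAR]; linarith [pow_le_pow_right₀ (by linarith : (1:ℝ) ≤ (k : ℝ) + 1) (show 2 ≤ 3 by norm_num), pow_nonneg (by linarith : (0:ℝ) ≤ (k : ℝ) + 1) 3]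
    · rw [← Real.exp_nat_mul, ← Real.exp_add]
      exact herr _ (by push_cast; linarith)
  · push Not at hc1 hc2
    refine triv (3 * D) (by linarith) ((case3 hS hc1.le hc2.le).trans ?_)
    rw [← hA, ← Real.exp_nat_mul]
    have : (A : ℝ) * (D / A) = D := by field_simp
    rw [this, show 3 * D = D + D + D by ring, Real.exp_add, Real.exp_add]
    gcongr

open Polynomial Finset

lemma prod_idem {R : Type*} [CommRing R] (A : Finset ℕ) (E : ℕ → R) (hE : ∀ i ∈ A, ∀ j ∈ A, i ≠ j → E i * E j = 0) (x : R) :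
    ∏ i ∈ A, (1 + (x - 1) * E i) = 1 + (x - 1) * ∑ i ∈ A, E i := by
  induction A using Finset.induction_on with
  | empty => simp
  | insert p A hp ih =>
    rw [prod_insert hp, sum_insert hp, ih fun i hi j hj => hE i (mem_insert_of_mem hi) j (mem_insert_of_mem hj)]
    have : E p * ∑ i ∈ A, E i = 0 := by
      rw [mul_sum]; exact sum_eq_zero fun i hi => hE p (mem_insert_self _ _) i (mem_insert_of_mem hi) (by rintro rfl; exact hp hi)
    linear_combination (x - 1) ^ 2 * this

lemma charsum_le {q : ℕ} [NeZero q] (χ : DirichletCharacter ℂ q) (hχ : χ ≠ 1) (N : ℕ) : ‖∑ n ∈ range N, χ n‖ ≤ q := by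
  rcases Nat.eq_zero_or_pos N with rfl | hN
  · simp
  have hq : 0 < q := Nat.pos_of_ne_zero (NeZero.ne q)
  have h := avg_per N q hN hq (fun n : ℤ => χ n) (fun n => χ.norm_le_one _) (fun x y hxy => by
    show χ x = χ y
    rw [(ZMod.intCast_eq_intCast_iff_dvd_sub y x q).2 hxy])
  have h0 : avg q (fun n : ℤ => χ n) = 0 := by
    unfold avg
    rw [sum_range_zmod q (fun n : ℤ => χ (n : ZMod q))]
    simp [MulChar.sum_eq_zero_of_ne_one hχ]
  have hN0 : (0 : ℝ) < N := by exact_mod_cast hN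
  rw [h0, norm_zero, zero_add] at h
  unfold avg at h
  rw [norm_div, Complex.norm_natCast, div_le_div_iff_of_pos_right hN0] at h
  simpa using h

lemma exists_loc {q : ℕ} [NeZero q] (χ : DirichletCharacter ℂ q) (hprim : χ.IsPrimitive) :
    ∃ φ : ℕ → ℤ → ℂ, (∀ p ∈ q.primeFactors, IsLoc p (q.factorization p) (φ p)) ∧ ∀ n : ℤ, χ n = ∏ p ∈ q.primeFactors, φ p n := by
  have hq0 : q ≠ 0 := NeZero.ne q
  have hq : 0 < q := Nat.pos_of_ne_zero hq0
  have hb : ∀ p ∈ q.primeFactors, ∃ x y : ℤ, x * ((q / p ^ q.factorization p : ℕ) : ℤ) + y * ((p ^ q.factorization p : ℕ) : ℤ) = 1 := by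
    intro p hp
    have hp' := Nat.prime_of_mem_primeFactors hp
    have := Nat.Coprime.pow_left (q.factorization p) (Nat.coprime_ordCompl hp' hq0)
    exact (Nat.isCoprime_iff_coprime.2 this.symm)
  choose! x y hxy using hb
  obtain ⟨E, hE⟩ : ∃ E : ℕ → ZMod q, E = fun p => ((x p * ((q / p ^ q.factorization p : ℕ) : ℤ) : ℤ) : ZMod q) := ⟨_, rfl⟩
  have hE1 : ∀ p ∈ q.primeFactors, 1 - E p = ((y p * ((p ^ q.factorization p : ℕ) : ℤ) : ℤ) : ZMod q) := fun p hp => by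
    have h := congrArg (Int.cast : ℤ → ZMod q) (hxy p hp)
    rw [Int.cast_add, Int.cast_one] at h
    rw [hE, ← h]; ring
  have hqq : ∀ p, p ^ q.factorization p * (q / p ^ q.factorization p) = q := fun p => Nat.ordProj_mul_ordCompl_eq_self q p
  have hz : ∀ m : ℤ, (q : ℤ) ∣ m → (m : ZMod q) = 0 := fun m h => (ZMod.intCast_zmod_eq_zero_iff_dvd m q).2 h
  have hidem : ∀ p ∈ q.primeFactors, E p * (1 - E p) = 0 := fun p hp => by
    rw [hE1 p hp, hE, ← Int.cast_mul]
    refine hz _ ⟨x p * y p, ?_⟩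
    conv_rhs => rw [← hqq p]
    push_cast; ring
  have horth : ∀ p ∈ q.primeFactors, ∀ r ∈ q.primeFactors, p ≠ r → E p * E r = 0 := fun p hp r hr hpr => by
    rw [hE, ← Int.cast_mul]
    have hpp := Nat.prime_of_mem_primeFactors hp
    have hrp := Nat.prime_of_mem_primeFactors hr
    have h1 : p ^ q.factorization p ∣ q / r ^ q.factorization r := by
      refine Nat.Coprime.dvd_of_dvd_mul_left (m := r ^ q.factorization r) (Nat.Coprime.pow _ _ ((Nat.coprime_primes hpp hrp).2 hpr)) ?_
      rw [hqq r]; exact Nat.ordProj_dvd q p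
    have h2 : q ∣ (q / p ^ q.factorization p) * (q / r ^ q.factorization r) := by
      conv_lhs => rw [← hqq p, mul_comm]
      exact mul_dvd_mul_left _ h1
    refine hz _ ?_
    rw [mul_mul_mul_comm]
    exact dvd_mul_of_dvd_right (by exact_mod_cast h2) _
  have hsum : ∑ p ∈ q.primeFactors, E p = 1 := by
    have h := prod_idem _ E horth 0
    have h2 : ∏ p ∈ q.primeFactors, (1 + (0 - 1) * E p) = 0 := by
      have : ∀ p ∈ q.primeFactors, (1 + (0 - 1) * E p) = ((y p * ((p ^ q.factorization p : ℕ) : ℤ) : ℤ) : ZMod q) := fun p hp => by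
        rw [← hE1 p hp]; ring
      rw [prod_congr rfl this, ← Int.cast_prod, prod_mul_distrib]
      refine hz _ (dvd_mul_of_dvd_right ?_ _)
      rw [← Nat.cast_prod]
      have := Nat.prod_factorization_pow_eq_self hq0
      rw [Finsupp.prod, Nat.support_factorization] at this
      rw [this]
    rw [h2] at h
    linear_combination h
  refine ⟨fun p n => χ (1 + ((n : ZMod q) - 1) * E p), fun p hp => ?_, fun n => ?_⟩
  swap
  · rw [← map_prod, prod_idem _ E horth, hsum]; congr 1; ring
  have hpp := Nat.prime_of_mem_primeFactors hp
  have hpq : p ∣ q := Nat.dvd_of_mem_primeFactors hp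
  have ha : q.factorization p ≠ 0 := (hpp.factorization_pos_of_dvd hq0 hpq).ne'
  have hid : E p * E p = E p := by have := hidem p hp; linear_combination -this
  have hper : ∀ u v : ℤ, ((p ^ q.factorization p : ℕ) : ℤ) ∣ u - v → (u : ZMod q) * E p = v * E p := by
    rintro u v ⟨c, hc⟩
    rw [← sub_eq_zero, ← sub_mul, ← Int.cast_sub, hc, hE, ← Int.cast_mul]
    refine hz _ ⟨c * x p, ?_⟩
    conv_rhs => rw [← hqq p]
    push_cast; ring
  have hunit : ∀ u : ℤ, IsUnit (1 + ((u : ZMod q) - 1) * E p) ↔ ¬ (p : ℤ) ∣ u := by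
    intro u
    constructor
    · intro hu hdiv
      have h1 := hu.map (ZMod.castHom hpq (ZMod p))
      have hEp : ZMod.castHom hpq (ZMod p) (E p) = 1 := by
        have h2 : ZMod.castHom hpq (ZMod p) (1 - E p) = 0 := by
          rw [hE1 p hp, map_intCast, ZMod.intCast_zmod_eq_zero_iff_dvd]
          exact dvd_mul_of_dvd_right (by exact_mod_cast dvd_pow_self p ha) _
        rw [map_sub, map_one] at h2; linear_combination -h2
      rw [map_add, map_mul, map_sub, map_one, hEp, map_intCast, (ZMod.intCast_zmod_eq_zero_iff_dvd u p).2 hdiv] at h1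
      have : Fact p.Prime := ⟨hpp⟩
      simp at h1
    · intro hu
      have hco : IsCoprime u ((p ^ q.factorization p : ℕ) : ℤ) := by
        push_cast
        exact (((Nat.prime_iff_prime_int.1 hpp).coprime_iff_not_dvd.2 hu).symm).pow_right
      obtain ⟨s, t, hst⟩ := hco
      have h1 : ((s * u : ℤ) : ZMod q) * E p = (1 : ℤ) * E p := hper _ _ ⟨-t, by linear_combination hst⟩
      push_cast at h1
      refine IsUnit.of_mul_eq_one (1 + ((s : ZMod q) - 1) * E p) ?_
      linear_combination ((u : ZMod q) - 1) * (s - 1) * hid + h1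
  refine ⟨fun u v => ?_, ?_, fun u v h => ?_, fun u h => ?_, fun u h => ?_, ?_⟩
  · dsimp only
    rw [← map_mul]; congr 1; push_cast; linear_combination -((u : ZMod q) - 1) * (v - 1) * hid
  · simp
  · dsimp only; congr 1; linear_combination hper u v h
  · exact χ.map_nonunit fun h' => (hunit u).1 h' h
  · obtain ⟨v, hv⟩ := (hunit u).2 h
    dsimp only
    rw [← hv]; exact DirichletCharacter.unit_norm_eq_one χ v
  · -- primitivity
    have hnf : ¬ χ.FactorsThrough (q / p) := by
      intro hf
      have h1 := DirichletCharacter.conductor_dvd_of_mem_conductorSet χ hf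
      rw [hprim] at h1
      exact absurd (Nat.le_of_dvd (Nat.div_pos (Nat.le_of_dvd hq hpq) hpp.pos) h1) (not_le.2 (Nat.div_lt_self hq hpp.one_lt))
    have hd : q / p ∣ q := Nat.div_dvd_of_dvd hpq
    rw [DirichletCharacter.factorsThrough_iff_ker_unitsMap hd, SetLike.not_le_iff_exists] at hnf
    obtain ⟨v, hv1, hv2⟩ := hnf
    rw [MonoidHom.mem_ker] at hv1 hv2
    have huv : (((v : ZMod q).val : ℤ) : ZMod q) = v := by simp
    have hdvd : ((q / p : ℕ) : ℤ) ∣ (v : ZMod q).val - 1 := by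
      have h1 := congrArg (Units.val) hv1
      rw [ZMod.unitsMap_def, Units.coe_map, Units.val_one] at h1
      have h2 : ZMod.castHom hd (ZMod (q / p)) ((((v : ZMod q).val : ℤ) - 1 : ℤ) : ZMod q) = 0 := by
        rw [Int.cast_sub, huv, map_sub, Int.cast_one, map_one, sub_eq_zero]; exact h1
      rwa [map_intCast, ZMod.intCast_zmod_eq_zero_iff_dvd] at h2
    have hpd : p ^ (q.factorization p - 1) * (q / p ^ q.factorization p) = q / p := by
      refine (Nat.div_eq_of_eq_mul_right hpp.pos ?_).symm
      rw [← mul_assoc, ← pow_succ', Nat.sub_add_cancel (Nat.pos_of_ne_zero ha), hqq]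
    have hfix : 1 + ((((v : ZMod q).val : ℤ) : ZMod q) - 1) * E p = v := by
      have h3 : ((((v : ZMod q).val : ℤ) - 1 : ℤ) : ZMod q) * (1 - E p) = 0 := by
        obtain ⟨c, hc⟩ := hdvd
        rw [hE1 p hp, ← Int.cast_mul, hc]
        refine hz _ ⟨c * y p * (p : ℤ) ^ (q.factorization p - 1), ?_⟩
        have e1 : ((q / p : ℕ) : ℤ) = (p : ℤ) ^ (q.factorization p - 1) * (q / p ^ q.factorization p : ℕ) := by exact_mod_cast hpd.symm
        have e2 : (q : ℤ) = ((p ^ q.factorization p : ℕ) : ℤ) * (q / p ^ q.factorization p : ℕ) := by exact_mod_cast (hqq p).symm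
        linear_combination c * y p * ((p ^ q.factorization p : ℕ) : ℤ) * e1 - c * y p * (p : ℤ) ^ (q.factorization p - 1) * e2
      rw [Int.cast_sub, huv, Int.cast_one] at h3
      rw [huv]; linear_combination -h3
    refine ⟨(v : ZMod q).val, ?_, ?_, ?_⟩
    · refine dvd_trans ?_ hdvd
      exact_mod_cast Dvd.intro _ hpd
    · rw [← hunit, hfix]; exact v.isUnit
    · dsimp only
      rw [hfix]
      intro h; exact hv2 (Units.ext (by simpa using h))

theorem KT {ℓ D : ℝ} (hℓ : 1 < ℓ) (hD : ℓ / Real.log ℓ ≤ D) {q : ℕ} [NeZero q] (χ : DirichletCharacter ℂ q) (hprim : χ.IsPrimitive) (hχ : χ ≠ 1)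
    (hSP : ∀ p ∈ q.primeFactors, (p : ℝ) ≤ Real.exp D) (hq : (q : ℝ) ≤ Real.exp (2 * ℓ)) (N : ℕ) (hN : Real.exp (1000 * D) ≤ N) :
    ‖∑ n ∈ range N, χ n‖ ≤ √N + 2 * N * Real.exp (-(D / ℓ ^ (1 / 4 : ℝ))) := by
  obtain ⟨φ, h1, h2⟩ := exists_loc χ hprim
  have e := Nat.prod_factorization_pow_eq_self (NeZero.ne q)
  rw [Finsupp.prod, Nat.support_factorization] at e
  have h3 : ∀ n : ℕ, χ n = ∏ p ∈ q.primeFactors, φ p n := fun n => by simpa using h2 n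
  have h4 := charsum_le χ hχ N
  simp only [h3] at h4 ⊢
  exact KT0 hℓ hD (fun p hp => Nat.prime_of_mem_primeFactors hp) h1 hSP (by rw [e]; exact hq) N hN (by rw [e]; exact h4)

open Polynomial Finset

section blaschke
open Complex Metric ComplexConjugate Topology

lemma bl_aux (a w : ℂ) : normSq (1 - conj a * w) - normSq (a - w) = (1 - normSq a) * (1 - normSq w) := by
  simp [normSq_apply]; ring

lemma bl_lt {a w : ℂ} (ha : ‖a‖ < 1) (hw : ‖w‖ < 1) : ‖a - w‖ < ‖1 - conj a * w‖ := by
  have h := bl_aux a w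
  rw [← sq_lt_sq₀ (norm_nonneg _) (norm_nonneg _), ← normSq_eq_norm_sq, ← normSq_eq_norm_sq]
  have h1 : normSq a < 1 := by rw [normSq_eq_norm_sq]; nlinarith [norm_nonneg a]
  have h2 : normSq w < 1 := by rw [normSq_eq_norm_sq]; nlinarith [norm_nonneg w]
  nlinarith [mul_pos (sub_pos.2 h1) (sub_pos.2 h2)]

lemma bl_div {g : ℂ → ℂ} (hg : DifferentiableOn ℂ g (ball 0 1)) (hb : ∀ z ∈ ball (0 : ℂ) 1, ‖g z‖ ≤ 1) {a : ℂ} (ha : ‖a‖ < 1) (h0 : g a = 0) :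
    ∃ h : ℂ → ℂ, DifferentiableOn ℂ h (ball 0 1) ∧ (∀ z ∈ ball (0 : ℂ) 1, ‖h z‖ ≤ 1) ∧ ∀ z, g z * (1 - conj a * z) = (z - a) * h z := by
  have haB : a ∈ ball (0 : ℂ) 1 := by simpa using ha
  have e : ∀ z, g z * (1 - conj a * z) = (z - a) * (dslope g a z * (1 - conj a * z)) := fun z => by
    have := sub_smul_dslope g a z
    rw [h0, sub_zero, smul_eq_mul] at this
    rw [← this]; ring
  have hd : DifferentiableOn ℂ (fun z => dslope g a z * (1 - conj a * z)) (ball 0 1) :=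
    ((Complex.differentiableOn_dslope (isOpen_ball.mem_nhds haB)).2 hg).mul (by fun_prop)
  have key : ∀ z ∈ ball (0 : ℂ) 1, z ≠ a → ‖dslope g a z * (1 - conj a * z)‖ ≤ 1 := by
    intro z hz hza
    have hz1 : ‖z‖ < 1 := by simpa using hz
    have hne : ∀ w : ℂ, ‖w‖ < 1 → 1 - conj a * w ≠ 0 := fun w hw h => by
      have := bl_lt ha hw; rw [h, norm_zero] at this; exact absurd this (not_lt.2 (norm_nonneg _))
    have hφ : ∀ w : ℂ, ‖w‖ < 1 → ‖(a - w) / (1 - conj a * w)‖ < 1 := fun w hw => by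
      rw [norm_div, div_lt_one (norm_pos_iff.2 (hne w hw))]; exact bl_lt ha hw
    have h1 := Complex.norm_le_norm_of_mapsTo_ball (f := fun w => g ((a - w) / (1 - conj a * w))) (R := 1) (z := (a - z) / (1 - conj a * z))
      (hg.comp (DifferentiableOn.div (by fun_prop) (by fun_prop) fun w hw => hne w (by simpa using hw)) fun w hw => by
        have := hφ w (by simpa using hw); simpa using this)
      (fun w hw => by
        have := hb _ (show (a - w) / (1 - conj a * w) ∈ ball (0 : ℂ) 1 by simpa using hφ w (by simpa using hw))
        simpa using this) (by simpa using h0) (hφ z hz1)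
    have h2 : (a - (a - z) / (1 - conj a * z)) / (1 - conj a * ((a - z) / (1 - conj a * z))) = z := by
      have h3 := hne z hz1
      have h4 : 1 - conj a * a ≠ 0 := hne a ha
      have h5 : 1 - conj a * ((a - z) / (1 - conj a * z)) = (1 - conj a * a) / (1 - conj a * z) := by field_simp; ring
      have h6 : a - (a - z) / (1 - conj a * z) = z * (1 - conj a * a) / (1 - conj a * z) := by
        rw [eq_div_iff h3, sub_mul, div_mul_cancel₀ _ h3]; ring
      rw [h5, h6, div_div_div_cancel_right₀ h3, mul_div_cancel_right₀ _ h4]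
    simp only [h2] at h1
    have h3 := congrArg norm (e z)
    rw [norm_mul, norm_mul (z - a)] at h3
    have hp : 0 < ‖z - a‖ := norm_pos_iff.2 (sub_ne_zero.2 hza)
    rw [norm_div, le_div_iff₀ (norm_pos_iff.2 (hne z hz1)), norm_sub_rev a z] at h1
    rw [h3] at h1
    exact le_of_mul_le_mul_left (by rw [mul_one]; exact h1) hp
  refine ⟨_, hd, fun z hz => ?_, e⟩
  by_cases hza : z = a
  · have hc : ContinuousAt (fun z => ‖dslope g a z * (1 - conj a * z)‖) z := (hd.continuousOn.continuousAt (isOpen_ball.mem_nhds hz)).norm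
    refine le_of_tendsto (hc.mono_left nhdsWithin_le_nhds : Filter.Tendsto _ (𝓝[≠] z) _) ?_
    filter_upwards [self_mem_nhdsWithin, nhdsWithin_le_nhds (isOpen_ball.mem_nhds hz)] with y hy hy2
    exact key y hy2 (by rw [← hza]; exact hy)
  · exact key z hz hza

lemma bl_zero {g h : ℂ → ℂ} {a z : ℂ} (ha : ‖a‖ < 1) (e : ∀ z, g z * (1 - conj a * z) = (z - a) * h z) (hz : z ∈ ball (0 : ℂ) 1) (h0 : h z = 0) : g z = 0 := by
  have h1 := e z
  rw [h0, mul_zero, mul_eq_zero] at h1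
  refine h1.resolve_right fun h2 => ?_
  have := bl_lt (a := a) (w := z) ha (by simpa using hz)
  rw [h2, norm_zero] at this; exact absurd this (not_lt.2 (norm_nonneg _))

lemma bl_rem {g h : ℂ → ℂ} {a : ℂ} (hg : DifferentiableAt ℂ g 0) (hh : DifferentiableAt ℂ h 0) (e : ∀ z, g z * (1 - conj a * z) = (z - a) * h z) (hg0 : g 0 ≠ 0) :
    h 0 ≠ 0 ∧ ‖g 0‖ = ‖a‖ * ‖h 0‖ ∧ (deriv g 0 / g 0).re = (1 - ‖a‖ ^ 2) * (-a⁻¹).re + (deriv h 0 / h 0).re := by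
  have e0 : g 0 = -a * h 0 := by have := e 0; simpa using this
  have ha : a ≠ 0 := fun h => by simp [h] at e0; exact hg0 e0
  have hh0 : h 0 ≠ 0 := fun h => by simp [h] at e0; exact hg0 e0
  refine ⟨hh0, by rw [e0]; simp, ?_⟩
  have h1 : HasDerivAt (fun z => g z * (1 - conj a * z)) (deriv g 0 * (1 - conj a * 0) + g 0 * (-(conj a * 1))) 0 :=
    hg.hasDerivAt.mul (((hasDerivAt_id (0 : ℂ)).const_mul (conj a)).const_sub 1)
  have h2 : HasDerivAt (fun z => (z - a) * h z) (1 * h 0 + (0 - a) * deriv h 0) 0 := ((hasDerivAt_id (0 : ℂ)).sub_const a).mul hh.hasDerivAt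
  have h3 := h1.unique (by rw [funext e]; exact h2)
  have h4 : deriv g 0 / g 0 = conj a - a⁻¹ + deriv h 0 / h 0 := by
    rw [eq_div_of_mul_eq (c := (1 : ℂ)) one_ne_zero (show deriv g 0 * 1 = g 0 * conj a + h 0 - a * deriv h 0 by linear_combination h3), e0]
    field_simp; ring
  rw [h4, add_re, sub_re, conj_re, neg_re, inv_re, normSq_eq_norm_sq]
  have : ‖a‖ ≠ 0 := norm_ne_zero_iff.2 ha
  field_simp; ring

lemma loc0 {M : ℝ} (hM : 0 < M) (n : ℕ) : ∀ g : ℂ → ℂ, DifferentiableOn ℂ g (ball 0 1) → (∀ z ∈ ball (0 : ℂ) 1, ‖g z‖ ≤ 1) →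
    (∀ z ∈ ball (0 : ℂ) 1, g z = 0 → z.re < 0) → (1 / 2) ^ n ≤ ‖g 0‖ → Real.exp (-M) ≤ ‖g 0‖ → -(8 * M) ≤ (deriv g 0 / g 0).re := by
  have B0 : (0 : ℂ) ∈ ball (0 : ℂ) 1 := by simp
  induction n with
  | zero =>
    intro g hg hb hz hn hM'
    have h1 := Complex.eqOn_of_isPreconnected_of_isMaxOn_norm (c := 0) (convex_ball (0 : ℂ) 1).isPreconnected isOpen_ball hg B0
      (fun z hz => (hb z hz).trans (by simpa using hn))
    have h2 : deriv g 0 = 0 := by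
      have : g =ᶠ[𝓝 0] Function.const ℂ (g 0) := h1.eventuallyEq_of_mem (isOpen_ball.mem_nhds B0)
      rw [this.deriv_eq]; exact deriv_const _ _
    rw [h2]; simp; linarith
  | succ n ih =>
    intro g hg hb hz hn hM'
    have hg0 : g 0 ≠ 0 := fun h => by have := hz 0 B0 h; simp at this
    have hgp := norm_pos_iff.2 hg0
    by_cases hex : ∃ a, ‖a‖ < 1 / 2 ∧ g a = 0
    · obtain ⟨a, ha, hga⟩ := hex
      obtain ⟨h, hh, hhb, e⟩ := bl_div hg hb (by linarith) hga
      obtain ⟨h0, hn1, hre⟩ := bl_rem (hg.differentiableAt (isOpen_ball.mem_nhds B0)) (hh.differentiableAt (isOpen_ball.mem_nhds B0)) e hg0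
      have hap : a.re < 0 := hz a (by simp; linarith) hga
      have hhp := norm_pos_iff.2 h0
      have hle : 2 * ‖g 0‖ ≤ ‖h 0‖ := by rw [hn1]; nlinarith
      have := ih h hh hhb (fun z hzB hz0 => hz z hzB (bl_zero (by linarith) e hzB hz0)) (by rw [pow_succ] at hn; linarith) (by linarith)
      rw [hre]
      have h3 : 0 ≤ (1 - ‖a‖ ^ 2) * (-a⁻¹).re := by
        refine mul_nonneg (by nlinarith [norm_nonneg a]) ?_
        rw [neg_re, inv_re, ← neg_div]; exact div_nonneg (by linarith) (normSq_nonneg _)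
      linarith
    · push Not at hex
      have hsub : ball (0 : ℂ) (1 / 2) ⊆ ball 0 1 := ball_subset_ball (by norm_num)
      have hB2 : (0 : ℂ) ∈ ball (0 : ℂ) (1 / 2) := by simp
      have hne : ∀ z ∈ ball (0 : ℂ) (1 / 2), g z ≠ 0 := fun z hz => hex z (by simpa using hz)
      have hL : DifferentiableOn ℂ (fun z => deriv g z / g z) (ball 0 (1 / 2)) := ((hg.deriv isOpen_ball).mono hsub).div (hg.mono hsub) hne
      obtain ⟨h, h0, hh⟩ := (hL.isExactOn_ball).with_val_at 0 0
      have hconst : ∀ z ∈ ball (0 : ℂ) (1 / 2), g z * cexp (-h z) = g 0 := by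
        intro z hz
        have := (convex_ball (0 : ℂ) (1 / 2)).is_const_of_fderivWithin_eq_zero (𝕜 := ℂ) (f := fun z => g z * cexp (-h z)) (x := z) (y := 0) ?_ ?_ hz hB2
        · rw [this, h0]; simp
        · intro w hw
          exact ((hg.differentiableAt (isOpen_ball.mem_nhds (hsub hw))).mul (hh w hw).differentiableAt.neg.cexp).differentiableWithinAt
        · intro w hw
          have h1 : HasDerivAt (fun z => g z * cexp (-h z)) 0 w := ((hg.differentiableAt (isOpen_ball.mem_nhds (hsub hw))).hasDerivAt.mul (hh w hw).neg.cexp).congr_deriv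
            (by have := hne w hw; simp only [Pi.neg_apply]; field_simp; ring)
          rw [h1.hasFDerivAt.hasFDerivWithinAt.fderivWithin (isOpen_ball.uniqueDiffWithinAt hw)]
          ext; simp
      have hre : ∀ z ∈ ball (0 : ℂ) (1 / 2), (h z).re ≤ M := by
        intro z hz
        have h1 := congrArg norm (hconst z hz)
        rw [norm_mul, norm_exp, neg_re] at h1
        have h2 : Real.exp (-M) ≤ Real.exp (-(h z).re) := by
          have := hb z (hsub hz)
          calc _ ≤ _ := hM'
            _ = _ := h1.symm
            _ ≤ _ := by have := Real.exp_pos (-(h z).re); nlinarith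
        have := Real.exp_le_exp.1 h2; linarith
      have hhd : DifferentiableOn ℂ h (ball 0 (1 / 2)) := fun z hz => (hh z hz).differentiableAt.differentiableWithinAt
      have hbd : ∀ z ∈ ball (0 : ℂ) (1 / 4), ‖h z‖ ≤ 2 * M := fun z hz => by
        have hz' : ‖z‖ < 1 / 4 := by simpa using hz
        refine (borelCaratheodory_zero hM hhd hre (by norm_num) (by simp; linarith) h0).trans ?_
        rw [div_le_iff₀ (by linarith)]; nlinarith
      have := Complex.norm_deriv_le_div_of_mapsTo_ball (f := h) (c := 0) (R₁ := 1 / 4) (R₂ := 2 * M) (hhd.mono (ball_subset_ball (by norm_num)))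
        (fun z hz => by simpa [h0] using hbd z hz) (by norm_num)
      rw [(hh 0 hB2).deriv] at this
      have h2 := (abs_le.1 ((Complex.abs_re_le_norm _).trans this)).1
      linarith

lemma loc0' {M : ℝ} (hM : 0 < M) {g : ℂ → ℂ} (hg : DifferentiableOn ℂ g (ball 0 1)) (hb : ∀ z ∈ ball (0 : ℂ) 1, ‖g z‖ ≤ 1)
    (hz : ∀ z ∈ ball (0 : ℂ) 1, g z = 0 → z.re < 0) (h0 : Real.exp (-M) ≤ ‖g 0‖) : -(8 * M) ≤ (deriv g 0 / g 0).re := by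
  obtain ⟨n, hn⟩ := exists_pow_lt_of_lt_one ((Real.exp_pos _).trans_le h0) (show (1 / 2 : ℝ) < 1 by norm_num)
  exact loc0 hM n g hg hb hz hn.le h0

lemma loc1 {M : ℝ} (hM : 0 < M) {g : ℂ → ℂ} (hg : DifferentiableOn ℂ g (ball 0 1)) (hb : ∀ z ∈ ball (0 : ℂ) 1, ‖g z‖ ≤ 1)
    (hz : ∀ z ∈ ball (0 : ℂ) 1, g z = 0 → z.re < 0) (h0 : Real.exp (-M) ≤ ‖g 0‖) {a : ℂ} (ha : ‖a‖ < 1) (hga : g a = 0) :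
    (1 - ‖a‖ ^ 2) * (-a⁻¹).re - 8 * M ≤ (deriv g 0 / g 0).re ∧
    ∀ b : ℂ, ‖b‖ < 1 → g b = 0 → (a = b → deriv g a = 0) → (1 - ‖a‖ ^ 2) * (-a⁻¹).re + (1 - ‖b‖ ^ 2) * (-b⁻¹).re - 8 * M ≤ (deriv g 0 / g 0).re := by
  have B0 : ball (0 : ℂ) 1 ∈ 𝓝 0 := isOpen_ball.mem_nhds (by simp)
  have hg0 : g 0 ≠ 0 := norm_pos_iff.1 ((Real.exp_pos _).trans_le h0)
  have up : ∀ {g h : ℂ → ℂ} {a : ℂ}, ‖a‖ < 1 → Real.exp (-M) ≤ ‖g 0‖ → ‖g 0‖ = ‖a‖ * ‖h 0‖ → Real.exp (-M) ≤ ‖h 0‖ := fun ha h e => by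
    refine h.trans (e.le.trans ?_); exact mul_le_of_le_one_left (norm_nonneg _) ha.le
  obtain ⟨h, hh, hhb, e⟩ := bl_div hg hb ha hga
  obtain ⟨h00, hn1, hre⟩ := bl_rem (hg.differentiableAt B0) (hh.differentiableAt B0) e hg0
  have hhz : ∀ z ∈ ball (0 : ℂ) 1, h z = 0 → z.re < 0 := fun z hzB hz0 => hz z hzB (bl_zero ha e hzB hz0)
  constructor
  · have := loc0' hM hh hhb hhz (up ha h0 hn1)
    rw [hre]; linarith
  · intro b hb1 hgb hab
    have hhb0 : h b = 0 := by
      by_cases hc : a = b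
      · subst hc
        have haB : ball (0 : ℂ) 1 ∈ 𝓝 a := isOpen_ball.mem_nhds (by simpa using ha)
        have h1 : HasDerivAt (fun z => g z * (1 - conj a * z)) (deriv g a * (1 - conj a * a) + g a * (-(conj a * 1))) a :=
          (hg.differentiableAt haB).hasDerivAt.mul (((hasDerivAt_id a).const_mul (conj a)).const_sub 1)
        have h2 : HasDerivAt (fun z => (z - a) * h z) (1 * h a + (a - a) * deriv h a) a := ((hasDerivAt_id a).sub_const a).mul (hh.differentiableAt haB).hasDerivAt
        have h3 := h1.unique (by rw [funext e]; exact h2)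
        rw [hab rfl, hga] at h3; linear_combination -h3
      · have := e b
        rw [hgb, zero_mul, eq_comm, mul_eq_zero, sub_eq_zero] at this
        exact this.resolve_left fun h => hc h.symm
    obtain ⟨k, hk, hkb, e'⟩ := bl_div hh hhb hb1 hhb0
    obtain ⟨h01, hn2, hre'⟩ := bl_rem (hh.differentiableAt B0) (hk.differentiableAt B0) e' h00
    have := loc0' hM hk hkb (fun z hzB hz0 => hhz z hzB (bl_zero hb1 e' hzB hz0)) (up hb1 (up ha h0 hn1) hn2)
    rw [hre, hre']; linarith

/-- scaled version -/
lemma LL {f : ℂ → ℂ} (hf : Differentiable ℂ f) {s : ℂ} {R M : ℝ} (hR : 0 < R) (hM : 0 < M) (h0 : f s ≠ 0) (hb : ∀ z ∈ ball s R, ‖f z‖ ≤ Real.exp M * ‖f s‖)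
    (hz : ∀ z, f z = 0 → z.re < s.re) : -(8 * M / R) ≤ (deriv f s / f s).re ∧ ∀ a ∈ ball s R, f a = 0 →
    (1 - (‖a - s‖ / R) ^ 2) * (1 / (s - a)).re - 8 * M / R ≤ (deriv f s / f s).re ∧
    ∀ b ∈ ball s R, f b = 0 → (a = b → deriv f a = 0) → (1 - (‖a - s‖ / R) ^ 2) * (1 / (s - a)).re + (1 - (‖b - s‖ / R) ^ 2) * (1 / (s - b)).re - 8 * M / R ≤ (deriv f s / f s).re := by
  obtain ⟨g, hg⟩ : ∃ g : ℂ → ℂ, g = fun z => f (s + R * z) / (Real.exp M * f s) := ⟨_, rfl⟩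
  have hRc : (R : ℂ) ≠ 0 := by exact_mod_cast hR.ne'
  have hE : ((Real.exp M : ℝ) : ℂ) * f s ≠ 0 := mul_ne_zero (by exact_mod_cast (Real.exp_pos M).ne') h0
  have hgd : ∀ z, HasDerivAt g (deriv f (s + R * z) * R / (Real.exp M * f s)) z := fun z => by
    rw [hg]
    have h1 : HasDerivAt (fun z : ℂ => s + R * z) R z := by simpa using ((hasDerivAt_id z).const_mul (R : ℂ)).const_add s
    exact (HasDerivAt.comp z (hf _).hasDerivAt h1).div_const _
  have hgD : DifferentiableOn ℂ g (ball 0 1) := fun z _ => (hgd z).differentiableAt.differentiableWithinAt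
  have hgb : ∀ z ∈ ball (0 : ℂ) 1, ‖g z‖ ≤ 1 := fun z hz => by
    have hz' : ‖z‖ < 1 := by simpa using hz
    rw [hg]; simp only [norm_div, norm_mul, norm_real, Real.norm_eq_abs, Real.abs_exp]
    rw [div_le_one (mul_pos (Real.exp_pos _) (norm_pos_iff.2 h0))]
    refine hb _ ?_
    rw [mem_ball, dist_eq_norm, add_sub_cancel_left, norm_mul, norm_real, Real.norm_eq_abs, abs_of_pos hR]; nlinarith
  have hgz : ∀ z ∈ ball (0 : ℂ) 1, g z = 0 → z.re < 0 := fun z _ h => by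
    rw [hg] at h
    have := hz _ ((div_eq_zero_iff.1 h).resolve_right hE)
    simp at this; nlinarith
  have hg0 : Real.exp (-M) ≤ ‖g 0‖ := by
    rw [hg]; simp only [mul_zero, add_zero, norm_div, norm_mul, norm_real, Real.norm_eq_abs, Real.abs_exp]
    rw [Real.exp_neg, div_mul_cancel_right₀ (norm_ne_zero_iff.2 h0)]
  have hq : deriv g 0 / g 0 = R * (deriv f s / f s) := by
    rw [(hgd 0).deriv, hg]; simp only [mul_zero, add_zero]; field_simp
  have hval : ∀ a, g ((a - s) / R) = f a / (Real.exp M * f s) := fun a => by rw [hg]; simp only [mul_div_cancel₀ _ hRc, add_sub_cancel]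
  have hn : ∀ a : ℂ, ‖(a - s) / R‖ = ‖a - s‖ / R := fun a => by rw [norm_div, norm_real, Real.norm_eq_abs, abs_of_pos hR]
  have hin : ∀ a ∈ ball s R, ‖(a - s) / R‖ < 1 := fun a ha => by
    rw [hn, div_lt_one hR, ← dist_eq_norm]; exact ha
  have hinv : ∀ a : ℂ, (-((a - s) / R)⁻¹).re = R * (1 / (s - a)).re := fun a => by
    rw [← re_ofReal_mul, inv_div, ← neg_sub s a, div_neg, neg_neg, mul_one_div]
  have fin : ∀ {x y : ℝ}, R * x - 8 * M ≤ R * y → x - 8 * M / R ≤ y := fun {x y} h => by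
    rw [sub_le_iff_le_add, ← sub_le_iff_le_add', le_div_iff₀ hR]; linarith
  refine ⟨?_, fun a ha hfa => ⟨?_, fun b hb' hfb hab => ?_⟩⟩
  · have := loc0' hM hgD hgb hgz hg0
    rw [hq, re_ofReal_mul] at this
    have := fin (x := 0) (y := (deriv f s / f s).re) (by linarith); linarith
  · have := (loc1 hM hgD hgb hgz hg0 (hin a ha) (by rw [hval, hfa, zero_div])).1
    rw [hq, re_ofReal_mul, hinv, hn] at this
    exact fin (by linarith)
  · have := (loc1 hM hgD hgb hgz hg0 (hin a ha) (by rw [hval, hfa, zero_div])).2 _ (hin b hb') (by rw [hval, hfb, zero_div]) (fun h => by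
      have hab' : a = b := by have := (div_left_inj' hRc).1 h; simpa using this
      rw [(hgd _).deriv, mul_div_cancel₀ _ hRc, add_sub_cancel, hab hab']; simp)
    rw [hq, re_ofReal_mul, hinv, hinv, hn, hn] at this
    exact fin (by linarith)
end blaschke

open Polynomial Finset

section series
open Complex Filter Topology

lemma cp_der {s : ℂ} {x : ℝ} (hx : 0 < x) : HasDerivAt (fun y : ℝ => (y : ℂ) ^ s) (s * (x : ℂ) ^ (s - 1)) x := by
  have h := ((hasDerivAt_id (x : ℂ)).cpow_const (c := s) (by simp [slitPlane, hx])).comp_ofReal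
  simpa using h

lemma cp_norm {x : ℝ} (hx : 0 < x) (s : ℂ) : ‖(x : ℂ) ^ s‖ = x ^ s.re := norm_cpow_eq_rpow_re_of_pos hx s

lemma cp_diff {s : ℂ} (hs : 0 < s.re) {n x : ℝ} (hn : 0 < n) (hx : n ≤ x) : ‖(x : ℂ) ^ (-s) - (n : ℂ) ^ (-s)‖ ≤ ‖s‖ * n ^ (-s.re - 1) * (x - n) := by
  have := Convex.norm_image_sub_le_of_norm_hasDerivWithin_le (s := Set.Ici n) (f := fun y : ℝ => (y : ℂ) ^ (-s)) (f' := fun y : ℝ => -s * (y : ℂ) ^ (-s - 1))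
    (C := ‖s‖ * n ^ (-s.re - 1)) (x := n) (y := x) (fun y hy => (cp_der (hn.trans_le hy)).hasDerivWithinAt) (fun y hy => ?_) (convex_Ici n) Set.self_mem_Ici hx
  · rwa [Real.norm_eq_abs, abs_of_nonneg (by linarith)] at this
  · rw [norm_mul, norm_neg, cp_norm (hn.trans_le hy)]
    exact mul_le_mul_of_nonneg_left (Real.rpow_le_rpow_of_nonpos hn hy (by simp; linarith)) (norm_nonneg _)

lemma v_diff {s : ℂ} (hs : 0 < s.re) {n : ℝ} (hn : 0 < n) : ‖(s - 1) * (n : ℂ) ^ (-s) - (n : ℂ) ^ (1 - s) + ((n + 1 : ℝ) : ℂ) ^ (1 - s)‖ ≤ ‖s - 1‖ * (‖s‖ * n ^ (-s.re - 1)) ∧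
    ‖(s - 1) * (n : ℂ) ^ (-s) - (n : ℂ) ^ (1 - s) + ((n + 1 : ℝ) : ℂ) ^ (1 - s)‖ ≤ ‖s - 1‖ * (2 * n ^ (-s.re)) := by
  have main : ∀ C : ℝ, (∀ y : ℝ, n ≤ y → y ≤ n + 1 → ‖(y : ℂ) ^ (-s) - (n : ℂ) ^ (-s)‖ ≤ C) →
      ‖(s - 1) * (n : ℂ) ^ (-s) - (n : ℂ) ^ (1 - s) + ((n + 1 : ℝ) : ℂ) ^ (1 - s)‖ ≤ ‖s - 1‖ * C := fun C hC => by
    have := Convex.norm_image_sub_le_of_norm_hasDerivWithin_le (s := Set.Icc n (n + 1)) (f := fun y : ℝ => (s - 1) * (n : ℂ) ^ (-s) * (y : ℂ) + (y : ℂ) ^ (1 - s))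
      (f' := fun y : ℝ => (s - 1) * (n : ℂ) ^ (-s) * 1 + (1 - s) * (y : ℂ) ^ (1 - s - 1))
      (C := ‖s - 1‖ * C) (x := n) (y := n + 1) (fun y hy => (((hasDerivAt_id (y : ℂ)).comp_ofReal.const_mul _).add (cp_der (hn.trans_le hy.1))).hasDerivWithinAt) (fun y hy => ?_)
      (convex_Icc _ _) (by simp) (by simp)
    · rw [add_sub_cancel_left, norm_one, mul_one] at this
      refine le_trans (le_of_eq ?_) this
      congr 1; push_cast; ring
    · rw [show (s - 1) * (n : ℂ) ^ (-s) * 1 + (1 - s) * (y : ℂ) ^ (1 - s - 1) = (1 - s) * ((y : ℂ) ^ (-s) - (n : ℂ) ^ (-s)) by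
        rw [show 1 - s - 1 = -s by ring]; ring, norm_mul, norm_sub_rev 1 s]
      exact mul_le_mul_of_nonneg_left (hC y hy.1 hy.2) (norm_nonneg _)
  refine ⟨main _ fun y h1 h2 => (cp_diff hs hn h1).trans (mul_le_of_le_one_right (by positivity) (by linarith)), main _ fun y h1 h2 => (norm_sub_le _ _).trans ?_⟩
  rw [cp_norm hn, cp_norm (hn.trans_le h1), neg_re]
  have := Real.rpow_le_rpow_of_nonpos hn h1 (show -s.re ≤ 0 by linarith)
  linarith

lemma sum_rp {a : ℝ} (ha : 0 < a) : Summable fun n : ℕ => ((n : ℝ) + 1) ^ (-a - 1) := by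
  have h := (summable_nat_add_iff 1).2 (Real.summable_nat_rpow.2 (show -a - 1 < -1 by linarith))
  exact_mod_cast h

lemma CONT {u : ℕ → ℂ → ℂ} (hu : ∀ n, Differentiable ℂ (u n)) {C : ℝ} (hC : 0 ≤ C)
    (hb : ∀ n s, 0 < s.re → ‖u n s‖ ≤ C * (‖s‖ + 1) ^ 2 * ((n : ℝ) + 1) ^ (-s.re - 1)) {G : ℂ → ℂ} (hG : Differentiable ℂ G)
    (hl : ∀ s, 1 < s.re → Tendsto (fun N => ∑ n ∈ range N, u n s) atTop (𝓝 (G s))) (s : ℂ) (hs : 0 < s.re) : HasSum (fun n => u n s) (G s) := by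
  have hsum : ∀ s : ℂ, 0 < s.re → Summable fun n => u n s := fun s hs => Summable.of_norm_bounded ((sum_rp hs).mul_left _) fun n => hb n s hs
  obtain ⟨U, hU⟩ : ∃ U : Set ℂ, U = {z : ℂ | s.re / 2 < z.re} ∩ Metric.ball 0 (‖s‖ + 3 + s.re) := ⟨_, rfl⟩
  have hUo : IsOpen U := by rw [hU]; exact (isOpen_lt continuous_const continuous_re).inter Metric.isOpen_ball
  have hUc : IsPreconnected U := by rw [hU]; exact ((convex_halfSpace_re_gt _).inter (convex_ball _ _)).isPreconnected
  have hsU : s ∈ U := by rw [hU]; refine ⟨show s.re / 2 < s.re by linarith, by simp; linarith⟩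
  have h2U : (2 + s.re : ℂ) ∈ U := by
    rw [hU]; refine ⟨show s.re / 2 < (2 + s.re : ℂ).re by simp; linarith, ?_⟩
    rw [mem_ball_zero_iff]
    refine (norm_add_le _ _).trans_lt ?_
    rw [norm_real, Real.norm_eq_abs, abs_of_pos hs, norm_ofNat]; linarith [norm_nonneg s]
  have hd : DifferentiableOn ℂ (fun w => ∑' n, u n w) U := by
    refine differentiableOn_tsum_of_summable_norm ((sum_rp (half_pos hs)).mul_left (C * (‖s‖ + 3 + s.re + 1) ^ 2)) (fun n => (hu n).differentiableOn) hUo fun n w hw => ?_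
    rw [hU] at hw
    have h1 : s.re / 2 < w.re := hw.1
    have h2 : ‖w‖ < ‖s‖ + 3 + s.re := by simpa using hw.2
    refine (hb n w (by linarith)).trans (mul_le_mul (mul_le_mul_of_nonneg_left (by gcongr) hC) ?_ (by positivity) (by positivity))
    exact Real.rpow_le_rpow_of_exponent_le (by linarith [n.cast_nonneg (α := ℝ)]) (by linarith)
  have heq := (hd.analyticOnNhd hUo).eqOn_of_preconnected_of_eventuallyEq (hG.differentiableOn.analyticOnNhd hUo) hUc h2U (by
    have : {z : ℂ | 1 < z.re} ∈ 𝓝 (2 + s.re : ℂ) := (isOpen_lt continuous_const continuous_re).mem_nhds (show 1 < (2 + s.re : ℂ).re by simp; linarith)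
    filter_upwards [this] with z hz
    have hz' : 1 < z.re := hz
    exact tendsto_nhds_unique (hsum z (by linarith)).hasSum.tendsto_sum_nat (hl z hz'))
  have := heq hsU
  simp only at this
  rw [← this]; exact (hsum s hs).hasSum

lemma term0 (s : ℂ) (n : ℕ) : Differentiable ℂ fun s : ℂ => ((n : ℂ) + 1) ^ (-s) := fun s =>
  (differentiable_neg s).const_cpow (Or.inl (by exact_mod_cast n.succ_ne_zero))

lemma cpn (s : ℂ) (n : ℕ) : ‖((n : ℂ) + 1) ^ s‖ = ((n : ℝ) + 1) ^ s.re := by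
  have := cp_norm (show (0 : ℝ) < n + 1 by positivity) s
  push_cast at this; exact this

lemma cpn_tendsto {s : ℂ} (hs : s.re < 0) : Tendsto (fun n : ℕ => ((n : ℂ) + 1) ^ s) atTop (𝓝 0) := by
  rw [tendsto_zero_iff_norm_tendsto_zero]
  simp only [cpn]
  have := (tendsto_rpow_neg_atTop (show 0 < -s.re by linarith)).comp (tendsto_atTop_add_const_right atTop (1 : ℝ) tendsto_natCast_atTop_atTop)
  simpa [Function.comp_def] using this

section L
variable {q : ℕ} [NeZero q] (χ : DirichletCharacter ℂ q)

lemma chi_zero {χ : DirichletCharacter ℂ q} (hχ : χ ≠ 1) : χ 0 = 0 := by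
  refine χ.map_nonunit fun h => hχ ?_
  have : Subsingleton (ZMod q) := by
    rw [isUnit_zero_iff] at h
    exact subsingleton_of_zero_eq_one h
  ext x; rw [Subsingleton.elim (x : ZMod q) 1]; simp

lemma lterm {s : ℂ} (hs : s ≠ 0) (j : ℕ) : LSeries.term (fun n => χ n) s j = χ j * (j : ℂ) ^ (-s) := by
  rcases eq_or_ne j 0 with rfl | hj
  · simp [hs]
  · rw [LSeries.term_of_ne_zero hj, cpow_neg, div_eq_mul_inv]

lemma abel_fin {χ : DirichletCharacter ℂ q} (hχ : χ ≠ 1) (s : ℂ) (N : ℕ) : ∑ n ∈ range N, (∑ j ∈ range (n + 2), χ j) * (((n : ℂ) + 1) ^ (-s) - ((n + 1 : ℕ) + 1 : ℂ) ^ (-s)) =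
    ∑ j ∈ range (N + 1), χ j * (j : ℂ) ^ (-s) - (∑ j ∈ range (N + 1), χ j) * ((N : ℂ) + 1) ^ (-s) := by
  induction N with
  | zero => simp [chi_zero hχ]
  | succ N ih =>
    rw [sum_range_succ, ih, sum_range_succ _ (N + 1), sum_range_succ _ (N + 1)]; push_cast; ring

lemma L_sum {χ : DirichletCharacter ℂ q} (hχ : χ ≠ 1) (s : ℂ) (hs : 0 < s.re) :
    HasSum (fun n : ℕ => (∑ j ∈ range (n + 2), χ j) * (((n : ℂ) + 1) ^ (-s) - ((n + 1 : ℕ) + 1 : ℂ) ^ (-s))) (χ.LFunction s) := by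
  refine CONT (u := fun n s => (∑ j ∈ range (n + 2), χ j) * (((n : ℂ) + 1) ^ (-s) - ((n + 1 : ℕ) + 1 : ℂ) ^ (-s))) (C := q)
    (fun n => ((term0 s n).sub (term0 s (n + 1))).const_mul _) (Nat.cast_nonneg q) (fun n s hs => ?_) (DirichletCharacter.differentiable_LFunction hχ) (fun s hs => ?_) s hs
  · rw [norm_mul, norm_sub_rev, mul_assoc]
    refine mul_le_mul (charsum_le χ hχ _) ?_ (norm_nonneg _) (Nat.cast_nonneg q)
    have := cp_diff hs (show (0 : ℝ) < n + 1 by positivity) (show (n : ℝ) + 1 ≤ n + 1 + 1 by linarith)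
    push_cast at this ⊢
    refine this.trans ?_
    rw [add_sub_cancel_left, mul_one]
    gcongr; nlinarith [norm_nonneg s]
  · simp only [abel_fin hχ]
    have hs0 : s ≠ 0 := fun h => by rw [h] at hs; simp at hs; linarith
    have h1 : Tendsto (fun N => ∑ j ∈ range (N + 1), χ j * (j : ℂ) ^ (-s)) atTop (𝓝 (χ.LFunction s)) := by
      rw [DirichletCharacter.LFunction_eq_LSeries χ hs]
      have := (DirichletCharacter.LSeriesSummable_of_one_lt_re χ hs).hasSum.tendsto_sum_nat.comp (tendsto_add_atTop_nat 1)
      simpa [Function.comp_def, lterm χ hs0, LSeries] using this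
    have h2 : Tendsto (fun N : ℕ => (∑ j ∈ range (N + 1), χ j) * ((N : ℂ) + 1) ^ (-s)) atTop (𝓝 0) := by
      refine squeeze_zero_norm (a := fun N : ℕ => q * ‖((N : ℂ) + 1) ^ (-s)‖) (fun N => ?_) ?_
      · rw [norm_mul]; exact mul_le_mul_of_nonneg_right (charsum_le χ hχ _) (norm_nonneg _)
      · simpa using (cpn_tendsto (s := -s) (by simp; linarith)).norm.const_mul (q : ℝ)
    simpa using h1.sub h2
end L

/-- the entire function `(s - 1) ζ(s)` -/
noncomputable def zt : ℂ → ℂ := DirichletCharacter.LFunctionTrivChar₁ 1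
lemma zt_diff : Differentiable ℂ zt := DirichletCharacter.differentiable_LFunctionTrivChar₁ 1
lemma zt_one : zt 1 = 1 := by simp [zt, DirichletCharacter.LFunctionTrivChar₁]
lemma zt_eq {s : ℂ} (hs : s ≠ 1) : zt s = (s - 1) * riemannZeta s := by
  simp [zt, DirichletCharacter.LFunctionTrivChar₁, hs, DirichletCharacter.LFunctionTrivChar, DirichletCharacter.LFunction_modOne_eq]

lemma zt_sum (s : ℂ) (hs : 0 < s.re) :
    HasSum (fun n : ℕ => (s - 1) * ((n : ℂ) + 1) ^ (-s) - ((n : ℂ) + 1) ^ (1 - s) + ((n + 1 : ℕ) + 1 : ℂ) ^ (1 - s)) (zt s - 1) := by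
  have hdf : ∀ n : ℕ, Differentiable ℂ fun s : ℂ => ((n : ℂ) + 1) ^ (1 - s) := fun n s =>
    ((differentiable_const (1 : ℂ)).sub differentiable_id s).const_cpow (Or.inl (by exact_mod_cast n.succ_ne_zero))
  refine CONT (u := fun n s => (s - 1) * ((n : ℂ) + 1) ^ (-s) - ((n : ℂ) + 1) ^ (1 - s) + ((n + 1 : ℕ) + 1 : ℂ) ^ (1 - s)) (C := 1) (G := fun s => zt s - 1)
    (fun n => ((((differentiable_id.sub_const 1).mul (term0 s n)).sub (hdf n)).add (hdf (n + 1)))) zero_le_one (fun n s hs => ?_) (zt_diff.sub_const 1) (fun s hs => ?_) s hs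
  · have := (v_diff hs (show (0 : ℝ) < n + 1 by positivity)).1
    push_cast at this ⊢
    refine this.trans ?_
    rw [← mul_assoc]
    refine mul_le_mul_of_nonneg_right ?_ (by positivity)
    have := norm_sub_le s 1
    rw [norm_one] at this
    have := mul_le_mul this (show ‖s‖ ≤ ‖s‖ + 1 by linarith) (norm_nonneg _) (by positivity)
    linarith
  · have hs1 : s ≠ 1 := fun h => by rw [h] at hs; simp at hs
    have e : ∀ N : ℕ, ∑ n ∈ range N, ((s - 1) * ((n : ℂ) + 1) ^ (-s) - ((n : ℂ) + 1) ^ (1 - s) + ((n + 1 : ℕ) + 1 : ℂ) ^ (1 - s)) =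
        (s - 1) * ∑ n ∈ range N, ((n : ℂ) + 1) ^ (-s) - 1 + ((N : ℂ) + 1) ^ (1 - s) := fun N => by
      induction N with
      | zero => simp
      | succ N ih => rw [sum_range_succ, ih, sum_range_succ]; push_cast; ring
    simp only [e]
    have h1 : Tendsto (fun N => ∑ n ∈ range N, ((n : ℂ) + 1) ^ (-s)) atTop (𝓝 (riemannZeta s)) := by
      rw [zeta_eq_tsum_one_div_nat_add_one_cpow hs]
      have h2 : Summable fun n : ℕ => 1 / ((n : ℂ) + 1) ^ s := by
        have := (summable_nat_add_iff 1).2 (Complex.summable_one_div_nat_cpow.2 hs)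
        simpa using this
      have := h2.hasSum.tendsto_sum_nat
      simpa [cpow_neg] using this
    rw [zt_eq hs1]
    have := ((h1.const_mul (s - 1)).sub_const 1).add (cpn_tendsto (s := 1 - s) (by simp; linarith))
    simpa using this
end series

open Polynomial Finset

section growth
open Real

lemma par {ℓ D : ℝ} (hℓ : 1 < ℓ) (hD : ℓ / log ℓ ≤ D) : exp 1 ≤ D ∧ 1 ≤ log D ∧ log D / D ≤ 3 / 8 ∧ ℓ * (log D / D) ≤ log ℓ ^ 2 + 1 := by
  have hlam : 0 < log ℓ := log_pos hℓ
  have h0 : exp 1 ≤ ℓ / log ℓ := by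
    rw [le_div_iff₀ hlam]
    have := add_one_le_exp (log ℓ - 1)
    have h2 : exp 1 * exp (log ℓ - 1) = ℓ := by rw [← exp_add, add_sub_cancel, exp_log (by linarith)]
    nlinarith [exp_pos 1]
  have h1 : exp 1 ≤ D := h0.trans hD
  have h2 : 1 ≤ log D := by rw [← log_exp 1]; exact log_le_log (exp_pos 1) h1
  have anti := Real.log_div_self_antitoneOn
  refine ⟨h1, h2, ?_, ?_⟩
  · refine le_trans (show log D / D ≤ log (exp 1) / exp 1 from anti (show exp 1 ≤ exp 1 from le_rfl) h1 h1) ?_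
    rw [log_exp, div_le_iff₀ (exp_pos 1)]; have := exp_one_gt_d9; linarith
  · refine (mul_le_mul_of_nonneg_left (show log D / D ≤ log (ℓ / log ℓ) / (ℓ / log ℓ) from anti h0 h1 hD) (by linarith)).trans ?_
    rw [log_div (by linarith) hlam.ne', mul_div_assoc', div_div_eq_mul_div, div_le_iff₀ (by linarith)]
    have h3 : log ℓ * (-log (log ℓ)) ≤ 1 := by
      have := log_le_sub_one_of_pos (inv_pos.2 hlam)
      rw [log_inv] at this
      have h4 := mul_le_mul_of_nonneg_left this hlam.le
      rw [mul_sub, mul_inv_cancel₀ hlam.ne'] at h4; linarith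
    have := mul_le_mul_of_nonneg_left h3 (show 0 ≤ ℓ by linarith)
    nlinarith

lemma expo {ℓ D : ℝ} (hℓ : 1 < ℓ) (hD : ℓ / log ℓ ≤ D) : D / √ℓ - D / ℓ ^ (1 / 4 : ℝ) + 4 * (ℓ * (log D / D)) + 4 * log ℓ ≤ 80000 := by
  have hlam : 0 < log ℓ := log_pos hℓ
  obtain ⟨-, -, -, h4⟩ := par hℓ hD
  obtain ⟨x, hx⟩ : ∃ x, x = exp (log ℓ / 8) := ⟨_, rfl⟩
  have hx1 : 1 ≤ x := by rw [hx]; exact one_le_exp (by linarith)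
  have e0 : ℓ = x ^ 8 := by rw [hx, ← exp_nat_mul, ← exp_log (show 0 < ℓ by linarith)]; congr 1; rw [log_exp]; push_cast; ring
  have e1 : ℓ ^ (1 / 4 : ℝ) = x ^ 2 := by
    rw [rpow_def_of_pos (by linarith), hx, ← exp_nat_mul]; congr 1; push_cast; ring
  have e2 : √ℓ = x ^ 4 := by rw [e0, show x ^ 8 = (x ^ 4) ^ 2 by ring]; exact sqrt_sq (by positivity)
  have hlog : log ℓ = 8 * log x := by rw [hx, log_exp]; ring
  have hl1 : log ℓ ≤ 4 * (x ^ 2 - 1) := by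
    have := log_le_sub_one_of_pos (show 0 < x ^ 2 by positivity)
    rw [log_pow] at this; push_cast at this; linarith
  have hl2 : log ℓ ≤ 8 * x := by have := log_le_sub_one_of_pos (show 0 < x by linarith); linarith
  have key : x ^ 4 / 4 ≤ D / x ^ 2 - D / x ^ 4 := by
    have h5 : x ^ 4 / 4 ≤ (ℓ / log ℓ) * ((x ^ 2 - 1) / x ^ 4) := by
      rw [div_mul_div_comm, div_le_div_iff₀ (by norm_num) (by positivity), e0, ← e0]
      have := mul_le_mul_of_nonneg_left hl1 (show 0 ≤ x ^ 8 by positivity)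
      nlinarith
    refine h5.trans ((mul_le_mul_of_nonneg_right hD (div_nonneg (by nlinarith) (by positivity))).trans (le_of_eq ?_))
    field_simp
  rw [e1, e2]
  nlinarith [sq_nonneg (x ^ 2 - 544), sq_nonneg (x - 1), mul_self_le_mul_self hlam.le hl2]

lemma harm {σ R : ℝ} (h : 1 - R ≤ σ) (hR : 0 ≤ R) (N : ℕ) : ∑ n ∈ range N, ((n : ℝ) + 1) ^ (-σ) ≤ (N : ℝ) ^ R * (1 + log N) := by
  have h1 := harmonic_le_one_add_log N
  have h2 : ∑ n ∈ range N, ((n : ℝ) + 1)⁻¹ ≤ 1 + log N := by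
    refine le_trans (le_of_eq ?_) h1
    simp [harmonic]
  refine le_trans ?_ (mul_le_mul_of_nonneg_left h2 (by positivity))
  rw [mul_sum]
  refine sum_le_sum fun n hn => ?_
  have hn1 : (1 : ℝ) ≤ n + 1 := by linarith [n.cast_nonneg (α := ℝ)]
  have hnN : (n : ℝ) + 1 ≤ N := by exact_mod_cast mem_range.1 hn
  calc ((n : ℝ) + 1) ^ (-σ) ≤ (n + 1) ^ (R + -1) := rpow_le_rpow_of_exponent_le hn1 (by linarith)
    _ = (n + 1) ^ R * (n + 1 : ℝ)⁻¹ := by rw [rpow_add (by linarith), rpow_neg_one]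
    _ ≤ _ := mul_le_mul_of_nonneg_right (rpow_le_rpow (by linarith) hnN hR) (by positivity)

lemma heads {D : ℝ} (h1 : exp 1 ≤ D) (h2 : 1 ≤ log D) : ((⌈exp (1000 * D)⌉₊ : ℝ) + 1) ^ (log D / D) * (2 + log (⌈exp (1000 * D)⌉₊ + 1)) ≤ exp (1009 * log D) := by
  have hD : 2 < D := by have := exp_one_gt_d9; linarith
  have h3 : (⌈exp (1000 * D)⌉₊ : ℝ) + 1 ≤ exp (1001 * D) := by
    have := Nat.ceil_lt_add_one (exp_pos (1000 * D)).le
    have h4 : exp (1001 * D) = exp (1000 * D) * exp D := by rw [← exp_add]; congr 1; ring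
    have h5 := add_one_le_exp D
    have h6 := one_le_exp (show 0 ≤ 1000 * D by linarith)
    nlinarith
  have hp : (0 : ℝ) < ⌈exp (1000 * D)⌉₊ + 1 := by positivity
  have h4 : log (⌈exp (1000 * D)⌉₊ + 1) ≤ 1001 * D := by rw [← log_exp (1001 * D)]; exact log_le_log hp h3
  have h5 : 2 + log (⌈exp (1000 * D)⌉₊ + 1) ≤ exp (8 * log D) := by
    rw [show 8 * log D = 7 * log D + log D by ring, exp_add, exp_log (by linarith)]
    have h6 : exp 7 ≤ exp (7 * log D) := exp_le_exp.2 (by linarith)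
    have h7 : 1096 ≤ exp 7 := by
      rw [show (7 : ℝ) = ((7 : ℕ) : ℝ) * 1 by norm_num, exp_nat_mul]
      have : (2.7182 : ℝ) ≤ exp 1 := by have := exp_one_gt_d9; linarith
      calc (1096 : ℝ) ≤ 2.7182 ^ 7 := by norm_num
        _ ≤ _ := by gcongr
    nlinarith
  have h6 : ((⌈exp (1000 * D)⌉₊ : ℝ) + 1) ^ (log D / D) ≤ exp (1001 * log D) := by
    refine (rpow_le_rpow hp.le h3 (div_nonneg (by linarith) (by linarith))).trans (le_of_eq ?_)
    rw [← exp_mul]; congr 1; field_simp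
  calc _ ≤ exp (1001 * log D) * exp (8 * log D) := mul_le_mul h6 h5 (by have := log_nonneg (show (1 : ℝ) ≤ ⌈exp (1000 * D)⌉₊ + 1 by linarith [(⌈exp (1000 * D)⌉₊).cast_nonneg (α := ℝ)]); linarith) (exp_pos _).le
    _ = _ := by rw [← exp_add]; congr 1; ring

lemma tails {D σ : ℝ} (hσ : 1 - 3 / 8 ≤ σ) {a : ℝ} (ha : a ≤ -σ - 1 / 2) (n : ℕ) :
    (((n + ⌈exp (1000 * D)⌉₊ : ℕ) : ℝ) + 1) ^ a ≤ exp (-(25 * D)) * ((n : ℝ) + 1) ^ (-(1 / 20) - 1 : ℝ) := by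
  have h1 : exp (1000 * D) ≤ ((n + ⌈exp (1000 * D)⌉₊ : ℕ) : ℝ) + 1 := by
    push_cast; linarith [Nat.le_ceil (exp (1000 * D)), n.cast_nonneg (α := ℝ)]
  obtain ⟨x, hx⟩ : ∃ x : ℝ, x = ((n + ⌈exp (1000 * D)⌉₊ : ℕ) : ℝ) + 1 := ⟨_, rfl⟩
  rw [← hx] at h1 ⊢
  have hxn : (n : ℝ) + 1 ≤ x := by rw [hx]; push_cast; linarith [(⌈exp (1000 * D)⌉₊).cast_nonneg (α := ℝ)]
  have hn : (1 : ℝ) ≤ n + 1 := by linarith [n.cast_nonneg (α := ℝ)]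
  calc x ^ a ≤ x ^ (-(1 / 40) + (-(1 / 20) - 1) : ℝ) := rpow_le_rpow_of_exponent_le (by linarith) (by linarith)
    _ = x ^ (-(1 / 40) : ℝ) * x ^ (-(1 / 20) - 1 : ℝ) := rpow_add (by linarith) _ _
    _ ≤ _ := by
      refine mul_le_mul ?_ (rpow_le_rpow_of_nonpos (by linarith) hxn (by norm_num)) (rpow_nonneg (by linarith) _) (exp_pos _).le
      refine (rpow_le_rpow_of_nonpos (exp_pos _) h1 (by norm_num)).trans (le_of_eq ?_)
      rw [← exp_mul]; congr 1; ring

lemma absorb (B : ℝ) (hB : 0 ≤ B) : ∃ K : ℝ, 0 < K ∧ ∀ D : ℝ, 1 ≤ log D → ∀ x, x ≤ 2 * exp (1009 * log D) + B → x ≤ exp (K * log D) := by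
  refine ⟨1009 + log (2 + B), by have := log_nonneg (show 1 ≤ 2 + B by linarith); linarith, fun D h x hx => hx.trans ?_⟩
  have h0 := log_nonneg (show 1 ≤ 2 + B by linarith)
  calc 2 * exp (1009 * log D) + B ≤ exp (1009 * log D) * (2 + B) := by
        have := one_le_exp (show 0 ≤ 1009 * log D by linarith); nlinarith
    _ = exp (1009 * log D + log (2 + B)) := by rw [exp_add, exp_log (by linarith)]
    _ ≤ _ := exp_le_exp.2 (by nlinarith)

lemma s_norm {ℓ D : ℝ} (hℓ : 1 < ℓ) (hD : 0 < D) {s : ℂ} (h1 : 0 < s.re) (h2 : s.re ≤ 2) (h3 : |s.im| ≤ 2 * exp (D / √ℓ) + 1) : ‖s‖ ≤ 5 * exp (D / √ℓ) ∧ ‖s‖ ≤ 5 * exp D := by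
  have h4 := Complex.norm_le_abs_re_add_abs_im s
  rw [abs_of_pos h1] at h4
  have h5 : 1 ≤ exp (D / √ℓ) := one_le_exp (by positivity)
  have h6 : exp (D / √ℓ) ≤ exp D := exp_le_exp.2 (div_le_self hD.le (by rw [Real.one_le_sqrt]; exact hℓ.le))
  constructor <;> linarith

theorem ZB : ∃ K : ℝ, 0 < K ∧ ∀ ℓ D : ℝ, 1 < ℓ → ℓ / log ℓ ≤ D → ∀ s : ℂ, 1 - log D / D ≤ s.re → s.re ≤ 2 → |s.im| ≤ 2 * exp (D / √ℓ) + 1 →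
    ‖zt s‖ ≤ (1 + ‖s - 1‖) * exp (K * log D) := by
  obtain ⟨Z, hZ⟩ : ∃ Z : ℝ, Z = ∑' n : ℕ, ((n : ℝ) + 1) ^ (-(1 / 20) - 1 : ℝ) := ⟨_, rfl⟩
  have hZs := (sum_rp (show (0 : ℝ) < 1 / 20 by norm_num)).hasSum
  rw [← hZ] at hZs
  have hZ0 : 0 ≤ Z := by rw [hZ]; exact tsum_nonneg fun n => by positivity
  obtain ⟨K, hK, hK'⟩ := absorb (1 + 5 * Z) (by positivity)
  refine ⟨K, hK, fun ℓ D hℓ hD s h1 h2 h3 => ?_⟩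
  obtain ⟨p1, p2, p3, p4⟩ := par hℓ hD
  have hD0 : 0 < D := (exp_pos 1).trans_le p1
  have hs : 0 < s.re := by linarith
  have hsn := (s_norm hℓ hD0 hs h2 h3).2
  have H := zt_sum s hs
  obtain ⟨N, hN⟩ : ∃ N : ℕ, N = ⌈exp (1000 * D)⌉₊ := ⟨_, rfl⟩
  have Ht := (hasSum_nat_add_iff' N).2 H
  have B1 := HasSum.norm_le_of_bounded Ht (hZs.mul_left (‖s - 1‖ * (‖s‖ * exp (-(25 * D))))) (fun n => ?_)
  swap
  · have := (v_diff hs (show (0 : ℝ) < ((n + N : ℕ) : ℝ) + 1 by positivity)).1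
    push_cast at this ⊢
    refine this.trans ?_
    have h6 := tails (D := D) (σ := s.re) (by linarith) (show -s.re - 1 ≤ -s.re - 1 / 2 by linarith) n
    rw [← hN] at h6; push_cast at h6
    calc _ ≤ ‖s - 1‖ * (‖s‖ * (exp (-(25 * D)) * ((n : ℝ) + 1) ^ (-(1 / 20) - 1 : ℝ))) := by gcongr
      _ = _ := by ring
  have B2 : ‖∑ n ∈ range N, ((s - 1) * ((n : ℂ) + 1) ^ (-s) - ((n : ℂ) + 1) ^ (1 - s) + ((n + 1 : ℕ) + 1 : ℂ) ^ (1 - s))‖ ≤ ‖s - 1‖ * (2 * exp (1009 * log D)) := by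
    refine (norm_sum_le_of_le _ (fun (n : ℕ) _ => (show _ ≤ ‖s - 1‖ * (2 * ((n : ℝ) + 1) ^ (-s.re)) by
      have := (v_diff hs (show (0 : ℝ) < (n : ℝ) + 1 by positivity)).2
      push_cast at this ⊢; exact this))).trans ?_
    rw [← mul_sum, ← mul_sum]
    have := harm h1 (div_nonneg (by linarith) hD0.le) N
    refine mul_le_mul_of_nonneg_left (mul_le_mul_of_nonneg_left (this.trans (le_trans ?_ (heads p1 p2))) (by norm_num)) (norm_nonneg _)
    rw [← hN]
    have hN1 : (0 : ℝ) < N := by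
      rw [hN]; exact_mod_cast Nat.ceil_pos.2 (exp_pos _)
    have hN2 : (1 : ℝ) ≤ N := by exact_mod_cast (by exact_mod_cast hN1 : 0 < N)
    have hl : log N ≤ log (N + 1) := log_le_log hN1 (by linarith)
    have := log_nonneg hN2
    gcongr <;> linarith
  have h7 : exp D * exp (-(25 * D)) ≤ 1 := by rw [← exp_add]; exact exp_le_one_iff.2 (by linarith)
  have h8 : ‖s‖ * exp (-(25 * D)) ≤ 5 := by nlinarith [exp_pos (-(25 * D))]
  have B3 : ‖zt s‖ ≤ 1 + ‖s - 1‖ * (2 * exp (1009 * log D)) + ‖s - 1‖ * (5 * Z) := by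
    have e : zt s = 1 + ∑ n ∈ range N, ((s - 1) * ((n : ℂ) + 1) ^ (-s) - ((n : ℂ) + 1) ^ (1 - s) + ((n + 1 : ℕ) + 1 : ℂ) ^ (1 - s)) +
      (zt s - 1 - ∑ n ∈ range N, ((s - 1) * ((n : ℂ) + 1) ^ (-s) - ((n : ℂ) + 1) ^ (1 - s) + ((n + 1 : ℕ) + 1 : ℂ) ^ (1 - s))) := by ring
    rw [e]
    refine (norm_add₃_le).trans ?_
    rw [norm_one]
    refine add_le_add (add_le_add_right B2 1) (B1.trans ?_)
    rw [mul_assoc]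
    gcongr
  have h9 := hK' D p2 _ le_rfl
  have h10 := norm_nonneg (s - 1)
  have h11 := one_le_exp (show 0 ≤ 1009 * log D by linarith)
  nlinarith

set_option maxHeartbeats 1000000 in
theorem LB : ∃ K : ℝ, 0 < K ∧ ∀ ℓ D : ℝ, 1 < ℓ → ℓ / log ℓ ≤ D → ∀ (q : ℕ) [NeZero q] (χ : DirichletCharacter ℂ q), χ.IsPrimitive → χ ≠ 1 →
    (∀ p ∈ q.primeFactors, (p : ℝ) ≤ exp D) → (q : ℝ) ≤ exp (2 * ℓ) → ∀ s : ℂ, 1 - log D / D ≤ s.re → s.re ≤ 2 → |s.im| ≤ 2 * exp (D / √ℓ) + 1 →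
    ‖χ.LFunction s‖ ≤ exp (K * log D) := by
  obtain ⟨Z, hZ⟩ : ∃ Z : ℝ, Z = ∑' n : ℕ, ((n : ℝ) + 1) ^ (-(1 / 20) - 1 : ℝ) := ⟨_, rfl⟩
  have hZs := (sum_rp (show (0 : ℝ) < 1 / 20 by norm_num)).hasSum
  rw [← hZ] at hZs
  have hZ0 : 0 ≤ Z := by rw [hZ]; exact tsum_nonneg fun n => by positivity
  obtain ⟨K, hK, hK'⟩ := absorb (10 * Z + 100 * exp 80000) (by positivity)
  refine ⟨K, hK, fun ℓ D hℓ hD q _ χ hprim hχ hSP hq s h1 h2 h3 => hK' D (par hℓ hD).2.1 _ ?_⟩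
  obtain ⟨p1, p2, p3, p4⟩ := par hℓ hD
  have hD0 : 0 < D := (exp_pos 1).trans_le p1
  have hs : 0 < s.re := by linarith
  obtain ⟨hsn1, hsn2⟩ := s_norm hℓ hD0 hs h2 h3
  have H := L_sum hχ s hs
  obtain ⟨N, hN⟩ : ∃ N : ℕ, N = ⌈exp (1000 * D)⌉₊ := ⟨_, rfl⟩
  have Ht := (hasSum_nat_add_iff' N).2 H
  rw [abel_fin hχ] at Ht
  obtain ⟨E, hE⟩ : ∃ E : ℝ, E = exp (-(D / ℓ ^ (1 / 4 : ℝ))) := ⟨_, rfl⟩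
  have hE0 : 0 < E := by rw [hE]; exact exp_pos _
  have hq0 : 0 < q := Nat.pos_of_ne_zero (NeZero.ne q)
  have hq1 : (1 : ℝ) ≤ q := by exact_mod_cast hq0
  have hind : HasSum (fun n : ℕ => if n < q ^ 2 then ((n : ℝ) + 1) ^ (-s.re) else 0) (∑ n ∈ range (q ^ 2), (if n < q ^ 2 then ((n : ℝ) + 1) ^ (-s.re) else 0)) := hasSum_sum_of_ne_finset_zero (fun n hn => if_neg (by simpa using hn))
  have hg := ((hZs.mul_left (2 * exp (-(25 * D)))).add (hind.mul_left (4 * E))).mul_left ‖s‖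
  have B1 := HasSum.norm_le_of_bounded Ht hg (fun n => ?_)
  swap
  · rw [norm_mul, norm_sub_rev]
    have c1 := cp_diff hs (show (0 : ℝ) < ((n + N : ℕ) : ℝ) + 1 by positivity) (show ((n + N : ℕ) : ℝ) + 1 ≤ (n + N : ℕ) + 1 + 1 by linarith)
    rw [add_sub_cancel_left, mul_one] at c1
    push_cast at c1 ⊢
    obtain ⟨y, hy⟩ : ∃ y : ℝ, y = (n : ℝ) + N + 1 := ⟨_, rfl⟩
    have hy1 : 1 ≤ y := by rw [hy]; linarith [n.cast_nonneg (α := ℝ), N.cast_nonneg (α := ℝ)]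
    have hyn : (n : ℝ) + 1 ≤ y := by rw [hy]; linarith [N.cast_nonneg (α := ℝ)]
    rw [← hy] at c1
    have t1 : y ^ (-s.re - 1 / 2) ≤ exp (-(25 * D)) * ((n : ℝ) + 1) ^ (-(1 / 20) - 1 : ℝ) := by
      have := tails (D := D) (σ := s.re) (by linarith) (le_refl (-s.re - 1 / 2)) n
      rw [← hN] at this; push_cast at this; rwa [hy]
    have t2 : y ^ (-s.re) ≤ ((n : ℝ) + 1) ^ (-s.re) := rpow_le_rpow_of_nonpos (by positivity) hyn (by linarith)
    have sq2 : √(y + 1) ≤ 2 * y ^ (1 / 2 : ℝ) := by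
      rw [← sqrt_eq_rpow, show (2 : ℝ) * √y = √(4 * y) by rw [sqrt_mul (by norm_num), show (4 : ℝ) = 2 ^ 2 by norm_num, sqrt_sq (by norm_num)]]
      exact sqrt_le_sqrt (by linarith)
    have e1 : y ^ (1 / 2 : ℝ) * y ^ (-s.re - 1) = y ^ (-s.re - 1 / 2) := by rw [← rpow_add (by linarith)]; congr 1; ring
    have e2 : y * y ^ (-s.re - 1) = y ^ (-s.re) := by rw [rpow_sub_one (by linarith)]; field_simp
    have yp : 0 ≤ y ^ (-s.re - 1) := by positivity
    have cS : ‖∑ j ∈ range (n + N + 2), χ j‖ ≤ 2 * y ^ (1 / 2 : ℝ) + (if n < q ^ 2 then 4 * E * y else 0) := by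
      have hcast : ((n + N + 2 : ℕ) : ℝ) = y + 1 := by rw [hy]; push_cast; ring
      by_cases hc : n < q ^ 2
      · rw [if_pos hc]
        have := KT hℓ hD χ hprim hχ hSP hq (n + N + 2) (by rw [hcast, hy, hN]; linarith [Nat.le_ceil (exp (1000 * D)), n.cast_nonneg (α := ℝ)])
        rw [hcast, ← hE] at this
        nlinarith
      · rw [if_neg hc, add_zero]
        refine (charsum_le χ hχ _).trans (le_trans ?_ sq2)
        refine le_sqrt_of_sq_le ?_
        have : q ^ 2 ≤ n := not_lt.1 hc
        have : ((q : ℝ)) ^ 2 ≤ n := by exact_mod_cast this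
        linarith
    calc _ ≤ (2 * y ^ (1 / 2 : ℝ) + (if n < q ^ 2 then 4 * E * y else 0)) * (‖s‖ * y ^ (-s.re - 1)) :=
          mul_le_mul cS c1 (norm_nonneg _) (by split_ifs <;> positivity)
      _ = ‖s‖ * (2 * (y ^ (1 / 2 : ℝ) * y ^ (-s.re - 1)) + 4 * E * (if n < q ^ 2 then y * y ^ (-s.re - 1) else 0)) := by split_ifs <;> ring
      _ ≤ _ := by
        rw [e1, e2, mul_assoc 2]
        refine mul_le_mul_of_nonneg_left (add_le_add (by linarith) (mul_le_mul_of_nonneg_left ?_ (by positivity))) (norm_nonneg _)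
        split_ifs
        · exact t2
        · rfl
  have hNp : (1 : ℝ) ≤ N + 1 := by linarith [N.cast_nonneg (α := ℝ)]
  have R0 : 0 ≤ log D / D := div_nonneg (by linarith) hD0.le
  have B2 : ‖∑ j ∈ range (N + 1), χ j * (j : ℂ) ^ (-s) - (∑ j ∈ range (N + 1), χ j) * ((N : ℂ) + 1) ^ (-s)‖ ≤ exp (1009 * log D) := by
    refine (norm_sub_le _ _).trans (le_trans ?_ (heads p1 p2))
    rw [← hN]
    have a1 : ‖∑ j ∈ range (N + 1), χ j * (j : ℂ) ^ (-s)‖ ≤ (N : ℝ) ^ (log D / D) * (1 + log N) := by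
      rw [sum_range_succ']
      simp only [Nat.cast_zero, chi_zero hχ, zero_mul, add_zero]
      refine (norm_sum_le_of_le _ fun n _ => ?_).trans (harm h1 R0 N)
      rw [norm_mul]; push_cast
      rw [cpn, Complex.neg_re]
      exact mul_le_of_le_one_left (by positivity) (χ.norm_le_one _)
    have a2 : ‖(∑ j ∈ range (N + 1), χ j) * ((N : ℂ) + 1) ^ (-s)‖ ≤ ((N : ℝ) + 1) ^ (log D / D) := by
      rw [norm_mul, cpn, Complex.neg_re]
      have : ‖∑ j ∈ range (N + 1), χ j‖ ≤ (N : ℝ) + 1 := (norm_sum_le_of_le _ fun j _ => χ.norm_le_one _).trans (by simp)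
      refine (mul_le_mul_of_nonneg_right this (by positivity)).trans ?_
      nth_rw 1 [← rpow_one ((N : ℝ) + 1)]; rw [← rpow_add (by linarith)]
      exact rpow_le_rpow_of_exponent_le hNp (by linarith)
    have hl : log N ≤ log (N + 1) := by
      rcases Nat.eq_zero_or_pos N with h | h
      · rw [h]; simp
      · exact log_le_log (by exact_mod_cast h) (by linarith)
    have hN2 : (N : ℝ) ^ (log D / D) ≤ ((N : ℝ) + 1) ^ (log D / D) := rpow_le_rpow (by positivity) (by linarith) R0
    have hN3 : 0 ≤ 1 + log N := by linarith [log_natCast_nonneg N]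
    nlinarith [mul_le_mul hN2 (show 1 + log N ≤ 1 + log (N + 1) by linarith) hN3 (by positivity : (0 : ℝ) ≤ ((N : ℝ) + 1) ^ (log D / D))]
  have h7 : exp D * exp (-(25 * D)) ≤ 1 := by rw [← exp_add]; exact exp_le_one_iff.2 (by linarith)
  have h8 : ‖s‖ * exp (-(25 * D)) ≤ 5 := by nlinarith [exp_pos (-(25 * D))]
  have h9 : ‖s‖ * (4 * E * ∑ n ∈ range (q ^ 2), (if n < q ^ 2 then ((n : ℝ) + 1) ^ (-s.re) else 0)) ≤ 100 * exp 80000 := by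
    rw [sum_congr rfl fun n hn => if_pos (mem_range.1 hn)]
    have g1 := harm h1 R0 (q ^ 2)
    push_cast at g1
    have g2 : ((q : ℝ) ^ 2) ^ (log D / D) ≤ exp (4 * (ℓ * (log D / D))) := by
      have : (q : ℝ) ^ 2 ≤ exp (4 * ℓ) := by
        rw [show 4 * ℓ = 2 * ℓ + 2 * ℓ by ring, exp_add, sq]; exact mul_le_mul hq hq (by positivity) (exp_pos _).le
      refine (rpow_le_rpow (by positivity) this R0).trans (le_of_eq ?_)
      rw [← exp_mul]; congr 1; ring
    have g3 : 1 + log ((q : ℝ) ^ 2) ≤ 5 * exp (4 * log ℓ) := by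
      rw [log_pow]
      have a1 : log q ≤ 2 * ℓ := by rw [← log_exp (2 * ℓ)]; exact log_le_log (by linarith) hq
      have a2 : ℓ ≤ exp (4 * log ℓ) := by
        nth_rw 1 [← exp_log (show 0 < ℓ by linarith)]; exact exp_le_exp.2 (by linarith [log_pos hℓ])
      push_cast; linarith
    have g4 : 0 ≤ 1 + log ((q : ℝ) ^ 2) := by have := log_nonneg (show 1 ≤ (q : ℝ) ^ 2 by nlinarith); linarith
    calc _ ≤ 5 * exp (D / √ℓ) * (4 * E * (exp (4 * (ℓ * (log D / D))) * (5 * exp (4 * log ℓ)))) := by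
          refine mul_le_mul hsn1 (mul_le_mul_of_nonneg_left (g1.trans (mul_le_mul g2 g3 g4 (exp_pos _).le)) (by positivity)) (by positivity) (by positivity)
      _ = 100 * exp (D / √ℓ - D / ℓ ^ (1 / 4 : ℝ) + 4 * (ℓ * (log D / D)) + 4 * log ℓ) := by
          rw [hE, sub_eq_add_neg, exp_add, exp_add, exp_add]; ring
      _ ≤ _ := by gcongr; exact expo hℓ hD
  have e : χ.LFunction s = (∑ j ∈ range (N + 1), χ j * (j : ℂ) ^ (-s) - (∑ j ∈ range (N + 1), χ j) * ((N : ℂ) + 1) ^ (-s)) +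
    (χ.LFunction s - (∑ j ∈ range (N + 1), χ j * (j : ℂ) ^ (-s) - (∑ j ∈ range (N + 1), χ j) * ((N : ℂ) + 1) ^ (-s))) := by ring
  rw [e]
  refine (norm_add_le _ _).trans ((add_le_add B2 B1).trans ?_)
  have h10 : ‖s‖ * (2 * exp (-(25 * D)) * Z) ≤ 10 * Z := by nlinarith
  rw [mul_add]
  linarith [exp_pos (1009 * log D)]
end growth

open Polynomial Finset

section loc
open Real Filter Topology

def pt (δ t : ℝ) : ℂ := ⟨1 + δ, t⟩

def LC (F : ℂ → ℂ) (δ : ℝ) (s : ℂ) : Prop := -(1 / (100 * δ)) ≤ (deriv F s / F s).re ∧ ∀ a, ‖a - s‖ ≤ 2 * δ → F a = 0 →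
    0.99 * (1 / (s - a)).re - 1 / (100 * δ) ≤ (deriv F s / F s).re ∧
    ∀ b, ‖b - s‖ ≤ 2 * δ → F b = 0 → (a = b → deriv F a = 0) → 0.99 * (1 / (s - a)).re + 0.99 * (1 / (s - b)).re - 1 / (100 * δ) ≤ (deriv F s / F s).re

lemma LCgen {F : ℂ → ℂ} (hf : Differentiable ℂ F) {s : ℂ} {R M δ : ℝ} (hR : 0 < R) (hM : 0 < M) (h0 : F s ≠ 0) (hb : ∀ z ∈ Metric.ball s R, ‖F z‖ ≤ Real.exp M * ‖F s‖)
    (hz : ∀ z, F z = 0 → z.re < s.re) (hδ : 0 < δ) (h1 : 20 * δ ≤ R) (h2 : 8 * M / R ≤ 1 / (100 * δ)) : LC F δ s := by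
  obtain ⟨A, B⟩ := LL hf hR hM h0 hb hz
  have pos : ∀ a, F a = 0 → 0 ≤ (1 / (s - a)).re := fun a ha => by
    rw [one_div, Complex.inv_re, Complex.sub_re]
    exact div_nonneg (by linarith [hz a ha]) (Complex.normSq_nonneg _)
  have mem : ∀ a, ‖a - s‖ ≤ 2 * δ → a ∈ Metric.ball s R := fun a ha => by
    rw [mem_ball_iff_norm]; linarith
  have fac : ∀ a, ‖a - s‖ ≤ 2 * δ → F a = 0 → 0.99 * (1 / (s - a)).re ≤ (1 - (‖a - s‖ / R) ^ 2) * (1 / (s - a)).re := fun a ha h => by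
    refine mul_le_mul_of_nonneg_right ?_ (pos a h)
    have g1 : ‖a - s‖ / R ≤ 1 / 10 := by rw [div_le_iff₀ hR]; linarith
    have g2 : 0 ≤ ‖a - s‖ / R := by positivity
    nlinarith
  refine ⟨by linarith, fun a ha h => ⟨?_, fun b hb' h' hab => ?_⟩⟩
  · have := (B a (mem a ha) h).1
    linarith [fac a ha h]
  · have := (B a (mem a ha) h).2 b (mem b hb') h' hab
    linarith [fac a ha h, fac b hb' h']

lemma zeta_real {σ : ℝ} (hσ : 1 < σ) : ‖riemannZeta σ‖ = ∑' n : ℕ, 1 / (n : ℝ) ^ σ := by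
  rw [zeta_eq_tsum_one_div_nat_cpow (by simpa using hσ)]
  have : ∀ n : ℕ, (1 : ℂ) / (n : ℂ) ^ (σ : ℂ) = ((1 / (n : ℝ) ^ σ : ℝ) : ℂ) := fun n => by
    rw [Complex.ofReal_div, Complex.ofReal_cpow (by positivity)]; simp
  simp_rw [this]
  rw [← Complex.ofReal_tsum, Complex.norm_real, Real.norm_eq_abs, abs_of_nonneg]
  exact tsum_nonneg fun n => by positivity

lemma Llow {m : ℕ} [NeZero m] (ψ : DirichletCharacter ℂ m) {s : ℂ} (hs : 1 < s.re) : 1 ≤ ‖ψ.LFunction s‖ * ‖riemannZeta s.re‖ := by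
  have h := DirichletCharacter.LSeries.mul_mu_eq_one ψ hs
  rw [← DirichletCharacter.LFunction_eq_LSeries ψ hs] at h
  have h' := congrArg norm h
  rw [norm_mul, norm_one] at h'
  rw [← h', zeta_real hs]
  refine mul_le_mul_of_nonneg_left ?_ (norm_nonneg _)
  refine tsum_of_norm_bounded (Real.summable_one_div_nat_rpow.2 hs).hasSum fun n => ?_
  rw [LSeries.norm_term_eq]
  split_ifs with h0
  · positivity
  · refine div_le_div_of_nonneg_right ?_ (by positivity)
    rw [Pi.mul_apply, norm_mul]
    refine mul_le_one₀ (ψ.norm_le_one _) (norm_nonneg _) ?_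
    rw [Complex.norm_intCast]
    exact_mod_cast ArithmeticFunction.abs_moebius_le_one

lemma ev {p : ℝ → Prop} (h : ∀ᶠ δ in 𝓝[>] (0 : ℝ), p δ) : ∀ᶠ a in 𝓝[>] (0 : ℝ), ∀ D : ℝ, 1 ≤ D → p (a / D) := by
  obtain ⟨u, hu, H⟩ := (mem_nhdsGT_iff_exists_Ioo_subset).1 h
  filter_upwards [Ioo_mem_nhdsGT hu] with a ha D hD
  exact H ⟨div_pos ha.1 (by linarith), (div_le_self ha.1.le hD).trans_lt ha.2⟩

lemma zt_line : Tendsto (fun δ : ℝ => zt (1 + (δ : ℝ))) (𝓝[>] 0) (𝓝 1) := by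
  have h : Continuous fun δ : ℝ => zt (1 + (δ : ℝ)) := zt_diff.continuous.comp (by fun_prop)
  have := h.tendsto 0
  simp only [Complex.ofReal_zero, add_zero, zt_one] at this
  exact this.mono_left nhdsWithin_le_nhds

lemma ev_zeta : ∀ᶠ δ in 𝓝[>] (0 : ℝ), ‖riemannZeta ((1 + δ : ℝ))‖ ≤ 2 / δ := by
  filter_upwards [zt_line.norm.eventually_le_const (show ‖(1 : ℂ)‖ < 2 by norm_num), self_mem_nhdsWithin] with δ h hδ
  have hδ : 0 < δ := hδ
  rw [zt_eq (by simpa using hδ.ne'), add_sub_cancel_left, norm_mul, Complex.norm_real, Real.norm_eq_abs, abs_of_pos hδ] at h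
  rw [le_div_iff₀ hδ]; push_cast; linarith

lemma ev_a (C : ℝ) : ∀ᶠ a in 𝓝[>] (0 : ℝ), a * (8 * (C + 4 - 2 * log a)) ≤ 1 / 100 := by
  have h : Continuous fun a : ℝ => a * (8 * (C + 4)) - 16 * (a * log a) := (by fun_prop : Continuous fun a : ℝ => a * (8 * (C + 4))).sub (continuous_const.mul Real.continuous_mul_log)
  have := (h.tendsto 0).mono_left (nhdsWithin_le_nhds (s := Set.Ioi 0))
  filter_upwards [this.eventually_le_const (show _ < (1 / 100 : ℝ) by norm_num)] with a ha
  linarith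

lemma Mbound {a D K M : ℝ} (ha : 0 < a) (hD : 0 < D) (hlD : 1 ≤ log D) (h : a * (8 * (K + 4 - 2 * log a)) ≤ 1 / 100)
    (hM : M ≤ (K + 4 - 2 * log a) * log D) : 8 * M / (log D / D) ≤ 1 / (100 * (a / D)) := by
  rw [div_le_div_iff₀ (by positivity) (by positivity)]
  calc 8 * M * (100 * (a / D)) ≤ 8 * ((K + 4 - 2 * log a) * log D) * (100 * (a / D)) := by gcongr
    _ = (a * (8 * (K + 4 - 2 * log a))) * (100 * (log D / D)) := by ring
    _ ≤ (1 / 100) * (100 * (log D / D)) := by gcongr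
    _ = _ := by ring

lemma ball_mem {δ t R V : ℝ} (hδ : 0 < δ) (hδ1 : δ ≤ 1 / 100) (hR : R ≤ 3 / 8) (ht : |t| ≤ 2 * V) {z : ℂ} (hz : z ∈ Metric.ball (pt δ t) R) :
    1 - R ≤ z.re ∧ z.re ≤ 2 ∧ |z.im| ≤ 2 * V + 1 := by
  rw [mem_ball_iff_norm] at hz
  have h1 := (Complex.abs_re_le_norm _).trans hz.le
  have h2 := (Complex.abs_im_le_norm _).trans hz.le
  rw [Complex.sub_re, pt] at h1
  rw [Complex.sub_im, pt] at h2
  have h3 : |z.im| ≤ |t| + |z.im - t| := by have := abs_add_le t (z.im - t); simpa using this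
  simp only [abs_le] at h1 h2 ⊢
  have h3' := abs_le.1 (h3.trans (add_le_add ht (show |z.im - t| ≤ R from abs_le.2 h2)))
  refine ⟨by linarith, by linarith, by linarith, by linarith⟩

theorem LOCN : ∀ᶠ a in 𝓝[>] (0 : ℝ), ∀ ℓ D : ℝ, 1 < ℓ → ℓ / log ℓ ≤ D → ∀ (m : ℕ) [NeZero m] (ψ : DirichletCharacter ℂ m), ψ.IsPrimitive → ψ ≠ 1 →
    (∀ p ∈ m.primeFactors, (p : ℝ) ≤ exp D) → (m : ℝ) ≤ exp (2 * ℓ) → ∀ t : ℝ, |t| ≤ 2 * exp (D / √ℓ) → LC ψ.LFunction (a / D) (pt (a / D) t) := by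
  obtain ⟨K, hK, H⟩ := LB
  filter_upwards [self_mem_nhdsWithin, Ioo_mem_nhdsGT (show (0 : ℝ) < 1 / 100 by norm_num), ev ev_zeta, ev_a K] with a ha ha1 hze haK ℓ D hℓ hD m _ ψ h1 h2 h3 h4 t ht
  have ha : 0 < a := ha
  obtain ⟨p1, p2, p3, p4⟩ := par hℓ hD
  have hD1 : 1 ≤ D := by have := exp_one_gt_d9; linarith
  have hD0 : 0 < D := by linarith
  have hδ : 0 < a / D := by positivity
  have hδ1 : a / D ≤ 1 / 100 := (div_le_self ha.le hD1).trans ha1.2.le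
  have hre : (pt (a / D) t).re = 1 + a / D := rfl
  have hlo := Llow ψ (s := pt (a / D) t) (by rw [hre]; linarith)
  rw [hre] at hlo
  have hlo2 : (a / D) / 2 ≤ ‖ψ.LFunction (pt (a / D) t)‖ := by
    have := hlo.trans (mul_le_mul_of_nonneg_left (hze D hD1) (norm_nonneg _))
    rw [mul_div_assoc', le_div_iff₀ hδ] at this; linarith
  have hla : log a ≤ 0 := log_nonpos ha.le (by linarith [ha1.2])
  have hl2 : 0 < 2 / (a / D) := by positivity
  have hlog : log (2 / (a / D)) = log 2 + log D - log a := by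
    rw [div_div_eq_mul_div, log_div (by positivity) ha.ne', log_mul (by norm_num) hD0.ne']
  have hlog2 : 0 < log 2 := log_pos (by norm_num)
  have hlog2' : log 2 ≤ 1 := by have := log_le_sub_one_of_pos (show (0 : ℝ) < 2 by norm_num); linarith
  refine LCgen (R := log D / D) (M := K * log D + log (2 / (a / D))) (DirichletCharacter.differentiable_LFunction h2) (by positivity) ?_ (norm_pos_iff.1 (by linarith)) (fun z hz => ?_) (fun z hz => ?_) hδ ?_ (Mbound ha hD0 p2 haK ?_)
  · rw [hlog]; have : 0 < K * log D := by positivity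
    linarith
  · obtain ⟨b1, b2, b3⟩ := ball_mem hδ hδ1 p3 ht hz
    refine (H ℓ D hℓ hD m ψ h1 h2 h3 h4 z b1 b2 b3).trans ?_
    rw [exp_add, exp_log hl2, mul_assoc]
    refine le_mul_of_one_le_right (exp_pos _).le ?_
    calc 1 = 2 / (a / D) * ((a / D) / 2) := by field_simp
      _ ≤ _ := by gcongr
  · by_contra hc
    exact DirichletCharacter.LFunction_ne_zero_of_one_le_re ψ (Or.inl h2) (by rw [hre] at hc; linarith) hz
  · rw [mul_div_assoc']; gcongr; linarith [ha1.2]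
  · rw [hlog]; nlinarith

theorem LOCZ : ∀ᶠ a in 𝓝[>] (0 : ℝ), ∀ ℓ D : ℝ, 1 < ℓ → ℓ / log ℓ ≤ D → ∀ t : ℝ, |t| ≤ 2 * exp (D / √ℓ) → LC zt (a / D) (pt (a / D) t) := by
  obtain ⟨K, hK, H⟩ := ZB
  filter_upwards [self_mem_nhdsWithin, Ioo_mem_nhdsGT (show (0 : ℝ) < 1 / 100 by norm_num), ev ev_zeta, ev_a K] with a ha ha1 hze haK ℓ D hℓ hD t ht
  have ha : 0 < a := ha
  obtain ⟨p1, p2, p3, p4⟩ := par hℓ hD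
  have hD1 : 1 ≤ D := by have := exp_one_gt_d9; linarith
  have hD0 : 0 < D := by linarith
  have hδ : 0 < a / D := by positivity
  have hδ1 : a / D ≤ 1 / 100 := (div_le_self ha.le hD1).trans ha1.2.le
  have hre : (pt (a / D) t).re = 1 + a / D := rfl
  have hlo := Llow (1 : DirichletCharacter ℂ 1) (s := pt (a / D) t) (by rw [hre]; linarith)
  rw [hre, DirichletCharacter.LFunction_modOne_eq] at hlo
  have hlo2 : (a / D) / 2 ≤ ‖riemannZeta (pt (a / D) t)‖ := by
    have := hlo.trans (mul_le_mul_of_nonneg_left (hze D hD1) (norm_nonneg _))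
    rw [mul_div_assoc', le_div_iff₀ hδ] at this; linarith
  have hn : a / D ≤ ‖pt (a / D) t - 1‖ := by
    refine le_trans (le_of_eq ?_) (Complex.re_le_norm _); rw [Complex.sub_re, hre]; simp
  have hne : pt (a / D) t ≠ 1 := fun h => by rw [h] at hn; simp at hn; linarith
  have hzt : ‖pt (a / D) t - 1‖ * ((a / D) / 2) ≤ ‖zt (pt (a / D) t)‖ := by
    rw [zt_eq hne, norm_mul]; gcongr
  have hla : log a ≤ 0 := log_nonpos ha.le (by linarith [ha1.2])
  have hl2 : 0 < 6 / (a / D) ^ 2 := by positivity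
  have hlog : log (6 / (a / D) ^ 2) = log 6 + 2 * log D - 2 * log a := by
    rw [log_div (by norm_num) (by positivity), log_pow, log_div ha.ne' hD0.ne']; push_cast; ring
  have hlog2 : 0 < log 6 := log_pos (by norm_num)
  have hlog2' : log 6 ≤ 2 := by
    rw [log_le_iff_le_exp (by norm_num), show (2 : ℝ) = 1 + 1 by norm_num, exp_add]
    have := exp_one_gt_d9; nlinarith
  refine LCgen (R := log D / D) (M := K * log D + log (6 / (a / D) ^ 2)) zt_diff (by positivity) ?_ (norm_pos_iff.1 (lt_of_lt_of_le (mul_pos (by linarith) (by positivity)) hzt)) (fun z hz => ?_) (fun z hz => ?_) hδ ?_ (Mbound ha hD0 p2 haK ?_)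
  · rw [hlog]; have : 0 < K * log D := by positivity
    linarith
  · obtain ⟨b1, b2, b3⟩ := ball_mem hδ hδ1 p3 ht hz
    refine (H ℓ D hℓ hD z b1 b2 b3).trans ?_
    rw [exp_add, exp_log hl2, mul_comm, mul_assoc]
    refine mul_le_mul_of_nonneg_left ?_ (exp_pos _).le
    have hz1 : ‖z - 1‖ ≤ ‖pt (a / D) t - 1‖ + 1 := by
      rw [mem_ball_iff_norm] at hz
      have := norm_add_le (z - pt (a / D) t) (pt (a / D) t - 1)
      rw [sub_add_sub_cancel] at this; linarith
    refine le_trans ?_ (mul_le_mul_of_nonneg_left hzt hl2.le)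
    rw [show 6 / (a / D) ^ 2 * (‖pt (a / D) t - 1‖ * (a / D / 2)) = 3 * ‖pt (a / D) t - 1‖ / (a / D) by field_simp; ring, le_div_iff₀ hδ]
    nlinarith
  · by_contra hc
    by_cases h1 : z = 1
    · rw [h1, zt_one] at hz; exact one_ne_zero hz
    · rw [zt_eq h1] at hz
      rcases mul_eq_zero.1 hz with h | h
      · exact h1 (sub_eq_zero.1 h)
      · exact riemannZeta_ne_zero_of_one_le_re (by rw [hre] at hc; linarith) h
  · rw [mul_div_assoc']; gcongr; linarith [ha1.2]
  · rw [hlog]; nlinarith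
end loc

open Polynomial Finset

section pos
open Real Filter Topology

noncomputable def nl (F : ℂ → ℂ) (s : ℂ) : ℝ := -(deriv F s / F s).re

lemma VM {q : ℕ} [NeZero q] (χ : DirichletCharacter ℂ q) {s : ℂ} (hs : 1 < s.re) :
    HasSum (fun n : ℕ => ArithmeticFunction.vonMangoldt n * (χ n * (n : ℂ) ^ (-s)).re) (nl χ.LFunction s) := by
  have h := (DirichletCharacter.LSeriesSummable_twist_vonMangoldt χ hs).hasSum
  have h2 := DirichletCharacter.LSeries_twist_vonMangoldt_eq χ hs
  rw [LSeries] at h2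
  rw [h2, ← DirichletCharacter.LFunction_eq_LSeries χ hs, ← DirichletCharacter.deriv_LFunction_eq_deriv_LSeries χ hs] at h
  have h3 := Complex.reCLM.hasSum h
  convert! h3 using 1
  · funext n
    simp only [Function.comp, Complex.reCLM_apply, LSeries.term_def]
    split_ifs with h0
    · simp [h0]
    · rw [Complex.cpow_neg, Pi.mul_apply, ← Complex.re_ofReal_mul]; congr 1; field_simp
  · rw [nl, Complex.reCLM_apply, neg_div, Complex.neg_re]

lemma ncp (δ t : ℝ) {n : ℕ} (hn : n ≠ 0) : ∃ w : ℂ, ‖w‖ = 1 ∧ (n : ℂ) ^ (-pt δ t) = ((n : ℝ) ^ (-(1 + δ)) : ℝ) * w ∧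
    (n : ℂ) ^ (-pt δ (2 * t)) = ((n : ℝ) ^ (-(1 + δ)) : ℝ) * w ^ 2 ∧ (n : ℂ) ^ (-pt δ 0) = ((n : ℝ) ^ (-(1 + δ)) : ℝ) := by
  have hc : (n : ℂ) ≠ 0 := by exact_mod_cast hn
  have e : ∀ u : ℝ, -pt δ u = ((-(1 + δ) : ℝ) : ℂ) + ((-u : ℝ) : ℂ) * Complex.I := fun u => by
    apply Complex.ext <;> simp [pt]
  have e2 : (n : ℂ) ^ ((-(1 + δ) : ℝ) : ℂ) = ((n : ℝ) ^ (-(1 + δ)) : ℝ) := by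
    rw [Complex.ofReal_cpow (by positivity)]; simp
  refine ⟨(n : ℂ) ^ (((-t : ℝ) : ℂ) * Complex.I), ?_, ?_, ?_, ?_⟩
  · rw [Complex.norm_natCast_cpow_of_pos (Nat.pos_of_ne_zero hn)]; simp
  · rw [e, Complex.cpow_add _ _ hc, e2]
  · rw [e, Complex.cpow_add _ _ hc, e2, ← Complex.cpow_nat_mul]; congr 2; push_cast; ring
  · rw [e, Complex.cpow_add _ _ hc, e2]; simp

lemma ptre {δ t : ℝ} (h : 0 < δ) : 1 < (pt δ t).re := by show 1 < 1 + δ; linarith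

lemma T341 {q m : ℕ} [NeZero q] [NeZero m] {χ : DirichletCharacter ℂ q} {ψ : DirichletCharacter ℂ m} (h : ∀ n : ℕ, χ n ≠ 0 → ψ n = χ n ^ 2) {δ t : ℝ} (hδ : 0 < δ) :
    0 ≤ 3 * nl riemannZeta (pt δ 0) + 4 * nl χ.LFunction (pt δ t) + nl ψ.LFunction (pt δ (2 * t)) := by
  have H := (((VM (1 : DirichletCharacter ℂ 1) (ptre (t := 0) hδ)).mul_left 3).add ((VM χ (ptre (t := t) hδ)).mul_left 4)).add (VM ψ (ptre (t := 2 * t) hδ))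
  rw [DirichletCharacter.LFunction_modOne_eq] at H
  refine H.nonneg fun n => ?_
  rcases eq_or_ne n 0 with rfl | hn
  · simp
  obtain ⟨w, h1, h2, h3, h4⟩ := ncp δ t hn
  rw [h2, h3, h4]
  have hr : 0 ≤ (n : ℝ) ^ (-(1 + δ)) := by positivity
  generalize (n : ℝ) ^ (-(1 + δ)) = r at hr
  have hL := ArithmeticFunction.vonMangoldt_nonneg (n := n)
  have one : (1 : DirichletCharacter ℂ 1) (n : ZMod 1) = 1 := by rw [Subsingleton.elim (n : ZMod 1) 1]; simp
  have e1 : ∀ a b : ℂ, (a * (r * b)).re = r * (a * b).re := fun a b => by rw [← Complex.re_ofReal_mul]; congr 1; ring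
  rw [e1, e1, one, one_mul, Complex.ofReal_re]
  have key : 0 ≤ 3 + 4 * (χ n * w).re + (ψ n * w ^ 2).re := by
    by_cases h0 : χ n = 0
    · rw [h0, zero_mul, Complex.zero_re]
      have h5 : ‖ψ n * w ^ 2‖ ≤ 1 := by rw [norm_mul, norm_pow, h1]; simpa using ψ.norm_le_one n
      have := (abs_le.1 ((Complex.abs_re_le_norm _).trans h5)).1
      linarith
    · rw [h n h0, ← mul_pow]
      have h5 : ‖χ n * w‖ = 1 := by
        rw [norm_mul, h1, mul_one]
        have hu : IsUnit (n : ZMod q) := by by_contra hc; exact h0 (χ.map_nonunit hc)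
        obtain ⟨u, hu⟩ := hu
        rw [← hu]; exact χ.unit_norm_eq_one u
      generalize χ n * w = z at h5
      have h6 : z.re * z.re + z.im * z.im = 1 := by rw [← Complex.normSq_apply, Complex.normSq_eq_norm_sq, h5]; norm_num
      rw [sq, Complex.mul_re]
      nlinarith [sq_nonneg (z.re + 1)]
  have := mul_nonneg (mul_nonneg hL hr) key
  linarith

lemma T4 {q m k : ℕ} [NeZero q] [NeZero m] [NeZero k] {χ : DirichletCharacter ℂ q} {ψ : DirichletCharacter ℂ m} {φ : DirichletCharacter ℂ k} (b : ℝ)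
    (h : ∀ n : ℕ, n ≠ 0 → 0 ≤ 1 + (χ n).re + b * ((ψ n).re + (φ n).re)) {δ : ℝ} (hδ : 0 < δ) :
    0 ≤ nl riemannZeta (pt δ 0) + nl χ.LFunction (pt δ 0) + b * (nl ψ.LFunction (pt δ 0) + nl φ.LFunction (pt δ 0)) := by
  have H := ((VM (1 : DirichletCharacter ℂ 1) (ptre (t := 0) hδ)).add (VM χ (ptre (t := 0) hδ))).add (((VM ψ (ptre (t := 0) hδ)).add (VM φ (ptre (t := 0) hδ))).mul_left b)
  rw [DirichletCharacter.LFunction_modOne_eq] at H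
  refine H.nonneg fun n => ?_
  rcases eq_or_ne n 0 with rfl | hn
  · simp
  obtain ⟨w, -, -, -, h4⟩ := ncp δ 0 hn
  have h := h n hn
  rw [h4]
  have hr : 0 ≤ (n : ℝ) ^ (-(1 + δ)) := by positivity
  generalize (n : ℝ) ^ (-(1 + δ)) = r at hr
  have hL := ArithmeticFunction.vonMangoldt_nonneg (n := n)
  have one : (1 : DirichletCharacter ℂ 1) (n : ZMod 1) = 1 := by rw [Subsingleton.elim (n : ZMod 1) 1]; simp
  rw [one, one_mul, Complex.ofReal_re, Complex.re_mul_ofReal, Complex.re_mul_ofReal, Complex.re_mul_ofReal]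
  have := mul_nonneg (mul_nonneg hL hr) h
  linarith

lemma ztd {s : ℂ} (h1 : 1 < s.re) : deriv zt s / zt s = 1 / (s - 1) + deriv riemannZeta s / riemannZeta s := by
  have hs : s ≠ 1 := fun h => by rw [h] at h1; simp at h1
  have h0 : riemannZeta s ≠ 0 := riemannZeta_ne_zero_of_one_le_re h1.le
  have h2 : zt =ᶠ[𝓝 s] fun z => (z - 1) * riemannZeta z := by
    filter_upwards [isOpen_ne.mem_nhds hs] with z hz using zt_eq hz
  have h3 : HasDerivAt (fun z => (z - 1) * riemannZeta z) (1 * riemannZeta s + (s - 1) * deriv riemannZeta s) s :=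
    ((hasDerivAt_id s).sub_const 1).mul (differentiableAt_riemannZeta hs).hasDerivAt
  rw [h2.deriv_eq, h3.deriv, zt_eq hs]
  have : s - 1 ≠ 0 := sub_ne_zero.2 hs
  field_simp

lemma ZU {δ t : ℝ} (hδ : 0 < δ) (h : LC zt δ (pt δ t)) : nl riemannZeta (pt δ t) ≤ δ / (δ ^ 2 + t ^ 2) + 1 / (100 * δ) := by
  have h1 := h.1
  rw [ztd (ptre hδ), Complex.add_re, one_div (pt δ t - 1), Complex.inv_re, Complex.normSq_apply] at h1
  have e : (pt δ t - 1).re = δ := by simp [pt]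
  have e2 : (pt δ t - 1).im = t := by simp [pt]
  rw [e, e2, ← sq, ← sq] at h1
  rw [nl]; linarith

lemma ZU0 {δ : ℝ} (hδ : 0 < δ) (h : LC zt δ (pt δ 0)) : nl riemannZeta (pt δ 0) ≤ 1.01 / δ := by
  refine (ZU hδ h).trans (le_of_eq ?_)
  field_simp; ring

lemma nlU {F : ℂ → ℂ} {δ t : ℝ} (hδ : 0 < δ) (h : LC F δ (pt δ t)) : nl F (pt δ t) ≤ 0.01 / δ := by
  have h1 := h.1
  rw [nl, show 0.01 / δ = 1 / (100 * δ) by field_simp; norm_num]; linarith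

/-- one zero at height `t` -/
lemma nlZ {F : ℂ → ℂ} {δ : ℝ} (hδ : 0 < δ) {ρ : ℂ} (h : LC F δ (pt δ ρ.im)) (h0 : F ρ = 0) (h1 : 1 - δ / 20 < ρ.re) (h2 : ρ.re ≤ 1) : nl F (pt δ ρ.im) ≤ -0.93 / δ := by
  have e : pt δ ρ.im - ρ = ((1 + δ - ρ.re : ℝ) : ℂ) := by apply Complex.ext <;> simp [pt]
  have h3 := (h.2 ρ (by
    rw [norm_sub_rev, e, Complex.norm_real, Real.norm_eq_abs, abs_le]; constructor <;> linarith) h0).1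
  rw [e, show (1 : ℂ) / ((1 + δ - ρ.re : ℝ) : ℂ) = ((1 / (1 + δ - ρ.re) : ℝ) : ℂ) by push_cast; rfl, Complex.ofReal_re] at h3
  have h4 : 1 / (1.05 * δ) ≤ 1 / (1 + δ - ρ.re) := one_div_le_one_div_of_le (by linarith) (by linarith)
  have h5 : 0.99 * (1 / (1.05 * δ)) - 1 / (100 * δ) ≥ 0.93 / δ := by
    rw [ge_iff_le, show 0.99 * (1 / (1.05 * δ)) - 1 / (100 * δ) = (0.99 / 1.05 - 0.01) / δ by field_simp; norm_num]
    gcongr; norm_num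
  rw [nl, neg_div]; linarith

/-- two zeros close to the real axis -/
lemma nlZ2 {F : ℂ → ℂ} {δ : ℝ} (hδ : 0 < δ) {a b : ℂ} (h : LC F δ (pt δ 0)) (ha : F a = 0) (hb : F b = 0) (hab : a = b → deriv F a = 0)
    (ha1 : 1 - δ / 20 < a.re) (ha2 : a.re ≤ 1) (ha3 : |a.im| ≤ δ / 2) (hb1 : 1 - δ / 20 < b.re) (hb2 : b.re ≤ 1) (hb3 : |b.im| ≤ δ / 2) : nl F (pt δ 0) ≤ -1.5 / δ := by
  have key : ∀ a : ℂ, 1 - δ / 20 < a.re → a.re ≤ 1 → |a.im| ≤ δ / 2 → ‖a - pt δ 0‖ ≤ 2 * δ ∧ 0.77 / δ ≤ (1 / (pt δ 0 - a)).re := fun a h1 h2 h3 => by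
    have e1 : (pt δ 0 - a).re = 1 + δ - a.re := by simp [pt]
    have e2 : (pt δ 0 - a).im = -a.im := by simp [pt]
    have h4 : a.im ^ 2 ≤ δ ^ 2 / 4 := by rw [← sq_abs]; nlinarith [abs_nonneg a.im]
    constructor
    · rw [norm_sub_rev]
      refine (Complex.norm_le_abs_re_add_abs_im _).trans ?_
      rw [e1, e2, abs_neg, abs_of_nonneg (by linarith)]; linarith
    · obtain ⟨x, hx⟩ : ∃ x, x = 1 + δ - a.re := ⟨_, rfl⟩
      rw [one_div, Complex.inv_re, Complex.normSq_apply, e1, e2, ← hx, div_le_div_iff₀ hδ (by nlinarith)]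
      nlinarith
  obtain ⟨k1, k2⟩ := key a ha1 ha2 ha3
  obtain ⟨k3, k4⟩ := key b hb1 hb2 hb3
  have h3 := (h.2 a k1 ha).2 b k3 hb hab
  have h5 : 0.99 * (0.77 / δ) + 0.99 * (0.77 / δ) - 1 / (100 * δ) ≥ 1.5 / δ := by
    rw [ge_iff_le, show 0.99 * (0.77 / δ) + 0.99 * (0.77 / δ) - 1 / (100 * δ) = (2 * 0.99 * 0.77 - 0.01) / δ by field_simp; norm_num]
    gcongr; norm_num
  rw [nl, neg_div]; linarith

/-- three-four-one with a nontrivial square -/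
lemma S1N {q m : ℕ} [NeZero q] [NeZero m] {χ : DirichletCharacter ℂ q} {ψ : DirichletCharacter ℂ m} (h : ∀ n : ℕ, χ n ≠ 0 → ψ n = χ n ^ 2) {δ : ℝ} (hδ : 0 < δ) {ρ : ℂ}
    (hz : LC zt δ (pt δ 0)) (hc : LC χ.LFunction δ (pt δ ρ.im)) (h0 : χ.LFunction ρ = 0) (h1 : 1 - δ / 20 < ρ.re) (h2 : ρ.re ≤ 1) : 0.6 / δ ≤ nl ψ.LFunction (pt δ (2 * ρ.im)) := by
  have a1 := T341 h (t := ρ.im) hδ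
  have a2 := ZU0 hδ hz
  have a3 := nlZ hδ hc h0 h1 h2
  have : 0.6 / δ ≤ -(3 * (1.01 / δ) + 4 * (-0.93 / δ)) := by
    rw [show -(3 * (1.01 / δ) + 4 * (-0.93 / δ)) = (4 * 0.93 - 3 * 1.01) / δ by field_simp; ring]; gcongr; norm_num
  linarith

lemma S1Z {q : ℕ} [NeZero q] {χ : DirichletCharacter ℂ q} (h : ∀ n : ℕ, χ n ≠ 0 → χ n ^ 2 = 1) {δ : ℝ} (hδ : 0 < δ) {ρ : ℂ}
    (hz : LC zt δ (pt δ 0)) (hz2 : LC zt δ (pt δ (2 * ρ.im))) (hc : LC χ.LFunction δ (pt δ ρ.im)) (h0 : χ.LFunction ρ = 0) (h1 : 1 - δ / 20 < ρ.re) (h2 : ρ.re ≤ 1) : |ρ.im| ≤ δ / 2 := by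
  by_contra hcon
  push Not at hcon
  have a := S1N (ψ := (1 : DirichletCharacter ℂ 1)) (fun n hn => by rw [h n hn, Subsingleton.elim (n : ZMod 1) 1]; simp) hδ hz hc h0 h1 h2
  rw [DirichletCharacter.LFunction_modOne_eq] at a
  have b := a.trans (ZU hδ hz2)
  have c1 : δ ^ 2 ≤ (2 * ρ.im) ^ 2 := by rw [← sq_abs (2 * ρ.im), abs_mul, abs_two]; nlinarith
  have c2 : δ / (δ ^ 2 + (2 * ρ.im) ^ 2) ≤ 0.5 / δ := by
    rw [div_le_div_iff₀ (by positivity) hδ]; nlinarith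
  have c3 : 0.5 / δ + 1 / (100 * δ) < 0.6 / δ := by
    rw [show 0.5 / δ + 1 / (100 * δ) = 0.51 / δ by field_simp; norm_num]; gcongr; norm_num
  linarith

lemma S1ZZ {δ : ℝ} (hδ : 0 < δ) {ρ : ℂ} (hz : LC zt δ (pt δ 0)) (hz2 : LC zt δ (pt δ (2 * ρ.im))) (hz1 : LC zt δ (pt δ ρ.im))
    (h0 : zt ρ = 0) (h1 : 1 - δ / 20 < ρ.re) (h2 : ρ.re ≤ 1) (h3 : 20 * δ ≤ |ρ.im|) : False := by
  have a := T341 (χ := (1 : DirichletCharacter ℂ 1)) (ψ := (1 : DirichletCharacter ℂ 1)) (fun n hn => by rw [Subsingleton.elim (n : ZMod 1) 1]; simp) (t := ρ.im) hδ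
  rw [DirichletCharacter.LFunction_modOne_eq] at a
  have a1 := ZU0 hδ hz
  have a2 := ZU hδ hz2
  have a3 := nlZ hδ hz1 h0 h1 h2
  have sm : ∀ t : ℝ, 20 * δ ≤ |t| → δ / (δ ^ 2 + t ^ 2) ≤ 0.01 / δ := fun t ht => by
    have : (20 * δ) ^ 2 ≤ t ^ 2 := by rw [← sq_abs t]; gcongr
    rw [div_le_div_iff₀ (by positivity) hδ]; nlinarith
  have b1 := sm _ h3
  have b2 := sm (2 * ρ.im) (by rw [abs_mul, abs_two]; linarith)
  have e : nl zt (pt δ ρ.im) = nl riemannZeta (pt δ ρ.im) - δ / (δ ^ 2 + ρ.im ^ 2) := by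
    rw [nl, nl, ztd (ptre hδ), Complex.add_re, one_div, Complex.inv_re, Complex.normSq_apply]
    have e : (pt δ ρ.im - 1).re = δ := by simp [pt]
    have e2 : (pt δ ρ.im - 1).im = ρ.im := by simp [pt]
    rw [e, e2, ← sq, ← sq]; ring
  have c : 3 * (1.01 / δ) + 4 * (-0.93 / δ + 0.01 / δ) + (0.01 / δ + 1 / (100 * δ)) < 0 := by
    rw [show 3 * (1.01 / δ) + 4 * (-0.93 / δ + 0.01 / δ) + (0.01 / δ + 1 / (100 * δ)) = -(4 * 0.93 - 3 * 1.01 - 0.06) / δ by field_simp; norm_num]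
    exact div_neg_of_neg_of_pos (by norm_num) hδ
  linarith

lemma S2 {q : ℕ} [NeZero q] {χ : DirichletCharacter ℂ q} {δ : ℝ} (hδ : 0 < δ) {a b : ℂ} (hz : LC zt δ (pt δ 0)) (h : LC χ.LFunction δ (pt δ 0)) (ha : χ.LFunction a = 0) (hb : χ.LFunction b = 0) (hab : a = b → deriv χ.LFunction a = 0)
    (ha1 : 1 - δ / 20 < a.re) (ha2 : a.re ≤ 1) (ha3 : |a.im| ≤ δ / 2) (hb1 : 1 - δ / 20 < b.re) (hb2 : b.re ≤ 1) (hb3 : |b.im| ≤ δ / 2) : False := by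
  have h1 := T4 (χ := χ) (ψ := χ) (φ := χ) 0 (fun n _ => by have := (abs_le.1 ((Complex.abs_re_le_norm _).trans (χ.norm_le_one n))).1; linarith) hδ
  have h2 := nlZ2 hδ h ha hb hab ha1 ha2 ha3 hb1 hb2 hb3
  have h3 := ZU0 hδ hz
  have : 1.01 / δ + -1.5 / δ < 0 := by rw [← add_div]; exact div_neg_of_neg_of_pos (by norm_num) hδ
  linarith

lemma S3 {q m k : ℕ} [NeZero q] [NeZero m] [NeZero k] {χ : DirichletCharacter ℂ q} {ψ : DirichletCharacter ℂ m} {φ : DirichletCharacter ℂ k}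
    (h : ∀ n : ℕ, n ≠ 0 → 0 ≤ 1 + (χ n).re + 1 * ((ψ n).re + (φ n).re)) {δ : ℝ} (hδ : 0 < δ) (hz : LC zt δ (pt δ 0)) (h1 : LC χ.LFunction δ (pt δ 0)) (h2 : LC ψ.LFunction δ (pt δ 0))
    (h3 : LC φ.LFunction δ (pt δ 0)) {a b : ℂ} (ha : χ.LFunction a = 0) (hb : ψ.LFunction b = 0)
    (ha1 : 1 - δ / 20 < a.re) (ha2 : a.re ≤ 1) (ha3 : a.im = 0) (hb1 : 1 - δ / 20 < b.re) (hb2 : b.re ≤ 1) (hb3 : b.im = 0) : False := by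
  have g1 := T4 1 h hδ
  have g2 := nlZ hδ (by rwa [ha3]) ha ha1 ha2
  have g3 := nlZ hδ (by rwa [hb3]) hb hb1 hb2
  rw [ha3] at g2; rw [hb3] at g3
  have g4 := nlU hδ h3
  have g5 := ZU0 hδ hz
  have : 1.01 / δ + -0.93 / δ + -0.93 / δ + 0.01 / δ < 0 := by rw [← add_div, ← add_div, ← add_div]; exact div_neg_of_neg_of_pos (by norm_num) hδ
  linarith
end pos

open Polynomial Finset

section chars
open DirichletCharacter

lemma chi_ne_iff {q : ℕ} (χ : DirichletCharacter ℂ q) (n : ℕ) : χ n ≠ 0 ↔ n.Coprime q := by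
  have := χ.apply_ne_zero_iff (n : ℤ)
  rw [Nat.isCoprime_iff_coprime] at this
  simpa using this

lemma real_val {q : ℕ} [NeZero q] {χ : DirichletCharacter ℂ q} (hr : ∀ n : ZMod q, (χ n).im = 0) (n : ZMod q) (hn : χ n ≠ 0) : χ n = 1 ∨ χ n = -1 := by
  have hu : IsUnit n := by by_contra hc; exact hn (χ.map_nonunit hc)
  obtain ⟨u, hu⟩ := hu
  have h := χ.unit_norm_eq_one u
  rw [hu] at h
  have e : χ n = ((χ n).re : ℂ) := Complex.ext rfl (by simpa using hr n)
  rw [e, Complex.norm_real, Real.norm_eq_abs] at h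
  rcases abs_eq (by norm_num : (0 : ℝ) ≤ 1) |>.1 h with h | h <;> rw [e, h] <;> simp

lemma real_sq {q : ℕ} [NeZero q] {χ : DirichletCharacter ℂ q} (hr : ∀ n : ZMod q, (χ n).im = 0) : χ * χ = 1 := by
  ext u
  rw [MulChar.mul_apply, MulChar.one_apply_coe]
  rcases real_val hr u (u.isUnit.map χ).ne_zero with h | h <;> rw [h] <;> norm_num

lemma prim_ap {N : ℕ} (Ψ : DirichletCharacter ℂ N) {n : ℕ} (h : n.Coprime N) : Ψ.primitiveCharacter n = Ψ n := by
  have := Ψ.primitiveCharacter_apply_of_isCoprime (a := (n : ℤ)) (Nat.isCoprime_iff_coprime.2 h)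
  simpa using this

lemma cl_ap {q N : ℕ} (χ : DirichletCharacter ℂ q) (hd : q ∣ N) {n : ℕ} (h : n.Coprime N) : changeLevel hd χ n = χ n := by
  have := changeLevel_eq_cast_of_dvd' χ hd (a := (n : ℤ)) (Nat.isCoprime_iff_coprime.2 h)
  simpa using this

lemma prim_ne_one {N : ℕ} [NeZero N] {Ψ : DirichletCharacter ℂ N} (h : Ψ ≠ 1) : Ψ.primitiveCharacter ≠ 1 := fun h1 => h (by
  rw [← Ψ.changeLevel_primitiveCharacter, h1, map_one])

lemma SQ {q : ℕ} [NeZero q] (χ : DirichletCharacter ℂ q) (hc : ¬ ∀ n : ZMod q, (χ n).im = 0) : ∃ (m : ℕ) (_ : NeZero m) (ψ : DirichletCharacter ℂ m),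
    ψ.IsPrimitive ∧ ψ ≠ 1 ∧ m ∣ q ∧ ∀ n : ℕ, χ n ≠ 0 → ψ n = χ n ^ 2 := by
  refine ⟨_, ⟨(χ * χ).conductor_ne_zero⟩, (χ * χ).primitiveCharacter, primitiveCharacter_isPrimitive _, prim_ne_one fun h => hc fun n => ?_, conductor_dvd_level _, fun n hn => ?_⟩
  · by_cases hn : IsUnit n
    · obtain ⟨u, rfl⟩ := hn
      have := congrArg (fun f : DirichletCharacter ℂ q => f u) h
      simp only [MulChar.mul_apply, MulChar.one_apply_coe] at this
      rcases mul_self_eq_one_iff.1 this with h | h <;> rw [h] <;> simp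
    · rw [χ.map_nonunit hn]; rfl
  · rw [prim_ap _ ((chi_ne_iff χ n).1 hn), MulChar.mul_apply, sq]

lemma PR {q r : ℕ} [NeZero q] [NeZero r] {χ : DirichletCharacter ℂ q} {ψ : DirichletCharacter ℂ r} (h1 : χ.IsPrimitive) (h2 : ψ.IsPrimitive)
    (hr1 : ∀ n : ZMod q, (χ n).im = 0) (hr2 : ∀ n : ZMod r, (ψ n).im = 0) (hne : q = r → ¬ HEq χ ψ) : ∃ (m : ℕ) (_ : NeZero m) (φ : DirichletCharacter ℂ m),
    φ.IsPrimitive ∧ φ ≠ 1 ∧ m ∣ q * r ∧ ∀ n : ℕ, n ≠ 0 → 0 ≤ 1 + (χ n).re + 1 * ((ψ n).re + (φ n).re) := by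
  have hN : NeZero (q * r) := ⟨mul_ne_zero (NeZero.ne q) (NeZero.ne r)⟩
  obtain ⟨X, hX⟩ : ∃ X, X = changeLevel (dvd_mul_right q r) χ := ⟨_, rfl⟩
  obtain ⟨Y, hY⟩ : ∃ Y, Y = changeLevel (dvd_mul_left r q) ψ := ⟨_, rfl⟩
  have X2 : X * X = 1 := by rw [hX, ← map_mul, real_sq hr1, map_one]
  have Y2 : Y * Y = 1 := by rw [hY, ← map_mul, real_sq hr2, map_one]
  have cX : X.conductor = q := by rw [hX, conductor_changeLevel, h1]
  have cY : Y.conductor = r := by rw [hY, conductor_changeLevel, h2]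
  have d1 : q ∣ (X * Y).conductor.lcm r := by
    have := conductor_mul_dvd_lcm_conductor (X * Y) Y
    rwa [mul_assoc, Y2, mul_one, cX, cY] at this
  have d2 : r ∣ (X * Y).conductor.lcm q := by
    have := conductor_mul_dvd_lcm_conductor (X * Y) X
    rwa [mul_comm X Y, mul_assoc, X2, mul_one, cX, cY, mul_comm Y X] at this
  refine ⟨_, ⟨(X * Y).conductor_ne_zero⟩, (X * Y).primitiveCharacter, primitiveCharacter_isPrimitive _, prim_ne_one fun h => ?_, conductor_dvd_level _, fun n hn => ?_⟩
  · have hXY : X = Y := by rw [← mul_one X, ← Y2, ← mul_assoc, h, one_mul]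
    have hqr : q = r := by rw [← cX, hXY, cY]
    subst hqr
    refine hne rfl (heq_of_eq (changeLevel_injective (dvd_mul_right q q) ?_))
    rw [← hX, hXY, hY]
  · have zero : ∀ {a b f : ℕ}, a ∣ f.lcm b → ¬ n.Coprime a → n.Coprime b → ¬ n.Coprime f := fun {a b f} hd ha hb hf => ha (by
      have : n.Coprime (f * b) := Nat.Coprime.mul_right hf hb
      exact Nat.Coprime.coprime_dvd_right (hd.trans (Nat.lcm_dvd_mul f b)) this)
    have lo : ∀ {k : ℕ} (χ : DirichletCharacter ℂ k), -1 ≤ (χ n).re := fun χ => (abs_le.1 ((Complex.abs_re_le_norm _).trans (χ.norm_le_one n))).1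
    by_cases k1 : n.Coprime q <;> by_cases k2 : n.Coprime r
    · have k : n.Coprime (q * r) := Nat.Coprime.mul_right k1 k2
      rw [prim_ap _ k, MulChar.mul_apply, hX, hY, cl_ap _ _ k, cl_ap _ _ k]
      rcases real_val hr1 n ((chi_ne_iff χ n).2 k1) with h | h <;> rcases real_val hr2 n ((chi_ne_iff ψ n).2 k2) with h' | h' <;> rw [h, h'] <;> norm_num
    · rw [not_not.1 (mt (chi_ne_iff ψ n).1 k2), not_not.1 (mt (chi_ne_iff (X * Y).primitiveCharacter n).1 (zero d2 k2 k1))]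
      have := lo χ; simp; linarith
    · rw [not_not.1 (mt (chi_ne_iff χ n).1 k1), not_not.1 (mt (chi_ne_iff (X * Y).primitiveCharacter n).1 (zero d1 k1 k2))]
      have := lo ψ; simp; linarith
    · rw [not_not.1 (mt (chi_ne_iff χ n).1 k1), not_not.1 (mt (chi_ne_iff ψ n).1 k2)]
      have := lo (X * Y).primitiveCharacter; simp; linarith

lemma Lconj {q : ℕ} [NeZero q] {χ : DirichletCharacter ℂ q} (hχ : χ ≠ 1) (hr : ∀ n : ZMod q, (χ n).im = 0) {s : ℂ} (hs : 0 < s.re) :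
    χ.LFunction (starRingEnd ℂ s) = starRingEnd ℂ (χ.LFunction s) := by
  have h1 := L_sum hχ s hs
  have h2 := L_sum hχ (starRingEnd ℂ s) (by simpa using hs)
  have h3 := (Complex.hasSum_conj' (f := _)).2 h1
  refine h2.unique ?_
  convert! h3 using 1
  funext n
  have cp : ∀ k : ℕ, ((k : ℂ) + 1) ^ (-starRingEnd ℂ s) = starRingEnd ℂ (((k : ℂ) + 1) ^ (-s)) := fun k => by
    have e : (k : ℂ) + 1 = ((k + 1 : ℕ) : ℂ) := by push_cast; rfl
    rw [e, ← map_neg, Complex.cpow_conj _ _ (by rw [Complex.natCast_arg]; exact Real.pi_pos.ne), Complex.conj_natCast]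
  rw [map_mul, map_sub, map_sum, cp, cp]
  congr 1
  refine sum_congr rfl fun j _ => ?_
  exact (Complex.conj_eq_iff_im.2 (hr j)).symm

lemma FT {q : ℕ} [NeZero q] {χ : DirichletCharacter ℂ q} (hp : χ.IsPrimitive) {d : ℕ} (hd : d ∣ q) (hdq : d < q)
    (h : ∀ u : (ZMod q)ˣ, ∀ k : ZMod q, (u : ZMod q) = 1 + d * k → χ u = 1) : False := by
  have hf : χ.FactorsThrough d := by
    rw [factorsThrough_iff_ker_unitsMap hd]
    intro u hu
    rw [MonoidHom.mem_ker] at hu ⊢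
    have e : (((u : ZMod q).val : ℕ) : ZMod q) = u := ZMod.natCast_zmod_val _
    have h1 : ((u : ZMod q).val : ZMod d) = ((1 : ℕ) : ZMod d) := by
      have := congrArg (fun x : (ZMod d)ˣ => (x : ZMod d)) hu
      simp only [ZMod.unitsMap_val, Units.val_one] at this
      rw [← ZMod.cast_eq_val, this]; simp
    rw [ZMod.natCast_eq_natCast_iff, ← Int.natCast_modEq_iff] at h1
    obtain ⟨k, hk⟩ := h1.symm.dvd
    have := h u (k : ZMod q) (by
      have hk' := congrArg (fun x : ℤ => (x : ZMod q)) hk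
      push_cast at hk'
      rw [ZMod.natCast_zmod_val] at hk'
      linear_combination hk')
    apply Units.ext
    simpa using this
  have := conductor_dvd_of_mem_conductorSet χ hf
  rw [hp] at this
  exact absurd (Nat.le_of_dvd (Nat.pos_of_ne_zero fun h => by rw [h] at hd; exact NeZero.ne q (Nat.eq_zero_of_zero_dvd hd)) this) (by omega)

lemma no_psq {q : ℕ} [NeZero q] {χ : DirichletCharacter ℂ q} (hp : χ.IsPrimitive) (hr : ∀ n : ZMod q, (χ n).im = 0) {p : ℕ} (pp : p.Prime) (p2 : p ≠ 2) : ¬ p ^ 2 ∣ q := by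
  rintro ⟨e, he⟩
  have hq := NeZero.ne q
  have he0 : 0 < e := Nat.pos_of_ne_zero fun h => hq (by rw [he, h, mul_zero])
  refine FT hp (d := p * e) ⟨p, by rw [he]; ring⟩ (by rw [he, sq]; nlinarith [pp.two_le, mul_pos pp.pos he0]) fun u k hu => ?_
  have hq0 : ((p : ZMod q)) * (p * e) = 0 := by have := (congrArg (Nat.cast : ℕ → ZMod q) he).symm.trans (ZMod.natCast_self q); push_cast at this; linear_combination this
  have hx2 : (((p * e : ℕ) : ZMod q) * k) ^ 2 = 0 := by push_cast; linear_combination (e * k ^ 2) * hq0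
  have hpow : ∀ n : ℕ, (u : ZMod q) ^ n = 1 + n * (((p * e : ℕ) : ZMod q) * k) := fun n => by
    induction n with
    | zero => simp
    | succ n ih => rw [pow_succ, ih, hu]; push_cast at hx2 ⊢; linear_combination n * hx2
  have h1 : (u : ZMod q) ^ p = 1 := by rw [hpow p]; push_cast; linear_combination k * hq0
  have h2 : χ u ^ p = 1 := by rw [← map_pow, h1, map_one]
  rcases real_val hr u (u.isUnit.map χ).ne_zero with h | h
  · exact h
  · rw [h, (pp.odd_of_ne_two p2).neg_one_pow] at h2; norm_num at h2

lemma no_16 {q : ℕ} [NeZero q] {χ : DirichletCharacter ℂ q} (hp : χ.IsPrimitive) (hr : ∀ n : ZMod q, (χ n).im = 0) : ¬ 16 ∣ q := by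
  rintro ⟨e, he⟩
  have hq := NeZero.ne q
  refine FT hp (d := 8 * e) ⟨2, by rw [he]; ring⟩ (by omega) fun u k hu => ?_
  have hq0 : (16 : ZMod q) * e = 0 := by have := (congrArg (Nat.cast : ℕ → ZMod q) he).symm.trans (ZMod.natCast_self q); push_cast at this; exact this
  have h1 : (1 + 4 * e * k) ^ 2 = (u : ZMod q) := by rw [hu]; push_cast; linear_combination (e * k ^ 2) * hq0
  have h2 : χ (1 + 4 * e * k) ^ 2 = χ u := by rw [← map_pow, h1]
  rw [← h2]
  have h3 : χ (1 + 4 * e * k) ≠ 0 := fun h => by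
    rw [h] at h2; exact (u.isUnit.map χ).ne_zero (by rw [← h2]; norm_num)
  rcases real_val hr _ h3 with h | h <;> rw [h] <;> norm_num

lemma logq {q : ℕ} [NeZero q] {χ : DirichletCharacter ℂ q} (hp : χ.IsPrimitive) (hr : ∀ n : ZMod q, (χ n).im = 0) (hq2 : 2 ≤ q) :
    (1 / 4) * Real.log q ≤ (maxPrimeFac q : ℝ) := by
  obtain ⟨P, hP⟩ : ∃ P, P = maxPrimeFac q := ⟨_, rfl⟩
  have hq := NeZero.ne q
  have le : ∀ p, p.Prime → p ∣ q → p ≤ P := fun p pp hpq => by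
    rw [hP]; exact Finset.le_sup (f := id) (Nat.mem_primeFactors.2 ⟨pp, hpq, hq⟩)
  have P2 : 2 ≤ P := by
    obtain ⟨p, pp, h⟩ := Nat.exists_prime_and_dvd (show q ≠ 1 by omega)
    exact pp.two_le.trans (le p pp h)
  have dv : q ∣ 8 * primorial P := by
    rw [Nat.dvd_iff_prime_pow_dvd_dvd]
    intro p k pp hk
    rcases Nat.eq_zero_or_pos k with rfl | hk0
    · simp
    have hpq : p ∣ q := (dvd_pow_self p hk0.ne').trans hk
    by_cases p2 : p = 2
    · subst p2
      have : k ≤ 3 := by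
        by_contra hc
        exact no_16 hp hr ((pow_dvd_pow 2 (show 4 ≤ k by omega)).trans hk)
      exact ((pow_dvd_pow 2 this)).trans (dvd_mul_right 8 _)
    · have : k ≤ 1 := by
        by_contra hc
        exact no_psq hp hr pp p2 ((pow_dvd_pow p (show 2 ≤ k by omega)).trans hk)
      have hk1 : k = 1 := by omega
      rw [hk1, pow_one]
      refine dvd_mul_of_dvd_right ?_ _
      rw [primorial]
      exact Finset.dvd_prod_of_mem (fun p => p) (Finset.mem_filter.2 ⟨Finset.mem_range.2 (by have := le p pp hpq; omega), pp⟩)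
  have h1 : q ≤ 8 * 4 ^ P := (Nat.le_of_dvd (by have := primorial_pos P; omega) dv).trans (Nat.mul_le_mul_left 8 (primorial_le_four_pow P))
  have h2 : (q : ℝ) ≤ 8 * 4 ^ P := by exact_mod_cast h1
  have h3 := Real.log_le_log (by exact_mod_cast Nat.pos_of_ne_zero hq) h2
  rw [Real.log_mul (by norm_num) (by positivity), Real.log_pow, show (8 : ℝ) = 2 ^ 3 by norm_num, show (4 : ℝ) = 2 ^ 2 by norm_num, Real.log_pow, Real.log_pow] at h3
  have h4 := Real.log_two_lt_d9
  have h5 := Real.log_pos (show (1 : ℝ) < 2 by norm_num)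
  have h6 : (2 : ℝ) ≤ P := by exact_mod_cast P2
  rw [← hP]
  push_cast at h3
  nlinarith
end chars

open Polynomial Finset

section siegel
open Complex Filter Topology

lemma geo_lb {y : ℝ} (hy : 0 ≤ y) : ∀ n : ℕ, ((n : ℝ) + 1) * y ^ n ≤ ∑ i ∈ range (n + 1), (y ^ 2) ^ i
  | 0 => by simp
  | 1 => by simp [sum_range_succ]; nlinarith [sq_nonneg (y - 1)]
  | n + 2 => by
    have ih := geo_lb hy n
    rw [sum_range_succ, sum_range_succ']
    simp only [pow_succ (y ^ 2), ← sum_mul] at *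
    have h1 := mul_le_mul_of_nonneg_right ih (sq_nonneg y)
    have h2 := sq_nonneg (y ^ (n + 2) - 1)
    have h3 : (y ^ 2) ^ n * y ^ 2 * y ^ 2 = (y ^ (n + 2)) ^ 2 := by ring
    have h4 : y ^ (n + 2) = y ^ n * y ^ 2 := by ring
    rw [h3]; push_cast
    simp only [pow_zero]
    nlinarith

/-- Monsky's weights -/
noncomputable def mb (z : ℝ) (n : ℕ) : ℝ := 1 / ((n + 1) * (1 - z)) - z ^ (n + 1) / (1 - z ^ (n + 1))

lemma mb_eq {z : ℝ} (h1 : z < 1) (n : ℕ) : mb z n * (1 - z) = 1 / (n + 1) - z ^ (n + 1) / (∑ i ∈ range (n + 1), z ^ i) := by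
  have h2 : 1 - z ≠ 0 := by linarith
  rw [mb, ← geom_sum_mul_neg z (n + 1), sub_mul, ← div_div, div_mul_cancel₀ _ h2, ← div_div, div_mul_cancel₀ _ h2]

lemma mb_anti {y : ℝ} (hy : 0 < y) (h1 : y < 1) (n : ℕ) : mb (y ^ 2) (n + 1) ≤ mb (y ^ 2) n := by
  have z1 : y ^ 2 < 1 := by nlinarith
  refine le_of_mul_le_mul_right ?_ (show 0 < 1 - y ^ 2 by linarith)
  rw [mb_eq z1, mb_eq z1]
  have e1 := geo_lb hy.le n
  have e2 := geo_lb hy.le (n + 1)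
  have e3 : ∑ i ∈ range (n + 1 + 1), (y ^ 2) ^ i = y ^ 2 * (∑ i ∈ range (n + 1), (y ^ 2) ^ i) + 1 := by
    rw [sum_range_succ', mul_sum]; simp [pow_succ']
  obtain ⟨G, hG⟩ : ∃ G, G = ∑ i ∈ range (n + 1), (y ^ 2) ^ i := ⟨_, rfl⟩
  obtain ⟨H, hH⟩ : ∃ H, H = ∑ i ∈ range (n + 1 + 1), (y ^ 2) ^ i := ⟨_, rfl⟩
  rw [← hG] at e1 e3 ⊢; rw [← hH] at e2 e3 ⊢
  push_cast at e2 ⊢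
  have n0 : (0 : ℝ) < n + 1 := by positivity
  have g0 : 0 < G := lt_of_lt_of_le (by positivity) e1
  have h0 : 0 < H := lt_of_lt_of_le (by positivity) e2
  have key : (y ^ 2) ^ (n + 1) / (G * H) ≤ 1 / ((n + 1) * (n + 1 + 1)) := by
    rw [div_le_div_iff₀ (by positivity) (by positivity), one_mul]
    have := mul_le_mul e1 e2 (by positivity) g0.le
    refine le_trans ?_ this
    have : (y ^ 2) ^ (n + 1) ≤ y ^ n * y ^ (n + 1) := by
      rw [← pow_mul, ← pow_add]; exact pow_le_pow_of_le_one hy.le h1.le (by omega)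
    have := mul_le_mul_of_nonneg_right this (show (0 : ℝ) ≤ (n + 1) * (n + 1 + 1) by positivity)
    linarith
  have i1 : (1 : ℝ) / (n + 1) - 1 / (n + 1 + 1) = 1 / ((n + 1) * (n + 1 + 1)) := by field_simp; ring
  have i2 : (y ^ 2) ^ (n + 1) / G - (y ^ 2) ^ (n + 1 + 1) / H = (y ^ 2) ^ (n + 1) / (G * H) := by
    rw [div_sub_div _ _ g0.ne' h0.ne', e3]; congr 1; ring
  linarith

lemma mb_nonneg {z : ℝ} (h0 : 0 < z) (h1 : z < 1) (n : ℕ) : 0 ≤ mb z n := by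
  refine nonneg_of_mul_nonneg_left ?_ (show 0 < 1 - z by linarith)
  rw [mb_eq h1, sub_nonneg, div_le_div_iff₀ (sum_pos (fun i _ => by positivity) (by simp)) (by positivity), one_mul]
  have : ∑ i ∈ range (n + 1), z ^ (n + 1) ≤ ∑ i ∈ range (n + 1), z ^ i := sum_le_sum fun i hi => pow_le_pow_of_le_one h0.le h1.le (by have := mem_range.1 hi; omega)
  simpa [mul_comm] using this

lemma abel_le {a : ℕ → ℂ} {b : ℕ → ℝ} {C : ℝ} (hA : ∀ N, ‖∑ n ∈ range N, a n‖ ≤ C) (hb : ∀ n, b (n + 1) ≤ b n) (h0 : ∀ n, 0 ≤ b n) (N : ℕ) :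
    ‖∑ n ∈ range N, a n * (b n : ℂ)‖ ≤ C * b 0 := by
  have hC : 0 ≤ C := (norm_nonneg _).trans (hA 0)
  have h : ‖∑ n ∈ range N, a n * (b n : ℂ) - (∑ n ∈ range N, a n) * (b N : ℂ)‖ ≤ C * (b 0 - b N) := by
    induction N with
    | zero => simp
    | succ N ih =>
      rw [sum_range_succ, sum_range_succ, ← sum_range_succ a,
        show ∑ n ∈ range N, a n * (b n : ℂ) + a N * (b N : ℂ) - (∑ n ∈ range (N + 1), a n) * (b (N + 1) : ℂ) =
        (∑ n ∈ range N, a n * (b n : ℂ) - (∑ n ∈ range N, a n) * (b N : ℂ)) + (∑ n ∈ range (N + 1), a n) * ((b N - b (N + 1) : ℝ) : ℂ) by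
          rw [sum_range_succ a]; push_cast; ring]
      refine (norm_add_le _ _).trans ?_
      rw [norm_mul, norm_real, Real.norm_eq_abs, abs_of_nonneg (by linarith [hb N])]
      have := mul_le_mul_of_nonneg_right (hA (N + 1)) (show 0 ≤ b N - b (N + 1) by linarith [hb N])
      linarith
  have h2 : ‖(∑ n ∈ range N, a n) * (b N : ℂ)‖ ≤ C * b N := by
    rw [norm_mul, norm_real, Real.norm_eq_abs, abs_of_nonneg (h0 N)]
    exact mul_le_mul_of_nonneg_right (hA N) (h0 N)
  have := norm_add_le (∑ n ∈ range N, a n * (b n : ℂ) - (∑ n ∈ range N, a n) * (b N : ℂ)) ((∑ n ∈ range N, a n) * (b N : ℂ))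
  rw [sub_add_cancel] at this
  linarith

variable {q : ℕ} [NeZero q] {χ : DirichletCharacter ℂ q}

lemma r_sum (n : ℕ) : χ.zetaMul n = ∑ i ∈ n.divisors, χ i := by
  rw [DirichletCharacter.zetaMul, ArithmeticFunction.coe_zeta_mul_apply]
  exact sum_congr rfl fun i hi => by simp [toArithmeticFunction, (Nat.pos_of_mem_divisors hi).ne']

lemma r_pp (hr : ∀ n : ZMod q, (χ n).im = 0) {p : ℕ} (hp : p.Prime) (k : ℕ) :
    (χ.zetaMul (p ^ k)).im = 0 ∧ 0 ≤ (χ.zetaMul (p ^ k)).re ∧ (Even k → 1 ≤ (χ.zetaMul (p ^ k)).re) := by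
  have h : χ.zetaMul (p ^ k) = ∑ i ∈ range (k + 1), χ p ^ i := by
    rw [r_sum, Nat.sum_divisors_prime_pow hp]; simp
  rw [h]
  by_cases h0 : χ p = 0
  · rw [sum_eq_single 0 (fun i _ hi => by simp [h0, hi]) (by simp)]; simp
  · rcases real_val hr _ h0 with h1 | h1 <;> rw [h1]
    · simp; intros; positivity
    · rw [neg_one_geom_sum]
      by_cases hk : Even k
      · simp [Nat.even_add_one, hk]
      · simp [Nat.even_add_one, hk]

lemma r_nn (hr : ∀ n : ZMod q, (χ n).im = 0) (n : ℕ) (hn : n ≠ 0) : (χ.zetaMul n).im = 0 ∧ 0 ≤ (χ.zetaMul n).re := by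
  rw [χ.isMultiplicative_zetaMul.multiplicative_factorization _ hn]
  refine Finset.prod_induction _ (fun z : ℂ => z.im = 0 ∧ 0 ≤ z.re) (fun a b ha hb => ?_) (by simp) fun p hp => ?_
  · simp [ha.1, hb.1, mul_nonneg ha.2 hb.2]
  · have := r_pp hr (Nat.prime_of_mem_primeFactors hp) (n.factorization p)
    exact ⟨this.1, this.2.1⟩

lemma r_sq (hr : ∀ n : ZMod q, (χ n).im = 0) (m : ℕ) (hm : m ≠ 0) : 1 ≤ (χ.zetaMul (m ^ 2)).re := by
  rw [χ.isMultiplicative_zetaMul.multiplicative_factorization _ (pow_ne_zero 2 hm)]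
  refine (Finset.prod_induction _ (fun z : ℂ => z.im = 0 ∧ 1 ≤ z.re) (fun a b ha hb => ?_) (by simp) fun p hp => ?_).2
  · simp only [mul_im, mul_re, ha.1, hb.1]; constructor
    · ring
    · nlinarith [ha.2, hb.2]
  · have := r_pp hr (Nat.prime_of_mem_primeFactors hp) ((m ^ 2).factorization p)
    exact ⟨this.1, this.2.2 (by simp [Nat.factorization_pow])⟩

lemma lambert {z : ℝ} (h0 : 0 < z) (h1 : z < 1) : ∃ A : ℂ, HasSum (fun n : ℕ => χ (n + 1 : ℕ) * ((z ^ (n + 1) / (1 - z ^ (n + 1)) : ℝ) : ℂ)) A ∧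
    HasSum (fun n : ℕ+ => χ.zetaMul n * ((z : ℂ) ^ (n : ℕ))) A := by
  have hs : Summable fun c : ℕ+ × ℕ+ => χ (c.1 : ℕ) * (z : ℂ) ^ (c.1 * c.2 : ℕ) := by
    have := summable_prod_mul_pow 0 (r := z) (by rw [Real.norm_eq_abs, abs_of_pos h0]; exact h1)
    refine Summable.of_norm_bounded this fun c => ?_
    rw [norm_mul, norm_pow, norm_real, Real.norm_eq_abs, abs_of_pos h0, pow_zero]
    exact mul_le_mul_of_nonneg_right (χ.norm_le_one _) (by positivity)
  refine ⟨∑' c : ℕ+ × ℕ+, χ (c.1 : ℕ) * (z : ℂ) ^ (c.1 * c.2 : ℕ), ?_, ?_⟩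
  · have h2 := hs.hasSum.prod_fiberwise (g := fun d : ℕ+ => χ (d : ℕ) * ((z ^ (d : ℕ) / (1 - z ^ (d : ℕ)) : ℝ) : ℂ)) (fun d => ?_)
    · have := (Equiv.pnatEquivNat.symm.hasSum_iff).2 h2
      simpa [Function.comp_def, Equiv.pnatEquivNat] using this
    · have h3 : ‖(z : ℂ) ^ (d : ℕ)‖ < 1 := by
        rw [norm_pow, norm_real, Real.norm_eq_abs, abs_of_pos h0]; exact pow_lt_one₀ h0.le h1 d.ne_zero
      have h4 := ((hasSum_geometric_of_norm_lt_one h3).mul_left ((z : ℂ) ^ (d : ℕ))).mul_left (χ (d : ℕ))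
      rw [← Equiv.pnatEquivNat.symm.hasSum_iff]
      push_cast
      rw [div_eq_mul_inv]
      refine (congrArg (fun f : ℕ → ℂ => HasSum f _) (funext fun n => ?_)).mpr h4
      simp [Equiv.pnatEquivNat, pow_mul, pow_succ']
  · have h2 := sigmaAntidiagonalEquivProd.hasSum_iff.2 hs.hasSum
    convert h2.sigma fun n => hasSum_fintype _ using 2 with n
    rw [r_sum, sum_mul, ← Nat.sum_divisorsAntidiagonal (f := fun d _ => χ d * (z : ℂ) ^ (n : ℕ)), ← Finset.sum_coe_sort]
    refine sum_congr rfl fun x _ => ?_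
    simp only [Function.comp, sigmaAntidiagonalEquivProd, divisorsAntidiagonalFactors, Equiv.coe_fn_mk, PNat.mk_coe]
    rw [(Nat.mem_divisorsAntidiagonal.1 x.2).1]

lemma L_one_lim (hχ : χ ≠ 1) : Tendsto (fun N => ∑ j ∈ range N, χ (j + 1 : ℕ) * ((1 / (j + 1) : ℝ) : ℂ)) atTop (𝓝 (χ.LFunction 1)) := by
  have h1 := (L_sum hχ 1 (by simp)).tendsto_sum_nat
  simp only [abel_fin hχ] at h1
  have h2 : Tendsto (fun N : ℕ => (∑ j ∈ range (N + 1), χ j) * ((N : ℂ) + 1) ^ (-1 : ℂ)) atTop (𝓝 0) := by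
    refine squeeze_zero_norm (a := fun N : ℕ => q * ‖((N : ℂ) + 1) ^ (-1 : ℂ)‖) (fun N => ?_) ?_
    · rw [norm_mul]; exact mul_le_mul_of_nonneg_right (charsum_le χ hχ _) (norm_nonneg _)
    · simpa using (cpn_tendsto (s := -1) (by simp)).norm.const_mul (q : ℝ)
  have h3 := h1.add h2
  simp only [sub_add_cancel, add_zero] at h3
  refine h3.congr fun N => ?_
  rw [sum_range_succ']
  simp [chi_zero hχ, cpow_neg_one]

lemma L_one_lb (hχ : χ ≠ 1) (hr : ∀ n : ZMod q, (χ n).im = 0) : 1 / (32 * q) ≤ (χ.LFunction 1).re := by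
  have q0 : (1 : ℝ) ≤ q := by exact_mod_cast NeZero.one_le
  obtain ⟨M, hM⟩ : ∃ M : ℕ, M = 4 * q := ⟨_, rfl⟩
  have hMr : (M : ℝ) = 4 * q := by rw [hM]; push_cast; ring
  obtain ⟨z, hz⟩ : ∃ z : ℝ, z = 1 - 1 / (2 * (M : ℝ) ^ 2) := ⟨_, rfl⟩
  have e0 : 1 / (2 * (M : ℝ) ^ 2) ≤ 1 / 32 := by
    rw [hMr]; exact one_div_le_one_div_of_le (by norm_num) (by nlinarith)
  have e1 : 0 < 1 / (2 * (M : ℝ) ^ 2) := by rw [hMr]; positivity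
  have z0 : 0 < z := by linarith
  have z1 : z < 1 := by linarith
  have zM : 1 / 2 ≤ z ^ (M ^ 2) := by
    have := one_add_mul_le_pow (a := -(1 / (2 * (M : ℝ) ^ 2))) (by linarith) (M ^ 2)
    rw [hz, sub_eq_add_neg]
    refine le_trans (le_of_eq ?_) this
    push_cast
    have : (M : ℝ) ≠ 0 := by rw [hMr]; positivity
    field_simp; norm_num
  obtain ⟨A, h1, h2⟩ := lambert (χ := χ) z0 z1
  have hA : (M : ℝ) / 2 ≤ A.re := by
    have h3 := Complex.hasSum_re h2
    have inj : Function.Injective fun m : ℕ => m.succPNat ^ 2 := fun a b h => by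
      have := congrArg PNat.val h
      simpa using this
    have re : ∀ n : ℕ+, (χ.zetaMul n * ((z : ℂ) ^ (n : ℕ))).re = (χ.zetaMul n).re * z ^ (n : ℕ) := fun n => by
      rw [← ofReal_pow, re_mul_ofReal]
    have h4 := sum_le_hasSum ((range M).image fun m : ℕ => m.succPNat ^ 2) (fun n _ => by
      rw [re]; exact mul_nonneg (r_nn hr n n.ne_zero).2 (by positivity)) h3
    rw [sum_image fun a _ b _ h => inj h] at h4
    refine le_trans ?_ h4
    rw [show (M : ℝ) / 2 = ∑ m ∈ range M, (1 / 2 : ℝ) by simp; ring]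
    refine sum_le_sum fun m hm => ?_
    rw [re, PNat.pow_coe, Nat.succPNat_coe, Nat.succ_eq_add_one]
    have h5 := r_sq hr (m + 1) (by omega)
    have h6 : z ^ (M ^ 2) ≤ z ^ ((m + 1) ^ 2) := pow_le_pow_of_le_one z0.le z1.le (Nat.pow_le_pow_left (by have := mem_range.1 hm; omega) 2)
    nlinarith
  have hlim : Tendsto (fun N => ∑ n ∈ range N, χ (n + 1 : ℕ) * (mb z n : ℂ)) atTop (𝓝 (χ.LFunction 1 * ((1 / (1 - z) : ℝ) : ℂ) - A)) := by
    refine (((L_one_lim hχ).mul_const ((1 / (1 - z) : ℝ) : ℂ)).sub h1.tendsto_sum_nat).congr fun N => ?_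
    rw [sum_mul, ← sum_sub_distrib]
    refine sum_congr rfl fun n _ => ?_
    rw [mb]; push_cast
    rw [← div_div]; ring
  have hb := le_of_tendsto hlim.norm (Eventually.of_forall fun N => abel_le (C := q) (fun N => ?_) (fun n => ?_) (mb_nonneg z0 z1) N)
  rotate_left
  · have := charsum_le χ hχ (N + 1)
    rw [sum_range_succ'] at this
    simpa [chi_zero hχ] using this
  · have := mb_anti (Real.sqrt_pos.2 z0) (by rw [Real.sqrt_lt' one_pos]; simpa using z1) n
    rwa [Real.sq_sqrt z0.le] at this
  have b0 : mb z 0 = 1 := by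
    have : 1 - z ≠ 0 := by linarith
    rw [mb]; simp; field_simp
  rw [b0, mul_one] at hb
  have h7 := (abs_le.1 ((Complex.abs_re_le_norm _).trans hb)).1
  rw [sub_re, re_mul_ofReal, show 1 / (1 - z) = 32 * q ^ 2 by rw [hz, hMr]; field_simp; ring] at h7
  rw [div_le_iff₀ (by positivity)]
  rw [hMr] at hA
  have : 0 ≤ q * ((χ.LFunction 1).re * (32 * q) - 1) := by nlinarith
  have := nonneg_of_mul_nonneg_right this (by linarith)
  linarith

lemma L_dist : ∃ C : ℝ, 0 < C ∧ ∀ (q : ℕ) [NeZero q] (χ : DirichletCharacter ℂ q), χ ≠ 1 → ∀ s : ℂ, ‖s - 1‖ ≤ 1 / 4 → ‖χ.LFunction 1 - χ.LFunction s‖ ≤ C * q * ‖1 - s‖ := by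
  obtain ⟨Z, hZ⟩ : ∃ Z, Z = ∑' n : ℕ, ((n : ℝ) + 1) ^ (-(1 / 2 : ℝ) - 1) := ⟨_, rfl⟩
  have Z0 : 0 ≤ Z := by rw [hZ]; exact tsum_nonneg fun n => by positivity
  refine ⟨8 * Z + 1, by positivity, fun q _ χ hχ s hs => ?_⟩
  have B : ∀ w : ℂ, ‖w - 1‖ ≤ 1 / 2 → ‖χ.LFunction w‖ ≤ 2 * q * Z := fun w hw => by
    have h1 : 1 / 2 ≤ w.re := by
      have := (abs_le.1 ((Complex.abs_re_le_norm _).trans hw)).1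
      simp at this; linarith
    have h2 : ‖w‖ ≤ 2 := by
      have := norm_add_le (w - 1) 1
      rw [sub_add_cancel, norm_one] at this; linarith
    have h3 := ((sum_rp (show (0 : ℝ) < 1 / 2 by norm_num)).hasSum).mul_left (2 * q : ℝ)
    rw [← hZ] at h3
    refine (L_sum hχ w (by linarith)).norm_le_of_bounded h3 fun n => ?_
    rw [norm_mul, norm_sub_rev, show (2 * q : ℝ) * ((n : ℝ) + 1) ^ (-(1 / 2 : ℝ) - 1) = q * (2 * ((n : ℝ) + 1) ^ (-(1 / 2 : ℝ) - 1)) by ring]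
    refine mul_le_mul (charsum_le χ hχ _) ?_ (norm_nonneg _) (Nat.cast_nonneg q)
    have := cp_diff (show 0 < w.re by linarith) (show (0 : ℝ) < n + 1 by positivity) (show (n : ℝ) + 1 ≤ n + 1 + 1 by linarith)
    push_cast at this ⊢
    refine this.trans ?_
    rw [add_sub_cancel_left, mul_one]
    refine mul_le_mul h2 (Real.rpow_le_rpow_of_exponent_le (by linarith [n.cast_nonneg (α := ℝ)]) (by linarith)) (by positivity) (by norm_num)
  have hD := DirichletCharacter.differentiable_LFunction hχ
  have D : ∀ w ∈ Metric.closedBall (1 : ℂ) (1 / 4), ‖deriv χ.LFunction w‖ ≤ (8 * Z + 1) * q := fun w hw => by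
    rw [mem_closedBall_iff_norm] at hw
    have := Complex.norm_deriv_le_of_forall_mem_sphere_norm_le (c := w) (R := 1 / 4) (C := 2 * q * Z) (f := χ.LFunction) (by norm_num) hD.diffContOnCl fun u hu => B u (by
      rw [mem_sphere_iff_norm] at hu
      have := norm_add_le (u - w) (w - 1)
      rw [sub_add_sub_cancel] at this; linarith)
    refine this.trans ?_
    have : (0 : ℝ) ≤ q := Nat.cast_nonneg q
    nlinarith
  exact Convex.norm_image_sub_le_of_norm_deriv_le (fun w _ => hD w) D (convex_closedBall _ _) (by rwa [mem_closedBall_iff_norm]) (by simp)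

/-- lower bound for the distance of a real zero from 1 -/
lemma zero_dist : ∃ C : ℝ, 0 < C ∧ ∀ (q : ℕ) [NeZero q] (χ : DirichletCharacter ℂ q), χ ≠ 1 → (∀ n : ZMod q, (χ n).im = 0) → ∀ s : ℂ, χ.LFunction s = 0 →
    1 ≤ C * q ^ 2 * ‖1 - s‖ := by
  obtain ⟨C, C0, hC⟩ := L_dist
  refine ⟨32 * C + 4, by positivity, fun q _ χ hχ hr s hs => ?_⟩
  have q0 : (1 : ℝ) ≤ q := by exact_mod_cast NeZero.one_le
  have h1 := L_one_lb hχ hr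
  by_cases h : ‖s - 1‖ ≤ 1 / 4
  · have h2 := hC q χ hχ s h
    rw [hs, sub_zero] at h2
    have h3 := h1.trans ((Complex.re_le_norm _).trans h2)
    rw [div_le_iff₀ (by positivity)] at h3
    have : 0 ≤ (q : ℝ) ^ 2 * ‖1 - s‖ := by positivity
    nlinarith
  · push Not at h
    rw [norm_sub_rev] at h
    have : (1 : ℝ) ≤ q ^ 2 := by nlinarith
    have : 1 / 4 < (q : ℝ) ^ 2 * ‖1 - s‖ := by nlinarith
    have : 0 ≤ C * ((q : ℝ) ^ 2 * ‖1 - s‖) := by positivity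
    nlinarith
end siegel

open Polynomial Finset

section final
open Complex Filter Topology

lemma CORE {δ D ℓ : ℝ} (hδ : 0 < δ) (hδ1 : δ < 1)
    (hN : ∀ (m : ℕ) [NeZero m] (ψ : DirichletCharacter ℂ m), ψ.IsPrimitive → ψ ≠ 1 → (∀ p ∈ m.primeFactors, (p : ℝ) ≤ Real.exp D) → (m : ℝ) ≤ Real.exp (2 * ℓ) →
      ∀ t : ℝ, |t| ≤ 2 * Real.exp (D / Real.sqrt ℓ) → LC ψ.LFunction δ (pt δ t))
    (hZ : ∀ t : ℝ, |t| ≤ 2 * Real.exp (D / Real.sqrt ℓ) → LC zt δ (pt δ t)) (hz : ∀ w : ℂ, ‖w - 1‖ ≤ 21 * δ → zt w ≠ 0)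
    {q : ℕ} [NeZero q] {χ : DirichletCharacter ℂ q} (hp : χ.IsPrimitive) (hs : ∀ p ∈ q.primeFactors, (p : ℝ) ≤ Real.exp D) (hq : (q : ℝ) ≤ Real.exp (2 * ℓ))
    {ρ : ℂ} (h0 : χ.LFunction ρ = 0) (h1 : 1 - δ / 20 < ρ.re) (h2 : |ρ.im| ≤ Real.exp (D / Real.sqrt ℓ)) :
    (∀ n : ZMod q, (χ n).im = 0) ∧ χ ≠ 1 ∧ ρ.im = 0 ∧ ρ.re ≤ 1 ∧ deriv χ.LFunction ρ ≠ 0 ∧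
      ∀ ρ' : ℂ, χ.LFunction ρ' = 0 → 1 - δ / 20 < ρ'.re → |ρ'.im| ≤ Real.exp (D / Real.sqrt ℓ) → ρ' = ρ := by
  obtain ⟨H, hH⟩ : ∃ H, H = Real.exp (D / Real.sqrt ℓ) := ⟨_, rfl⟩
  have H0 : 0 < H := by rw [hH]; exact Real.exp_pos _
  rw [← hH] at hN hZ h2 ⊢
  have z0 := hZ 0 (by simp; linarith)
  have t2 : ∀ t : ℝ, |t| ≤ H → |2 * t| ≤ 2 * H := fun t ht => by rw [abs_mul, abs_two]; linarith
  have hχ : χ ≠ 1 := by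
    intro h
    have q1 : q = 1 := by
      rw [DirichletCharacter.isPrimitive_def, h, DirichletCharacter.conductor_one] at hp; exact hp.symm
    subst q1
    rw [DirichletCharacter.LFunction_modOne_eq] at h0
    have r1 : ρ.re ≤ 1 := by
      by_contra hc; exact riemannZeta_ne_zero_of_one_le_re (not_le.1 hc).le h0
    have e1 : ρ ≠ 1 := by rintro rfl; exact riemannZeta_ne_zero_of_one_le_re (by simp) h0
    have e2 : zt ρ = 0 := by rw [zt_eq e1, h0, mul_zero]
    refine S1ZZ hδ z0 (hZ _ (t2 _ h2)) (hZ _ (by linarith)) e2 h1 r1 ?_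
    by_contra hc
    push Not at hc
    refine hz ρ ((Complex.norm_le_abs_re_add_abs_im _).trans ?_) e2
    have : |(ρ - 1).re| ≤ δ / 20 := by rw [sub_re, one_re, abs_le]; constructor <;> linarith
    have e3 : (ρ - 1).im = ρ.im := by simp
    rw [e3]; linarith
  have re1 : ∀ w : ℂ, χ.LFunction w = 0 → w.re ≤ 1 := fun w hw => by
    by_contra hc; exact DirichletCharacter.LFunction_ne_zero_of_one_le_re χ (Or.inl hχ) (not_le.1 hc).le hw
  have c0 := hN q χ hp hχ hs hq
  have c00 := c0 0 (by simp; linarith)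
  have hr : ∀ n : ZMod q, (χ n).im = 0 := by
    by_contra hc
    obtain ⟨m, _, ψ, p1, p2, p3, p4⟩ := SQ χ hc
    have a := S1N p4 hδ z0 (c0 ρ.im (by linarith)) h0 h1 (re1 _ h0)
    have b := nlU hδ (hN m ψ p1 p2 (fun p hp => hs p (Nat.primeFactors_mono p3 (NeZero.ne q) hp))
      (le_trans (by exact_mod_cast Nat.le_of_dvd (Nat.pos_of_ne_zero (NeZero.ne q)) p3) hq) (2 * ρ.im) (t2 _ h2))
    have := a.trans b
    rw [div_le_div_iff_of_pos_right hδ] at this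
    norm_num at this
  have im : ∀ w : ℂ, χ.LFunction w = 0 → 1 - δ / 20 < w.re → |w.im| ≤ H → |w.im| ≤ δ / 2 := fun w w0 w1 w2 =>
    S1Z (fun n hn => by rcases real_val hr n hn with h | h <;> rw [h] <;> norm_num) hδ z0 (hZ _ (t2 _ w2)) (c0 _ (by linarith)) w0 w1 (re1 _ w0)
  have U : ∀ w : ℂ, χ.LFunction w = 0 → 1 - δ / 20 < w.re → |w.im| ≤ H → w = ρ := fun w w0 w1 w2 => by
    by_contra hc
    exact S2 hδ z0 c00 w0 h0 (fun h => (hc h).elim) w1 (re1 _ w0) (im _ w0 w1 w2) h1 (re1 _ h0) (im _ h0 h1 h2)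
  refine ⟨hr, hχ, ?_, re1 _ h0, fun hd => S2 hδ z0 c00 h0 h0 (fun _ => hd) h1 (re1 _ h0) (im _ h0 h1 h2) h1 (re1 _ h0) (im _ h0 h1 h2), U⟩
  have := U (starRingEnd ℂ ρ) (by rw [Lconj hχ hr (by linarith), h0, map_zero]) (by simpa using h1) (by simpa using h2)
  exact Complex.conj_eq_iff_im.1 this

lemma LOGT : ∃ c₂ : ℝ, 0 < c₂ ∧ ∀ (q : ℕ) [NeZero q] (χ : DirichletCharacter ℂ q), χ ≠ 1 → (∀ n : ZMod q, (χ n).im = 0) → 2 ≤ q → ∀ (s : ℂ) (ℓ D : ℝ), 1 < ℓ → ℓ / Real.log ℓ ≤ D →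
    χ.LFunction s = 0 → s.im = 0 → s.re ≤ 1 → 1 - 1 / D < s.re → c₂ * Real.log ℓ ≤ Real.log q := by
  obtain ⟨C, C0, hC⟩ := zero_dist
  have l2 := Real.log_pos (show (1 : ℝ) < 2 by norm_num)
  obtain ⟨B, hB⟩ : ∃ B, B = |Real.log (2 * C)| / Real.log 2 + 2 := ⟨_, rfl⟩
  have B0 : 0 < B := by rw [hB]; positivity
  refine ⟨1 / (2 * B), by positivity, fun q _ χ hχ hr q2 s ℓ D hℓ hD hs him hre hre2 => ?_⟩
  have q2r : (2 : ℝ) ≤ q := by exact_mod_cast q2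
  have hlam := Real.log_pos hℓ
  have h1 := hC q χ hχ hr s hs
  have e1 : 1 - s = ((1 - s.re : ℝ) : ℂ) := by apply Complex.ext <;> simp [him]
  rw [e1, norm_real, Real.norm_eq_abs, abs_of_nonneg (by linarith)] at h1
  have d0 : 0 < ℓ / Real.log ℓ := by positivity
  have h2 : 1 / D ≤ Real.log ℓ / ℓ := by rw [← one_div_div ℓ]; exact one_div_le_one_div_of_le d0 hD
  have s0 : 0 < Real.sqrt ℓ := Real.sqrt_pos.2 (by linarith)
  have ss : Real.sqrt ℓ * Real.sqrt ℓ = ℓ := Real.mul_self_sqrt (by linarith)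
  have h3 : Real.log ℓ ≤ 2 * Real.sqrt ℓ := by
    have := Real.log_le_self s0.le
    rw [Real.log_sqrt (by linarith)] at this; linarith
  have h4 : Real.log ℓ / ℓ ≤ 2 / Real.sqrt ℓ := by
    rw [div_le_div_iff₀ (by linarith) s0]; nlinarith
  have h5 : 1 - s.re ≤ 2 / Real.sqrt ℓ := by linarith
  have h6 : 1 ≤ C * q ^ 2 * (2 / Real.sqrt ℓ) := h1.trans (mul_le_mul_of_nonneg_left h5 (by positivity))
  have h7 : Real.sqrt ℓ ≤ 2 * C * q ^ 2 := by
    rw [mul_div_assoc', le_div_iff₀ s0] at h6; linarith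
  have h8 := Real.log_le_log s0 h7
  rw [Real.log_sqrt (by linarith), Real.log_mul (by positivity) (by positivity), Real.log_pow] at h8
  have h9 : Real.log 2 ≤ Real.log q := Real.log_le_log (by norm_num) q2r
  have h10 : |Real.log (2 * C)| ≤ |Real.log (2 * C)| / Real.log 2 * Real.log q := by
    rw [div_mul_eq_mul_div, le_div_iff₀ l2]; exact mul_le_mul_of_nonneg_left h9 (abs_nonneg _)
  have h11 : Real.log ℓ / 2 ≤ B * Real.log q := by
    rw [hB, add_mul]; push_cast at h8; linarith [le_abs_self (Real.log (2 * C))]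
  rw [one_div_mul_eq_div, div_le_iff₀ (by positivity)]; linarith

lemma smooth {q : ℕ} {P : ℝ} (hP : 0 < P) (h : (maxPrimeFac q : ℝ) ≤ P) : ∀ p ∈ q.primeFactors, (p : ℝ) ≤ Real.exp (Real.log P) := fun p hp => by
  rw [Real.exp_log hP]
  exact le_trans (by exact_mod_cast Finset.le_sup (f := id) hp) h
end final

theorem stmt15 :
    ∃ c c₁ c₂ : ℝ, 0 < c ∧ 0 < c₁ ∧ 0 < c₂ ∧
      ∀ T P : ℝ, 3 ≤ T → T ^ (1 / Real.log (Real.log T)) ≤ P →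
        -- at most one primitive character `χ` mod `q ≤ T` with `P⁺(q) ≤ P` whose `L`-function
        -- vanishes somewhere in the region
        {qχ : Σ q : {n : ℕ // n ≠ 0}, DirichletCharacter ℂ q.1 |
            (qχ.1.1 : ℝ) ≤ T ∧ (maxPrimeFac qχ.1.1 : ℝ) ≤ P ∧ qχ.2.IsPrimitive ∧
              ∃ s : ℂ, ZeroInRegion c P T qχ.1.2 qχ.2 s}.Subsingleton ∧
        -- if such a character exists and is real, its `L`-function has exactly one zero in the
        -- region, which is simple and real, and `P⁺(q) ≫ log q ≫ log log T`
        ∀ (q : ℕ) (hq : q ≠ 0) (χ : DirichletCharacter ℂ q),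
          (q : ℝ) ≤ T → (maxPrimeFac q : ℝ) ≤ P → χ.IsPrimitive →
          (∀ n : ZMod q, (χ n).im = 0) →
          (∃ s : ℂ, ZeroInRegion c P T hq χ s) →
          (∃! s : ℂ, ZeroInRegion c P T hq χ s) ∧
          (∀ s : ℂ, ZeroInRegion c P T hq χ s → s.im = 0 ∧ LDerivNeZero hq χ s) ∧
          c₁ * Real.log q ≤ (maxPrimeFac q : ℝ) ∧
          c₂ * Real.log (Real.log T) ≤ Real.log q := by
  obtain ⟨c₂, c20, hc2⟩ := LOGT
  obtain ⟨r, r0, hr0⟩ : ∃ r : ℝ, 0 < r ∧ ∀ w : ℂ, ‖w - 1‖ < r → zt w ≠ 0 := by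
    have := zt_diff.continuous.continuousAt.eventually_ne (show zt 1 ≠ 0 by rw [zt_one]; exact one_ne_zero)
    obtain ⟨r, r0, h⟩ := Metric.eventually_nhds_iff.1 this
    exact ⟨r, r0, fun w hw => h (by rwa [dist_eq_norm])⟩
  have ex := (((LOCN.and LOCZ).and (Ioo_mem_nhdsGT (show (0 : ℝ) < min 1 (r / 21) by positivity)))).exists
  obtain ⟨a, ⟨hN, hZ⟩, a0, a1⟩ := ex
  have a2 := a1.trans_le (min_le_left _ _)
  have a3 := a1.trans_le (min_le_right _ _)
  refine ⟨a / 20, 1 / 4, c₂, by positivity, by norm_num, c20, fun T P hT hP => ?_⟩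
  have T0 : 0 < T := by linarith
  obtain ⟨ℓ, hℓ⟩ : ∃ ℓ, ℓ = Real.log T := ⟨_, rfl⟩
  have ℓ1 : 1 < ℓ := by
    rw [hℓ, Real.lt_log_iff_exp_lt T0]; exact Real.exp_one_lt_d9.trans_le (by linarith)
  have P0 : 0 < P := (Real.rpow_pos_of_pos T0 _).trans_le hP
  obtain ⟨D, hD⟩ : ∃ D, D = Real.log P := ⟨_, rfl⟩
  have hDℓ : ℓ / Real.log ℓ ≤ D := by
    have := Real.log_le_log (Real.rpow_pos_of_pos T0 _) hP
    rw [Real.log_rpow T0, ← hℓ, ← hD] at this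
    rwa [div_eq_mul_one_div, mul_comm]
  have D1 : 1 ≤ D := by
    have := (par ℓ1 hDℓ).1
    linarith [Real.add_one_le_exp 1]
  have hTe : T = Real.exp ℓ := by rw [hℓ, Real.exp_log T0]
  have hTe2 : T ≤ Real.exp (2 * ℓ) := by rw [hTe]; exact Real.exp_le_exp.2 (by linarith)
  obtain ⟨δ, hδ⟩ : ∃ δ, δ = a / D := ⟨_, rfl⟩
  have δ0 : 0 < δ := by rw [hδ]; positivity
  have δa : δ ≤ a := by rw [hδ]; exact div_le_self a0.le D1
  have cδ : a / 20 / D = δ / 20 := by rw [hδ]; ring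
  have N' := hN ℓ D ℓ1 hDℓ
  have Z' := hZ ℓ D ℓ1 hDℓ
  rw [← hδ] at N' Z'
  have main : ∀ (q : ℕ) [NeZero q] (χ : DirichletCharacter ℂ q), (q : ℝ) ≤ T → (maxPrimeFac q : ℝ) ≤ P → χ.IsPrimitive → ∀ ρ : ℂ, χ.LFunction ρ = 0 → 1 - δ / 20 < ρ.re →
      |ρ.im| ≤ Real.exp (D / Real.sqrt ℓ) → (∀ n : ZMod q, (χ n).im = 0) ∧ χ ≠ 1 ∧ ρ.im = 0 ∧ ρ.re ≤ 1 ∧ deriv χ.LFunction ρ ≠ 0 ∧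
      ∀ ρ' : ℂ, χ.LFunction ρ' = 0 → 1 - δ / 20 < ρ'.re → |ρ'.im| ≤ Real.exp (D / Real.sqrt ℓ) → ρ' = ρ := fun q _ χ hq hs hp ρ h0 h1 h2 =>
    CORE δ0 (by linarith) N' Z' (fun w hw => hr0 w (by linarith)) hp (by rw [hD]; exact smooth P0 hs) (hq.trans hTe2) h0 h1 h2
  simp only [ZeroInRegion, LDerivNeZero, ← hD, ← hℓ, cδ]
  constructor
  · rintro ⟨⟨q, q0⟩, χ⟩ ⟨u1, u2, u3, s, u4, u5, u6⟩ ⟨⟨m, m0⟩, ψ⟩ ⟨v1, v2, v3, t, v4, v5, v6⟩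
    by_contra hne
    have : NeZero q := ⟨q0⟩
    have : NeZero m := ⟨m0⟩
    simp only at u1 u2 u3 u4 v1 v2 v3 v4
    obtain ⟨x1, x2, x3, x4, -, -⟩ := main q χ u1 u2 u3 s u4 u5 u6
    obtain ⟨y1, y2, y3, y4, -, -⟩ := main m ψ v1 v2 v3 t v4 v5 v6
    obtain ⟨k, _, φ, p1, p2, p3, p4⟩ := PR u3 v3 x1 y1 (fun h h2 => hne (by subst h; rw [eq_of_heq h2]))
    have hH : |(0 : ℝ)| ≤ 2 * Real.exp (D / Real.sqrt ℓ) := by simp; positivity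
    have sm : ∀ {q : ℕ}, (maxPrimeFac q : ℝ) ≤ P → ∀ p ∈ q.primeFactors, (p : ℝ) ≤ Real.exp D := fun h => by rw [hD]; exact smooth P0 h
    refine S3 p4 δ0 (Z' 0 hH) (N' q χ u3 x2 (sm u2) (u1.trans hTe2) 0 hH) (N' m ψ v3 y2 (sm v2) (v1.trans hTe2) 0 hH) (N' k φ p1 p2 (fun p hp => ?_) ?_ 0 hH) u4 v4 u5 x4 x3 v5 y4 y3
    · have := Nat.primeFactors_mono p3 (mul_ne_zero q0 m0) hp
      rw [Nat.primeFactors_mul q0 m0, Finset.mem_union] at this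
      exact this.elim (sm u2 p) (sm v2 p)
    · have h1 : (k : ℝ) ≤ q * m := by exact_mod_cast Nat.le_of_dvd (Nat.pos_of_ne_zero (mul_ne_zero q0 m0)) p3
      refine h1.trans ?_
      rw [two_mul, Real.exp_add, ← hTe]
      exact mul_le_mul u1 v1 (Nat.cast_nonneg _) T0.le
  · rintro q q0 χ u1 u2 u3 u7 ⟨s, u4, u5, u6⟩
    have : NeZero q := ⟨q0⟩
    obtain ⟨x1, x2, x3, x4, x5, x6⟩ := main q χ u1 u2 u3 s u4 u5 u6
    have q2 : 2 ≤ q := by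
      rcases Nat.lt_or_ge q 2 with h | h
      · have q1 : q = 1 := by omega
        subst q1
        exact (x2 (DirichletCharacter.level_one χ)).elim
      · exact h
    refine ⟨⟨s, ⟨u4, u5, u6⟩, fun t ht => x6 t ht.1 ht.2.1 ht.2.2⟩, fun t ht => ?_, logq u3 u7 q2, hc2 q χ x2 u7 q2 s ℓ D ℓ1 hDℓ u4 x3 x4 ?_⟩
    · rw [x6 t ht.1 ht.2.1 ht.2.2]; exact ⟨x3, x5⟩
    · have : δ / 20 ≤ 1 / D := by rw [hδ, div_div, div_le_div_iff₀ (by positivity) (by positivity)]; nlinarith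
      linarith
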